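/- For all n ≥ 14, every n-vertex planar graph containing no Theta graph on 6 vertices as a subgraph has at most (18/7)n - 48/7 edges. -/

import Mathlib

open SimpleGraph

/-- `H` is a minor of `G`: there is an assignment of disjoint connected branch sets
of `G` to the vertices of `H` realizing all edges of `H`. -/
def HasMinor {V : Type*} {W : Type*} (G : SimpleGraph V) (H : SimpleGraph W) : Prop :=
  ∃ f : V → Option W,
    (∀ w : W, ∃ v, f v = some w) ∧
    (∀ w : W, (G.induce {v | f v = some w}).Preconnected) ∧
    (∀ w₁ w₂ : W, H.Adj w₁ w₂ →
      ∃ v₁ v₂, f v₁ = some w₁ ∧ f v₂ = some w₂ ∧ G.Adj v₁ v₂)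

/-- Planarity, via Wagner's theorem: no `K₅` minor and no `K₃,₃` minor. -/
def IsPlanar {V : Type*} (G : SimpleGraph V) : Prop :=
  ¬ HasMinor G (completeGraph (Fin 5)) ∧
    ¬ HasMinor G (completeBipartiteGraph (Fin 3) (Fin 3))

/-- `G` contains a Theta graph on 6 vertices: a 6-cycle together with a chord
joining two non-consecutive vertices of the cycle. -/
def HasTheta6 {V : Type*} (G : SimpleGraph V) : Prop :=
  ∃ v : Fin 6 → V, Function.Injective v ∧
    (∀ i : Fin 6, G.Adj (v i) (v (i + 1))) ∧
    ∃ i j : Fin 6, i ≠ j ∧ j ≠ i + 1 ∧ i ≠ j + 1 ∧ G.Adj (v i) (v j)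

namespace Th

universe u
variable {V : Type u}

/-! ### Connectivity (cut formulation) -/

/-- `A` is connected in `H`: every nontrivial bipartition of `A` is crossed by an edge. -/
def Conn (H : SimpleGraph V) (A : Set V) : Prop :=
  ∀ S ⊆ A, S.Nonempty → (A \ S).Nonempty → ∃ x ∈ S, ∃ y ∈ A \ S, H.Adj x y

theorem Conn.mono {H H' : SimpleGraph V} (h : H ≤ H') {A : Set V} (hA : Conn H A) : Conn H' A := by
  intro S hS h1 h2
  obtain ⟨x, hx, y, hy, hxy⟩ := hA S hS h1 h2
  exact ⟨x, hx, y, hy, h hxy⟩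

theorem conn_empty (H : SimpleGraph V) : Conn H ∅ := by
  intro S hS h1 h2
  simp at h2

theorem conn_singleton (H : SimpleGraph V) (x : V) : Conn H {x} := by
  intro S hS ⟨a, ha⟩ ⟨b, hb, hb'⟩
  have := hS ha
  simp only [Set.mem_singleton_iff] at this hb
  subst this; subst hb; exact absurd ha hb'

theorem Conn.cut' {H : SimpleGraph V} {A : Set V} (hA : Conn H A) (S : Set V) {a b : V}
    (ha : a ∈ A) (haS : a ∈ S) (hb : b ∈ A) (hbS : b ∉ S) :
    ∃ x ∈ A, x ∈ S ∧ ∃ y ∈ A, y ∉ S ∧ H.Adj x y := by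
  obtain ⟨x, hx, y, hy, hxy⟩ := hA (S ∩ A) Set.inter_subset_right ⟨a, haS, ha⟩
    ⟨b, hb, fun h => hbS h.1⟩
  exact ⟨x, hx.2, hx.1, y, hy.1, fun h => hy.2 ⟨h, hy.1⟩, hxy⟩

theorem conn_of_cut {H : SimpleGraph V} {A : Set V}
    (h : ∀ S : Set V, ∀ a ∈ A, a ∈ S → ∀ b ∈ A, b ∉ S → ∃ x ∈ A, x ∈ S ∧ ∃ y ∈ A, y ∉ S ∧ H.Adj x y) :
    Conn H A := by
  intro S hS ⟨a, ha⟩ ⟨b, hb, hb'⟩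
  obtain ⟨x, hx, hxS, y, hy, hyS, hxy⟩ := h S a (hS ha) ha b hb hb'
  exact ⟨x, hxS, y, ⟨hy, hyS⟩, hxy⟩

/-- connectivity through a hub -/
theorem conn_of_hub {H : SimpleGraph V} {A : Set V} (c : V)
    (h : ∀ a ∈ A, ∃ B ⊆ A, Conn H B ∧ a ∈ B ∧ c ∈ B) : Conn H A := by
  apply conn_of_cut
  intro S a ha haS b hb hbS
  by_cases hc : c ∈ S
  · obtain ⟨B, hBA, hB, hbB, hcB⟩ := h b hb
    obtain ⟨x, hx, hxS, y, hy, hyS, hxy⟩ := hB.cut' S hcB hc hbB hbS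
    exact ⟨x, hBA hx, hxS, y, hBA hy, hyS, hxy⟩
  · obtain ⟨B, hBA, hB, hbB, hcB⟩ := h a ha
    obtain ⟨x, hx, hxS, y, hy, hyS, hxy⟩ := hB.cut' S hbB haS hcB hc
    exact ⟨x, hBA hx, hxS, y, hBA hy, hyS, hxy⟩

theorem conn_pair {H : SimpleGraph V} {x y : V} (h : H.Adj x y) : Conn H {x, y} := by
  apply conn_of_cut
  intro S a ha haS b hb hbS
  simp only [Set.mem_insert_iff, Set.mem_singleton_iff] at ha hb
  refine ⟨a, by simpa using ha, haS, b, by simpa using hb, hbS, ?_⟩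
  rcases ha with rfl | rfl <;> rcases hb with rfl | rfl
  · exact absurd haS hbS
  · exact h
  · exact h.symm
  · exact absurd haS hbS

theorem Conn.union_of_mem {H : SimpleGraph V} {A B : Set V} (hA : Conn H A) (hB : Conn H B)
    {c : V} (hcA : c ∈ A) (hcB : c ∈ B) : Conn H (A ∪ B) := by
  apply conn_of_hub c
  rintro a (ha | ha)
  · exact ⟨A, Set.subset_union_left, hA, ha, hcA⟩
  · exact ⟨B, Set.subset_union_right, hB, ha, hcB⟩

theorem Conn.union_of_adj {H : SimpleGraph V} {A B : Set V} (hA : Conn H A) (hB : Conn H B)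
    {a b : V} (ha : a ∈ A) (hb : b ∈ B) (hab : H.Adj a b) : Conn H (A ∪ B) := by
  have h1 : Conn H (A ∪ {a, b}) := hA.union_of_mem (conn_pair hab) ha (by simp)
  have h2 := h1.union_of_mem hB (c := b) (by simp) hb
  convert h2 using 1
  ext v; simp only [Set.mem_union, Set.mem_insert_iff, Set.mem_singleton_iff]
  constructor
  · tauto
  · rintro ((h | rfl | rfl) | h) <;> tauto

theorem Conn.insert_adj {H : SimpleGraph V} {A : Set V} (hA : Conn H A)
    {a b : V} (ha : a ∈ A) (hab : H.Adj a b) : Conn H (insert b A) := by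
  have := hA.union_of_adj (conn_singleton H b) ha rfl hab
  rwa [Set.union_singleton] at this

/-- component of `z` in `A` -/
def comp (H : SimpleGraph V) (A : Set V) (z : V) : Set V :=
  {y | ∃ B ⊆ A, Conn H B ∧ z ∈ B ∧ y ∈ B}

theorem comp_sub {H : SimpleGraph V} {A : Set V} {z : V} : comp H A z ⊆ A := by
  rintro y ⟨B, hB, -, -, hy⟩; exact hB hy

theorem mem_comp_self {H : SimpleGraph V} {A : Set V} {z : V} (hz : z ∈ A) : z ∈ comp H A z :=
  ⟨{z}, by simpa using hz, conn_singleton H z, rfl, rfl⟩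

theorem sub_comp {H : SimpleGraph V} {A B : Set V} {z : V} (hBA : B ⊆ A) (hB : Conn H B)
    (hz : z ∈ B) : B ⊆ comp H A z := fun y hy => ⟨B, hBA, hB, hz, hy⟩

theorem conn_comp {H : SimpleGraph V} {A : Set V} {z : V} : Conn H (comp H A z) := by
  apply conn_of_hub z
  rintro y ⟨B, hB, hc, hz, hy⟩
  exact ⟨B, sub_comp hB hc hz, hc, hy, hz⟩

theorem comp_closed {H : SimpleGraph V} {A : Set V} {z x y : V} (hx : x ∈ comp H A z)
    (hxy : H.Adj x y) (hy : y ∈ A) : y ∈ comp H A z := by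
  obtain ⟨B, hB, hc, hz, hxB⟩ := hx
  exact ⟨insert y B, Set.insert_subset hy hB, hc.insert_adj hxB hxy, by simp [hz], by simp⟩

theorem Conn.eq_comp {H : SimpleGraph V} {A : Set V} (hA : Conn H A) {z : V} (hz : z ∈ A) :
    comp H A z = A :=
  Set.Subset.antisymm comp_sub (sub_comp le_rfl hA hz)

/-! ### Conversion to Mathlib preconnectedness -/

theorem Conn.preconnected {H : SimpleGraph V} {A : Set V} (hA : Conn H A) :
    (H.induce A).Preconnected := by
  rintro ⟨x, hx⟩ ⟨y, hy⟩
  by_contra hcon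
  obtain ⟨a, ha, ⟨ha', hra⟩, b, hb, hbS, hab⟩ := hA.cut'
    {v | ∃ h : v ∈ A, (H.induce A).Reachable ⟨x, hx⟩ ⟨v, h⟩} hx ⟨hx, Reachable.refl _⟩ hy
    (fun ⟨_, h⟩ => hcon h)
  exact hbS ⟨hb, hra.trans (Adj.reachable (by simpa using hab))⟩

theorem conn_of_preconnected {H : SimpleGraph V} {A : Set V} (hA : (H.induce A).Preconnected) :
    Conn H A := by
  apply conn_of_cut
  intro S a ha haS b hb hbS
  obtain ⟨w⟩ := hA ⟨a, ha⟩ ⟨b, hb⟩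
  have key : ∀ (p q : A) (w : (H.induce A).Walk p q), (p : V) ∈ S → (q : V) ∉ S →
      ∃ x ∈ A, x ∈ S ∧ ∃ y ∈ A, y ∉ S ∧ H.Adj x y := by
    intro p q w
    induction w with
    | nil => intro h1 h2; exact absurd h1 h2
    | @cons p r q h w ih =>
      intro h1 h2
      by_cases hr : (r : V) ∈ S
      · exact ih hr h2
      · exact ⟨p, p.2, h1, r, r.2, hr, by simpa using h⟩
  exact key _ _ w haS hbS

/-! ### Minor helpers -/

theorem hasMinor_of_sets {W : Type*} [Finite W] {G : SimpleGraph V} {H : SimpleGraph W}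
    (S : W → Set V) (hne : ∀ w, (S w).Nonempty) (hc : ∀ w, Conn G (S w))
    (hd : ∀ w w', w ≠ w' → Disjoint (S w) (S w'))
    (he : ∀ w w', H.Adj w w' → ∃ x ∈ S w, ∃ y ∈ S w', G.Adj x y) : HasMinor G H := by
  classical
  have huniq : ∀ v w w', v ∈ S w → v ∈ S w' → w = w' := by
    intro v w w' h1 h2
    by_contra hne
    exact Set.disjoint_left.1 (hd w w' hne) h1 h2
  let f : V → Option W := fun v => if h : ∃ w, v ∈ S w then some h.choose else none
  have hf : ∀ v w, f v = some w ↔ v ∈ S w := by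
    intro v w
    simp only [f]
    split_ifs with h
    · constructor
      · intro h'; have := Option.some.inj h'; rw [← this]; exact h.choose_spec
      · intro h'; congr 1; exact huniq v _ _ h.choose_spec h'
    · simp only [reduceCtorEq, false_iff]; exact fun h' => h ⟨w, h'⟩
  refine ⟨f, fun w => ?_, fun w => ?_, fun w w' h => ?_⟩
  · obtain ⟨v, hv⟩ := hne w; exact ⟨v, (hf v w).2 hv⟩
  · have : {v | f v = some w} = S w := by ext v; exact hf v w
    rw [this]; exact (hc w).preconnected
  · obtain ⟨x, hx, y, hy, hxy⟩ := he w w' h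
    exact ⟨x, y, (hf _ _).2 hx, (hf _ _).2 hy, hxy⟩

/-- there is an edge between the two sets -/
def Lk (H : SimpleGraph V) (A B : Set V) : Prop := ∃ x ∈ A, ∃ y ∈ B, H.Adj x y

theorem Lk.symm {H : SimpleGraph V} {A B : Set V} (h : Lk H A B) : Lk H B A := by
  obtain ⟨x, hx, y, hy, hxy⟩ := h; exact ⟨y, hy, x, hx, hxy.symm⟩

theorem Lk.mono {H : SimpleGraph V} {A B A' B' : Set V} (h : Lk H A B) (hA : A ⊆ A') (hB : B ⊆ B') :
    Lk H A' B' := by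
  obtain ⟨x, hx, y, hy, hxy⟩ := h; exact ⟨x, hA hx, y, hB hy, hxy⟩

theorem no_K5 {G : SimpleGraph V} (hp : IsPlanar G) {A B C D E : Set V}
    (cA : Conn G A) (cB : Conn G B) (cC : Conn G C) (cD : Conn G D) (cE : Conn G E)
    (dAB : Disjoint A B) (dAC : Disjoint A C) (dAD : Disjoint A D) (dAE : Disjoint A E)
    (dBC : Disjoint B C) (dBD : Disjoint B D) (dBE : Disjoint B E)
    (dCD : Disjoint C D) (dCE : Disjoint C E) (dDE : Disjoint D E)
    (lAB : Lk G A B) (lAC : Lk G A C) (lAD : Lk G A D) (lAE : Lk G A E)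
    (lBC : Lk G B C) (lBD : Lk G B D) (lBE : Lk G B E)
    (lCD : Lk G C D) (lCE : Lk G C E) (lDE : Lk G D E) : False := by
  apply hp.1
  have h5 : ∀ w w' : Fin 5, w ≠ w' → Disjoint (![A, B, C, D, E] w) (![A, B, C, D, E] w') := by
    intro w w' h
    fin_cases w <;> fin_cases w' <;> first | exact absurd rfl h | assumption | (apply Disjoint.symm; assumption)
  have l5 : ∀ w w' : Fin 5, w ≠ w' → Lk G (![A, B, C, D, E] w) (![A, B, C, D, E] w') := by
    intro w w' h
    fin_cases w <;> fin_cases w' <;> first | exact absurd rfl h | assumption | (apply Lk.symm; assumption)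
  refine hasMinor_of_sets ![A, B, C, D, E] ?_ ?_ h5 ?_
  · intro w
    obtain ⟨w', hw⟩ : ∃ w' : Fin 5, w ≠ w' := ⟨w + 1, by fin_cases w <;> decide⟩
    obtain ⟨x, hx, -⟩ := l5 w w' hw
    exact ⟨x, hx⟩
  · intro w; fin_cases w <;> assumption
  · intro w w' h
    exact l5 w w' h.ne

theorem no_K33 {G : SimpleGraph V} (hp : IsPlanar G) {A B C D E F : Set V}
    (cA : Conn G A) (cB : Conn G B) (cC : Conn G C) (cD : Conn G D) (cE : Conn G E) (cF : Conn G F)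
    (dAB : Disjoint A B) (dAC : Disjoint A C) (dAD : Disjoint A D) (dAE : Disjoint A E)
    (dAF : Disjoint A F)
    (dBC : Disjoint B C) (dBD : Disjoint B D) (dBE : Disjoint B E) (dBF : Disjoint B F)
    (dCD : Disjoint C D) (dCE : Disjoint C E) (dCF : Disjoint C F)
    (dDE : Disjoint D E) (dDF : Disjoint D F) (dEF : Disjoint E F)
    (lAD : Lk G A D) (lAE : Lk G A E) (lAF : Lk G A F)
    (lBD : Lk G B D) (lBE : Lk G B E) (lBF : Lk G B F)
    (lCD : Lk G C D) (lCE : Lk G C E) (lCF : Lk G C F) : False := by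
  apply hp.2
  have h5 : ∀ w w' : Fin 3 ⊕ Fin 3, w ≠ w' →
      Disjoint (Sum.elim ![A, B, C] ![D, E, F] w) (Sum.elim ![A, B, C] ![D, E, F] w') := by
    rintro (w | w) (w' | w') h <;>
    fin_cases w <;> fin_cases w' <;> first | exact absurd rfl h | assumption | (apply Disjoint.symm; assumption)
  have l5 : ∀ w w' : Fin 3, Lk G (![A, B, C] w) (![D, E, F] w') := by
    intro w w'
    fin_cases w <;> fin_cases w' <;> assumption
  refine hasMinor_of_sets (Sum.elim ![A, B, C] ![D, E, F]) ?_ ?_ h5 ?_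
  · rintro (w | w)
    · obtain ⟨x, hx, -⟩ := l5 w 0; exact ⟨x, hx⟩
    · obtain ⟨x, -, y, hy, -⟩ := l5 0 w; exact ⟨y, hy⟩
  · rintro (w | w) <;> fin_cases w <;> assumption
  · rintro (w | w) (w' | w') h
    · simp at h
    · exact l5 w w'
    · exact (l5 w' w).symm
    · simp at h

/-- split a connected set around two disjoint connected subsets -/
theorem split_conn {H : SimpleGraph V} {K X Y : Set V} (hK : Conn H K) (hX : Conn H X) (hY : Conn H Y)
    (hXK : X ⊆ K) (hYK : Y ⊆ K) (hXY : Disjoint X Y) (hXn : X.Nonempty) (hYn : Y.Nonempty) :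
    ∃ X' Y', X ⊆ X' ∧ Y ⊆ Y' ∧ X' ⊆ K ∧ Y' ⊆ K ∧ Disjoint X' Y' ∧ Conn H X' ∧ Conn H Y' ∧ Lk H X' Y' := by
  obtain ⟨y, hy⟩ := hYn
  obtain ⟨x, hx⟩ := hXn
  have hYKX : Y ⊆ K \ X := fun v hv => ⟨hYK hv, fun h => Set.disjoint_left.1 hXY h hv⟩
  set Y' := comp H (K \ X) y with hY'
  have hYY' : Y ⊆ Y' := sub_comp hYKX hY hy
  have hY'K : Y' ⊆ K \ X := comp_sub
  refine ⟨K \ Y', Y', fun v hv => ⟨hXK hv, fun h => (hY'K h).2 hv⟩, hYY', Set.diff_subset,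
    fun v hv => (hY'K hv).1, Set.disjoint_sdiff_left, ?_, conn_comp, ?_⟩
  · apply conn_of_cut
    intro S a ha haS b hb hbS
    -- wlog argument on X
    have main : ∀ T : Set V, ∀ a ∈ K \ Y', a ∈ T → (∀ v ∈ X, v ∉ T) →
        ∃ p ∈ K \ Y', p ∈ T ∧ ∃ q ∈ K \ Y', q ∉ T ∧ H.Adj p q := by
      intro T a ha haT hXT
      obtain ⟨p, hp, hpT, q, hq, hqT, hpq⟩ := hK.cut' (T \ Y') ha.1 ⟨haT, ha.2⟩ (hXK hx)
        (fun h => hXT x hx h.1)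
      refine ⟨p, ⟨hp, hpT.2⟩, hpT.1, q, ⟨hq, ?_⟩, ?_, hpq⟩
      · intro hqY
        exact hpT.2 (comp_closed hqY hpq.symm ⟨hp, fun h => hXT p h hpT.1⟩)
      · intro hqT'
        apply hqT ⟨hqT', ?_⟩
        intro hqY
        exact hpT.2 (comp_closed hqY hpq.symm ⟨hp, fun h => hXT p h hpT.1⟩)
    by_cases h1 : ∃ v ∈ X, v ∈ S
    · by_cases h2 : ∃ v ∈ X, v ∉ S
      · obtain ⟨c, hc, hcS⟩ := h1
        obtain ⟨d, hd, hdS⟩ := h2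
        obtain ⟨p, hp, hpS, q, hq, hqS, hpq⟩ := hX.cut' S hc hcS hd hdS
        exact ⟨p, ⟨hXK hp, fun h => (hY'K h).2 hp⟩, hpS, q, ⟨hXK hq, fun h => (hY'K h).2 hq⟩, hqS, hpq⟩
      · push Not at h2
        obtain ⟨p, hp, hpS, q, hq, hqS, hpq⟩ := main Sᶜ b hb hbS (fun v hv h => h (h2 v hv))
        exact ⟨q, hq, not_not.1 hqS, p, hp, hpS, hpq.symm⟩
    · push Not at h1
      exact main S a ha haS h1
  · obtain ⟨p, hp, hpS, q, hq, hqS, hpq⟩ := hK.cut' Y' (hYK hy) (hYY' hy) (hXK hx)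
        (fun h => (hY'K h).2 hx)
    exact ⟨q, ⟨hq, hqS⟩, p, hpS, hpq.symm⟩

end Th


namespace Th
universe u
variable {V : Type u}
open scoped Classical in
/-- indicator of an edge as a vector over `ZMod 2` -/
noncomputable def sv (e : Sym2 V) : Sym2 V → ZMod 2 := fun f => if f = e then 1 else 0

theorem sv_self (e : Sym2 V) : sv e e = 1 := by simp [sv]
theorem sv_ne {e f : Sym2 V} (h : f ≠ e) : sv e f = 0 := by simp [sv, h]

/-- edge vector of a path -/
noncomputable def pv : List V → (Sym2 V → ZMod 2)
  | [] => 0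
  | [_] => 0
  | a :: b :: l => sv s(a, b) + pv (b :: l)

theorem add_self_vec {E : Type*} (x : E → ZMod 2) : x + x = 0 := by
  funext e; exact CharTwo.add_self_eq_zero _

@[simp] theorem pv_nil : pv ([] : List V) = 0 := rfl
@[simp] theorem pv_one (a : V) : pv [a] = 0 := rfl
theorem pv_cons (a b : V) (l : List V) : pv (a :: b :: l) = sv s(a, b) + pv (b :: l) := rfl

theorem pv_append (l₁ l₂ : List V) (a : V) :
    pv (l₁ ++ a :: l₂) = pv (l₁ ++ [a]) + pv (a :: l₂) := by
  induction l₁ with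
  | nil => simp
  | cons b l ih =>
    cases l with
    | nil => simp [pv_cons]
    | cons c l => simp only [List.cons_append, pv_cons] at ih ⊢; rw [ih, add_assoc]

theorem pv_reverse (l : List V) : pv l.reverse = pv l := by
  induction l with
  | nil => rfl
  | cons a l ih =>
    cases l with
    | nil => rfl
    | cons b l =>
      rw [pv_cons, ← ih, List.reverse_cons, List.reverse_cons, List.append_assoc]
      simp only [List.cons_append, List.nil_append]
      rw [pv_append, pv_cons, Sym2.eq_swap]; simp [add_comm]

/-- an edge appearing in the vector of a path is a consecutive pair -/
theorem pv_supp {l : List V} {e : Sym2 V} (h : pv l e ≠ 0) :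
    ∃ l₁ a b l₂, l = l₁ ++ a :: b :: l₂ ∧ e = s(a, b) := by
  induction l with
  | nil => simp at h
  | cons a l ih =>
    cases l with
    | nil => simp at h
    | cons b l =>
      by_cases he : e = s(a, b)
      · exact ⟨[], a, b, l, rfl, he⟩
      · rw [pv_cons, Pi.add_apply, sv_ne he, zero_add] at h
        obtain ⟨l₁, a', b', l₂, h1, h2⟩ := ih h
        exact ⟨a :: l₁, a', b', l₂, by simp [h1], h2⟩

theorem pv_supp_mem {l : List V} {e : Sym2 V} (h : pv l e ≠ 0) {x : V} (hx : x ∈ e) : x ∈ l := by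
  obtain ⟨l₁, a, b, l₂, rfl, rfl⟩ := pv_supp h
  rcases Sym2.mem_iff.1 hx with rfl | rfl <;> simp

theorem pv_supp_adj {H : SimpleGraph V} {l : List V} (hl : l.IsChain H.Adj) {e : Sym2 V}
    (h : pv l e ≠ 0) : e ∈ H.edgeSet := by
  obtain ⟨l₁, a, b, l₂, rfl, rfl⟩ := pv_supp h
  rw [List.isChain_append_cons_cons] at hl
  exact hl.2.1

/-- edges of a path `a A b` with nonempty interior touch the interior -/
theorem pv_touch {A : List V} (hA : A ≠ []) {a b : V} {e : Sym2 V}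
    (h : pv (a :: A ++ [b]) e ≠ 0) : ∃ x ∈ A, x ∈ e := by
  obtain ⟨l₁, p, q, l₂, h1, rfl⟩ := pv_supp h
  by_contra hcon
  push Not at hcon
  have hp : p ∉ A := fun h => hcon p h (by simp)
  have hq : q ∉ A := fun h => hcon q h (by simp)
  cases l₁ with
  | nil =>
    simp only [List.cons_append, List.nil_append, List.cons.injEq] at h1
    obtain ⟨rfl, h1⟩ := h1
    cases A with
    | nil => exact hA rfl
    | cons c A => simp only [List.cons_append, List.cons.injEq] at h1; exact hq (by simp [h1.1])
  | cons c l₁ =>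
    simp only [List.cons_append, List.cons.injEq] at h1
    obtain ⟨rfl, h1⟩ := h1
    apply hp
    have h2 : A = l₁ ++ p :: (q :: l₂).dropLast := by
      have := congrArg List.dropLast h1
      simpa [List.dropLast_append_of_ne_nil] using this
    rw [h2]; simp

/-! ### splitting lists -/

theorem first_split {p : V → Prop} {l : List V} (h : ∃ x ∈ l, p x) :
    ∃ l₁ a l₂, l = l₁ ++ a :: l₂ ∧ p a ∧ ∀ x ∈ l₁, ¬ p x := by
  induction l with
  | nil => simp at h
  | cons b l ih =>
    by_cases hb : p b
    · exact ⟨[], b, l, rfl, hb, by simp⟩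
    · obtain ⟨x, hx, hpx⟩ := h
      obtain ⟨l₁, a, l₂, h1, h2, h3⟩ := ih ⟨x, by
        rcases List.mem_cons.1 hx with rfl | h
        · exact absurd hpx hb
        · exact h, hpx⟩
      refine ⟨b :: l₁, a, l₂, by simp [h1], h2, ?_⟩
      intro y hy
      rcases List.mem_cons.1 hy with rfl | h
      · exact hb
      · exact h3 y h

theorem last_split {p : V → Prop} {l : List V} (h : ∃ x ∈ l, p x) :
    ∃ l₁ a l₂, l = l₁ ++ a :: l₂ ∧ p a ∧ ∀ x ∈ l₂, ¬ p x := by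
  obtain ⟨x, hx, hp⟩ := h
  obtain ⟨l₁, a, l₂, h1, h2, h3⟩ := first_split (l := l.reverse) ⟨x, by simpa using hx, hp⟩
  refine ⟨l₂.reverse, a, l₁.reverse, ?_, h2, by simpa using h3⟩
  have := congrArg List.reverse h1
  simpa using this

/-- segment lemma -/
theorem segment {p q : V → Prop} {x : V} {l : List V} (hx : p x) (hy : ∃ y ∈ l, q y)
    (hpq : ∀ v, p v → ¬ q v) :
    ∃ l₁ a P b l₂, x :: l = l₁ ++ a :: P ++ b :: l₂ ∧ p a ∧ q b ∧ ∀ v ∈ P, ¬ p v ∧ ¬ q v := by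
  obtain ⟨y, hy, hqy⟩ := hy
  obtain ⟨l₁, b, l₂, h1, h2, h3⟩ := first_split (p := q) (l := x :: l) ⟨y, by simp [hy], hqy⟩
  have hl : ∃ v ∈ l₁, p v := by
    cases l₁ with
    | nil => simp only [List.nil_append, List.cons.injEq] at h1; exact absurd h2 (h1.1 ▸ hpq x hx)
    | cons c l₁ =>
      simp only [List.cons_append, List.cons.injEq] at h1
      exact ⟨c, by simp, h1.1 ▸ hx⟩
  obtain ⟨m₁, a, P, h4, h5, h6⟩ := last_split hl
  refine ⟨m₁, a, P, b, l₂, by simp [h1, h4], h5, h2, fun v hv => ⟨h6 v hv, h3 v (by simp [h4, hv])⟩⟩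

/-! ### paths -/

/-- `l` is a path from `x` to `y` inside `A` -/
structure PathIn (H : SimpleGraph V) (A : Set V) (x y : V) (l : List V) : Prop where
  ch : l.IsChain H.Adj
  nd : l.Nodup
  hd : l.head? = some x
  ls : l.getLast? = some y
  mem : ∀ v ∈ l, v ∈ A

theorem Conn.path {H : SimpleGraph V} {A : Set V} (hA : Conn H A) {x y : V} (hx : x ∈ A)
    (hy : y ∈ A) : ∃ l, PathIn H A x y l := by
  by_contra hcon
  obtain ⟨a, ha, ⟨l, hl⟩, b, hb, hbS, hab⟩ := hA.cut' {v | ∃ l, PathIn H A x v l} hx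
    ⟨[x], by simp, by simp, rfl, rfl, by simpa using hx⟩ hy hcon
  apply hbS
  by_cases hbl : b ∈ l
  · obtain ⟨l₁, l₂, rfl⟩ := List.append_of_mem hbl
    have h1 : (l₁ ++ [b]).IsChain H.Adj := (List.isChain_split.1 hl.ch).1
    refine ⟨l₁ ++ [b], h1, ?_, ?_, by simp, ?_⟩
    · exact hl.nd.sublist (by simp)
    · have := hl.hd; cases l₁ <;> simpa using this
    · intro v hv; apply hl.mem; simp at hv ⊢; tauto
  · have hls := hl.ls
    refine ⟨l ++ [b], ?_, ?_, ?_, by simp, ?_⟩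
    · rw [List.isChain_append]
      refine ⟨hl.ch, by simp, ?_⟩
      intro p hp q hq
      rw [hls] at hp
      simp at hp hq; subst hp; subst hq; exact hab
    · rw [List.nodup_append]; refine ⟨hl.nd, by simp, ?_⟩
      intro p hp q hq; simp at hq; subst hq; rintro rfl; exact hbl hp
    · have := hl.hd; cases l <;> simp_all
    · intro v hv; simp at hv; rcases hv with h | rfl
      · exact hl.mem v h
      · exact hb

theorem conn_list {H : SimpleGraph V} {l : List V} (hl : l.IsChain H.Adj) : Conn H {v | v ∈ l} := by
  induction l with
  | nil => convert conn_empty H using 1; ext; simp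
  | cons a l ih =>
    cases l with
    | nil => convert conn_singleton H a using 1; ext; simp
    | cons b l =>
      rw [List.isChain_cons_cons] at hl
      have := (ih hl.2).insert_adj (a := b) (b := a) (by simp) hl.1.symm
      convert this using 1
      ext v; simp

/-! ### cycles -/

/-- closed chain conditions for a cyclic list -/
def IsCyc (H : SimpleGraph V) : List V → Prop
  | [] => False
  | a :: t => (a :: t).Nodup ∧ (a :: t ++ [a]).IsChain H.Adj ∧ 2 ≤ t.length

/-- edge vector of a cyclic list -/
noncomputable def cv : List V → (Sym2 V → ZMod 2)
  | [] => 0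
  | a :: t => pv (a :: t ++ [a])

theorem IsCyc.nd {H : SimpleGraph V} {l : List V} (h : IsCyc H l) : l.Nodup := by
  cases l with
  | nil => simp
  | cons a t => exact h.1

theorem IsCyc.len {H : SimpleGraph V} {l : List V} (h : IsCyc H l) : 3 ≤ l.length := by
  cases l with
  | nil => exact h.elim
  | cons a t => have := h.2.2; simp; omega

theorem chain_glue {H : SimpleGraph V} {l₁ l₂ : List V} {a : V} :
    (l₁ ++ a :: l₂).IsChain H.Adj ↔ (l₁ ++ [a]).IsChain H.Adj ∧ (a :: l₂).IsChain H.Adj :=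
  List.isChain_split

theorem isCyc_cons_iff {H : SimpleGraph V} {a b : V} {A B : List V} :
    IsCyc H (a :: A ++ b :: B) ↔ (a :: A ++ b :: B).Nodup ∧ (a :: A ++ [b]).IsChain H.Adj ∧
      (b :: B ++ [a]).IsChain H.Adj ∧ 1 ≤ A.length + B.length := by
  have h : a :: A ++ b :: B = a :: (A ++ b :: B) := rfl
  rw [h]
  change (a :: (A ++ b :: B)).Nodup ∧ (a :: (A ++ b :: B) ++ [a]).IsChain H.Adj ∧
    2 ≤ (A ++ b :: B).length ↔ _
  have h2 : a :: (A ++ b :: B) ++ [a] = (a :: A) ++ b :: (B ++ [a]) := by simp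
  rw [h2, chain_glue]
  simp only [List.length_append, List.length_cons, List.cons_append]
  constructor
  · rintro ⟨h1, ⟨h3, h4⟩, h5⟩; exact ⟨h1, h3, h4, by omega⟩
  · rintro ⟨h1, h3, h4, h5⟩; exact ⟨h1, ⟨h3, h4⟩, by omega⟩

theorem cv_cons {a b : V} {A B : List V} :
    cv (a :: A ++ b :: B) = pv (a :: A ++ [b]) + pv (b :: B ++ [a]) := by
  have h : a :: A ++ b :: B = a :: (A ++ b :: B) := rfl
  rw [h]
  change pv (a :: (A ++ b :: B) ++ [a]) = _
  have h2 : a :: (A ++ b :: B) ++ [a] = (a :: A) ++ b :: (B ++ [a]) := by simp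
  rw [h2, pv_append]; rfl

/-- `l'` is the same cycle as `l` -/
structure CEq (H : SimpleGraph V) (l l' : List V) : Prop where
  cyc : IsCyc H l'
  vec : cv l' = cv l
  mem : ∀ v, v ∈ l' ↔ v ∈ l
  len : l'.length = l.length

theorem CEq.refl {H : SimpleGraph V} {l : List V} (h : IsCyc H l) : CEq H l l :=
  ⟨h, rfl, fun _ => Iff.rfl, rfl⟩

theorem CEq.trans {H : SimpleGraph V} {l l' l'' : List V} (h : CEq H l l') (h' : CEq H l' l'') :
    CEq H l l'' :=
  ⟨h'.cyc, h'.vec.trans h.vec, fun v => (h'.mem v).trans (h.mem v), h'.len.trans h.len⟩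

theorem CEq.rot {H : SimpleGraph V} {l₁ l₂ : List V} (h : IsCyc H (l₁ ++ l₂)) :
    CEq H (l₁ ++ l₂) (l₂ ++ l₁) := by
  cases l₁ with
  | nil => simpa using CEq.refl h
  | cons a A =>
    cases l₂ with
    | nil => simpa using CEq.refl h
    | cons b B =>
      have h' := isCyc_cons_iff.1 h
      refine ⟨isCyc_cons_iff.2 ⟨?_, h'.2.2.1, h'.2.1, by omega⟩, ?_, ?_, ?_⟩
      · exact (List.perm_append_comm.nodup_iff).1 h'.1
      · rw [cv_cons, cv_cons, add_comm]
      · intro v; simp only [List.mem_append]; tauto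
      · simp only [List.length_append]; omega

theorem CEq.rev {H : SimpleGraph V} {a : V} {t : List V} (h : IsCyc H (a :: t)) :
    CEq H (a :: t) (a :: t.reverse) := by
  have key : a :: t.reverse ++ [a] = (a :: t ++ [a]).reverse := by simp
  refine ⟨⟨?_, ?_, ?_⟩, ?_, by simp, by simp⟩
  · have := h.1; simpa using this
  · rw [key, List.isChain_reverse]
    exact h.2.1.imp (fun _ _ h => h.symm)
  · simpa using h.2.2
  · change pv (a :: t.reverse ++ [a]) = pv (a :: t ++ [a]); rw [key, pv_reverse]

/-- rotate to start at a given vertex -/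
theorem IsCyc.start {H : SimpleGraph V} {l : List V} (h : IsCyc H l) {a : V} (ha : a ∈ l) :
    ∃ t, CEq H l (a :: t) := by
  obtain ⟨l₁, l₂, rfl⟩ := List.append_of_mem ha
  exact ⟨l₂ ++ l₁, CEq.rot h⟩

theorem IsCyc.split {H : SimpleGraph V} {l : List V} (h : IsCyc H l) {a b : V} (ha : a ∈ l)
    (hb : b ∈ l) (hab : a ≠ b) : ∃ A B, CEq H l (a :: A ++ b :: B) := by
  obtain ⟨t, ht⟩ := h.start ha
  have : b ∈ t := by
    have := (ht.mem b).2 hb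
    rcases List.mem_cons.1 this with h | h
    · exact absurd h.symm hab
    · exact h
  obtain ⟨A, B, rfl⟩ := List.append_of_mem this
  exact ⟨A, B, ht⟩

/-- start a cycle at a given edge -/
theorem IsCyc.edge_start {H : SimpleGraph V} {l : List V} (h : IsCyc H l) {a b : V}
    (hab : cv l s(a, b) ≠ 0) : ∃ t, CEq H l (a :: b :: t) := by
  cases l with
  | nil => exact h.elim
  | cons c t =>
    obtain ⟨l₁, p, q, l₂, h1, h2⟩ := pv_supp hab
    -- it suffices to find a rotation starting with p q
    have main : ∃ t', CEq H (c :: t) (p :: q :: t') := by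
      rcases List.eq_nil_or_concat l₂ with rfl | ⟨l₃, d, rfl⟩
      · have h3 : c :: t = l₁ ++ [p] ∧ c = q := by
          have h3 : c :: t ++ [c] = (l₁ ++ [p]) ++ [q] := by simpa using h1
          have := List.append_inj' h3 rfl
          exact ⟨this.1, by simpa using this.2⟩
        have h4 : t ≠ [] := by rintro rfl; have := h.2.2; simp at this
        cases l₁ with
        | nil => simp at h3; exact absurd h3.1.2 h4
        | cons d l₁ =>
          have h5 : c = d := by have := h3.1; simp at this; exact this.1
          refine ⟨l₁, ?_⟩
          have h6 := h3.1
          rw [h6] at h ⊢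
          have := CEq.rot h
          rw [← h5, h3.2] at this ⊢
          simpa using this
      · have h3 : c :: t = l₁ ++ p :: q :: l₃ := by
          have h3 : c :: t ++ [c] = (l₁ ++ p :: q :: l₃) ++ [d] := by simpa using h1
          exact (List.append_inj' h3 rfl).1
        rw [h3] at h ⊢
        exact ⟨l₃ ++ l₁, by simpa using CEq.rot h⟩
    obtain ⟨t', ht'⟩ := main
    rcases Sym2.eq_iff.1 h2 with ⟨rfl, rfl⟩ | ⟨rfl, rfl⟩
    · exact ⟨t', ht'⟩
    · -- reversed
      have h3 := CEq.rev ht'.cyc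
      have h4 := ht'.trans h3
      refine ⟨t'.reverse, ?_⟩
      have h5 : b :: (a :: t').reverse = (b :: t'.reverse) ++ [a] := by simp
      rw [h5] at h4
      simpa using h4.trans (CEq.rot h4.cyc)

theorem IsCyc.edge_mem {H : SimpleGraph V} {l : List V} (h : IsCyc H l) {e : Sym2 V}
    (he : cv l e ≠ 0) {x : V} (hx : x ∈ e) : x ∈ l := by
  cases l with
  | nil => exact h.elim
  | cons c t =>
    have := pv_supp_mem he hx
    simp at this ⊢; tauto

theorem IsCyc.edge_adj {H : SimpleGraph V} {l : List V} (h : IsCyc H l) {e : Sym2 V}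
    (he : cv l e ≠ 0) : e ∈ H.edgeSet := by
  cases l with
  | nil => exact h.elim
  | cons c t => exact pv_supp_adj h.2.1 he

theorem cv_two {H : SimpleGraph V} {a b : V} {t : List V} (h : IsCyc H (a :: b :: t)) :
    cv (a :: b :: t) s(a, b) = 1 := by
  have h1 : cv (a :: b :: t) = sv s(a, b) + pv (b :: t ++ [a]) := rfl
  rw [h1, Pi.add_apply, sv_self]
  by_contra hcon
  have h2 : pv (b :: t ++ [a]) s(a, b) ≠ 0 := fun h => hcon (by rw [h, add_zero])
  have h3 : t ≠ [] := by rintro rfl; have := h.len; simp at this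
  obtain ⟨x, hx, hxe⟩ := pv_touch h3 h2
  have hnd := h.nd
  simp only [List.nodup_cons, List.mem_cons, not_or] at hnd
  rcases Sym2.mem_iff.1 hxe with rfl | rfl
  · exact hnd.1.2 hx
  · exact hnd.2.1 hx

theorem cv_last {H : SimpleGraph V} {a b : V} {t : List V} (h : IsCyc H (a :: t ++ [b])) :
    cv (a :: t ++ [b]) s(a, b) = 1 := by
  have := CEq.rot (l₁ := a :: t) (l₂ := [b]) h
  rw [← this.vec, Sym2.eq_swap]
  exact cv_two this.cyc

theorem zmod2_ne {x : ZMod 2} : x ≠ 0 ↔ x = 1 := by revert x; decide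

/-- theta decomposition -/
theorem theta {H : SimpleGraph V} {a b : V} {A B P : List V} (h : IsCyc H (a :: A ++ b :: B))
    (hP : (a :: P ++ [b]).IsChain H.Adj) (hnd : P.Nodup)
    (hd : ∀ v ∈ P, v ∉ a :: A ++ b :: B) :
    (1 ≤ A.length + P.length → IsCyc H (a :: A ++ b :: P.reverse)) ∧
    (1 ≤ P.length + B.length → IsCyc H (a :: P ++ b :: B)) ∧
    cv (a :: A ++ b :: B) = cv (a :: A ++ b :: P.reverse) + cv (a :: P ++ b :: B) := by
  have h' := isCyc_cons_iff.1 h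
  have hrev : b :: P.reverse ++ [a] = (a :: P ++ [b]).reverse := by simp
  have hn := h'.1
  refine ⟨fun hl => isCyc_cons_iff.2 ⟨?_, h'.2.1, ?_, by simpa using hl⟩,
    fun hl => isCyc_cons_iff.2 ⟨?_, hP, h'.2.2.1, hl⟩, ?_⟩
  · simp only [List.cons_append, List.nodup_cons, List.mem_append, List.mem_cons, List.nodup_append,
      List.mem_reverse, List.nodup_reverse] at hn hd ⊢
    grind
  · rw [hrev, List.isChain_reverse]; exact hP.imp (fun _ _ h => h.symm)
  · simp only [List.cons_append, List.nodup_cons, List.mem_append, List.mem_cons, List.nodup_append,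
      List.mem_reverse, List.nodup_reverse] at hn hd ⊢
    grind
  · rw [cv_cons, cv_cons, cv_cons, hrev, pv_reverse]
    have := add_self_vec (pv (a :: P ++ [b]))
    calc _ = pv (a :: A ++ [b]) + (pv (a :: P ++ [b]) + pv (a :: P ++ [b])) + pv (b :: B ++ [a]) := by
          rw [this, add_zero]
      _ = _ := by abel

end Th


namespace Th
universe u
variable {V : Type u}

/-- peripheral cycle: induced and nonseparating -/
structure Periph (H : SimpleGraph V) (W : Set V) (l : List V) : Prop where
  cyc : IsCyc H l
  ind : ∀ x ∈ l, ∀ y ∈ l, H.Adj x y → cv l s(x, y) ≠ 0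
  con : Conn H (W \ {v | v ∈ l})

theorem ear_chain {H : SimpleGraph V} {A : Set V} {x y d e : V} {p : List V} (hp : PathIn H A d e p)
    (hx : H.Adj x d) (hy : H.Adj e y) : (x :: p ++ [y]).IsChain H.Adj := by
  rw [List.cons_append, List.isChain_cons, List.isChain_append]
  refine ⟨?_, hp.ch, by simp, ?_⟩
  · intro z hz
    have := hp.hd
    rw [List.head?_append, this] at hz
    simp at hz; subst hz; exact hx
  · intro u hu v hv
    rw [hp.ls] at hu; simp at hu hv; subst hu; subst hv; exact hy

theorem IsCyc.sub {H : SimpleGraph V} {W : Set V} (hW : ∀ x y, H.Adj x y → x ∈ W) {l : List V}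
    (h : IsCyc H l) : ∀ v ∈ l, v ∈ W := by
  intro v hv
  obtain ⟨t, ht⟩ := h.start hv
  have := ht.cyc
  cases t with
  | nil => have := this.len; simp at this
  | cons b t =>
    have h2 := this.2.1
    simp only [List.cons_append, List.isChain_cons_cons] at h2
    exact hW _ _ h2.1

/-- the conclusion of a step -/
def Better (H : SimpleGraph V) (W : Set V) (Bad : (Sym2 V → ZMod 2) → Prop) (l : List V)
    (K : Set V) : Prop :=
  ∃ l' K', IsCyc H l' ∧ Conn H K' ∧ K' ⊆ W \ {v | v ∈ l'} ∧ Bad (cv l') ∧ K ⊆ K' ∧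
    (K ≠ K' ∨ l'.length < l.length)

theorem better_grow {H : SimpleGraph V} {W : Set V} {Bad : (Sym2 V → ZMod 2) → Prop} {l : List V}
    {K : Set V} (hK : Conn H K) (hKW : K ⊆ W) {l1 : List V} (h1 : IsCyc H l1)
    (hb : Bad (cv l1)) (hd : ∀ v ∈ l1, v ∉ K) {n k : V} (hn : n ∉ l1) (hnW : n ∈ W) (hnK : n ∉ K)
    (hk : k ∈ K) (hkn : H.Adj k n) : Better H W Bad l K := by
  refine ⟨l1, insert n K, h1, hK.insert_adj hk hkn, ?_, hb, Set.subset_insert _ _, Or.inl ?_⟩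
  · intro v hv
    rcases hv with rfl | hv
    · exact ⟨hnW, hn⟩
    · exact ⟨hKW hv, fun h => hd v h hv⟩
  · intro h; apply hnK; rw [h]; simp

theorem step_chord {H : SimpleGraph V} {W : Set V} {Bad : (Sym2 V → ZMod 2) → Prop}
    (hBad : ∀ x y, Bad (x + y) → Bad x ∨ Bad y) {l : List V}
    {K : Set V} (hK : Conn H K) (hKW : K ⊆ W \ {v | v ∈ l}) (hl : IsCyc H l) (hb : Bad (cv l))
    {x y : V} (hx : x ∈ l) (hy : y ∈ l) (hxy : H.Adj x y) (hc : cv l s(x, y) = 0) :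
    Better H W Bad l K := by
  obtain ⟨A, B, hAB⟩ := hl.split hx hy hxy.ne
  have hA : A ≠ [] := by
    rintro rfl
    have := cv_two (t := B) hAB.cyc
    have h2 := hAB.vec
    simp only [List.cons_append, List.nil_append] at h2
    rw [h2, hc] at this; simp at this
  have hB : B ≠ [] := by
    rintro rfl
    have := cv_last (t := A) hAB.cyc
    rw [hAB.vec, hc] at this; simp at this
  have hA' := List.length_pos_iff.2 hA
  have hB' := List.length_pos_iff.2 hB
  obtain ⟨t1, t2, t3⟩ := theta (P := []) hAB.cyc (by simpa using hxy) (by simp) (by simp)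
  have t1 := t1 (by simp; omega)
  have t2 := t2 (by simp; omega)
  rw [hAB.vec] at t3
  have hlen := hAB.len
  simp only [List.length_append, List.length_cons] at hlen
  rw [t3] at hb
  rcases hBad _ _ hb with h | h
  · refine ⟨_, K, t1, hK, ?_, h, le_rfl, Or.inr ?_⟩
    · intro v hv
      refine ⟨(hKW hv).1, fun h => (hKW hv).2 ((hAB.mem v).1 ?_)⟩
      simp at h ⊢; tauto
    · simp; omega
  · refine ⟨_, K, t2, hK, ?_, h, le_rfl, Or.inr ?_⟩
    · intro v hv
      refine ⟨(hKW hv).1, fun h => (hKW hv).2 ((hAB.mem v).1 ?_)⟩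
      simp at h ⊢; tauto
    · simp; omega

theorem step_tripod {H : SimpleGraph V} {W : Set V} (hW : ∀ x y, H.Adj x y → x ∈ W)
    {Bad : (Sym2 V → ZMod 2) → Prop}
    (hBad : ∀ x y, Bad (x + y) → Bad x ∨ Bad y) {l : List V}
    {K : Set V} (hK : Conn H K) (hKW : K ⊆ W \ {v | v ∈ l}) (hb : Bad (cv l))
    {D : Set V} (hD : Conn H D) (hDK : Disjoint D K) (hDl : ∀ v ∈ l, v ∉ D)
    {x1 x2 x3 d1 d2 d3 k1 k2 k3 : V} {A B : List V} (hAB : CEq H l (x1 :: A ++ x2 :: B))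
    (h3 : x3 ∈ B) (hd1 : d1 ∈ D) (hd2 : d2 ∈ D) (hd3 : d3 ∈ D) (hk1 : k1 ∈ K) (hk2 : k2 ∈ K)
    (hk3 : k3 ∈ K) (e1 : H.Adj x1 d1) (e2 : H.Adj x2 d2) (e3 : H.Adj x3 d3)
    (f1 : H.Adj k1 x1) (f2 : H.Adj k2 x2) (f3 : H.Adj k3 x3) : Better H W Bad l K := by
  have hKW' : K ⊆ W := fun v hv => (hKW hv).1
  have hlK : ∀ v, v ∈ x1 :: A ++ x2 :: B → v ∉ K := fun v hv hvK =>
    (hKW hvK).2 ((hAB.mem v).1 hv)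
  have hlD : ∀ v, v ∈ x1 :: A ++ x2 :: B → v ∉ D := fun v hv => hDl v ((hAB.mem v).1 hv)
  have hlW : ∀ v, v ∈ x1 :: A ++ x2 :: B → v ∈ W := hAB.cyc.sub hW
  have hDK' : ∀ v ∈ D, v ∉ K := fun v h1 h2 => Set.disjoint_left.1 hDK h1 h2
  obtain ⟨P, hP⟩ := hD.path hd1 hd2
  have hPn : P ≠ [] := by rintro rfl; have := hP.hd; simp at this
  have hPn' := List.length_pos_iff.2 hPn
  obtain ⟨t1, t2, t3⟩ := theta (P := P) hAB.cyc (ear_chain hP e1 e2.symm) hP.nd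
    (fun v hv h => hlD v h (hP.mem v hv))
  have t1 := t1 (by omega)
  have t2 := t2 (by omega)
  rw [← hAB.vec, t3] at hb
  have hnd := hAB.cyc.nd
  simp only [List.cons_append, List.nodup_cons, List.mem_append, List.mem_cons, List.nodup_append]
    at hnd
  have hmx1 : x1 ∈ x1 :: A ++ x2 :: B := by simp
  have hmx2 : x2 ∈ x1 :: A ++ x2 :: B := by simp
  have hmx3 : x3 ∈ x1 :: A ++ x2 :: B := by simp [h3]
  rcases hBad _ _ hb with h | h
  · refine better_grow hK hKW' t1 h ?_ (n := x3) ?_ (hlW _ hmx3) (hlK _ hmx3) hk3 f3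
    · intro v hv
      by_cases hvP : v ∈ P
      · exact hDK' v (hP.mem v hvP)
      · apply hlK; simp at hv ⊢; tauto
    · have hx3P : x3 ∉ P := fun h => hlD _ hmx3 (hP.mem _ h)
      simp only [List.cons_append, List.mem_cons, List.mem_append, List.mem_reverse, not_or]
      refine ⟨?_, ?_, ?_, hx3P⟩
      · rintro rfl; exact hnd.1 (by simp [h3])
      · intro h; exact hnd.2.2.2 _ h x3 (by simp [h3]) rfl
      · rintro rfl; exact hnd.2.2.1.1 h3
  · obtain ⟨q, hq⟩ := hD.path hd3 hd1
    have hd1P : d1 ∈ P := List.mem_of_mem_head? (by rw [hP.hd]; rfl)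
    have hd1q : d1 ∈ q := List.mem_of_getLast? hq.ls
    obtain ⟨q1, p, q2, hq12, hpP, hq1⟩ := first_split (p := fun v => v ∈ P) ⟨d1, hd1q, hd1P⟩
    obtain ⟨P1, P2, rfl⟩ := List.append_of_mem hpP
    obtain ⟨B1, B2, rfl⟩ := List.append_of_mem h3
    have hq1D : ∀ v ∈ q1, v ∈ D := fun v hv => hq.mem v (by simp [hq12, hv])
    have hrot : x1 :: (P1 ++ p :: P2) ++ x2 :: (B1 ++ x3 :: B2) =
        (x1 :: (P1 ++ p :: P2) ++ x2 :: B1) ++ (x3 :: B2) := by simp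
    have r := CEq.rot (H := H) (l₁ := x1 :: (P1 ++ p :: P2) ++ x2 :: B1) (l₂ := x3 :: B2)
      (by rw [← hrot]; exact t2)
    have hrot2 : (x3 :: B2) ++ (x1 :: (P1 ++ p :: P2) ++ x2 :: B1) =
        x3 :: (B2 ++ x1 :: P1) ++ p :: (P2 ++ x2 :: B1) := by simp
    rw [hrot2, ← hrot] at r
    have hear : (x3 :: q1 ++ [p]).IsChain H.Adj := by
      have h1 := hq.ch
      have h2 : (x3 :: q).IsChain H.Adj := by
        rw [List.isChain_cons]; refine ⟨?_, h1⟩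
        intro y hy; rw [hq.hd] at hy; simp at hy; subst hy; exact e3
      rw [hq12] at h2
      have h3 : (x3 :: q1 ++ p :: q2).IsChain H.Adj := by simpa using h2
      exact (chain_glue.1 h3).1
    have hq1nd : q1.Nodup := by
      have := hq.nd; rw [hq12] at this; exact (List.nodup_append.1 this).1
    obtain ⟨s1, s2, s3⟩ := theta r.cyc hear hq1nd (by
      intro v hv hmem
      have hv1 := (r.mem v).1 hmem
      have h1 := hq1 v hv
      have h2 := hq1D v hv
      have h3 := hlD v
      rcases List.mem_append.1 hv1 with h4 | h4
      · rcases List.mem_cons.1 h4 with rfl | h4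
        · exact h3 (by simp) h2
        · exact h1 h4
      · exact h3 (List.mem_append_right _ h4) h2)
    have s1 := s1 (by simp; omega)
    have s2 := s2 (by simp; omega)
    rw [← r.vec, s3] at h
    have hPD := hP.mem
    have hnd2 := r.cyc.nd
    have hnd3 := s1.nd
    have hnd4 := s2.nd
    simp only [List.cons_append, List.nodup_cons, List.mem_append, List.mem_cons, List.nodup_append,
      List.append_assoc] at hnd2
    rcases hBad _ _ h with h | h
    · refine better_grow hK hKW' s1 h ?_ (n := x2) ?_ (hlW _ hmx2) (hlK _ hmx2) hk2 f2
      · intro v hv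
        by_cases hvD : v ∈ D
        · exact hDK' v hvD
        · apply hlK
          have h1 := hq1D v
          have h2 := hPD v
          clear * - hv h1 h2 hvD
          simp at hv h2 ⊢
          grind
      · intro hmem
        have h1 : x2 ∉ q1 := fun h => hlD _ hmx2 (hq1D _ h)
        clear * - hmem h1 hnd2
        simp at hmem
        grind
    · refine better_grow hK hKW' s2 h ?_ (n := x1) ?_ (hlW _ hmx1) (hlK _ hmx1) hk1 f1
      · intro v hv
        by_cases hvD : v ∈ D
        · exact hDK' v hvD
        · apply hlK
          have h1 := hq1D v
          have h2 := hPD v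
          clear * - hv h1 h2 hvD
          simp at hv h2 ⊢
          grind
      · intro hmem
        have h1 : x1 ∉ q1 := fun h => hlD _ hmx1 (hq1D _ h)
        clear * - hmem h1 hnd2
        simp at hmem
        grind

end Th


namespace Th
universe u
variable {V : Type u}

theorem step_ear {H : SimpleGraph V} {W : Set V} (hW : ∀ x y, H.Adj x y → x ∈ W)
    {Bad : (Sym2 V → ZMod 2) → Prop}
    (hBad : ∀ x y, Bad (x + y) → Bad x ∨ Bad y) {l : List V}
    {K : Set V} (hK : Conn H K) (hKW : K ⊆ W \ {v | v ∈ l}) (hb : Bad (cv l))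
    {D : Set V} (hD : Conn H D) (hDK : Disjoint D K)
    {s t x d a0 k1 k2 : V} {J R : List V} (hJR : CEq H l (t :: J ++ s :: R))
    (ha0 : a0 ∈ J) (ha0D : a0 ∈ D) (hx : x ∈ R) (hd : d ∈ D) (hdx : H.Adj d x)
    (hsD : s ∉ D) (htD : t ∉ D) (hxD : x ∉ D)
    (hk1 : k1 ∈ K) (hk2 : k2 ∈ K) (f1 : H.Adj k1 s) (f2 : H.Adj k2 t) : Better H W Bad l K := by
  have hKW' : K ⊆ W := fun v hv => (hKW hv).1
  have hlK : ∀ v, v ∈ t :: J ++ s :: R → v ∉ K := fun v hv hvK =>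
    (hKW hvK).2 ((hJR.mem v).1 hv)
  have hlW : ∀ v, v ∈ t :: J ++ s :: R → v ∈ W := hJR.cyc.sub hW
  have hDK' : ∀ v ∈ D, v ∉ K := fun v h1 h2 => Set.disjoint_left.1 hDK h1 h2
  have hnd := hJR.cyc.nd
  simp only [List.cons_append, List.nodup_cons, List.mem_append, List.mem_cons, List.nodup_append]
    at hnd
  have hJRd : ∀ v, v ∈ J → v ∉ R := by
    intro v h1 h2; exact hnd.2.2.2 v h1 v (Or.inr h2) rfl
  have hmt : t ∈ t :: J ++ s :: R := by simp
  have hms : s ∈ t :: J ++ s :: R := by simp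
  obtain ⟨q, hq⟩ := hD.path ha0D hd
  have hch : (q ++ [x]).IsChain H.Adj := by
    rw [List.isChain_append]
    refine ⟨hq.ch, by simp, ?_⟩
    intro u hu v hv
    rw [hq.ls] at hu; simp at hu hv; subst hu; subst hv; exact hdx
  have hqnd : (q ++ [x]).Nodup := by
    rw [List.nodup_append]
    refine ⟨hq.nd, by simp, ?_⟩
    intro u hu v hv; simp at hv; subst hv; rintro rfl; exact hxD (hq.mem _ hu)
  have hqm : ∀ v ∈ q ++ [x], v ∈ D ∨ v = x := by
    intro v hv; simp at hv; rcases hv with h | h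
    · exact Or.inl (hq.mem v h)
    · exact Or.inr h
  obtain ⟨q', rfl⟩ : ∃ q', q = a0 :: q' := by
    cases q with
    | nil => have := hq.hd; simp at this
    | cons c q' => have := hq.hd; simp at this; exact ⟨q', by rw [this]⟩
  obtain ⟨l₁, a, P, b, l₂, h1, haJ, hbR, hP⟩ := segment (p := fun v => v ∈ J) (q := fun v => v ∈ R)
    (x := a0) (l := q' ++ [x]) ha0 ⟨x, by simp, hx⟩ hJRd
  have h1' : a0 :: q' ++ [x] = l₁ ++ (a :: P ++ b :: l₂) := by
    rw [List.cons_append, h1, List.append_assoc]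
  rw [h1'] at hch hqnd hqm
  have hPm : ∀ v ∈ P, v ∈ D ∨ v = x := fun v hv => hqm v (by simp [hv])
  have hPch : (a :: P ++ [b]).IsChain H.Adj := by
    have := (List.isChain_append.1 hch).2.1
    exact (chain_glue.1 this).1
  have hPnd : P.Nodup := by
    have := (List.nodup_append.1 hqnd).2.1
    have := (List.nodup_append.1 this).1
    exact (List.nodup_cons.1 this).2
  have hxs : x ≠ s := by rintro rfl; exact hnd.2.2.1.1 hx
  have hxt : x ≠ t := by rintro rfl; exact hnd.1 (by simp [hx])
  have hPK : ∀ v ∈ P, v ∉ K := by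
    intro v hv
    rcases hPm v hv with h | rfl
    · exact hDK' v h
    · exact hlK _ (by simp [hx])
  have hPs : s ∉ P := fun h => (hPm s h).elim hsD (fun h => hxs h.symm)
  have hPt : t ∉ P := fun h => (hPm t h).elim htD (fun h => hxt h.symm)
  obtain ⟨J1, J2, rfl⟩ := List.append_of_mem haJ
  obtain ⟨R1, R2, rfl⟩ := List.append_of_mem hbR
  have e1 : t :: (J1 ++ a :: J2) ++ s :: (R1 ++ b :: R2) =
    (t :: J1) ++ (a :: (J2 ++ s :: R1) ++ b :: R2) := by simp
  have r := CEq.rot (H := H) (l₁ := t :: J1) (l₂ := a :: (J2 ++ s :: R1) ++ b :: R2)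
    (by rw [← e1]; exact hJR.cyc)
  have e2 : a :: (J2 ++ s :: R1) ++ b :: R2 ++ (t :: J1) =
    a :: (J2 ++ s :: R1) ++ b :: (R2 ++ t :: J1) := by simp
  rw [e2, ← e1] at r
  obtain ⟨t1, t2, t3⟩ := theta r.cyc hPch hPnd (by
    intro v hv hm
    have h2 := (r.mem v).1 hm
    have h3 := hP v hv
    rcases List.mem_append.1 h2 with h4 | h4
    · rcases List.mem_cons.1 h4 with rfl | h4
      · exact hPt hv
      · exact h3.1 h4
    · rcases List.mem_cons.1 h4 with rfl | h4
      · exact hPs hv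
      · exact h3.2 h4)
  have t1 := t1 (by simp; omega)
  have t2 := t2 (by simp; omega)
  have hnd2 := r.cyc.nd
  rw [← hJR.vec, ← r.vec, t3] at hb
  simp only [List.cons_append, List.nodup_cons, List.mem_append, List.mem_cons, List.nodup_append,
      List.append_assoc] at hnd2
  rcases hBad _ _ hb with h | h
  · refine better_grow hK hKW' t1 h ?_ (n := t) ?_ (hlW _ hmt) (hlK _ hmt) hk2 f2
    · intro v hv
      by_cases hvP : v ∈ P
      · exact hPK v hvP
      · apply hlK
        clear * - hv hvP
        simp at hv ⊢
        grind
    · intro hmem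
      clear * - hmem hnd2 hPt
      simp at hmem
      grind
  · refine better_grow hK hKW' t2 h ?_ (n := s) ?_ (hlW _ hms) (hlK _ hms) hk1 f1
    · intro v hv
      by_cases hvP : v ∈ P
      · exact hPK v hvP
      · apply hlK
        clear * - hv hvP
        simp at hv ⊢
        grind
    · intro hmem
      clear * - hmem hnd2 hPs
      simp at hmem
      grind

theorem stepT {H : SimpleGraph V} {W : Set V} (hW : ∀ x y, H.Adj x y → x ∈ W)
    (h3c : ∀ x y, Conn H (W \ {x, y}))
    {Bad : (Sym2 V → ZMod 2) → Prop}
    (hBad : ∀ x y, Bad (x + y) → Bad x ∨ Bad y) {l : List V} {K : Set V} (hl : IsCyc H l)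
    (hK : Conn H K) (hKW : K ⊆ W \ {v | v ∈ l}) (hb : Bad (cv l)) (hnp : ¬ Periph H W l) :
    Better H W Bad l K := by
  have hKW' : K ⊆ W := fun v hv => (hKW hv).1
  have hKl : ∀ v ∈ l, v ∉ K := fun v h1 h2 => (hKW h2).2 h1
  by_cases hch : ∃ x ∈ l, ∃ y ∈ l, H.Adj x y ∧ cv l s(x, y) = 0
  · obtain ⟨x, hx, y, hy, hxy, hc⟩ := hch
    exact step_chord hBad hK hKW hl hb hx hy hxy hc
  have hncon : ¬ Conn H (W \ {v | v ∈ l}) := by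
    intro hc
    apply hnp
    refine ⟨hl, ?_, hc⟩
    intro x hx y hy hxy h0
    exact hch ⟨x, hx, y, hy, hxy, h0⟩
  have hz : ∃ z ∈ W \ {v | v ∈ l}, z ∉ K := by
    by_contra hcon
    push Not at hcon
    have : K = W \ {v | v ∈ l} := Set.Subset.antisymm hKW hcon
    exact hncon (this ▸ hK)
  obtain ⟨z, hz, hzK⟩ := hz
  by_cases hK0 : K = ∅
  · subst hK0
    refine ⟨l, {z}, hl, conn_singleton H z, by simpa using hz, hb, by simp, Or.inl ?_⟩
    exact (Set.singleton_ne_empty z).symm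
  obtain ⟨k0, hk0⟩ := Set.nonempty_iff_ne_empty.2 hK0
  by_cases hg : ∃ k ∈ K, ∃ y, H.Adj k y ∧ y ∉ K ∧ y ∉ l
  · obtain ⟨k, hk, y, hky, hyK, hyl⟩ := hg
    exact better_grow hK hKW' hl hb hKl hyl (hW _ _ hky.symm) hyK hk hky
  push Not at hg
  set N : Set V := {x | x ∈ l ∧ ∃ k ∈ K, H.Adj k x} with hN
  have hNl : ∀ x ∈ N, x ∈ l := fun x hx => hx.1
  have hKN : ∀ k ∈ K, ∀ y, H.Adj k y → y ∈ K ∨ y ∈ N := by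
    intro k hk y hky
    by_cases hy : y ∈ K
    · exact Or.inl hy
    · exact Or.inr ⟨hg k hk y hky hy, k, hk, hky⟩
  have hzN : z ∉ N := fun h => hz.2 h.1
  set D := comp H (W \ (K ∪ N)) z with hDdef
  have hDs : ∀ v ∈ D, v ∈ W ∧ v ∉ K ∧ v ∉ N := by
    intro v hv
    have := comp_sub hv
    simp only [Set.mem_sdiff, Set.mem_union, not_or] at this
    exact this
  have hDK : Disjoint D K := Set.disjoint_left.2 (fun v h1 h2 => (hDs v h1).2.1 h2)
  have hzD : z ∈ D := mem_comp_self ⟨hz.1, by simp [hzK, hzN]⟩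
  have hDcl : ∀ v ∈ D, ∀ y, H.Adj v y → y ∈ D ∨ y ∈ N := by
    intro v hv y hvy
    by_contra hcon
    push Not at hcon
    apply hcon.1
    refine comp_closed hv hvy ⟨hW _ _ hvy.symm, ?_⟩
    rintro (h | h)
    · rcases hKN y h v hvy.symm with h' | h'
      · exact (hDs v hv).2.1 h'
      · exact (hDs v hv).2.2 h'
    · exact hcon.2 h
  have hx3 : ∀ s t, s ∉ D → t ∉ D → s ∉ K → t ∉ K → ∃ x ∈ N, x ≠ s ∧ x ≠ t ∧ ∃ d ∈ D, H.Adj x d := by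
    intro s t hs ht hsK htK
    have hzz : z ∈ W \ {s, t} := by
      refine ⟨hz.1, ?_⟩
      rintro (rfl | rfl) <;> contradiction
    have hkk : k0 ∈ W \ {s, t} := by
      refine ⟨hKW' hk0, ?_⟩
      rintro (rfl | rfl) <;> contradiction
    obtain ⟨d, hd, hdD, y, hy, hyD, hdy⟩ := (h3c s t).cut' D hzz hzD hkk
      (fun h => (hDs _ h).2.1 hk0)
    rcases hDcl d hdD y hdy with h | h
    · exact absurd h hyD
    · exact ⟨y, h, fun h => hy.2 (by simp [h]), fun h => hy.2 (by simp [h]), d, hdD, hdy.symm⟩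
  have hlne : ∃ a, a ∈ l := by
    cases l with
    | nil => exact hl.elim
    | cons a t => exact ⟨a, by simp⟩
  by_cases hDl : ∃ a0 ∈ l, a0 ∈ D
  · obtain ⟨a0, ha0l, ha0D⟩ := hDl
    have hnN : ∀ s, s ∉ K → ∃ x ∈ N, x ≠ s := by
      intro s hsK
      have : ∃ w ∈ W, w ∉ K ∧ w ≠ s := by
        by_cases h : z = s
        · refine ⟨a0, (hDs _ ha0D).1, hKl _ ha0l, ?_⟩
          rintro rfl; subst h; exact hz.2 ha0l
        · exact ⟨z, hz.1, hzK, h⟩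
      obtain ⟨w, hwW, hwK, hws⟩ := this
      obtain ⟨k, hk, hkK, y, hy, hyK, hky⟩ := (h3c s s).cut' K (a := k0) (b := w)
        ⟨hKW' hk0, by rintro (rfl | rfl) <;> contradiction⟩ hk0 ⟨hwW, by simpa using hws⟩ hwK
      rcases hKN k hkK y hky with h | h
      · exact absurd h hyK
      · exact ⟨y, h, fun h => hy.2 (by simp [h])⟩
    obtain ⟨T, hT⟩ := hl.start ha0l
    have hNT : ∀ x ∈ N, x ∈ T := by
      intro x hx
      have := (hT.mem x).2 (hNl x hx)
      rcases List.mem_cons.1 this with rfl | h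
      · exact absurd hx (hDs _ ha0D).2.2
      · exact h
    obtain ⟨n1, hn1, -⟩ := hnN z hzK
    obtain ⟨T1, s, T2, hT12, hsN, hT1⟩ := first_split (p := fun v => v ∈ N) ⟨n1, hNT _ hn1, hn1⟩
    obtain ⟨n2, hn2, hn2s⟩ := hnN s (hKl _ (hNl _ hsN))
    have hn2T : n2 ∈ T2 := by
      have := hNT _ hn2
      rw [hT12] at this
      rcases List.mem_append.1 this with h | h
      · exact absurd hn2 (hT1 _ h)
      · rcases List.mem_cons.1 h with h | h
        · exact absurd h hn2s
        · exact h
    obtain ⟨R, t, T3, hR, htN, hT3⟩ := last_split (p := fun v => v ∈ N) ⟨n2, hn2T, hn2⟩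
    have e1 : a0 :: T = (a0 :: (T1 ++ s :: R)) ++ (t :: T3) := by rw [hT12, hR]; simp
    rw [e1] at hT
    have r := hT.trans (CEq.rot hT.cyc)
    have e2 : t :: T3 ++ a0 :: (T1 ++ s :: R) = t :: (T3 ++ a0 :: T1) ++ s :: R := by simp
    rw [e2] at r
    have hsD : s ∉ D := fun h => (hDs _ h).2.2 hsN
    have htD : t ∉ D := fun h => (hDs _ h).2.2 htN
    obtain ⟨x, hxN, hxs, hxt, d, hd, hxd⟩ := hx3 s t hsD htD (hKl _ (hNl _ hsN)) (hKl _ (hNl _ htN))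
    have hxR : x ∈ R := by
      have := hNT x hxN
      rw [hT12, hR] at this
      simp only [List.mem_append, List.mem_cons] at this
      rcases this with h | h | h | h | h
      · exact absurd hxN (hT1 _ h)
      · exact absurd h hxs
      · exact h
      · exact absurd h hxt
      · exact absurd hxN (hT3 _ h)
    obtain ⟨k1, hk1, f1⟩ := hsN.2
    obtain ⟨k2, hk2, f2⟩ := htN.2
    exact step_ear hW hBad hK hKW hb conn_comp hDK r (a0 := a0) (by simp) ha0D hxR hd hxd.symm hsD htD
      (fun h => (hDs _ h).2.2 hxN) hk1 hk2 f1 f2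
  · push Not at hDl
    obtain ⟨a, ha⟩ := hlne
    obtain ⟨x1, hx1, -, -, d1, hd1, e1⟩ := hx3 a a (hDl a ha) (hDl a ha) (hKl a ha) (hKl a ha)
    have m1 := hNl _ hx1
    obtain ⟨x2, hx2, h21, -, d2, hd2, e2⟩ := hx3 x1 x1 (hDl _ m1) (hDl _ m1) (hKl _ m1) (hKl _ m1)
    have m2 := hNl _ hx2
    obtain ⟨x3, hx3, h31, h32, d3, hd3, e3⟩ := hx3 x1 x2 (hDl _ m1) (hDl _ m2) (hKl _ m1) (hKl _ m2)
    have m3 := hNl _ hx3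
    obtain ⟨k1, hk1, f1⟩ := hx1.2
    obtain ⟨k2, hk2, f2⟩ := hx2.2
    obtain ⟨k3, hk3, f3⟩ := hx3.2
    obtain ⟨A, B, hAB⟩ := hl.split m1 m2 h21.symm
    have m3' := (hAB.mem _).2 m3
    simp only [List.cons_append, List.mem_cons, List.mem_append] at m3'
    rcases m3' with h | h | h | h
    · exact absurd h h31
    · have r := hAB.trans (CEq.rot hAB.cyc)
      exact step_tripod hW hBad hK hKW hb conn_comp hDK hDl r h hd2 hd1 hd3 hk2 hk1 hk3 e2 e1 e3 f2 f1 f3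
    · exact absurd h h32
    · exact step_tripod hW hBad hK hKW hb conn_comp hDK hDl hAB h hd1 hd2 hd3 hk1 hk2 hk3 e1 e2 e3 f1 f2 f3

theorem lemmaT [Finite V] {H : SimpleGraph V} {W : Set V} (hW : ∀ x y, H.Adj x y → x ∈ W)
    (h3c : ∀ x y, Conn H (W \ {x, y}))
    {Bad : (Sym2 V → ZMod 2) → Prop}
    (hBad : ∀ x y, Bad (x + y) → Bad x ∨ Bad y) {l : List V} {K : Set V} (hl : IsCyc H l)
    (hK : Conn H K) (hKW : K ⊆ W \ {v | v ∈ l}) (hb : Bad (cv l)) :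
    ∃ l', Periph H W l' ∧ Bad (cv l') ∧ K ⊆ W \ {v | v ∈ l'} := by
  have main : ∀ m n : ℕ, ∀ l K, IsCyc H l → Conn H K → K ⊆ W \ {v | v ∈ l} → Bad (cv l) →
      (W \ K).ncard ≤ m → l.length ≤ n →
      ∃ l', Periph H W l' ∧ Bad (cv l') ∧ K ⊆ W \ {v | v ∈ l'} := by
    intro m
    induction m using Nat.strong_induction_on with
    | _ m ihm =>
      intro n
      induction n with
      | zero =>
        intro l K hl _ _ _ _ h0
        have := hl.len; omega
      | succ n ihn =>
        intro l K hl hK hKW hb hm hn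
        by_cases hp : Periph H W l
        · exact ⟨l, hp, hb, hKW⟩
        obtain ⟨l', K', hl', hK', hKW', hb', hKK', hor⟩ := stepT hW h3c hBad hl hK hKW hb hp
        by_cases hne : K = K'
        · subst hne
          have : l'.length < l.length := by
            rcases hor with h | h
            · exact absurd rfl h
            · exact h
          exact ihn l' K hl' hK hKW' hb' hm (by omega)
        · have hlt : (W \ K').ncard < (W \ K).ncard := by
            apply Set.ncard_lt_ncard _ (Set.toFinite _)
            rw [Set.ssubset_iff_subset_ne]
            refine ⟨Set.sdiff_subset_sdiff_right hKK', ?_⟩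
            intro heq
            apply hne
            apply Set.Subset.antisymm hKK'
            intro v hv
            by_contra hvK
            have : v ∈ W \ K := ⟨(hKW' hv).1, hvK⟩
            rw [← heq] at this
            exact this.2 hv
          obtain ⟨l'', h1, h2, h3⟩ := ihm (W \ K').ncard (by omega) l'.length l' K' hl' hK' hKW' hb'
            le_rfl le_rfl
          exact ⟨l'', h1, h2, hKK'.trans h3⟩
  exact main _ _ l K hl hK hKW hb le_rfl le_rfl

end Th


namespace Th
universe u
variable {V : Type u}

theorem cv_cross {H : SimpleGraph V} {m n p q : V} {X Y : List V} (h : IsCyc H (m :: X ++ n :: Y))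
    (hp : p ∈ X) (hq : q ∈ Y) : cv (m :: X ++ n :: Y) s(p, q) = 0 := by
  have hnd := h.nd
  simp only [List.cons_append, List.nodup_cons, List.mem_append, List.mem_cons, List.nodup_append]
    at hnd
  rw [cv_cons]
  have h1 : pv (m :: X ++ [n]) s(p, q) = 0 := by
    by_contra hcon
    have := pv_supp_mem hcon (x := q) (by simp)
    simp only [List.cons_append, List.mem_cons, List.mem_append, List.not_mem_nil, or_false] at this
    clear * - this hnd hp hq
    grind
  have h2 : pv (n :: Y ++ [m]) s(p, q) = 0 := by
    by_contra hcon
    have := pv_supp_mem hcon (x := p) (by simp)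
    simp only [List.cons_append, List.mem_cons, List.mem_append, List.not_mem_nil, or_false] at this
    clear * - this hnd hp hq
    grind
  rw [Pi.add_apply, h1, h2, add_zero]

/-- ends of a chain are linked to a nonempty interior -/
theorem lk_ends {H : SimpleGraph V} {a b : V} {A : List V} (h : (a :: A ++ [b]).IsChain H.Adj)
    (hA : A ≠ []) : Lk H {a} {v | v ∈ A} ∧ Lk H {b} {v | v ∈ A} ∧ Conn H {v | v ∈ A} := by
  refine ⟨?_, ?_, ?_⟩
  · cases A with
    | nil => exact absurd rfl hA
    | cons c A =>
      simp only [List.cons_append, List.isChain_cons_cons] at h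
      exact ⟨a, rfl, c, by simp, h.1⟩
  · rcases List.eq_nil_or_concat A with rfl | ⟨A', c, rfl⟩
    · exact absurd rfl hA
    · have h2 : (a :: A' ++ c :: [b]).IsChain H.Adj := by simpa using h
      have := (chain_glue.1 h2).2
      simp only [List.isChain_cons_cons] at this
      exact ⟨b, rfl, c, by simp, this.1.symm⟩
  · apply conn_list
    have h2 := List.isChain_append.1 h
    exact (List.isChain_cons.1 h2.1).2

theorem Periph.congr {H : SimpleGraph V} {W : Set V} {l l' : List V} (h : Periph H W l)
    (h' : CEq H l l') : Periph H W l' := by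
  refine ⟨h'.cyc, ?_, ?_⟩
  · intro x hx y hy hxy
    rw [h'.vec]
    exact h.ind x ((h'.mem x).1 hx) y ((h'.mem y).1 hy) hxy
  · have : {v | v ∈ l'} = {v | v ∈ l} := by ext v; exact h'.mem v
    rw [this]; exact h.con

theorem periph_caseI {H : SimpleGraph V} (hp : IsPlanar H) {W : Set V} {a b : V} {A B Q R : List V}
    (hW : ∀ x y, H.Adj x y → x ∈ W)
    (h1 : Periph H W (a :: A ++ b :: B)) (h2 : Periph H W (a :: Q ++ b :: R)) (hQ : Q ≠ [])
    (hQ1 : ∀ v ∈ Q, v ∉ a :: A ++ b :: B) {r r' : V} (hr : r ∈ A) (hr' : r' ∈ B)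
    (hr2 : r ∉ a :: Q ++ b :: R) (hr2' : r' ∉ a :: Q ++ b :: R) : False := by
  have hc1 := isCyc_cons_iff.1 h1.cyc
  have hc2 := isCyc_cons_iff.1 h2.cyc
  have hnd := hc1.1
  simp only [List.cons_append, List.nodup_cons, List.mem_append, List.mem_cons, List.nodup_append]
    at hnd
  have hAn : A ≠ [] := by rintro rfl; simp at hr
  have hBn : B ≠ [] := by rintro rfl; simp at hr'
  have hAB : ∀ v ∈ A, v ∉ B := fun v hv hv' => hnd.2.2.2 v hv v (Or.inr hv') rfl
  have hW1 := h1.cyc.sub hW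
  have hW2 := h2.cyc.sub hW
  obtain ⟨p, hpp⟩ := h2.con.path (x := r) (y := r') ⟨hW1 _ (by simp [hr]), hr2⟩
    ⟨hW1 _ (by simp [hr']), hr2'⟩
  obtain ⟨p', rfl⟩ : ∃ p', p = r :: p' := by
    cases p with
    | nil => have := hpp.hd; simp at this
    | cons c q' => have := hpp.hd; simp at this; exact ⟨q', by rw [this]⟩
  have hr'p : r' ∈ p' := by
    have := List.mem_of_getLast? hpp.ls
    rcases List.mem_cons.1 this with h | h
    · subst h; exact absurd hr' (hAB _ hr)
    · exact h
  obtain ⟨l₁, s, P, s', l₂, h3, hsA, hsB, hP⟩ := segment (p := fun v => v ∈ A) (q := fun v => v ∈ B)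
    (x := r) (l := p') hr ⟨r', hr'p, hr'⟩ hAB
  have h3' : r :: p' = l₁ ++ (s :: P ++ s' :: l₂) := by rw [h3, List.append_assoc]
  have hch := hpp.ch
  have hmem := hpp.mem
  rw [h3'] at hch hmem
  have hPch : (s :: P ++ [s']).IsChain H.Adj :=
    (chain_glue.1 (List.isChain_append.1 hch).2.1).1
  have hPm : ∀ v ∈ P, v ∈ W \ {v | v ∈ a :: Q ++ b :: R} := fun v hv => hmem v (by simp [hv])
  have hP1 : ∀ v ∈ P, v ∉ a :: A ++ b :: B := by
    intro v hv hv'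
    have h4 := (hPm v hv).2
    have h5 := hP v hv
    simp at h4 hv'
    tauto
  have hPn : P ≠ [] := by
    rintro rfl
    have hadj : H.Adj s s' := by simpa using hPch
    exact h1.ind s (by simp [hsA]) s' (by simp [hsB]) hadj (cv_cross h1.cyc hsA hsB)
  obtain ⟨la, lb, cA⟩ := lk_ends hc1.2.1 hAn
  obtain ⟨lb', la', cB⟩ := lk_ends hc1.2.2.1 hBn
  obtain ⟨qa, qb, cQ⟩ := lk_ends hc2.2.1 hQ
  obtain ⟨ps, ps', cP⟩ := lk_ends hPch hPn
  have hQP : Disjoint {v | v ∈ Q} {v | v ∈ P} := by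
    rw [Set.disjoint_left]
    intro v hv hv'
    exact (hPm v hv').2 (by simp at hv ⊢; tauto)
  obtain ⟨Q', P', hQQ', hPP', hQK, hPK, hd, cQ', cP', lQP⟩ := split_conn h1.con cQ cP
    (fun v hv => ⟨hW2 v (by simp at hv ⊢; tauto), hQ1 v hv⟩) (fun v hv => ⟨(hPm v hv).1, hP1 v hv⟩)
    hQP (by obtain ⟨x, hx⟩ := List.exists_mem_of_ne_nil _ hQ; exact ⟨x, hx⟩)
    (by obtain ⟨x, hx⟩ := List.exists_mem_of_ne_nil _ hPn; exact ⟨x, hx⟩)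
  have hQ'1 : ∀ v ∈ Q', v ∉ a :: A ++ b :: B := fun v hv => (hQK hv).2
  have hP'1 : ∀ v ∈ P', v ∉ a :: A ++ b :: B := fun v hv => (hPK hv).2
  simp only [List.cons_append, List.mem_append, List.mem_cons, not_or] at hQ'1 hP'1
  refine no_K33 hp (A := {a}) (B := {b}) (C := P') (D := {v | v ∈ A}) (E := {v | v ∈ B}) (F := Q')
    (conn_singleton _ _) (conn_singleton _ _) cP' cA cB cQ' ?_ ?_ ?_ ?_ ?_ ?_ ?_ ?_ ?_ ?_ ?_ ?_ ?_ ?_ ?_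
    la la' (qa.mono le_rfl hQQ') lb lb' (qb.mono le_rfl hQQ') ?_ ?_ lQP.symm
  case refine_16 => exact (ps.mono (by simpa using hsA) hPP').symm
  case refine_17 => exact (ps'.mono (by simpa using hsB) hPP').symm
  case refine_12 => exact hd.symm
  all_goals
    rw [Set.disjoint_left]
    intro v hv hv'
    simp only [Set.mem_singleton_iff, Set.mem_ofPred_eq] at hv hv'
    clear * - hv hv' hnd hQ'1 hP'1
    grind

theorem periph_caseII {H : SimpleGraph V} (hp : IsPlanar H) {W : Set V} {a b : V} {A B Q R : List V}
    (hW : ∀ x y, H.Adj x y → x ∈ W) (h3c : ∀ x y, Conn H (W \ {x, y}))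
    (h1 : Periph H W (a :: A ++ b :: B)) (h2 : Periph H W (a :: Q ++ b :: R)) (hQ : Q ≠ [])
    (hQ1 : ∀ v ∈ Q, v ∉ a :: A ++ b :: B) (hA2 : ∀ v ∈ A, v ∈ a :: Q ++ b :: R) :
    ∀ v, v ∈ a :: A ++ b :: B → v ∈ a :: Q ++ b :: R → v = a ∨ v = b := by
  have hc1 := isCyc_cons_iff.1 h1.cyc
  have hc2 := isCyc_cons_iff.1 h2.cyc
  have hnd := hc1.1
  have hnd2 := hc2.1
  simp only [List.cons_append, List.nodup_cons, List.mem_append, List.mem_cons, List.nodup_append]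
    at hnd hnd2
  simp only [List.cons_append, List.mem_append, List.mem_cons, not_or] at hQ1 hA2
  have hAR : ∀ v ∈ A, v ∈ R := by
    intro v hv
    have := hA2 v hv
    have h4 := hQ1 v
    clear * - this h4 hv hnd
    grind
  have hRA : ∀ v ∈ R, v ∈ A := by
    intro ρ hρ
    by_contra hρA
    obtain ⟨R1, R2, rfl⟩ := List.append_of_mem hρ
    cases Q with
    | nil => exact hQ rfl
    | cons q Q =>
      have e1 : a :: (q :: Q) ++ b :: (R1 ++ ρ :: R2) = [a] ++ (q :: (Q ++ b :: R1) ++ ρ :: R2) := by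
        simp
      have r := CEq.rot (H := H) (l₁ := [a]) (l₂ := q :: (Q ++ b :: R1) ++ ρ :: R2)
        (by rw [← e1]; exact h2.cyc)
      have e2 : q :: (Q ++ b :: R1) ++ ρ :: R2 ++ [a] = q :: (Q ++ b :: R1) ++ ρ :: (R2 ++ [a]) := by
        simp
      rw [← e1, e2] at r
      have h2' := h2.congr r
      have hcon := conn_list hc1.2.1
      obtain ⟨p, hpA, hpS, s, hsA, hsS, hps⟩ := hcon.cut' (insert a {v | v ∈ R2}) (a := a) (b := b)
        (by simp) (by simp) (by simp) (by
          simp only [Set.mem_insert_iff, Set.mem_ofPred_eq]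
          clear * - hnd2
          grind)
      have hs : s ∈ Q ++ b :: R1 := by
        have h5 := hAR s
        simp only [Set.mem_ofPred_eq, List.cons_append, List.mem_append, List.mem_cons,
          List.not_mem_nil, or_false, Set.mem_insert_iff] at hsA hsS h5 ⊢
        clear * - hsA hsS h5 hρA
        grind
      have hp' : p ∈ R2 ++ [a] := by
        simp only [Set.mem_ofPred_eq, Set.mem_insert_iff] at hpS
        simp; tauto
      have := cv_cross r.cyc hs hp'
      refine h2'.ind s ?_ p ?_ hps.symm this
      · exact List.mem_append_left _ (List.mem_cons_of_mem _ hs)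
      · exact List.mem_append_right _ (List.mem_cons_of_mem _ hp')
  have hAn : A = [] := by
    by_contra hAn
    have hW1 := h1.cyc.sub hW
    have hW2 := h2.cyc.sub hW
    simp only [List.cons_append, List.mem_append, List.mem_cons] at hW1 hW2
    obtain ⟨q0, hq0⟩ := List.exists_mem_of_ne_nil _ hQ
    obtain ⟨z0, hz0⟩ := List.exists_mem_of_ne_nil _ hAn
    have hRn : R ≠ [] := by rintro rfl; have := hAR z0 hz0; simp at this
    have hBn : B ≠ [] := by
      rintro rfl
      have hadj : H.Adj b a := by have := hc1.2.2.1; simpa using this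
      -- a and b are not consecutive in the second cycle
      cases Q with
      | nil => exact hQ rfl
      | cons q Q =>
        cases R with
        | nil => exact hRn rfl
        | cons ρ R =>
          have e1 : a :: (q :: Q) ++ b :: (ρ :: R) = [a] ++ (q :: (Q ++ [b]) ++ ρ :: R) := by
            simp
          have r := CEq.rot (H := H) (l₁ := [a]) (l₂ := q :: (Q ++ [b]) ++ ρ :: R)
            (by rw [← e1]; exact h2.cyc)
          have e2 : q :: (Q ++ [b]) ++ ρ :: R ++ [a] = q :: (Q ++ [b]) ++ ρ :: (R ++ [a]) := by
            simp
          rw [← e1, e2] at r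
          have h2' := h2.congr r
          exact h2'.ind b (by simp) a (by simp) hadj
            (cv_cross r.cyc (by simp) (by simp))
    obtain ⟨b0, hb0⟩ := List.exists_mem_of_ne_nil _ hBn
    have hb0W : b0 ∈ W := hW1 b0 (by simp [hb0])
    have hq0W : q0 ∈ W := hW2 q0 (by simp [hq0])
    -- an outside neighbour
    obtain ⟨p, hpW, hpA, r, hrW, hrA, hpr⟩ := (h3c a b).cut' {v | v ∈ A} (a := z0) (b := q0)
      ⟨hW1 z0 (by simp [hz0]), by
        simp only [Set.mem_insert_iff, Set.mem_singleton_iff]; clear * - hnd hz0; grind⟩ hz0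
      ⟨hq0W, by
        have := hQ1 q0 hq0
        simp only [Set.mem_insert_iff, Set.mem_singleton_iff]; tauto⟩ (by
        have := hQ1 q0 hq0
        simp only [Set.mem_ofPred_eq]; tauto)
    simp only [Set.mem_sdiff, Set.mem_insert_iff, Set.mem_singleton_iff, not_or, Set.mem_ofPred_eq]
      at hpW hpA hrW hrA
    have hrB : r ∉ B := by
      intro h
      exact h1.ind p (by simp [hpA]) r (by simp [h]) hpr (cv_cross h1.cyc hpA h)
    have hrQ : r ∉ Q := by
      intro h
      exact h2.ind r (by simp [h]) p (by simp [hAR p hpA]) hpr.symm (cv_cross h2.cyc h (hAR p hpA))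
    have hrR : r ∉ R := fun h => hrA (hRA r h)
    set Z : Set V := W \ ({v | v ∈ a :: A ++ b :: B} ∪ {v | v ∈ a :: Q ++ b :: R}) with hZ
    have hrZ : r ∈ Z := by
      refine ⟨hrW.1, ?_⟩
      simp only [List.cons_append, List.mem_append, List.mem_cons, Set.mem_union, Set.mem_ofPred_eq]
      tauto
    set D := comp H Z r with hD
    have hrD : r ∈ D := mem_comp_self hrZ
    have hDZ : ∀ v ∈ D, v ∈ Z := fun v hv => comp_sub hv
    have hZ' : ∀ v ∈ Z, v ∈ W ∧ v ≠ a ∧ v ≠ b ∧ v ∉ A ∧ v ∉ B ∧ v ∉ Q ∧ v ∉ R := by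
      intro v hv
      simp only [hZ, List.cons_append, List.mem_append, List.mem_cons, Set.mem_union, Set.mem_ofPred_eq,
        Set.mem_sdiff] at hv
      clear * - hv
      grind
    have lQ : Lk H D {v | v ∈ Q} := by
      obtain ⟨d, hd, hdD, y, hy, hyD, hdy⟩ := h1.con.cut' D (a := r) (b := q0)
        ⟨hrW.1, by have := hZ' r hrZ; simp; tauto⟩ hrD
        ⟨hq0W, by have := hQ1 q0 hq0; simp; tauto⟩ (fun h => (hZ' _ (hDZ _ h)).2.2.2.2.2.1 hq0)
      refine ⟨d, hdD, y, ?_, hdy⟩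
      by_contra hyQ
      apply hyD
      refine comp_closed hdD hdy ⟨hy.1, ?_⟩
      have h5 := hy.2
      have h6 := hRA y
      simp only [List.cons_append, List.mem_append, List.mem_cons, Set.mem_union, Set.mem_ofPred_eq]
        at h5 hyQ ⊢
      clear * - h5 h6 hyQ
      grind
    have lB : Lk H D {v | v ∈ B} := by
      have hb02 : b0 ∉ a :: Q ++ b :: R := by
        have h6 := hRA b0
        have h7 := hQ1 b0
        simp only [List.cons_append, List.mem_append, List.mem_cons]
        clear * - h6 h7 hnd hb0
        grind
      obtain ⟨d, hd, hdD, y, hy, hyD, hdy⟩ := h2.con.cut' D (a := r) (b := b0)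
        ⟨hrW.1, by have := hZ' r hrZ; simp; tauto⟩ hrD
        ⟨hb0W, hb02⟩ (fun h => (hZ' _ (hDZ _ h)).2.2.2.2.1 hb0)
      refine ⟨d, hdD, y, ?_, hdy⟩
      by_contra hyB
      apply hyD
      refine comp_closed hdD hdy ⟨hy.1, ?_⟩
      have h5 := hy.2
      have h6 := hAR y
      simp only [List.cons_append, List.mem_append, List.mem_cons, Set.mem_union, Set.mem_ofPred_eq]
        at h5 hyB ⊢
      clear * - h5 h6 hyB
      grind
    have lA : Lk H D {v | v ∈ A} := ⟨r, hrD, p, hpA, hpr.symm⟩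
    obtain ⟨la, lb, cA⟩ := lk_ends hc1.2.1 hAn
    obtain ⟨lb', la', cB⟩ := lk_ends hc1.2.2.1 hBn
    obtain ⟨qa, qb, cQ⟩ := lk_ends hc2.2.1 hQ
    have hD' : ∀ v ∈ D, _ := fun v hv => hZ' v (hDZ v hv)
    refine no_K33 hp (A := {a}) (B := {b}) (C := D) (D := {v | v ∈ A}) (E := {v | v ∈ B})
      (F := {v | v ∈ Q})
      (conn_singleton _ _) (conn_singleton _ _) conn_comp cA cB cQ ?_ ?_ ?_ ?_ ?_ ?_ ?_ ?_ ?_ ?_ ?_ ?_ ?_ ?_ ?_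
      la la' qa lb lb' qb lA lB lQ
    all_goals
      rw [Set.disjoint_left]
      intro v hv hv'
      simp only [Set.mem_singleton_iff, Set.mem_ofPred_eq] at hv hv'
      clear * - hv hv' hnd hD' hQ1
      clear_value D
      grind
  subst hAn
  intro v hv hv'
  have h5 := hRA v
  have h6 := hQ1 v
  simp only [List.cons_append, List.nil_append, List.mem_append, List.mem_cons, List.not_mem_nil] at hv hv' h5 h6
  clear * - hv hv' h5 h6
  grind

/-- two peripheral cycles meeting in two vertices meet nowhere else -/
theorem periph_inter {H : SimpleGraph V} (hp : IsPlanar H) {W : Set V}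
    (hW : ∀ x y, H.Adj x y → x ∈ W) (h3c : ∀ x y, Conn H (W \ {x, y})) {l1 l2 : List V}
    (h1 : Periph H W l1) (h2 : Periph H W l2) {x y : V} (hxy : x ≠ y) (hx1 : x ∈ l1) (hy1 : y ∈ l1)
    (hx2 : x ∈ l2) (hy2 : y ∈ l2) {q : V} (hq2 : q ∈ l2) (hq1 : q ∉ l1) :
    ∀ v, v ∈ l1 → v ∈ l2 → v = x ∨ v = y := by
  obtain ⟨T, hT⟩ := h2.cyc.start hq2
  have hT1 : ∀ v, v ∈ l1 → v ∈ l2 → v ∈ T := by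
    intro v hv1 hv2
    rcases List.mem_cons.1 ((hT.mem v).2 hv2) with h | h
    · subst h; exact absurd hv1 hq1
    · exact h
  obtain ⟨T1, b, T2, hT12, hb, hbf⟩ := first_split (p := fun v => v ∈ l1) ⟨x, hT1 x hx1 hx2, hx1⟩
  have hT2 : ∃ v ∈ T2, v ∈ l1 := by
    have hx := hT1 x hx1 hx2
    have hy := hT1 y hy1 hy2
    rw [hT12] at hx hy
    simp only [List.mem_append, List.mem_cons] at hx hy
    by_cases hxb : x = b
    · refine ⟨y, ?_, hy1⟩
      rcases hy with h | h | h
      · exact absurd hy1 (hbf _ h)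
      · exact absurd (hxb.trans h.symm) hxy
      · exact h
    · refine ⟨x, ?_, hx1⟩
      rcases hx with h | h | h
      · exact absurd hx1 (hbf _ h)
      · exact absurd h hxb
      · exact h
  obtain ⟨M, a, T3, hM, ha, haf⟩ := last_split hT2
  have e1 : q :: T = (q :: (T1 ++ b :: M)) ++ (a :: T3) := by rw [hT12, hM]; simp
  rw [e1] at hT
  have r := hT.trans (CEq.rot hT.cyc)
  have e2 : a :: T3 ++ q :: (T1 ++ b :: M) = a :: (T3 ++ q :: T1) ++ b :: M := by simp
  rw [e2] at r
  have h2' := h2.congr r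
  have hnd := r.cyc.nd
  have hab : a ≠ b := by
    rintro rfl; simp at hnd
  obtain ⟨A, B, hAB⟩ := h1.cyc.split ha hb hab
  have h1' := h1.congr hAB
  have hQ1 : ∀ v ∈ T3 ++ q :: T1, v ∉ l1 := by
    intro v hv hv1
    rcases List.mem_append.1 hv with h | h
    · exact haf v h hv1
    · rcases List.mem_cons.1 h with rfl | h
      · exact hq1 hv1
      · exact hbf v h hv1
  have fin : (∀ v, v ∈ a :: A ++ b :: B → v ∈ a :: (T3 ++ q :: T1) ++ b :: M → v = a ∨ v = b) →
      ∀ v, v ∈ l1 → v ∈ l2 → v = x ∨ v = y := by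
    intro h v hv1 hv2
    have k := fun v h1 h2 => h v ((hAB.mem v).2 h1) ((r.mem v).2 h2)
    have kx := k x hx1 hx2
    have ky := k y hy1 hy2
    have kv := k v hv1 hv2
    clear * - kx ky kv hxy
    grind
  by_cases hA : ∃ r1 ∈ A, r1 ∉ a :: (T3 ++ q :: T1) ++ b :: M
  · by_cases hB : ∃ r1 ∈ B, r1 ∉ a :: (T3 ++ q :: T1) ++ b :: M
    · obtain ⟨r1, hr1, hr1'⟩ := hA
      obtain ⟨r2, hr2, hr2'⟩ := hB
      exact (periph_caseI hp hW h1' h2' (by simp) (fun v hv h => hQ1 v hv ((hAB.mem v).1 h))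
        hr1 hr2 hr1' hr2').elim
    · push Not at hB
      apply fin
      -- reverse the first cycle
      have e3 : a :: A ++ b :: B = a :: (A ++ b :: B) := by simp
      have rr := CEq.rev (H := H) (a := a) (t := A ++ b :: B) (by rw [← e3]; exact hAB.cyc)
      have e4 : a :: (A ++ b :: B).reverse = a :: B.reverse ++ b :: A.reverse := by simp
      rw [← e3, e4] at rr
      have h1'' := h1'.congr rr
      have := periph_caseII hp hW h3c h1'' h2' (by simp)
        (fun v hv h => hQ1 v hv ((hAB.mem v).1 ((rr.mem v).1 h))) (fun v hv => hB v (by simpa using hv))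
      intro v hv hv2
      exact this v ((rr.mem v).2 hv) hv2
  · push Not at hA
    apply fin
    exact periph_caseII hp hW h3c h1' h2' (by simp) (fun v hv h => hQ1 v hv ((hAB.mem v).1 h)) hA

end Th

namespace Th

universe u
variable {V : Type u}

/-! ### At most two peripheral cycles through an edge -/

theorem comp_eq_of_mem {H : SimpleGraph V} {A : Set V} {z a : V} (ha : a ∈ comp H A z) (hz : z ∈ A) :
    comp H A a = comp H A z := by
  have h1 : comp H A z ⊆ comp H A a := sub_comp comp_sub conn_comp ha
  exact Set.Subset.antisymm (sub_comp comp_sub conn_comp (h1 (mem_comp_self hz))) h1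

theorem three_lk {H : SimpleGraph V} {W Z I1 I2 I3 : Set V} {x y : V}
    (hZ : ∀ v, v ∈ Z ↔ v ∈ W ∧ v ≠ x ∧ v ≠ y ∧ v ∉ I1 ∧ v ∉ I2 ∧ v ∉ I3)
    (hc : Conn H (W \ ({x, y} ∪ I3)))
    (n1 : ∃ v ∈ I1, v ∈ W ∧ v ≠ x ∧ v ≠ y ∧ v ∉ I3)
    (n2 : ∃ v ∈ I2, v ∈ W ∧ v ≠ x ∧ v ≠ y ∧ v ∉ I3 ∧ v ∉ I1)
    (hno : ∀ v ∈ Z, ¬ (Lk H (comp H Z v) I1 ∧ Lk H (comp H Z v) I2 ∧ Lk H (comp H Z v) I3)) :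
    Lk H (I1 ∪ {v | v ∈ Z ∧ Lk H (comp H Z v) I1 ∧ ¬ Lk H (comp H Z v) I3})
      (I2 ∪ {v | v ∈ Z ∧ Lk H (comp H Z v) I2 ∧ ¬ Lk H (comp H Z v) I1}) := by
  obtain ⟨a, ha, haW, hax, hay, ha3⟩ := n1
  obtain ⟨b, hb, hbW, hbx, hby, hb3, hb1⟩ := n2
  have hbZ : b ∉ Z := fun h => ((hZ b).1 h).2.2.2.2.1 hb
  obtain ⟨p, hp, hpT, q, hq, hqT, hpq⟩ := hc.cut' (I1 ∪ {v | v ∈ Z ∧ Lk H (comp H Z v) I1})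
    (a := a) (b := b) ⟨haW, by simp [hax, hay, ha3]⟩ (Or.inl ha) ⟨hbW, by simp [hbx, hby, hb3]⟩
    (by simp [hb1, hbZ])
  simp only [Set.mem_union, Set.mem_ofPred_eq, not_or, not_and, Set.mem_sdiff, Set.mem_insert_iff,
    Set.mem_singleton_iff] at hp hpT hq hqT
  have hq' : q ∈ I2 ∨ q ∈ Z := by
    rw [hZ]
    clear * - hq hqT
    tauto
  rcases hpT with hp1 | ⟨hpZ, hp1⟩
  · rcases hq' with hq2 | hqZ
    · exact ⟨p, Or.inl hp1, q, Or.inl hq2, hpq⟩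
    · exact absurd ⟨q, mem_comp_self hqZ, p, hp1, hpq.symm⟩ (hqT.2 hqZ)
  · rcases hq' with hq2 | hqZ
    · refine ⟨p, Or.inr ⟨hpZ, hp1, fun h3 => hno p hpZ ⟨hp1, ⟨p, mem_comp_self hpZ, q, hq2, hpq⟩, h3⟩⟩,
        q, Or.inl hq2, hpq⟩
    · have : q ∈ comp H Z p := comp_closed (mem_comp_self hpZ) hpq hqZ
      rw [← comp_eq_of_mem this hpZ] at hp1
      exact absurd hp1 (hqT.2 hqZ)

theorem three_conn {H : SimpleGraph V} {Z I1 I3 : Set V} (h1 : Conn H I1) {c : V} (hc : c ∈ I1) :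
    Conn H (I1 ∪ {v | v ∈ Z ∧ Lk H (comp H Z v) I1 ∧ ¬ Lk H (comp H Z v) I3}) := by
  refine conn_of_hub c ?_
  rintro a (ha | ⟨haZ, h, h'⟩)
  · exact ⟨I1, Set.subset_union_left, h1, ha, hc⟩
  · obtain ⟨p, hp, q, hq, hpq⟩ := id h
    refine ⟨comp H Z a ∪ I1, ?_, Conn.union_of_adj conn_comp h1 hp hq hpq,
      Or.inl (mem_comp_self haZ), Or.inr hc⟩
    rintro v (hv | hv)
    · refine Or.inr ⟨comp_sub hv, ?_⟩
      rw [comp_eq_of_mem hv haZ]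
      exact ⟨h, h'⟩
    · exact Or.inl hv

theorem three_sets {H : SimpleGraph V} (hp : IsPlanar H) {W I1 I2 I3 : Set V} {x y : V}
    (hxy : H.Adj x y)
    (c1 : Conn H I1) (c2 : Conn H I2) (c3 : Conn H I3)
    (n1 : I1.Nonempty) (n2 : I2.Nonempty) (n3 : I3.Nonempty)
    (m1 : ∀ v ∈ I1, v ∈ W ∧ v ≠ x ∧ v ≠ y) (m2 : ∀ v ∈ I2, v ∈ W ∧ v ≠ x ∧ v ≠ y)
    (m3 : ∀ v ∈ I3, v ∈ W ∧ v ≠ x ∧ v ≠ y)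
    (d12 : ∀ v ∈ I1, v ∉ I2) (d13 : ∀ v ∈ I1, v ∉ I3) (d23 : ∀ v ∈ I2, v ∉ I3)
    (x1 : Lk H {x} I1) (x2 : Lk H {x} I2) (x3 : Lk H {x} I3)
    (y1 : Lk H {y} I1) (y2 : Lk H {y} I2) (y3 : Lk H {y} I3)
    (k1 : Conn H (W \ ({x, y} ∪ I1))) (k2 : Conn H (W \ ({x, y} ∪ I2)))
    (k3 : Conn H (W \ ({x, y} ∪ I3))) : False := by
  set Z : Set V := {v | v ∈ W ∧ v ≠ x ∧ v ≠ y ∧ v ∉ I1 ∧ v ∉ I2 ∧ v ∉ I3} with hZ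
  have hZm : ∀ v, v ∈ Z ↔ v ∈ W ∧ v ≠ x ∧ v ≠ y ∧ v ∉ I1 ∧ v ∉ I2 ∧ v ∉ I3 := fun v => Iff.rfl
  have hxyne := hxy.ne
  have hno : ∀ v ∈ Z, ¬ (Lk H (comp H Z v) I1 ∧ Lk H (comp H Z v) I2 ∧ Lk H (comp H Z v) I3) := by
    rintro v hv ⟨l1, l2, l3⟩
    have hD : ∀ w ∈ comp H Z v, _ := fun w hw => (hZm w).1 (comp_sub hw)
    refine no_K33 hp (A := {x}) (B := {y}) (C := comp H Z v) (D := I1) (E := I2) (F := I3)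
      (conn_singleton _ _) (conn_singleton _ _) conn_comp c1 c2 c3 ?_ ?_ ?_ ?_ ?_ ?_ ?_ ?_ ?_ ?_ ?_ ?_ ?_ ?_ ?_
      x1 x2 x3 y1 y2 y3 l1 l2 l3
    all_goals
      rw [Set.disjoint_left]
      intro w hw hw'
      try simp only [Set.mem_singleton_iff] at hw hw'
      clear * - hw hw' hD m1 m2 m3 d12 d13 d23 hxyne
      grind
  obtain ⟨a1, ha1⟩ := n1
  obtain ⟨a2, ha2⟩ := n2
  obtain ⟨a3, ha3⟩ := n3
  have e12 := three_lk (W := W) hZm k3 ⟨a1, ha1, by grind⟩ ⟨a2, ha2, by grind⟩ hno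
  have e23 := three_lk (W := W) (Z := Z) (I1 := I2) (I2 := I3) (I3 := I1) (x := x) (y := y)
    (by intro v; rw [hZm]; tauto) k1 ⟨a2, ha2, by grind⟩ ⟨a3, ha3, by grind⟩ (by
      intro v hv h; exact hno v hv ⟨h.2.2, h.1, h.2.1⟩)
  have e31 := three_lk (W := W) (Z := Z) (I1 := I3) (I2 := I1) (I3 := I2) (x := x) (y := y)
    (by intro v; rw [hZm]; tauto) k2 ⟨a3, ha3, by grind⟩ ⟨a1, ha1, by grind⟩ (by
      intro v hv h; exact hno v hv ⟨h.2.1, h.2.2, h.1⟩)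
  have s : ∀ (I : Set V) (p : V → Prop), I ⊆ I ∪ {v | p v} := fun I p => Set.subset_union_left
  have cc : ∀ {a : V} , ({a} : Set V) ⊆ {a} := fun {a} => subset_rfl
  refine no_K5 hp (conn_singleton _ x) (conn_singleton _ y) (three_conn (Z := Z) (I3 := I3) c1 ha1)
    (three_conn (Z := Z) (I3 := I1) c2 ha2) (three_conn (Z := Z) (I3 := I2) c3 ha3)
    ?_ ?_ ?_ ?_ ?_ ?_ ?_ ?_ ?_ ?_ ⟨x, rfl, y, rfl, hxy⟩
    (x1.mono cc (s _ _)) (x2.mono cc (s _ _)) (x3.mono cc (s _ _))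
    (y1.mono cc (s _ _)) (y2.mono cc (s _ _)) (y3.mono cc (s _ _)) e12 e31.symm e23
  all_goals
      rw [Set.disjoint_left]
      intro w hw hw'
      have hw3 := hZm w
      simp only [Set.mem_singleton_iff, Set.mem_union, Set.mem_ofPred_eq] at hw hw'
      clear * - hw hw' hw3 m1 m2 m3 d12 d13 d23 hxyne
      clear_value Z
      grind

theorem periph_two {H : SimpleGraph V} (hp : IsPlanar H) {W : Set V}
    (hW : ∀ x y, H.Adj x y → x ∈ W) (h3c : ∀ x y, Conn H (W \ {x, y})) {l1 l2 : List V}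
    (h1 : Periph H W l1) (h2 : Periph H W l2) (hne : cv l1 ≠ cv l2) {x y : V} (hxy : x ≠ y)
    (hx1 : x ∈ l1) (hy1 : y ∈ l1) (hx2 : x ∈ l2) (hy2 : y ∈ l2) :
    ∀ v, v ∈ l1 → v ∈ l2 → v = x ∨ v = y := by
  by_cases ha : ∃ q ∈ l2, q ∉ l1
  · obtain ⟨q, hq, hq'⟩ := ha
    exact periph_inter hp hW h3c h1 h2 hxy hx1 hy1 hx2 hy2 hq hq'
  by_cases hb : ∃ q ∈ l1, q ∉ l2
  · obtain ⟨q, hq, hq'⟩ := hb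
    intro v hv1 hv2
    exact periph_inter hp hW h3c h2 h1 hxy hx2 hy2 hx1 hy1 hq hq' v hv2 hv1
  push Not at ha hb
  exfalso
  apply hne
  have key : ∀ {l l' : List V}, Periph H W l → Periph H W l' → (∀ v ∈ l, v ∈ l') → ∀ e, cv l e ≠ 0 →
      cv l' e ≠ 0 := by
    intro l l' hl hl' hs e he
    induction e with
    | _ a b =>
      exact hl'.ind a (hs a (hl.cyc.edge_mem he (by simp))) b (hs b (hl.cyc.edge_mem he (by simp)))
        (hl.cyc.edge_adj he)
  funext e
  have k1 := key h1 h2 hb e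
  have k2 := key h2 h1 ha e
  rw [zmod2_ne, zmod2_ne] at k1 k2
  by_cases h : cv l1 e = 1
  · rw [h, k1 h]
  · have h' : ¬ cv l2 e = 1 := fun h'' => h (k2 h'')
    rw [← zmod2_ne, not_not] at h h'
    rw [h, h']

theorem periph_three {H : SimpleGraph V} (hp : IsPlanar H) {W : Set V}
    (hW : ∀ x y, H.Adj x y → x ∈ W) (h3c : ∀ x y, Conn H (W \ {x, y})) {l1 l2 l3 : List V}
    (h1 : Periph H W l1) (h2 : Periph H W l2) (h3 : Periph H W l3)
    (h12 : cv l1 ≠ cv l2) (h13 : cv l1 ≠ cv l3) (h23 : cv l2 ≠ cv l3) {e : Sym2 V}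
    (e1 : cv l1 e ≠ 0) (e2 : cv l2 e ≠ 0) (e3 : cv l3 e ≠ 0) : False := by
  induction e with
  | _ x y =>
  have hxy : H.Adj x y := h1.cyc.edge_adj e1
  obtain ⟨t1, q1⟩ := h1.cyc.edge_start e1
  obtain ⟨t2, q2⟩ := h2.cyc.edge_start e2
  obtain ⟨t3, q3⟩ := h3.cyc.edge_start e3
  have H1 := h1.congr q1
  have H2 := h2.congr q2
  have H3 := h3.congr q3
  have i12 := periph_two hp hW h3c H1 H2 (by rw [q1.vec, q2.vec]; exact h12) hxy.ne
    (by simp) (by simp) (by simp) (by simp)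
  have i13 := periph_two hp hW h3c H1 H3 (by rw [q1.vec, q3.vec]; exact h13) hxy.ne
    (by simp) (by simp) (by simp) (by simp)
  have i23 := periph_two hp hW h3c H2 H3 (by rw [q2.vec, q3.vec]; exact h23) hxy.ne
    (by simp) (by simp) (by simp) (by simp)
  have key : ∀ {t : List V}, Periph H W (x :: y :: t) → Conn H {v | v ∈ t} ∧
      ({v | v ∈ t} : Set V).Nonempty ∧ (∀ v ∈ {v | v ∈ t}, v ∈ W ∧ v ≠ x ∧ v ≠ y) ∧
      Lk H {x} {v | v ∈ t} ∧ Lk H {y} {v | v ∈ t} ∧ Conn H (W \ ({x, y} ∪ {v | v ∈ t})) := by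
    intro t ht
    have hc := ht.cyc
    have e : x :: y :: t = x :: [] ++ y :: t := rfl
    rw [e, isCyc_cons_iff] at hc
    have hn : t ≠ [] := by
      rintro rfl; simp at hc
    obtain ⟨a, b, c⟩ := lk_ends hc.2.2.1 hn
    refine ⟨c, ?_, ?_, b, a, ?_⟩
    · obtain ⟨v, hv⟩ := List.exists_mem_of_ne_nil t hn
      exact ⟨v, hv⟩
    · intro v hv
      refine ⟨ht.cyc.sub hW v (by simp at hv; simp [hv]), ?_, ?_⟩
      · rintro rfl
        have := ht.cyc.nd
        simp at this hv
        tauto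
      · rintro rfl
        have := ht.cyc.nd
        simp at this hv
        tauto
    · have := ht.con
      have e : ({v | v ∈ x :: y :: t} : Set V) = {x, y} ∪ {v | v ∈ t} := by
        ext v; simp [or_assoc]
      rwa [e] at this
  obtain ⟨c1, n1, m1, x1, y1, k1⟩ := key H1
  obtain ⟨c2, n2, m2, x2, y2, k2⟩ := key H2
  obtain ⟨c3, n3, m3, x3, y3, k3⟩ := key H3
  refine three_sets hp hxy c1 c2 c3 n1 n2 n3 m1 m2 m3 ?_ ?_ ?_ x1 x2 x3 y1 y2 y3 k1 k2 k3
  · intro v hv hv'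
    have := i12 v (by simp at hv; simp [hv]) (by simp at hv'; simp [hv'])
    have := m1 v hv
    tauto
  · intro v hv hv'
    have := i13 v (by simp at hv; simp [hv]) (by simp at hv'; simp [hv'])
    have := m1 v hv
    tauto
  · intro v hv hv'
    have := i23 v (by simp at hv; simp [hv]) (by simp at hv'; simp [hv'])
    have := m2 v hv
    tauto

end Th

namespace Th

universe u
variable {V : Type u}

theorem cyc_avoid [Finite V] {H : SimpleGraph V} {W : Set V} (hW : ∀ x y, H.Adj x y → x ∈ W)
    (h3c : ∀ x y, Conn H (W \ {x, y})) (h4 : 4 ≤ W.ncard) {x y z : V} (hxy : H.Adj x y)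
    (hzx : z ≠ x) (hzy : z ≠ y) : ∃ l, IsCyc H l ∧ cv l s(x, y) ≠ 0 ∧ z ∉ l := by
  have hx : x ∈ W := hW x y hxy
  have hy : y ∈ W := hW y x hxy.symm
  have hv : ∃ v ∈ W, v ≠ x ∧ v ≠ y ∧ v ≠ z := by
    by_contra hcon
    push Not at hcon
    have hs : W ⊆ {x, y, z} := by
      intro v hv
      have := hcon v hv
      simp only [Set.mem_insert_iff, Set.mem_singleton_iff]
      tauto
    have h1 := Set.ncard_le_ncard hs (Set.toFinite _)
    have h2 := Set.ncard_insert_le x ({y, z} : Set V)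
    have h3 := Set.ncard_insert_le y ({z} : Set V)
    have h4 := Set.ncard_singleton z
    omega
  obtain ⟨v, hv, hvx, hvy, hvz⟩ := hv
  have hxyn := hxy.ne
  obtain ⟨x', _, hx', w, hw, hwx, hxw⟩ := (h3c y z).cut' {x} (a := x) (b := v)
    ⟨hx, by simp [hxyn, hzx.symm]⟩ rfl ⟨hv, by simp [hvy, hvz]⟩ (by simpa using hvx)
  obtain rfl : x' = x := hx'
  simp only [Set.mem_sdiff, Set.mem_insert_iff, Set.mem_singleton_iff, not_or] at hw hwx
  obtain ⟨p, hp⟩ := (h3c x' z).path (x := y) (y := w) ⟨hy, by simp [hxyn.symm, hzy.symm]⟩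
    ⟨hw.1, by simp [hwx, hw.2]⟩
  have hch := ear_chain hp hxy hxw.symm
  have hhd := hp.hd
  have hls := hp.ls
  have hnd := hp.nd
  have hm := hp.mem
  cases p with
  | nil => simp at hhd
  | cons y' t =>
    simp at hhd
    subst hhd
    have ht : t ≠ [] := by
      rintro rfl
      simp at hls
      exact hw.2.1 hls.symm
    have hc : IsCyc H (x' :: y' :: t) := by
      refine ⟨?_, hch, ?_⟩
      · rw [List.nodup_cons]
        refine ⟨?_, hnd⟩
        intro h
        exact (hm _ h).2 (by simp)
      · have : 0 < t.length := List.length_pos_of_ne_nil ht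
        simp only [List.length_cons]
        omega
    refine ⟨x' :: y' :: t, hc, ?_, ?_⟩
    · rw [cv_two hc]; decide
    · intro h
      rcases List.mem_cons.1 h with h | h
      · exact hzx h
      · exact (hm _ h).2 (by simp)

theorem periph_exists_two [Finite V] {H : SimpleGraph V} {W : Set V}
    (hW : ∀ x y, H.Adj x y → x ∈ W)
    (h3c : ∀ x y, Conn H (W \ {x, y})) (h4 : 4 ≤ W.ncard) {x y : V} (hxy : H.Adj x y) :
    ∃ l1 l2, Periph H W l1 ∧ Periph H W l2 ∧ cv l1 s(x, y) ≠ 0 ∧ cv l2 s(x, y) ≠ 0 ∧ cv l1 ≠ cv l2 := by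
  have key : ∀ z ∈ W, z ≠ x → z ≠ y → ∃ l, Periph H W l ∧ cv l s(x, y) ≠ 0 ∧ z ∉ l := by
    intro z hz hzx hzy
    obtain ⟨l, hl, hl1, hl2⟩ := cyc_avoid hW h3c h4 hxy hzx hzy
    obtain ⟨l', h1, h2, h3⟩ := lemmaT hW h3c (Bad := fun c => c s(x, y) ≠ 0) (K := {z}) (l := l)
      (by
        intro a b h
        by_contra hcon
        push Not at hcon
        apply h
        rw [Pi.add_apply, hcon.1, hcon.2, add_zero]) hl (conn_singleton _ _)
      (by rintro _ rfl; exact ⟨hz, hl2⟩) hl1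
    exact ⟨l', h1, h2, fun h => (h3 rfl).2 h⟩
  have hz : ∃ z ∈ W, z ≠ x ∧ z ≠ y := by
    by_contra hcon
    push Not at hcon
    have hs : W ⊆ {x, y} := by
      intro v hv
      have := hcon v hv
      simp only [Set.mem_insert_iff, Set.mem_singleton_iff]
      tauto
    have h1 := Set.ncard_le_ncard hs (Set.toFinite _)
    have h2 := Set.ncard_insert_le x ({y} : Set V)
    have h4 := Set.ncard_singleton y
    omega
  obtain ⟨z, hz, hzx, hzy⟩ := hz
  obtain ⟨l1, p1, e1, -⟩ := key z hz hzx hzy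
  obtain ⟨t, ht⟩ := p1.cyc.edge_start e1
  cases t with
  | nil => exact absurd ht.cyc.len (by simp)
  | cons w t =>
    have hnd := ht.cyc.nd
    simp at hnd
    have hw : w ∈ W := ht.cyc.sub hW w (by simp)
    obtain ⟨l2, p2, e2, h2⟩ := key w hw (by tauto) (by tauto)
    refine ⟨l1, l2, p1, p2, e1, e2, ?_⟩
    intro heq
    have h1 : cv (x :: y :: w :: t) s(y, w) ≠ 0 := by
      have hr := CEq.rot (l₁ := [x]) (l₂ := y :: w :: t) ht.cyc
      have h3 := cv_two (t := t ++ [x]) hr.cyc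
      have h4 : cv (y :: w :: (t ++ [x])) = cv (x :: y :: w :: t) := hr.vec
      rw [← h4, h3]
      decide
    rw [ht.vec, heq] at h1
    exact h2 (p2.cyc.edge_mem h1 (by simp))

/-- A MacLane family of cycles. -/
structure Mac (H : SimpleGraph V) (F : Multiset (List V)) : Prop where
  cyc : ∀ l ∈ F, IsCyc H l
  two : ∀ e ∈ H.edgeSet, (F.filter (fun l => cv l e ≠ 0)).card = 2
  span : ∀ l, IsCyc H l → cv l ∈ Submodule.span (ZMod 2) {c | ∃ l' ∈ F, cv l' = c}

theorem mac_3conn [Finite V] {H : SimpleGraph V} (hp : IsPlanar H) {W : Set V}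
    (hW : ∀ x y, H.Adj x y → x ∈ W)
    (h3c : ∀ x y, Conn H (W \ {x, y})) (h4 : 4 ≤ W.ncard) : ∃ F, Mac H F := by
  classical
  have := Fintype.ofFinite V
  set P : Finset (Sym2 V → ZMod 2) := Finset.univ.filter (fun c => ∃ l, Periph H W l ∧ cv l = c) with hP
  have hPm : ∀ c ∈ P, ∃ l, Periph H W l ∧ cv l = c := fun c hc => (Finset.mem_filter.1 hc).2
  have hPm' : ∀ l, Periph H W l → cv l ∈ P := fun l hl =>
    Finset.mem_filter.2 ⟨Finset.mem_univ _, l, hl, rfl⟩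
  have : ∃ g : (Sym2 V → ZMod 2) → List V, ∀ c ∈ P, Periph H W (g c) ∧ cv (g c) = c := by
    choose! g hg using hPm
    exact ⟨g, hg⟩
  obtain ⟨g, hg⟩ := this
  refine ⟨P.val.map g, ?_, ?_, ?_⟩
  · intro l hl
    obtain ⟨c, hc, rfl⟩ := Multiset.mem_map.1 hl
    exact (hg c hc).1.cyc
  · intro e he
    induction e with
    | _ x y =>
    obtain ⟨l1, l2, p1, p2, e1, e2, hne⟩ := periph_exists_two hW h3c h4 he
    rw [Multiset.filter_map, Multiset.card_map]
    have h1 : Multiset.filter ((fun l => cv l s(x, y) ≠ 0) ∘ g) P.val =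
        (P.filter (fun c => cv (g c) s(x, y) ≠ 0)).val := by
      rw [Finset.filter_val]; rfl
    rw [h1, Finset.card_val]
    have h2 : P.filter (fun c => cv (g c) s(x, y) ≠ 0) = {cv l1, cv l2} := by
      ext c
      simp only [Finset.mem_filter, Finset.mem_insert, Finset.mem_singleton]
      constructor
      · rintro ⟨hc, hc'⟩
        by_contra hcon
        push Not at hcon
        refine periph_three hp hW h3c p1 p2 (hg c hc).1 hne ?_ ?_ e1 e2 hc'
        · rw [(hg c hc).2]; exact hcon.1.symm
        · rw [(hg c hc).2]; exact hcon.2.symm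
      · rintro (rfl | rfl)
        · exact ⟨hPm' _ p1, by rw [(hg _ (hPm' _ p1)).2]; exact e1⟩
        · exact ⟨hPm' _ p2, by rw [(hg _ (hPm' _ p2)).2]; exact e2⟩
    rw [h2, Finset.card_pair hne]
  · intro l hl
    by_contra hcon
    obtain ⟨l', h1, h2, -⟩ := lemmaT hW h3c (Bad := fun c => c ∉ Submodule.span (ZMod 2)
      {c | ∃ l' ∈ P.val.map g, cv l' = c}) (K := ∅) (l := l) (by
        intro a b h
        by_contra hc
        push Not at hc
        exact h (Submodule.add_mem _ hc.1 hc.2)) hl (conn_empty _) (by simp) hcon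
    apply h2
    apply Submodule.subset_span
    exact ⟨g (cv l'), Multiset.mem_map_of_mem _ (hPm' _ h1), (hg _ (hPm' _ h1)).2⟩

end Th

namespace Th

universe u
variable {V : Type u}

/-! ### Minors under contraction -/

theorem minor_lift {W : Type*} [Finite W] {H H1 : SimpleGraph V} {K : SimpleGraph W}
    (hK : ∀ w, ∃ w', K.Adj w w') (T : V → Set V) (hT : ∀ a, Conn H (T a))
    (hd : ∀ a b, a ≠ b → ∀ v ∈ T a, v ∉ T b) (hl : ∀ a b, H1.Adj a b → Lk H (T a) (T b))
    (hm : HasMinor H1 K) : HasMinor H K := by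
  obtain ⟨f, f1, f2, f3⟩ := hm
  refine hasMinor_of_sets (fun w => {v | ∃ a, f a = some w ∧ v ∈ T a}) ?_ ?_ ?_ ?_
  · intro w
    obtain ⟨w', hw⟩ := hK w
    obtain ⟨a, b, ha, hb, hab⟩ := f3 w w' hw
    obtain ⟨x, hx, -⟩ := hl a b hab
    exact ⟨x, a, ha, hx⟩
  · intro w
    have hc := conn_of_preconnected (f2 w)
    apply conn_of_cut
    rintro S p ⟨a, ha, hp⟩ hpS q ⟨b, hb, hq⟩ hqS
    by_cases hsp : ∃ c, f c = some w ∧ (∃ r ∈ T c, r ∈ S) ∧ ∃ r ∈ T c, r ∉ S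
    · obtain ⟨c, hc, ⟨r, hr, hrS⟩, r', hr', hrS'⟩ := hsp
      obtain ⟨x, hx, hxS, y, hy, hyS, hxy⟩ := (hT c).cut' S hr hrS hr' hrS'
      exact ⟨x, ⟨c, hc, hx⟩, hxS, y, ⟨c, hc, hy⟩, hyS, hxy⟩
    · push Not at hsp
      obtain ⟨c, hc1, hcS, d, hd1, hdS, hcd⟩ := hc.cut' {c | ∃ r ∈ T c, r ∈ S} (a := a) (b := b)
        ha ⟨p, hp, hpS⟩ hb (fun ⟨r, hr, hrS⟩ => hqS (hsp b hb ⟨r, hr, hrS⟩ q hq))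
      obtain ⟨x, hx, y, hy, hxy⟩ := hl c d hcd
      obtain ⟨r, hr, hrS⟩ := hcS
      refine ⟨x, ⟨c, hc1, hx⟩, hsp c hc1 ⟨r, hr, hrS⟩ x hx, y, ⟨d, hd1, hy⟩, fun h => hdS ⟨y, hy, h⟩, hxy⟩
  · intro w w' hw
    rw [Set.disjoint_left]
    rintro v ⟨a, ha, hv⟩ ⟨b, hb, hv'⟩
    refine hd a b ?_ v hv hv'
    rintro rfl
    rw [ha] at hb
    exact hw (Option.some_injective _ hb)
  · intro w w' hw
    obtain ⟨a, b, ha, hb, hab⟩ := f3 w w' hw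
    obtain ⟨x, hx, y, hy, hxy⟩ := hl a b hab
    exact ⟨x, ⟨a, ha, hx⟩, y, ⟨b, hb, hy⟩, hxy⟩

theorem planar_lift {H H1 : SimpleGraph V} (hp : IsPlanar H) (T : V → Set V) (hT : ∀ a, Conn H (T a))
    (hd : ∀ a b, a ≠ b → ∀ v ∈ T a, v ∉ T b) (hl : ∀ a b, H1.Adj a b → Lk H (T a) (T b)) :
    IsPlanar H1 := by
  refine ⟨fun h => hp.1 (minor_lift ?_ T hT hd hl h), fun h => hp.2 (minor_lift ?_ T hT hd hl h)⟩
  · intro w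
    exact ⟨w + 1, by revert w; decide⟩
  · rintro (w | w)
    · exact ⟨Sum.inr 0, by simp⟩
    · exact ⟨Sum.inl 0, by simp⟩

theorem IsPlanar.mono {H H1 : SimpleGraph V} (hp : IsPlanar H) (h : H1 ≤ H) : IsPlanar H1 := by
  refine planar_lift hp (fun a => {a}) (fun a => conn_singleton _ _) ?_ ?_
  · rintro a b hab v hv hv'
    exact hab (hv.symm.trans hv')
  · intro a b hab
    exact ⟨a, rfl, b, rfl, h hab⟩

/-! ### 2-separations -/

structure Sep (H : SimpleGraph V) (W : Set V) (u v : V) (X Y : Set V) : Prop where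
  ne : u ≠ v
  uW : u ∈ W
  vW : v ∈ W
  memX : ∀ x ∈ X, x ∈ W ∧ x ≠ u ∧ x ≠ v ∧ x ∉ Y
  memY : ∀ x ∈ Y, x ∈ W ∧ x ≠ u ∧ x ≠ v ∧ x ∉ X
  cov : ∀ x ∈ W, x = u ∨ x = v ∨ x ∈ X ∨ x ∈ Y
  neX : X.Nonempty
  neY : Y.Nonempty
  no : ∀ x ∈ X, ∀ y ∈ Y, ¬ H.Adj x y

theorem Sep.symm {H : SimpleGraph V} {W : Set V} {u v : V} {X Y : Set V} (h : Sep H W u v X Y) :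
    Sep H W u v Y X :=
  ⟨h.ne, h.uW, h.vW, h.memY, h.memX, fun x hx => by have := h.cov x hx; tauto, h.neY, h.neX,
    fun x hx y hy hxy => h.no y hy x hx hxy.symm⟩

theorem Sep.swap {H : SimpleGraph V} {W : Set V} {u v : V} {X Y : Set V} (h : Sep H W u v X Y) :
    Sep H W v u X Y :=
  ⟨h.ne.symm, h.vW, h.uW, fun x hx => by have := h.memX x hx; tauto,
    fun x hx => by have := h.memY x hx; tauto, fun x hx => by have := h.cov x hx; tauto,
    h.neX, h.neY, h.no⟩

theorem exists_sep {H : SimpleGraph V} {W : Set V} (h2 : ∀ x, Conn H (W \ {x})) {u v : V}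
    (h : ¬ Conn H (W \ {u, v})) : ∃ X Y, Sep H W u v X Y := by
  have hne : u ≠ v := by
    rintro rfl
    apply h
    simpa using h2 u
  have huW : u ∈ W := by
    by_contra hu
    apply h
    have : W \ {u, v} = W \ {v} := by
      ext x
      simp only [Set.mem_sdiff, Set.mem_insert_iff, Set.mem_singleton_iff]
      constructor
      · tauto
      · rintro ⟨a, b⟩
        refine ⟨a, ?_⟩
        rintro (rfl | c)
        · exact hu a
        · exact b c
    rw [this]; exact h2 v
  have hvW : v ∈ W := by
    by_contra hu
    apply h
    have : W \ {u, v} = W \ {u} := by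
      ext x
      simp only [Set.mem_sdiff, Set.mem_insert_iff, Set.mem_singleton_iff]
      constructor
      · tauto
      · rintro ⟨a, b⟩
        refine ⟨a, ?_⟩
        rintro (c | rfl)
        · exact b c
        · exact hu a
    rw [this]; exact h2 u
  unfold Conn at h
  push Not at h
  obtain ⟨S, hS, h1, h2, h3⟩ := h
  refine ⟨S, (W \ {u, v}) \ S, hne, huW, hvW, ?_, ?_, ?_, h1, h2, h3⟩
  · intro x hx
    have := hS hx
    simp only [Set.mem_sdiff, Set.mem_insert_iff, Set.mem_singleton_iff] at this ⊢
    tauto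
  · intro x hx
    simp only [Set.mem_sdiff, Set.mem_insert_iff, Set.mem_singleton_iff] at hx ⊢
    tauto
  · intro x hx
    simp only [Set.mem_sdiff, Set.mem_insert_iff, Set.mem_singleton_iff]
    tauto

/-- one side of a 2-separation together with the virtual edge -/
def side (H : SimpleGraph V) (X : Set V) (u v : V) : SimpleGraph V where
  Adj a b := a ≠ b ∧ ((H.Adj a b ∧ a ∈ X ∪ {u, v} ∧ b ∈ X ∪ {u, v}) ∨ s(a, b) = s(u, v))
  symm := ⟨by
    rintro a b ⟨h1, h2⟩
    refine ⟨h1.symm, ?_⟩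
    rw [Sym2.eq_swap (a := b)]
    rcases h2 with h | h
    · exact Or.inl ⟨h.1.symm, h.2.2, h.2.1⟩
    · exact Or.inr h⟩
  loopless := ⟨fun a h => h.1 rfl⟩

theorem side_supp {H : SimpleGraph V} {X : Set V} {u v : V} :
    ∀ a b, (side H X u v).Adj a b → a ∈ X ∪ {u, v} := by
  rintro a b ⟨-, h | h⟩
  · exact h.2.1
  · rw [Sym2.eq_iff] at h
    rcases h with h | h <;> simp [h.1]

theorem Sep.conn_side {H : SimpleGraph V} {W : Set V} {u v : V}
    {X Y : Set V} (h : Sep H W u v X Y) (h2 : ∀ x, Conn H (W \ {x})) :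
    ∀ x, Conn (side H X u v) ((X ∪ {u, v}) \ {x}) := by
  intro x
  -- a subset of `X` sends an edge to the rest of the side
  have key : ∀ R : Set V, ∀ a ∈ R, R ⊆ X → x ∉ R → ∀ b ∈ (X ∪ {u, v}) \ {x}, b ∉ R →
      ∃ p ∈ R, ∃ q ∈ (X ∪ {u, v}) \ {x}, q ∉ R ∧ (side H X u v).Adj p q := by
    intro R a ha hRX hxR b hb hbR
    have hbW : b ∈ W := by
      rcases hb.1 with h' | h'
      · exact (h.memX b h').1
      · rcases h' with rfl | rfl
        · exact h.uW
        · exact h.vW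
    obtain ⟨p, hp, hpR, q, hq, hqR, hpq⟩ := (h2 x).cut' R (a := a) (b := b)
      ⟨(h.memX a (hRX ha)).1, fun h' => hxR (h' ▸ ha)⟩ ha ⟨hbW, hb.2⟩ hbR
    have hqX : q ∈ X ∪ {u, v} := by
      rcases h.cov q hq.1 with h' | h' | h' | h'
      · simp [h']
      · simp [h']
      · exact Or.inl h'
      · exact absurd hpq (h.no p (hRX hpR) q h')
    exact ⟨p, hpR, q, ⟨hqX, hq.2⟩, hqR, hpq.ne, Or.inl ⟨hpq, Or.inl (hRX hpR), hqX⟩⟩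
  apply conn_of_cut
  intro S a ha haS b hb hbS
  set A := (X ∪ {u, v}) \ {x} with hA
  by_cases c1 : (u ∈ A ∧ u ∈ S) ∨ (v ∈ A ∧ v ∈ S)
  · by_cases c2 : (u ∈ A ∧ u ∉ S) ∨ (v ∈ A ∧ v ∉ S)
    · have hadj : (side H X u v).Adj u v := ⟨h.ne, Or.inr rfl⟩
      rcases c1 with c1 | c1 <;> rcases c2 with c2 | c2
      · exact absurd c1.2 c2.2
      · exact ⟨u, c1.1, c1.2, v, c2.1, c2.2, hadj⟩
      · exact ⟨v, c1.1, c1.2, u, c2.1, c2.2, hadj.symm⟩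
      · exact absurd c1.2 c2.2
    · obtain ⟨p, hp, q, hq, hqR, hpq⟩ := key (A \ S) b ⟨hb, hbS⟩ (by
        rintro r ⟨hr, hrS⟩
        rcases hr.1 with h' | rfl | rfl
        · exact h'
        · exact absurd (Or.inl ⟨hr, hrS⟩) c2
        · exact absurd (Or.inr ⟨hr, hrS⟩) c2) (fun h' => h'.1.2 rfl) a ha (fun h' => h'.2 haS)
      exact ⟨q, hq, by_contra fun h' => hqR ⟨hq, h'⟩, p, hp.1, hp.2, hpq.symm⟩
  · obtain ⟨p, hp, q, hq, hqR, hpq⟩ := key (A ∩ S) a ⟨ha, haS⟩ (by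
        rintro r ⟨hr, hrS⟩
        rcases hr.1 with h' | rfl | rfl
        · exact h'
        · exact absurd (Or.inl ⟨hr, hrS⟩) c1
        · exact absurd (Or.inr ⟨hr, hrS⟩) c1) (fun h' => h'.1.2 rfl) b hb (fun h' => hbS h'.2)
    exact ⟨p, hp.1, hp.2, q, hq, fun h' => hqR ⟨hq, h'⟩, hpq⟩

/-- one open side plus one attachment vertex is connected -/
theorem Sep.conn_insert {H : SimpleGraph V} {W : Set V} {u v : V}
    {X Y : Set V} (h : Sep H W u v X Y) (h2 : ∀ x, Conn H (W \ {x})) : Conn H (insert u Y) := by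
  have key : ∀ R ⊆ Y, R.Nonempty → ∃ p ∈ R, ∃ q ∈ insert u Y, q ∉ R ∧ H.Adj p q := by
    rintro R hR ⟨a, ha⟩
    obtain ⟨p, hp, hpR, q, hq, hqR, hpq⟩ := (h2 v).cut' R (a := a) (b := u)
      ⟨(h.memY a (hR ha)).1, (h.memY a (hR ha)).2.2.1⟩ ha ⟨h.uW, h.ne⟩
      (fun h' => (h.memY _ (hR h')).2.1 rfl)
    refine ⟨p, hpR, q, ?_, hqR, hpq⟩
    rcases h.cov q hq.1 with h' | h' | h' | h'
    · exact Or.inl h'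
    · exact absurd h' hq.2
    · exact absurd hpq.symm (h.no q h' p (hR hpR))
    · exact Or.inr h'
  apply conn_of_cut
  intro S a ha haS b hb hbS
  by_cases hu : u ∈ S
  · obtain ⟨p, hp, q, hq, hqR, hpq⟩ := key (Y \ S) Set.sdiff_subset ⟨b, by
      rcases hb with rfl | hb
      · exact absurd hu hbS
      · exact ⟨hb, hbS⟩⟩
    refine ⟨q, hq, ?_, p, Or.inr hp.1, hp.2, hpq.symm⟩
    rcases hq with rfl | hq
    · exact hu
    · exact by_contra fun h' => hqR ⟨hq, h'⟩
  · obtain ⟨p, hp, q, hq, hqR, hpq⟩ := key (Y ∩ S) Set.inter_subset_left ⟨a, by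
      rcases ha with rfl | ha
      · exact absurd haS hu
      · exact ⟨ha, haS⟩⟩
    refine ⟨p, Or.inr hp.1, hp.2, q, hq, ?_, hpq⟩
    rcases hq with rfl | hq
    · exact hu
    · exact fun h' => hqR ⟨hq, h'⟩

theorem Sep.lk {H : SimpleGraph V} {W : Set V} {u v : V}
    {X Y : Set V} (h : Sep H W u v X Y) (h2 : ∀ x, Conn H (W \ {x})) : Lk H Y {u} := by
  obtain ⟨y, hy⟩ := h.neY
  obtain ⟨p, hp, hpR, q, hq, hqR, hpq⟩ := (h.conn_insert h2).cut' Y (a := y) (b := u) (Or.inr hy) hy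
    (Or.inl rfl) (fun h' => (h.memY _ h').2.1 rfl)
  rcases hq with rfl | hq
  · exact ⟨p, hpR, q, rfl, hpq⟩
  · exact absurd hq hqR

theorem Sep.planar {H : SimpleGraph V} (hp : IsPlanar H) {W : Set V} {u v : V}
    {X Y : Set V} (h : Sep H W u v X Y) (h2 : ∀ x, Conn H (W \ {x})) : IsPlanar (side H X u v) := by
  classical
  have hX : ∀ a ∈ X ∪ {u, v}, a ∉ Y := by
    rintro a (h' | rfl | rfl) hY
    · exact (h.memX a h').2.2.2 hY
    · exact (h.memY _ hY).2.1 rfl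
    · exact (h.memY _ hY).2.2.1 rfl
  let T : V → Set V := fun a => if a = u then insert u Y else if a ∈ X ∪ {u, v} then {a} else ∅
  have hT1 : ∀ a, a ∈ X ∪ {u, v} → a ∈ T a := by
    intro a ha
    by_cases hau : a = u
    · simp [T, hau]
    · simp only [T, if_neg hau, if_pos ha]; rfl
  have hT2 : ∀ a c, c ∈ T a → (c = a ∧ a ∈ X ∪ {u, v}) ∨ (a = u ∧ c ∈ Y) := by
    intro a c hc
    by_cases hau : a = u
    · subst hau
      simp only [T, if_pos rfl] at hc
      rcases hc with rfl | hc
      · left; simp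
      · right; exact ⟨rfl, hc⟩
    · simp only [T, if_neg hau] at hc
      split_ifs at hc with h1
      · left; exact ⟨hc, h1⟩
      · exact absurd hc (by simp)
  refine planar_lift hp T ?_ ?_ ?_
  · intro a
    by_cases hau : a = u
    · simp only [T, if_pos hau]; exact h.conn_insert h2
    · simp only [T, if_neg hau]
      split_ifs
      · exact conn_singleton _ _
      · exact conn_empty _
  · intro a b hab c hc hc'
    rcases hT2 a c hc with ⟨rfl, h1⟩ | ⟨rfl, h1⟩ <;> rcases hT2 b c hc' with ⟨rfl, h3⟩ | ⟨rfl, h3⟩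
    · exact hab rfl
    · exact hX c h1 h3
    · exact hX c h3 h1
    · exact hab rfl
  · have huv : Lk H (T u) (T v) := by
      obtain ⟨y, hy, q, rfl, hyq⟩ := h.swap.lk h2
      exact ⟨y, by simp [T, hy], q, hT1 _ (by simp), hyq⟩
    rintro a b ⟨-, hab | hab⟩
    · exact ⟨a, hT1 a hab.2.1, b, hT1 b hab.2.2, hab.1⟩
    · rw [Sym2.eq_iff] at hab
      rcases hab with ⟨rfl, rfl⟩ | ⟨rfl, rfl⟩
      · exact huv
      · exact huv.symm

end Th

namespace Th

universe u
variable {V : Type u}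

theorem cv_consec {H : SimpleGraph V} {a : V} {t l₁ l₂ : List V} {x y : V} (h : IsCyc H (a :: t))
    (he : a :: t ++ [a] = l₁ ++ x :: y :: l₂) : cv (a :: t) s(x, y) = 1 := by
  rcases List.eq_nil_or_concat l₂ with rfl | ⟨l₃, b, rfl⟩
  · have e1 : a :: t ++ [a] = (l₁ ++ [x]) ++ [y] := by rw [he]; simp
    obtain ⟨e2, e3⟩ := List.append_inj' e1 rfl
    simp at e3
    subst e3
    rw [e2] at h ⊢
    have hr := CEq.rot h
    rw [← hr.vec]
    cases l₁ with
    | nil => have := h.len; simp at this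
    | cons b l₁ =>
      simp at e2
      obtain ⟨rfl, -⟩ := e2
      exact cv_two hr.cyc
  · have e1 : a :: t ++ [a] = (l₁ ++ x :: y :: l₃) ++ [b] := by rw [he]; simp
    obtain ⟨e2, e3⟩ := List.append_inj' e1 rfl
    rw [e2] at h ⊢
    have hr := CEq.rot h
    rw [← hr.vec]
    exact cv_two (t := l₃ ++ l₁) hr.cyc

theorem IsCyc.transfer {H H' : SimpleGraph V} {l : List V} (h : IsCyc H' l)
    (he : ∀ e, cv l e ≠ 0 → e ∈ H'.edgeSet → e ∈ H.edgeSet) : IsCyc H l := by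
  cases l with
  | nil => exact h.elim
  | cons a t =>
    refine ⟨h.1, ?_, h.2.2⟩
    have h2 := h.2.1
    rw [List.isChain_iff_forall_rel_of_append_cons_cons] at h2 ⊢
    intro x y l₁ l₂ hl
    have h3 := h2 hl
    refine he s(x, y) ?_ h3
    rw [cv_consec h hl]
    decide

theorem IsCyc.mono {H H' : SimpleGraph V} (hH : H ≤ H') {l : List V} (h : IsCyc H l) : IsCyc H' l :=
  h.transfer (fun _ _ he => (SimpleGraph.edgeSet_subset_edgeSet.2 hH) he)

section Glue

variable {H : SimpleGraph V} {W : Set V} {u v : V} {X Y : Set V}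

theorem side_edge {e : Sym2 V} (he : e ∈ (side H X u v).edgeSet) (hne : e ≠ s(u, v)) :
    e ∈ H.edgeSet ∧ ∀ x ∈ e, x ∈ X ∪ {u, v} := by
  induction e with
  | _ a b =>
    rcases he with ⟨h1, h2 | h2⟩
    · refine ⟨h2.1, ?_⟩
      intro x hx
      rcases Sym2.mem_iff.1 hx with rfl | rfl
      · exact h2.2.1
      · exact h2.2.2
    · exact absurd h2 hne

theorem Sep.edge_zero (h : Sep H W u v X Y) {l : List V} (hl : IsCyc (side H X u v) l)
    {e : Sym2 V} (he : e ∈ (side H Y u v).edgeSet) (hne : e ≠ s(u, v)) : cv l e = 0 := by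
  by_contra h0
  have h1 := side_edge (hl.edge_adj h0) hne
  have h2 := side_edge he hne
  induction e with
  | _ a b =>
    have key : ∀ x ∈ s(a, b), x = u ∨ x = v := by
      intro x hx
      have h3 := h1.2 x hx
      have h4 := h2.2 x hx
      rcases h3 with h3 | h3
      · rcases h4 with h4 | h4
        · exact absurd h4 (h.memX x h3).2.2.2
        · simpa using h4
      · simpa using h3
    have ha := key a (by simp)
    have hb := key b (by simp)
    have hab : a ≠ b := (h1.1 : H.Adj a b).ne
    apply hne
    rw [Sym2.eq_iff]
    clear * - ha hb hab
    grind

/-- merging two cycles through the virtual edge -/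
theorem Sep.merge (h : Sep H W u v X Y) {c1 c2 : List V} (h1 : IsCyc (side H X u v) c1)
    (h2 : IsCyc (side H Y u v) c2) (e1 : cv c1 s(u, v) ≠ 0) (e2 : cv c2 s(u, v) ≠ 0) :
    ∃ m, IsCyc H m ∧ cv m = cv c1 + cv c2 := by
  obtain ⟨t1, q1⟩ := h1.edge_start e1
  obtain ⟨t2, q2⟩ := h2.edge_start e2
  have hn1 := q1.cyc.nd
  have hn2 := q2.cyc.nd
  have i1 := q1.cyc
  have i2 := q2.cyc
  rw [show u :: v :: t1 = u :: [] ++ v :: t1 from rfl, isCyc_cons_iff] at i1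
  rw [show u :: v :: t2 = u :: [] ++ v :: t2 from rfl, isCyc_cons_iff] at i2
  set Hp := side H X u v ⊔ side H Y u v with hHp
  have m1 := q1.cyc.sub side_supp
  have m2 := q2.cyc.sub side_supp
  have hdis : ∀ a ∈ t1, a ∉ t2 := by
    intro a ha ha'
    have k1 := m1 a (by simp [ha])
    have k2 := m2 a (by simp [ha'])
    simp only [Set.mem_union, Set.mem_insert_iff, Set.mem_singleton_iff] at k1 k2
    have := h.memX a
    simp only [List.nodup_cons, List.mem_cons, not_or] at hn1
    clear * - k1 k2 this hn1 ha
    grind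
  have ih1 : IsCyc Hp (v :: t1 ++ u :: t2.reverse) := by
    rw [isCyc_cons_iff]
    refine ⟨?_, ?_, ?_, ?_⟩
    · simp only [List.cons_append, List.nodup_cons, List.mem_append, List.mem_cons, List.mem_reverse,
        List.nodup_append, List.nodup_reverse, not_or] at hn1 hn2 ⊢
      have := h.ne
      clear * - hn1 hn2 this hdis
      grind
    · exact i1.2.2.1.imp (fun a b hab => Or.inl hab)
    · have := i2.2.2.1.imp (S := Hp.Adj) (fun a b hab => Or.inr hab)
      have h3 : (v :: t2 ++ [u]).reverse.IsChain Hp.Adj := by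
        rw [List.isChain_reverse]
        exact this.imp (fun a b hab => hab.symm)
      simpa using h3
    · have := i1.2.2.2
      simp at this ⊢
      omega
  obtain ⟨-, -, hvec⟩ := theta (a := v) (b := u) (A := t1) (B := t2.reverse) (P := []) ih1
    (by simp; exact Or.inl ⟨h.ne.symm, Or.inr Sym2.eq_swap⟩) (by simp) (by simp)
  have r1 : cv (v :: t1 ++ u :: ([] : List V).reverse) = cv c1 := by
    rw [← q1.vec]
    exact (CEq.rot (l₁ := [u]) (l₂ := v :: t1) q1.cyc).vec
  have r2 : cv (v :: [] ++ u :: t2.reverse) = cv c2 := by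
    rw [← q2.vec]
    have r3 := CEq.rev q2.cyc
    rw [← r3.vec]
    have e : u :: (v :: t2).reverse = (u :: t2.reverse) ++ [v] := by simp
    rw [e] at r3 ⊢
    exact (CEq.rot r3.cyc).vec
  rw [r1, r2] at hvec
  refine ⟨_, ih1.transfer ?_, hvec⟩
  intro e he heH
  have hne : e ≠ s(u, v) := by
    rintro rfl
    apply he
    rw [hvec, Pi.add_apply, zmod2_ne.1 e1, zmod2_ne.1 e2]
    decide
  rw [hHp, SimpleGraph.edgeSet_sup] at heH
  rcases heH with h' | h'
  · exact (side_edge h' hne).1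
  · exact (side_edge h' hne).1

theorem side_le_cyc {l : List V} (hl : IsCyc H l) (hX : ∀ a ∈ l, a ∈ X ∪ {u, v}) :
    IsCyc (side H X u v) l := by
  refine hl.transfer ?_
  intro e he heH
  induction e with
  | _ a b =>
    exact ⟨heH.ne, Or.inl ⟨heH, hX a (hl.edge_mem he (by simp)), hX b (hl.edge_mem he (by simp))⟩⟩

theorem Sep.conn_sub (h : Sep H W u v X Y) {A : Set V} (hA : Conn H A) (hAW : A ⊆ W) (hu : u ∉ A)
    (hv : v ∉ A) : A ⊆ X ∨ A ⊆ Y := by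
  by_cases hX : A ⊆ X
  · exact Or.inl hX
  right
  intro b hb
  rw [Set.not_subset] at hX
  obtain ⟨a, ha, haX⟩ := hX
  by_contra hbY
  have hbX : b ∈ X := by
    rcases h.cov b (hAW hb) with rfl | rfl | h' | h'
    · exact absurd hb hu
    · exact absurd hb hv
    · exact h'
    · exact absurd h' hbY
  obtain ⟨p, hp, hpX, q, hq, hqX, hpq⟩ := hA.cut' X hb hbX ha haX
  rcases h.cov q (hAW hq) with rfl | rfl | h' | h'
  · exact hu hq
  · exact hv hq
  · exact hqX h'
  · exact h.no p hpX q h' hpq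

theorem cyc_minus {l : List V} (hl : IsCyc H l) (a : V) : Conn H ({x | x ∈ l} \ {a}) := by
  by_cases ha : a ∈ l
  · obtain ⟨t, ht⟩ := hl.start ha
    have h1 := ht.cyc.2.1
    have h2 : t.IsChain H.Adj := by
      have := (List.isChain_append.1 h1).1
      exact this.tail
    have h3 := conn_list h2
    convert h3 using 1
    ext x
    have := ht.mem x
    have hn := ht.cyc.nd
    simp only [List.mem_cons, List.nodup_cons] at this hn
    simp only [Set.mem_sdiff, Set.mem_ofPred_eq, Set.mem_singleton_iff]
    constructor
    · intro h; tauto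
    · intro h
      refine ⟨this.1 (Or.inr h), ?_⟩
      rintro rfl
      exact hn.1 h
  · have e : ({x | x ∈ l} \ {a} : Set V) = {x | x ∈ l} := by
      ext x
      simp only [Set.mem_sdiff, Set.mem_ofPred_eq, Set.mem_singleton_iff, and_iff_left_iff_imp]
      rintro h rfl
      exact ha h
    rw [e]
    cases l with
    | nil => exact hl.elim
    | cons b t => exact conn_list (List.isChain_append.1 hl.2.1).1

/-- every cycle is a sum of cycles of the two sides -/
theorem Sep.decomp (h : Sep H W u v X Y) (hW : ∀ x y, H.Adj x y → x ∈ W) {l : List V}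
    (hl : IsCyc H l) (P : Submodule (ZMod 2) (Sym2 V → ZMod 2))
    (hX : ∀ l, IsCyc (side H X u v) l → cv l ∈ P) (hY : ∀ l, IsCyc (side H Y u v) l → cv l ∈ P) :
    cv l ∈ P := by
  have hlW := hl.sub hW
  -- if one of u, v is missing
  have key : ∀ a b : V, Sep H W a b X Y → ({a, b} : Set V) = {u, v} → a ∉ l → cv l ∈ P := by
    intro a b hab heq ha
    have := hab.conn_sub (cyc_minus hl b) (fun x hx => hlW x hx.1) (fun h' => ha h'.1) (fun h' => h'.2 rfl)
    rcases this with hs | hs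
    · apply hX
      apply side_le_cyc hl
      intro x hx
      rw [← heq]
      by_cases hxb : x = b
      · simp [hxb]
      · exact Or.inl (hs ⟨hx, hxb⟩)
    · apply hY
      apply side_le_cyc hl
      intro x hx
      rw [← heq]
      by_cases hxb : x = b
      · simp [hxb]
      · exact Or.inl (hs ⟨hx, hxb⟩)
  by_cases hu : u ∈ l
  swap
  · exact key u v h rfl hu
  by_cases hv : v ∈ l
  swap
  · exact key v u h.swap (Set.pair_comm _ _) hv
  obtain ⟨A, B, hAB⟩ := hl.split hu hv h.ne
  have hn := hAB.cyc.nd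
  have hc := isCyc_cons_iff.1 hAB.cyc
  have hmem := hAB.mem
  have inner : ∀ (C : List V) (a b : V), (a :: C ++ [b]).IsChain H.Adj → (∀ x ∈ C, x ∈ l ∧ x ≠ u ∧ x ≠ v) →
      (∀ x ∈ C, x ∈ X) ∨ (∀ x ∈ C, x ∈ Y) := by
    intro C a b hC hm
    have h1 : C.IsChain H.Adj := (List.isChain_append.1 hC).1.tail
    exact h.conn_sub (conn_list h1) (fun x hx => hlW x (hm x hx).1) (fun h' => (hm _ h').2.1 rfl)
      (fun h' => (hm _ h').2.2 rfl)
  have hA := inner A u v hc.2.1 (by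
    intro x hx
    refine ⟨(hmem x).1 (by simp [hx]), ?_⟩
    simp only [List.cons_append, List.nodup_cons, List.mem_append, List.mem_cons, List.nodup_append, not_or] at hn
    clear * - hn hx
    grind)
  have hB := inner B v u hc.2.2.1 (by
    intro x hx
    refine ⟨(hmem x).1 (by simp [hx]), ?_⟩
    simp only [List.cons_append, List.nodup_cons, List.mem_append, List.mem_cons, List.nodup_append, not_or] at hn
    clear * - hn hx
    grind)
  rw [← hAB.vec]
  have one : ∀ Z : Set V, (∀ x ∈ A, x ∈ Z) → (∀ x ∈ B, x ∈ Z) → IsCyc (side H Z u v) (u :: A ++ v :: B) := by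
    intro Z hA hB
    apply side_le_cyc hAB.cyc
    intro x hx
    simp only [List.cons_append, List.mem_append, List.mem_cons] at hx
    rcases hx with rfl | hx | rfl | hx
    · simp
    · exact Or.inl (hA x hx)
    · simp
    · exact Or.inl (hB x hx)
  by_cases hAX : (∀ x ∈ A, x ∈ X) ∧ (∀ x ∈ B, x ∈ X)
  · exact hX _ (one X hAX.1 hAX.2)
  by_cases hAY : (∀ x ∈ A, x ∈ Y) ∧ (∀ x ∈ B, x ∈ Y)
  · exact hY _ (one Y hAY.1 hAY.2)
  have hAn : A ≠ [] := by
    rintro rfl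
    rcases hB with hB | hB
    · exact hAX ⟨by simp, hB⟩
    · exact hAY ⟨by simp, hB⟩
  have hBn : B ≠ [] := by
    rintro rfl
    rcases hA with hA | hA
    · exact hAX ⟨hA, by simp⟩
    · exact hAY ⟨hA, by simp⟩
  have mX : ∀ (C : List V) (Z : Set V), (∀ x ∈ C, x ∈ Z) → ∀ a b, s(a, b) = s(u, v) → (a :: C ++ [b]).IsChain H.Adj →
      (a :: C ++ [b]).IsChain (side H Z u v).Adj := by
    intro C Z hC a b hab hch
    have : ∀ x ∈ a :: C ++ [b], x ∈ Z ∪ {u, v} := by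
      intro x hx
      simp only [List.cons_append, List.mem_append, List.mem_cons, List.not_mem_nil, or_false] at hx
      rw [Sym2.eq_iff] at hab
      have := hC x
      simp only [Set.mem_union, Set.mem_insert_iff, Set.mem_singleton_iff]
      clear * - hx hab this
      grind
    rw [List.isChain_iff_forall_rel_of_append_cons_cons] at hch ⊢
    intro x y l₁ l₂ hl
    rw [hl] at this
    exact ⟨(hch hl).ne, Or.inl ⟨hch hl, this x (by simp), this y (by simp)⟩⟩
  have hA0 := List.length_pos_of_ne_nil hAn
  have hB0 := List.length_pos_of_ne_nil hBn
  -- cycles of the two sides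
  have cA : ∀ Z, (∀ x ∈ A, x ∈ Z) → IsCyc (side H Z u v) (u :: A ++ v :: []) := by
    intro Z hZ
    rw [isCyc_cons_iff]
    refine ⟨hn.sublist (by simp), mX A Z hZ u v rfl hc.2.1, ?_, by omega⟩
    simp
    exact ⟨h.ne.symm, Or.inr Sym2.eq_swap⟩
  have cB : ∀ Z, (∀ x ∈ B, x ∈ Z) → IsCyc (side H Z u v) (u :: [] ++ v :: B) := by
    intro Z hZ
    rw [isCyc_cons_iff]
    refine ⟨hn.sublist (by simp), ?_, mX B Z hZ v u Sym2.eq_swap hc.2.2.1, by omega⟩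
    simp
    exact ⟨h.ne, Or.inr rfl⟩
  have hvec : cv (u :: A ++ v :: B) = cv (u :: A ++ v :: []) + cv (u :: [] ++ v :: B) := by
    rw [cv_cons, cv_cons, cv_cons]
    have e1 : pv ([v] ++ [u]) = sv s(u, v) := by
      rw [show [v] ++ [u] = [v, u] from rfl, pv_cons, Sym2.eq_swap]; simp
    have e2 : pv ([u] ++ [v]) = sv s(u, v) := by
      rw [show [u] ++ [v] = [u, v] from rfl, pv_cons]; simp
    rw [e1, e2]
    have := add_self_vec (sv s(u, v))
    calc _ = pv (u :: A ++ [v]) + pv (v :: B ++ [u]) + 0 := by rw [add_zero]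
      _ = _ := by rw [← this]; abel
  rw [hvec]
  apply Submodule.add_mem
  · rcases hA with hA | hA
    · exact hX _ (cA X hA)
    · exact hY _ (cA Y hA)
  · rcases hB with hB | hB
    · exact hX _ (cB X hB)
    · exact hY _ (cB Y hB)

end Glue
end Th

namespace Th

universe u
variable {V : Type u}

/-- number of members of the family through the edge `e` -/
noncomputable def cnt (e : Sym2 V) (F : Multiset (List V)) : ℕ := (F.filter (fun l => cv l e ≠ 0)).card

theorem cnt_cons (e : Sym2 V) (a : List V) (F : Multiset (List V)) :
    cnt e (a ::ₘ F) = (if cv a e ≠ 0 then 1 else 0) + cnt e F := by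
  unfold cnt
  by_cases h : cv a e ≠ 0
  · rw [Multiset.filter_cons_of_pos (p := fun l => cv l e ≠ 0) _ h, if_pos h, Multiset.card_cons, add_comm]
  · rw [Multiset.filter_cons_of_neg (p := fun l => cv l e ≠ 0) _ h, if_neg h, zero_add]

theorem cnt_add (e : Sym2 V) (F F' : Multiset (List V)) : cnt e (F + F') = cnt e F + cnt e F' := by
  unfold cnt
  rw [Multiset.filter_add, Multiset.card_add]

theorem cnt_zero {e : Sym2 V} {F : Multiset (List V)} (h : ∀ l ∈ F, cv l e = 0) : cnt e F = 0 := by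
  unfold cnt
  rw [Multiset.card_eq_zero, Multiset.filter_eq_nil]
  intro l hl
  simp [h l hl]

theorem sum_cv (e : Sym2 V) (F : Multiset (List V)) : (F.map cv).sum e = (cnt e F : ZMod 2) := by
  induction F using Multiset.induction with
  | empty => simp [cnt]
  | cons a F ih =>
    rw [Multiset.map_cons, Multiset.sum_cons, Pi.add_apply, ih, cnt_cons]
    by_cases h : cv a e ≠ 0
    · rw [if_pos h, zmod2_ne.1 h]; push_cast; rfl
    · rw [if_neg h]; push Not at h; rw [h]; simp

theorem Mac.sum {H : SimpleGraph V} {F : Multiset (List V)} (h : Mac H F) : (F.map cv).sum = 0 := by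
  funext e
  rw [sum_cv]
  by_cases he : e ∈ H.edgeSet
  · have : cnt e F = 2 := h.two e he
    rw [this]; rfl
  · rw [cnt_zero]
    · rfl
    · intro l hl
      by_contra h0
      exact he ((h.cyc l hl).edge_adj h0)

theorem Mac.extract {H : SimpleGraph V} {F : Multiset (List V)} (h : Mac H F) {e : Sym2 V}
    (he : e ∈ H.edgeSet) : ∃ c d R, F = c ::ₘ d ::ₘ R ∧ cv c e ≠ 0 ∧ cv d e ≠ 0 ∧
      (∀ l ∈ R, cv l e = 0) := by
  obtain ⟨c, d, hcd⟩ := Multiset.card_eq_two.1 (h.two e he)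
  refine ⟨c, d, F.filter (fun l => ¬ cv l e ≠ 0), ?_, ?_, ?_, ?_⟩
  · have := Multiset.filter_add_not (fun l => cv l e ≠ 0) F
    rw [hcd] at this
    exact this.symm.trans (by simp only [Multiset.insert_eq_cons, Multiset.cons_add, Multiset.singleton_add])
  · have : c ∈ F.filter (fun l => cv l e ≠ 0) := by rw [hcd]; simp
    exact (Multiset.mem_filter.1 this).2
  · have : d ∈ F.filter (fun l => cv l e ≠ 0) := by rw [hcd]; simp
    exact (Multiset.mem_filter.1 this).2
  · intro l hl
    have := (Multiset.mem_filter.1 hl).2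
    push Not at this
    exact this

theorem sum_mem_span {P : Submodule (ZMod 2) (Sym2 V → ZMod 2)} {F : Multiset (List V)}
    (h : ∀ l ∈ F, cv l ∈ P) : (F.map cv).sum ∈ P := by
  apply multiset_sum_mem
  intro c hc
  obtain ⟨l, hl, rfl⟩ := Multiset.mem_map.1 hc
  exact h l hl

theorem Mac.first_mem {H : SimpleGraph V} {c d : List V} {R : Multiset (List V)} (h : Mac H (c ::ₘ d ::ₘ R))
    {P : Submodule (ZMod 2) (Sym2 V → ZMod 2)} (hd : cv d ∈ P) (hR : ∀ l ∈ R, cv l ∈ P) : cv c ∈ P := by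
  have := h.sum
  rw [Multiset.map_cons, Multiset.sum_cons] at this
  have h2 : cv c = ((d ::ₘ R).map cv).sum := by
    have h3 := add_self_vec ((d ::ₘ R).map cv).sum
    rw [← h3] at this
    exact add_right_cancel this
  rw [h2]
  apply sum_mem_span
  intro l hl
  rcases Multiset.mem_cons.1 hl with rfl | hl
  · exact hd
  · exact hR l hl

theorem Sep.edge_cov {H : SimpleGraph V} {W : Set V} (hW : ∀ x y, H.Adj x y → x ∈ W) {u v : V}
    {X Y : Set V} (h : Sep H W u v X Y) {e : Sym2 V} (he : e ∈ H.edgeSet) :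
    e ∈ (side H X u v).edgeSet ∨ e ∈ (side H Y u v).edgeSet := by
  induction e with
  | _ a b =>
    have hab : H.Adj a b := he
    have ha := h.cov a (hW a b hab)
    have hb := h.cov b (hW b a hab.symm)
    have n1 := h.no a
    have n2 := h.no b
    by_cases hX : a ∈ X ∪ {u, v} ∧ b ∈ X ∪ {u, v}
    · exact Or.inl ⟨hab.ne, Or.inl ⟨hab, hX⟩⟩
    · right
      refine ⟨hab.ne, Or.inl ⟨hab, ?_⟩⟩
      simp only [Set.mem_union, Set.mem_insert_iff, Set.mem_singleton_iff] at hX ⊢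
      have := hab.symm
      clear * - ha hb n1 n2 hX hab this
      grind

theorem Sep.glue {H : SimpleGraph V} {W : Set V} (hW : ∀ x y, H.Adj x y → x ∈ W) {u v : V}
    {X Y : Set V} (h : Sep H W u v X Y) {F1 F2 : Multiset (List V)} (h1 : Mac (side H X u v) F1)
    (h2 : Mac (side H Y u v) F2) : ∃ F, Mac H F := by
  have huv1 : s(u, v) ∈ (side H X u v).edgeSet := ⟨h.ne, Or.inr rfl⟩
  have huv2 : s(u, v) ∈ (side H Y u v).edgeSet := ⟨h.ne, Or.inr rfl⟩
  obtain ⟨c1, d1, R1, rfl, hc1, hd1, hR1⟩ := h1.extract huv1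
  obtain ⟨c2, d2, R2, rfl, hc2, hd2, hR2⟩ := h2.extract huv2
  obtain ⟨m, hm, hmv⟩ := h.merge (h1.cyc c1 (by simp)) (h2.cyc c2 (by simp)) hc1 hc2
  obtain ⟨n, hn, hnv⟩ := h.merge (h1.cyc d1 (by simp)) (h2.cyc d2 (by simp)) hd1 hd2
  have z1 : ∀ {l}, IsCyc (side H X u v) l → ∀ e ∈ (side H Y u v).edgeSet, e ≠ s(u, v) → cv l e = 0 :=
    fun hl e he hne => h.edge_zero hl he hne
  have z2 : ∀ {l}, IsCyc (side H Y u v) l → ∀ e ∈ (side H X u v).edgeSet, e ≠ s(u, v) → cv l e = 0 :=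
    fun hl e he hne => h.symm.edge_zero hl he hne
  have toH : ∀ {Z : Set V} {l}, IsCyc (side H Z u v) l → (cv l s(u, v) = 0 ∨ H.Adj u v) → IsCyc H l := by
    intro Z l hl h0
    refine hl.transfer ?_
    intro e he he'
    by_cases hne : e = s(u, v)
    · subst hne
      rcases h0 with h0 | h0
      · exact absurd h0 he
      · exact h0
    · exact (side_edge he' hne).1
  -- counting away from the virtual edge
  have count : ∀ e ∈ H.edgeSet, e ≠ s(u, v) →
      (if cv m e ≠ 0 then 1 else 0) + (if cv d1 e ≠ 0 then 1 else 0) + (if cv d2 e ≠ 0 then 1 else 0)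
        + cnt e R1 + cnt e R2 = 2 ∧
      (if cv m e ≠ 0 then 1 else 0) + (if cv n e ≠ 0 then 1 else 0) + cnt e R1 + cnt e R2 = 2 := by
    intro e he hne
    rcases h.edge_cov hW he with h' | h'
    · have t := h1.two e h'
      change cnt e _ = 2 at t
      rw [cnt_cons, cnt_cons] at t
      have a1 : cv c2 e = 0 := z2 (h2.cyc c2 (by simp)) e h' hne
      have a2 : cv d2 e = 0 := z2 (h2.cyc d2 (by simp)) e h' hne
      have a3 : cnt e R2 = 0 := cnt_zero (fun l hl => z2 (h2.cyc l (by simp [hl])) e h' hne)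
      rw [hmv, hnv, Pi.add_apply, Pi.add_apply, a1, a2, a3]
      simp only [add_zero, ne_eq, not_true_eq_false, if_false] at t ⊢
      omega
    · have t := h2.two e h'
      change cnt e _ = 2 at t
      rw [cnt_cons, cnt_cons] at t
      have a1 : cv c1 e = 0 := z1 (h1.cyc c1 (by simp)) e h' hne
      have a2 : cv d1 e = 0 := z1 (h1.cyc d1 (by simp)) e h' hne
      have a3 : cnt e R1 = 0 := cnt_zero (fun l hl => z1 (h1.cyc l (by simp [hl])) e h' hne)
      rw [hmv, hnv, Pi.add_apply, Pi.add_apply, a1, a2, a3]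
      simp only [zero_add, ne_eq, not_true_eq_false, if_false] at t ⊢
      omega
  have spanof : ∀ P : Submodule (ZMod 2) (Sym2 V → ZMod 2), cv d1 ∈ P → cv d2 ∈ P → (∀ l ∈ R1, cv l ∈ P) →
      (∀ l ∈ R2, cv l ∈ P) → ∀ l, IsCyc H l → cv l ∈ P := by
    intro P p1 p2 p3 p4 l hl
    refine h.decomp hW hl P ?_ ?_
    · intro l hl
      refine (Submodule.span_le.2 ?_) (h1.span l hl)
      rintro _ ⟨l', hl', rfl⟩
      rw [Multiset.mem_cons, Multiset.mem_cons] at hl'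
      rcases hl' with rfl | rfl | hl'
      · exact h1.first_mem p1 p3
      · exact p1
      · exact p3 _ hl'
    · intro l hl
      refine (Submodule.span_le.2 ?_) (h2.span l hl)
      rintro _ ⟨l', hl', rfl⟩
      rw [Multiset.mem_cons, Multiset.mem_cons] at hl'
      rcases hl' with rfl | rfl | hl'
      · exact h2.first_mem p2 p4
      · exact p2
      · exact p4 _ hl'
  have hmz : cv m s(u, v) = 0 := by
    rw [hmv, Pi.add_apply, zmod2_ne.1 hc1, zmod2_ne.1 hc2]; decide
  have hnz : cv n s(u, v) = 0 := by
    rw [hnv, Pi.add_apply, zmod2_ne.1 hd1, zmod2_ne.1 hd2]; decide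
  by_cases hadj : H.Adj u v
  · refine ⟨m ::ₘ d1 ::ₘ d2 ::ₘ (R1 + R2), ?_, ?_, ?_⟩
    · intro l hl
      simp only [Multiset.mem_cons, Multiset.mem_add] at hl
      rcases hl with rfl | rfl | rfl | hl | hl
      · exact hm
      · exact toH (h1.cyc _ (by simp)) (Or.inr hadj)
      · exact toH (h2.cyc _ (by simp)) (Or.inr hadj)
      · exact toH (h1.cyc l (by simp [hl])) (Or.inr hadj)
      · exact toH (h2.cyc l (by simp [hl])) (Or.inr hadj)
    · intro e he
      change cnt e _ = 2
      rw [cnt_cons, cnt_cons, cnt_cons, cnt_add]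
      by_cases hne : e = s(u, v)
      · subst hne
        rw [cnt_zero hR1, cnt_zero hR2, if_pos hd1, if_pos hd2, if_neg (by simpa using hmz)]
      · have := (count e he hne).1
        omega
    · apply spanof
      · exact Submodule.subset_span ⟨d1, by simp, rfl⟩
      · exact Submodule.subset_span ⟨d2, by simp, rfl⟩
      · exact fun l hl => Submodule.subset_span ⟨l, by simp [hl], rfl⟩
      · exact fun l hl => Submodule.subset_span ⟨l, by simp [hl], rfl⟩
  · refine ⟨m ::ₘ n ::ₘ (R1 + R2), ?_, ?_, ?_⟩
    · intro l hl
      simp only [Multiset.mem_cons, Multiset.mem_add] at hl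
      rcases hl with rfl | rfl | hl | hl
      · exact hm
      · exact hn
      · exact toH (h1.cyc l (by simp [hl])) (Or.inl (hR1 l hl))
      · exact toH (h2.cyc l (by simp [hl])) (Or.inl (hR2 l hl))
    · intro e he
      change cnt e _ = 2
      rw [cnt_cons, cnt_cons, cnt_add]
      have hne : e ≠ s(u, v) := by
        rintro rfl
        exact hadj he
      have := (count e he hne).2
      omega
    · intro l hl
      set P := Submodule.span (ZMod 2) {c | ∃ l' ∈ m ::ₘ n ::ₘ (R1 + R2), cv l' = c} with hP
      have hz : ∀ c ∈ P, c s(u, v) = 0 := by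
        intro c hc
        induction hc using Submodule.span_induction with
        | mem c hc =>
          obtain ⟨l', hl', rfl⟩ := hc
          simp only [Multiset.mem_cons, Multiset.mem_add] at hl'
          rcases hl' with rfl | rfl | hl' | hl'
          · exact hmz
          · exact hnz
          · exact hR1 _ hl'
          · exact hR2 _ hl'
        | zero => rfl
        | add a b _ _ ha hb => rw [Pi.add_apply, ha, hb, add_zero]
        | smul t a _ ha => rw [Pi.smul_apply, ha, smul_zero]
      have hPm : ∀ l', l' ∈ m ::ₘ n ::ₘ (R1 + R2) → cv l' ∈ P := fun l' hl' =>
        Submodule.subset_span ⟨l', hl', rfl⟩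
      have hQ : cv l ∈ P ⊔ Submodule.span (ZMod 2) {cv d1} := by
        have hd1' : cv d1 ∈ P ⊔ Submodule.span (ZMod 2) {cv d1} :=
          Submodule.mem_sup_right (Submodule.mem_span_singleton_self _)
        apply spanof _ hd1' _ _ _ l hl
        · have : cv d2 = cv n + cv d1 := by
            rw [hnv]
            have := add_self_vec (cv d1)
            calc cv d2 = cv d2 + 0 := (add_zero _).symm
              _ = _ := by rw [← this]; abel
          rw [this]
          exact Submodule.add_mem _ (Submodule.mem_sup_left (hPm n (by simp))) hd1'
        · exact fun l hl => Submodule.mem_sup_left (hPm l (by simp [hl]))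
        · exact fun l hl => Submodule.mem_sup_left (hPm l (by simp [hl]))
      obtain ⟨p, hp, q, hq, hpq⟩ := Submodule.mem_sup.1 hQ
      obtain ⟨t, rfl⟩ := Submodule.mem_span_singleton.1 hq
      have h0 : cv l s(u, v) = 0 := by
        by_contra h0
        exact hadj (hl.edge_adj h0)
      have ht : t = 0 := by
        have h4 := congrFun hpq s(u, v)
        rw [Pi.add_apply, Pi.smul_apply, hz p hp, h0, zmod2_ne.1 hd1] at h4
        simpa using h4
      rw [ht, zero_smul, add_zero] at hpq
      rw [← hpq]
      exact hp

theorem mac_triangle {H : SimpleGraph V} {a b c : V} (hab : H.Adj a b) (hbc : H.Adj b c) (hca : H.Adj c a)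
    (hs : ∀ x y, H.Adj x y → x = a ∨ x = b ∨ x = c) : Mac H {[a, b, c], [a, b, c]} := by
  classical
  have n1 := hab.ne
  have n2 := hbc.ne
  have n3 := hca.ne
  have hc : IsCyc H [a, b, c] := by
    refine ⟨by simp [n1, n2, n3.symm], by simp [hab, hbc, hca], by simp⟩
  have hval : cv [a, b, c] s(a, b) = 1 ∧ cv [a, b, c] s(b, c) = 1 ∧ cv [a, b, c] s(c, a) = 1 := by
    refine ⟨cv_two hc, ?_, ?_⟩
    · have h3 := CEq.rot (l₁ := [a]) (l₂ := [b, c]) hc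
      have h4 := cv_two (t := [a]) h3.cyc
      rw [← h4]; exact congrFun h3.vec.symm _
    · have h3 := CEq.rot (l₁ := [a, b]) (l₂ := [c]) hc
      have h4 := cv_two (t := [b]) h3.cyc
      rw [← h4]; exact congrFun h3.vec.symm _
  have hedge : ∀ x y, H.Adj x y → s(x, y) = s(a, b) ∨ s(x, y) = s(b, c) ∨ s(x, y) = s(c, a) := by
    intro x y hxy
    have hx := hs x y hxy
    have hy := hs y x hxy.symm
    have := hxy.ne
    simp only [Sym2.eq_iff]
    clear * - hx hy this
    grind
  refine ⟨?_, ?_, ?_⟩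
  · intro l hl
    simp at hl
    rw [hl]; exact hc
  · intro e he
    have : cv [a, b, c] e ≠ 0 := by
      induction e with
      | _ x y =>
        rcases hedge x y he with h | h | h <;> rw [h]
        · rw [hval.1]; decide
        · rw [hval.2.1]; decide
        · rw [hval.2.2]; decide
    change cnt e ([a, b, c] ::ₘ [a, b, c] ::ₘ 0) = 2
    rw [cnt_cons, cnt_cons, cnt_zero (by simp), if_pos this]
  · intro l hl
    apply Submodule.subset_span
    refine ⟨[a, b, c], by simp, ?_⟩
    have hm : ∀ v ∈ l, v = a ∨ v = b ∨ v = c := hl.sub (W := {x | x = a ∨ x = b ∨ x = c}) hs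
    have hl3 := hl.len
    have ha : a ∈ l := by
      by_contra ha
      have hsub : l.toFinset ⊆ {b, c} := by
        intro v hv
        have hv' : v ∈ l := by simpa using hv
        rcases hm v hv' with rfl | h
        · exact absurd hv' ha
        · simpa using h
      have := Finset.card_le_card hsub
      rw [List.toFinset_card_of_nodup hl.nd] at this
      have := this.trans Finset.card_le_two
      omega
    obtain ⟨t, ht⟩ := hl.start ha
    have hn := ht.cyc.nd
    have hlen := ht.cyc.len
    have hmt : ∀ v ∈ t, v = b ∨ v = c := by
      intro v hv
      have h1 := hm v ((ht.mem v).1 (by simp [hv]))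
      rcases h1 with rfl | h1
      · simp at hn; exact absurd hv hn.1
      · exact h1
    rw [← ht.vec]
    match t, hn, hlen, hmt, ht with
    | [], _, hlen, _, _ => simp at hlen
    | [p], _, hlen, _, _ => simp at hlen
    | [p, q], hn, _, hmt, ht =>
      have hp := hmt p (by simp)
      have hq := hmt q (by simp)
      simp at hn
      rcases hp with rfl | rfl <;> rcases hq with rfl | rfl
      · simp at hn
      · rfl
      · exact (CEq.rev hc).vec.symm
      · simp at hn
    | p :: q :: r :: t, hn, _, hmt, _ =>
      have hp := hmt p (by simp)
      have hq := hmt q (by simp)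
      have hr := hmt r (by simp)
      simp at hn
      grind

theorem mac_2conn [Finite V] : ∀ (n : ℕ) (H : SimpleGraph V) (W : Set V), IsPlanar H →
    (∀ x y, H.Adj x y → x ∈ W) → (∀ x, Conn H (W \ {x})) → 3 ≤ W.ncard → W.ncard = n → ∃ F, Mac H F := by
  intro n
  induction n using Nat.strong_induction_on with
  | _ n ih =>
  intro H W hp hW h2 h3 hn
  by_cases h3' : W.ncard = 3
  · obtain ⟨a, b, c, hab, hac, hbc, rfl⟩ := Set.ncard_eq_three.1 h3'
    have key : ∀ p q r : V, p ≠ q → p ≠ r → q ≠ r → ({a, b, c} : Set V) = {p, q, r} → H.Adj q r := by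
      intro p q r hpq hpr hqr he
      have h4 := h2 p
      rw [he] at h4
      obtain ⟨x, hx, hx', y, hy, hy', hxy⟩ := h4.cut' {q} (a := q) (b := r) (by simp [hpq.symm]) rfl
        (by simp [hpr.symm]) (by simpa using hqr.symm)
      simp at hx' hy hy'
      subst hx'
      have : y = r := by tauto
      rwa [this] at hxy
    refine ⟨_, mac_triangle (a := a) (b := b) (c := c) (key c a b hac.symm hbc.symm hab ?_)
      (key a b c hab hac hbc rfl) (key b c a hbc hab.symm hac.symm ?_) ?_⟩
    · ext x; simp; tauto
    · ext x; simp; tauto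
    · intro x y hxy; simpa using hW x y hxy
  by_cases h3c : ∀ x y, Conn H (W \ {x, y})
  · exact mac_3conn hp hW h3c (by omega)
  push Not at h3c
  obtain ⟨u, v, huv⟩ := h3c
  obtain ⟨X, Y, hs⟩ := exists_sep h2 huv
  have key : ∀ X Y : Set V, Sep H W u v X Y → ∃ F, Mac (side H X u v) F := by
    intro X Y hs
    have hsub : X ∪ {u, v} ⊂ W := by
      constructor
      · rintro x (hx | rfl | rfl)
        · exact (hs.memX x hx).1
        · exact hs.uW
        · exact hs.vW
      · intro hsub
        obtain ⟨y, hy⟩ := hs.neY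
        have h5 := hs.memY y hy
        have h6 := hsub h5.1
        simp only [Set.mem_union, Set.mem_insert_iff, Set.mem_singleton_iff] at h6
        tauto
    have hlt := Set.ncard_lt_ncard hsub (Set.toFinite _)
    refine ih (X ∪ {u, v} : Set V).ncard (by omega) _ _ (hs.planar hp h2) side_supp (hs.conn_side h2) ?_ rfl
    obtain ⟨x, hx⟩ := hs.neX
    have h5 := hs.memX x hx
    have h6 : ({x, u, v} : Set V) ⊆ X ∪ {u, v} := by
      rintro z (rfl | hz)
      · exact Or.inl hx
      · exact Or.inr hz
    have h7 := Set.ncard_le_ncard h6 (Set.toFinite _)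
    have h8 : ({x, u, v} : Set V).ncard = 3 :=
      Set.ncard_eq_three.2 ⟨x, u, v, h5.2.1, h5.2.2.1, hs.ne, rfl⟩
    omega
  obtain ⟨F1, h1⟩ := key X Y hs
  obtain ⟨F2, h2⟩ := key Y X hs.symm
  exact hs.glue hW h1 h2

end Th

namespace Th

universe u
variable {V : Type u}

/-- An indexed family of faces. -/
structure FS {ι : Type} [Fintype ι] (H : SimpleGraph V) (φ : ι → List V) : Prop where
  cyc : ∀ i, IsCyc H (φ i)
  two : ∀ e ∈ H.edgeSet, ∃ i j, i ≠ j ∧ cv (φ i) e ≠ 0 ∧ cv (φ j) e ≠ 0 ∧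
    ∀ k, cv (φ k) e ≠ 0 → k = i ∨ k = j
  span : ∀ l, IsCyc H l → ∃ c : ι → ZMod 2, ∑ i, c i • cv (φ i) = cv l

theorem Mac.fs {H : SimpleGraph V} {F : Multiset (List V)} (h : Mac H F) :
    ∃ (n : ℕ) (φ : Fin n → List V), FS H φ := by
  classical
  refine ⟨F.toList.length, F.toList.get, ?_, ?_, ?_⟩
  · intro i
    exact h.cyc _ (Multiset.mem_toList.1 (List.get_mem _ _))
  · intro e he
    have h2 := h.two e he
    have hF : F = (Finset.univ : Finset (Fin F.toList.length)).val.map F.toList.get := by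
      rw [Fin.univ_val_map, List.ofFn_get, Multiset.coe_toList]
    have h3 : (Finset.univ.filter (fun i => cv (F.toList.get i) e ≠ 0)).card = 2 := by
      have h4 : (Multiset.filter (fun l => cv l e ≠ 0)
          ((Finset.univ : Finset (Fin F.toList.length)).val.map F.toList.get)).card = 2 :=
        (congrArg (fun M => (Multiset.filter (fun l => cv l e ≠ 0) M).card) hF.symm).trans h2
      rw [Multiset.filter_map, Multiset.card_map] at h4
      exact h4
    obtain ⟨i, j, hij, hs⟩ := Finset.card_eq_two.1 h3
    have hm : ∀ k, cv (F.toList.get k) e ≠ 0 ↔ k = i ∨ k = j := by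
      intro k
      have : k ∈ Finset.univ.filter (fun i => cv (F.toList.get i) e ≠ 0) ↔ k ∈ ({i, j} : Finset _) := by
        rw [hs]
      simpa using this
    exact ⟨i, j, hij, (hm i).2 (Or.inl rfl), (hm j).2 (Or.inr rfl), fun k hk => (hm k).1 hk⟩
  · intro l hl
    have := h.span l hl
    rw [← Submodule.mem_span_range_iff_exists_fun]
    convert this using 3
    ext c
    simp only [Set.mem_range, Set.mem_ofPred_eq]
    constructor
    · rintro ⟨i, rfl⟩
      exact ⟨_, Multiset.mem_toList.1 (List.get_mem _ _), rfl⟩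
    · rintro ⟨l', hl', rfl⟩
      obtain ⟨i, hi⟩ := List.get_of_mem (Multiset.mem_toList.2 hl')
      exact ⟨i, by rw [hi]⟩

/-- spanning tree -/
theorem span_tree [Finite V] {H : SimpleGraph V} {W : Set V} (hc : Conn H W) {r : V} (hr : r ∈ W) :
    ∀ k : ℕ, k + 1 ≤ W.ncard → ∃ (A : Set V) (T : Set (Sym2 V)), A ⊆ W ∧ T ⊆ H.edgeSet ∧
      Conn (SimpleGraph.fromEdgeSet T) A ∧ A.ncard = k + 1 ∧ T.ncard ≤ k ∧ r ∈ A := by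
  intro k
  induction k with
  | zero => exact fun _ => ⟨{r}, ∅, by simpa using hr, by simp, conn_singleton _ _, by simp, by simp, rfl⟩
  | succ k ih =>
    intro hk
    obtain ⟨A, T, hA, hT, hcA, hAc, hTc, hrA⟩ := ih (by omega)
    have : ∃ b ∈ W, b ∉ A := by
      by_contra hcon
      push Not at hcon
      have := Set.ncard_le_ncard (hcon : W ⊆ A)
      omega
    obtain ⟨b, hb, hbA⟩ := this
    obtain ⟨x, hx, hxA, y, hy, hyA, hxy⟩ := hc.cut' A hr hrA hb hbA
    refine ⟨insert y A, insert s(x, y) T, ?_, ?_, ?_, ?_, ?_, Or.inr hrA⟩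
    · exact Set.insert_subset hy hA
    · exact Set.insert_subset hxy hT
    · have h1 : Conn (SimpleGraph.fromEdgeSet (insert s(x, y) T)) A :=
        hcA.mono (SimpleGraph.fromEdgeSet_mono (Set.subset_insert _ _))
      have h2 : (SimpleGraph.fromEdgeSet (insert s(x, y) T)).Adj x y := by
        rw [SimpleGraph.fromEdgeSet_adj]
        exact ⟨Or.inl rfl, hxy.ne⟩
      exact h1.insert_adj hxA h2
    · rw [Set.ncard_insert_of_notMem hyA, hAc]
    · have := Set.ncard_insert_le s(x, y) T
      omega

theorem FS.sum {ι : Type} [Fintype ι] {H : SimpleGraph V} {φ : ι → List V} (h : FS H φ) :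
    ∑ i, cv (φ i) = 0 := by
  classical
  funext e
  rw [Finset.sum_apply]
  by_cases he : e ∈ H.edgeSet
  · obtain ⟨i, j, hij, hi, hj, hk⟩ := h.two e he
    rw [← Finset.sum_subset (Finset.subset_univ {i, j})]
    · rw [Finset.sum_pair hij, zmod2_ne.1 hi, zmod2_ne.1 hj]; rfl
    · intro k _ hk'
      by_contra h0
      have := hk k h0
      simp at hk'
      tauto
  · apply Finset.sum_eq_zero
    intro i _
    by_contra h0
    exact he ((h.cyc i).edge_adj h0)

theorem FS.euler [Finite V] {ι : Type} [Fintype ι] {H : SimpleGraph V} {φ : ι → List V} (h : FS H φ)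
    {W : Set V} (hc : Conn H W) (hW : W.Nonempty) (hs : ∀ x y, H.Adj x y → x ∈ W)
    (hne : ∃ e, e ∈ H.edgeSet) :
    H.edgeSet.ncard + 2 ≤ Fintype.card ι + W.ncard := by
  classical
  have := Fintype.ofFinite V
  obtain ⟨r, hr⟩ := hW
  have hpos : 0 < W.ncard := (Set.ncard_pos).2 ⟨r, hr⟩
  obtain ⟨A, T, hA, hT, hcA, hAc, hTc, hrA⟩ := span_tree hc hr (W.ncard - 1) (by omega)
  have hAW : A = W := Set.eq_of_subset_of_ncard_le hA (by omega)
  subst hAW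
  set N : Set (Sym2 V) := H.edgeSet \ T with hN
  have hTH : SimpleGraph.fromEdgeSet T ≤ H := by
    intro a b hab
    rw [SimpleGraph.fromEdgeSet_adj] at hab
    exact hT hab.1
  -- fundamental cycles
  have fund : ∀ e : N, ∃ l, IsCyc H l ∧ ∀ e' : N, cv l e' = if e' = e then 1 else 0 := by
    rintro ⟨e, he, heT⟩
    induction e with
    | _ x y =>
      have hxy : H.Adj x y := he
      obtain ⟨l, hl⟩ := hcA.path (hs x y hxy) (hs y x hxy.symm)
      match l, hl with
      | [], hl => exact absurd hl.hd (by simp)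
      | [a], hl =>
        have h1 := hl.hd
        have h2 := hl.ls
        simp at h1 h2
        exact absurd (h1.symm.trans h2) hxy.ne
      | [a, b], hl =>
        have h1 := hl.hd
        have h2 := hl.ls
        have h3 := hl.ch
        simp at h1 h2 h3
        subst h1; subst h2
        exact absurd h3.1 heT
      | a :: b :: c :: t, hl =>
        have h1 := hl.hd
        simp at h1
        subst h1
        have h2 := hl.ls
        obtain ⟨t', ht'⟩ : ∃ t', a :: b :: c :: t = a :: t' ++ [y] := by
          have hne' : b :: c :: t ≠ [] := by simp
          refine ⟨(b :: c :: t).dropLast, ?_⟩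
          have h4 : (b :: c :: t).getLast hne' = y := by
            have : (a :: b :: c :: t).getLast? = some ((b :: c :: t).getLast hne') := by
              rw [List.getLast?_eq_some_getLast (by simp)]
              simp
            rw [this] at h2
            exact Option.some.inj h2
          rw [List.cons_append]
          congr 1
          rw [← h4]
          exact (List.dropLast_append_getLast hne').symm
        have hch := hl.ch
        have hnd := hl.nd
        have hlen : 1 ≤ t'.length := by
          have := congrArg List.length ht'
          simp at this
          omega
        rw [ht'] at hch hnd
        have hcyc : IsCyc H (a :: t' ++ [y]) := by
          refine (isCyc_cons_iff (B := [])).2 ⟨hnd, ?_, ?_, ?_⟩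
          · exact hch.imp (fun _ _ hh => hTH hh)
          · simpa using hxy.symm
          · simpa using hlen
        refine ⟨_, hcyc, ?_⟩
        rintro ⟨e', he', heT'⟩
        by_cases hee : e' = s(a, y)
        · subst hee
          simp only [if_true]
          exact cv_last hcyc
        · rw [if_neg (fun hh => hee (congrArg Subtype.val hh))]
          have : cv (a :: t' ++ [y]) = pv (a :: t' ++ [y]) + pv (y :: [] ++ [a]) := cv_cons (B := [])
          have h5 : pv (y :: [] ++ [a]) = sv s(y, a) := by
            change pv [y, a] = _
            rw [pv_cons, pv_one, add_zero]
          rw [this, h5, Pi.add_apply, sv_ne (by rw [Sym2.eq_swap]; exact hee), add_zero]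
          by_contra h0
          have h6 := pv_supp_adj hch h0
          rw [SimpleGraph.edgeSet_fromEdgeSet] at h6
          exact heT' h6.1
  choose fc hfc hfv using fund
  -- the linear map
  let M : (ι → ZMod 2) →ₗ[ZMod 2] (N → ZMod 2) :=
    { toFun := fun c e => ∑ i, c i * cv (φ i) e
      map_add' := by
        intro c d; funext e
        simp only [Pi.add_apply, add_mul, Finset.sum_add_distrib]
      map_smul' := by
        intro t c; funext e
        simp only [Pi.smul_apply, smul_eq_mul, RingHom.id_apply, mul_assoc, Finset.mul_sum] }
  have hsurj : LinearMap.range M = ⊤ := by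
    rw [LinearMap.range_eq_top]
    intro g
    choose cc hcc using fun e : N => h.span (fc e) (hfc e)
    refine ⟨∑ e : N, g e • cc e, ?_⟩
    rw [map_sum]
    funext e'
    rw [Finset.sum_apply]
    have : ∀ e : N, M (g e • cc e) e' = if e' = e then g e else 0 := by
      intro e
      rw [map_smul, Pi.smul_apply]
      have h1 : M (cc e) e' = cv (fc e) e' := by
        rw [← hcc e, Finset.sum_apply]
        rfl
      rw [h1, hfv e e']
      split_ifs <;> simp
    rw [Finset.sum_congr rfl (fun e _ => this e)]
    simp
  have hker : 1 ≤ Module.finrank (ZMod 2) (LinearMap.ker M) := by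
    rw [Nat.one_le_iff_ne_zero]
    intro h0
    rw [Submodule.finrank_eq_zero] at h0
    have h1 : (fun _ => 1 : ι → ZMod 2) ∈ LinearMap.ker M := by
      rw [LinearMap.mem_ker]
      funext e
      change ∑ i, 1 * cv (φ i) e = 0
      simp only [one_mul]
      have := congrFun h.sum (e : Sym2 V)
      rwa [Finset.sum_apply] at this
    rw [h0, Submodule.mem_bot] at h1
    obtain ⟨e, he⟩ := hne
    obtain ⟨i, _⟩ := h.two e he
    exact one_ne_zero (congrFun h1 i)
  have hrn := LinearMap.finrank_range_add_finrank_ker M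
  rw [hsurj, finrank_top, Module.finrank_fintype_fun_eq_card, Module.finrank_fintype_fun_eq_card] at hrn
  have hNc : Fintype.card N = N.ncard := by
    rw [← Nat.card_eq_fintype_card]; rfl
  have hNe : N.ncard + T.ncard = H.edgeSet.ncard := Set.ncard_sdiff_add_ncard_of_subset hT
  omega

end Th

namespace Th

universe u
variable {V : Type u}

theorem IsCyc.deg_two {H : SimpleGraph V} {l : List V} (h : IsCyc H l) {v : V} (hv : v ∈ l) :
    ∃ x y, x ≠ y ∧ ∀ z, cv l s(v, z) ≠ 0 ↔ z = x ∨ z = y := by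
  obtain ⟨t, ht⟩ := h.start hv
  match t, ht with
  | [], ht => have := ht.cyc.len; simp at this
  | x :: t, ht =>
    rcases List.eq_nil_or_concat t with rfl | ⟨m, y, rfl⟩
    · have := ht.cyc.len; simp at this
    rw [List.concat_eq_append] at ht
    have hnd := ht.cyc.nd
    refine ⟨x, y, ?_, ?_⟩
    · rintro rfl
      simp at hnd
    · intro z
      rw [← ht.vec]
      have h1 : cv (v :: (x :: (m ++ [y]))) = sv s(v, x) + (pv (x :: (m ++ [y])) + sv s(y, v)) := by
        have h2 : cv (v :: (x :: (m ++ [y]))) = sv s(v, x) + pv ((x :: m) ++ y :: [v]) := by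
          change pv (v :: (x :: (m ++ [y])) ++ [v]) = _
          simp [pv_cons]
        rw [h2, pv_append]
        have h3 : pv [y, v] = sv s(y, v) := by rw [pv_cons, pv_one, add_zero]
        rw [h3]
        rfl
      rw [h1, Pi.add_apply, Pi.add_apply]
      have h3 : pv (x :: (m ++ [y])) s(v, z) = 0 := by
        by_contra h0
        have := pv_supp_mem h0 (x := v) (by simp)
        exact (List.nodup_cons.1 hnd).1 this
      rw [h3, zero_add]
      have hxy : x ≠ y := by
        rintro rfl
        simp at hnd
      have hvx : v ≠ x := by
        rintro rfl
        simp at hnd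
      have hvy : v ≠ y := by
        rintro rfl
        simp at hnd
      have e1 : s(v, z) = s(v, x) ↔ z = x := by
        rw [Sym2.eq_iff]; constructor
        · rintro (⟨_, h⟩ | ⟨h1, h2⟩)
          · exact h
          · exact absurd h1 hvx
        · rintro rfl; exact Or.inl ⟨rfl, rfl⟩
      have e2 : s(v, z) = s(y, v) ↔ z = y := by
        rw [Sym2.eq_iff]; constructor
        · rintro (⟨h, _⟩ | ⟨h1, h2⟩)
          · exact absurd h hvy
          · exact h2
        · rintro rfl; exact Or.inr ⟨rfl, rfl⟩
      unfold sv
      by_cases c1 : z = x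
      · have : z ≠ y := by rw [c1]; exact hxy
        rw [if_pos (e1.2 c1), if_neg (fun hh => this (e2.1 hh))]
        simp [c1]
      · rw [if_neg (fun hh => c1 (e1.1 hh))]
        by_cases c2 : z = y
        · rw [if_pos (e2.2 c2)]; simp [c2]
        · rw [if_neg (fun hh => c2 (e2.1 hh))]; simp [c1, c2]

section

variable {ι : Type} [Fintype ι] {H : SimpleGraph V} {φ : ι → List V} {W : Set V}

theorem FS.eval (h : FS H φ) {c : ι → ZMod 2} {e : Sym2 V} (he : e ∈ H.edgeSet) {i j : ι} (hij : i ≠ j)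
    (hi : cv (φ i) e ≠ 0) (hj : cv (φ j) e ≠ 0) : (∑ k, c k • cv (φ k)) e = c i + c j := by
  classical
  rw [Finset.sum_apply]
  obtain ⟨i', j', hij', hi', hj', hk⟩ := h.two e he
  have hk2 : ∀ k, cv (φ k) e ≠ 0 → k = i ∨ k = j := by
    intro k hk'
    have a1 := hk k hk'
    have a2 := hk i hi
    have a3 := hk j hj
    clear * - a1 a2 a3 hij
    grind
  rw [← Finset.sum_subset (Finset.subset_univ {i, j})]
  · rw [Finset.sum_pair hij, Pi.smul_apply, Pi.smul_apply, zmod2_ne.1 hi, zmod2_ne.1 hj]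
    simp
  · intro k _ hk'
    have : cv (φ k) e = 0 := by
      by_contra h0
      have := hk2 k h0
      simp at hk'
      tauto
    rw [Pi.smul_apply, this, smul_zero]

theorem FS.other (h : FS H φ) {e : Sym2 V} {i : ι} (hi : cv (φ i) e ≠ 0) :
    ∃ j, j ≠ i ∧ cv (φ j) e ≠ 0 ∧ ∀ k, cv (φ k) e ≠ 0 → k = i ∨ k = j := by
  obtain ⟨i', j', hij', hi', hj', hk⟩ := h.two e ((h.cyc i).edge_adj hi)
  rcases hk i hi with rfl | rfl
  · exact ⟨j', hij'.symm, hj', hk⟩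
  · exact ⟨i', hij', hi', fun k hk' => (hk k hk').symm⟩

/-- a third face at an edge is one of the two -/
theorem FS.third (h : FS H φ) {e : Sym2 V} {i j k : ι} (hi : cv (φ i) e ≠ 0) (hj : cv (φ j) e ≠ 0)
    (hij : i ≠ j) (hk : cv (φ k) e ≠ 0) : k = i ∨ k = j := by
  obtain ⟨j', h1, h2, h3⟩ := h.other hi
  have := h3 j hj
  have := h3 k hk
  clear h3
  grind

theorem FS.link [Finite V] (h : FS H φ) (hs : ∀ x y, H.Adj x y → x ∈ W) (hc : ∀ x, Conn H (W \ {x}))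
    {v x0 : V} {A : Set V} (hA : x0 ∈ A) (h0 : H.Adj v x0)
    (hcl : ∀ i, ∀ x ∈ A, cv (φ i) s(v, x) ≠ 0 → ∀ y, cv (φ i) s(v, y) ≠ 0 → y ∈ A) :
    ∀ y, H.Adj v y → y ∈ A := by
  classical
  have := Fintype.ofFinite V
  intro y hvy
  by_contra hyA
  have hxy : x0 ≠ y := by rintro rfl; exact hyA hA
  obtain ⟨p, hp⟩ := (hc v).path (x := x0) (y := y) ⟨hs _ _ h0.symm, fun hh => h0.ne hh.symm⟩
    ⟨hs _ _ hvy.symm, fun hh => hvy.ne hh.symm⟩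
  -- the cycle
  have hcyc : ∃ m, IsCyc H (v :: (x0 :: m ++ [y])) := by
    match p, hp with
    | [], hp => exact absurd hp.hd (by simp)
    | a :: t, hp =>
      have h1 := hp.hd
      simp at h1
      subst h1
      rcases List.eq_nil_or_concat t with rfl | ⟨m, b, rfl⟩
      · have := hp.ls
        simp at this
        exact absurd this hxy
      · rw [List.concat_eq_append] at hp
        have h2 : b = y := by
          have h3 := hp.ls
          rw [← List.cons_append, List.getLast?_concat] at h3
          exact Option.some.inj h3
        subst h2
        refine ⟨m, ⟨?_, ?_, by simp⟩⟩
        · rw [List.nodup_cons]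
          exact ⟨fun hh => (hp.mem v hh).2 rfl, hp.nd⟩
        · have h3 := hp.ch
          have e : v :: (a :: m ++ [b]) ++ [v] = v :: a :: m ++ b :: [v] := by simp
          rw [e, chain_glue]
          refine ⟨?_, by simpa using hvy.symm⟩
          exact List.isChain_cons_cons.2 ⟨h0, h3⟩
  obtain ⟨m, hm⟩ := hcyc
  set l := v :: (x0 :: m ++ [y]) with hl
  obtain ⟨c, hcc⟩ := h.span l hm
  obtain ⟨p1, p2, hp12, hp⟩ := hm.deg_two (v := v) (by simp [hl])
  have e1 : cv l s(v, x0) = 1 := cv_two hm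
  have e2 : cv l s(v, y) = 1 := cv_last (t := x0 :: m) hm
  have e3 : ∀ z, cv l s(v, z) ≠ 0 ↔ z = x0 ∨ z = y := by
    intro z
    have a1 := (hp x0).1 (by rw [e1]; decide)
    have a2 := (hp y).1 (by rw [e2]; decide)
    rw [hp]
    clear * - a1 a2 hxy hp12
    grind
  let L : (Sym2 V → ZMod 2) → ZMod 2 := fun g => ∑ z : V, if z ∈ A then g s(v, z) else 0
  have hL1 : L (cv l) = 1 := by
    change (∑ z : V, if z ∈ A then cv l s(v, z) else 0) = 1
    rw [Finset.sum_eq_single x0]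
    · rw [if_pos hA, e1]
    · intro z _ hz
      split_ifs with hzA
      · by_contra h0
        rcases (e3 z).1 h0 with rfl | rfl
        · exact hz rfl
        · exact hyA hzA
      · rfl
    · simp
  have hLf : ∀ i, L (cv (φ i)) = 0 := by
    intro i
    change (∑ z : V, if z ∈ A then cv (φ i) s(v, z) else 0) = 0
    by_cases hv : v ∈ φ i
    · obtain ⟨x, y, hxy, hz⟩ := (h.cyc i).deg_two hv
      rw [← Finset.sum_subset (Finset.subset_univ {x, y})]
      · rw [Finset.sum_pair hxy, zmod2_ne.1 ((hz x).2 (Or.inl rfl)), zmod2_ne.1 ((hz y).2 (Or.inr rfl))]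
        have : x ∈ A ↔ y ∈ A := ⟨fun hx => hcl i x hx ((hz x).2 (Or.inl rfl)) y ((hz y).2 (Or.inr rfl)),
          fun hx => hcl i y hx ((hz y).2 (Or.inr rfl)) x ((hz x).2 (Or.inl rfl))⟩
        by_cases hx : x ∈ A
        · rw [if_pos hx, if_pos (this.1 hx)]; decide
        · rw [if_neg hx, if_neg (fun hh => hx (this.2 hh))]; rfl
      · intro z _ hz'
        split_ifs
        · by_contra h0
          have := (hz z).1 h0
          simp at hz'
          tauto
        · rfl
    · apply Finset.sum_eq_zero
      intro z _
      split_ifs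
      · by_contra h0
        exact hv ((h.cyc i).edge_mem h0 (by simp))
      · rfl
  have hL2 : L (cv l) = 0 := by
    rw [← hcc]
    change (∑ z : V, if z ∈ A then (∑ i, c i • cv (φ i)) s(v, z) else 0) = 0
    have : ∀ z : V, (if z ∈ A then (∑ i, c i • cv (φ i)) s(v, z) else 0)
        = ∑ i, c i * (if z ∈ A then cv (φ i) s(v, z) else 0) := by
      intro z
      split_ifs
      · rw [Finset.sum_apply]; rfl
      · simp
    rw [Finset.sum_congr rfl (fun z _ => this z), Finset.sum_comm]
    apply Finset.sum_eq_zero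
    intro i _
    rw [← Finset.mul_sum]
    have := hLf i
    change (∑ z : V, if z ∈ A then cv (φ i) s(v, z) else 0) = 0 at this
    rw [this, mul_zero]
  rw [hL1] at hL2
  exact one_ne_zero hL2

theorem FS.const [Finite V] (h : FS H φ) (hs : ∀ x y, H.Adj x y → x ∈ W) (hc : ∀ x, Conn H (W \ {x}))
    {l : List V} (hl : IsCyc H l) {c : ι → ZMod 2} (hcl : ∑ i, c i • cv (φ i) = cv l) {v : V} (hv : v ∉ l)
    {i j : ι} (hi : v ∈ φ i) (hj : v ∈ φ j) : c i = c j := by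
  have heq : ∀ e : Sym2 V, v ∈ e → ∀ k k', cv (φ k) e ≠ 0 → cv (φ k') e ≠ 0 → c k = c k' := by
    intro e hve k k' hk hk'
    by_cases hkk : k = k'
    · rw [hkk]
    · have := h.eval (c := c) ((h.cyc k).edge_adj hk) hkk hk hk'
      rw [hcl] at this
      have h0 : cv l e = 0 := by
        by_contra h0
        exact hv (hl.edge_mem h0 hve)
      rw [h0] at this
      exact CharTwo.add_eq_zero.1 this.symm
  obtain ⟨x, _, _, hx⟩ := (h.cyc i).deg_two hi
  obtain ⟨y, _, _, hy⟩ := (h.cyc j).deg_two hj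
  have hx := (hx x).2 (Or.inl rfl)
  have hy := (hy y).2 (Or.inl rfl)
  have := h.link hs hc (v := v) (x0 := x) (A := {z | ∀ k, cv (φ k) s(v, z) ≠ 0 → c i = c k})
    (fun k hk => heq _ (by simp) _ _ hx hk) ((h.cyc i).edge_adj hx) (by
      intro k z hz hk y hy k' hk'
      exact (hz k hk).trans (heq _ (by simp) _ _ hy hk')) y ((h.cyc j).edge_adj hy)
  exact this j hy

/-- faces are induced cycles -/
theorem FS.induced [Finite V] (h : FS H φ) (hs : ∀ x y, H.Adj x y → x ∈ W) (hc : ∀ x, Conn H (W \ {x}))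
    (hcut : ∀ x y, H.Adj x y → Conn H (W \ {x, y})) {i : ι} {x y : V} (hx : x ∈ φ i) (hy : y ∈ φ i)
    (hxy : H.Adj x y) : cv (φ i) s(x, y) ≠ 0 := by
  classical
  intro h0
  obtain ⟨A, B, hAB⟩ := (h.cyc i).split hx hy hxy.ne
  have hAB' := hAB.cyc
  have hA : A ≠ [] := by
    rintro rfl
    have := cv_two hAB'
    rw [← hAB.vec] at h0
    exact one_ne_zero (this.symm.trans h0)
  have hB : B ≠ [] := by
    rintro rfl
    have := cv_last hAB'
    rw [← hAB.vec] at h0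
    rw [this] at h0
    exact one_ne_zero h0
  obtain ⟨p, hp⟩ := List.exists_mem_of_ne_nil A hA
  obtain ⟨q, hq⟩ := List.exists_mem_of_ne_nil B hB
  have hAl : 1 ≤ A.length := List.length_pos_iff.2 hA
  have hBl : 1 ≤ B.length := List.length_pos_iff.2 hB
  obtain ⟨t1, t2, t3⟩ := theta (P := []) hAB' (by simpa using hxy) (by simp) (by simp)
  have t1 := t1 (by simpa using hAl)
  have t2 := t2 (by simpa using hBl)
  obtain ⟨c, hcc⟩ := h.span _ t1
  have hcc2 : ∑ k, (c k + if k = i then 1 else 0) • cv (φ k) = cv (x :: [] ++ y :: B) := by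
    have : ∀ k, (c k + if k = i then 1 else 0) • cv (φ k) = c k • cv (φ k) + if k = i then cv (φ k) else 0 := by
      intro k
      rw [add_smul]
      split_ifs <;> simp
    rw [Finset.sum_congr rfl (fun k _ => this k), Finset.sum_add_distrib, hcc, Finset.sum_ite_eq' Finset.univ i]
    simp only [Finset.mem_univ, if_true]
    rw [← hAB.vec, t3, ← add_assoc, add_self_vec, zero_add]
  have hnd := hAB'.nd
  have hmem : ∀ v, v ∈ φ i ↔ v = x ∨ v ∈ A ∨ v = y ∨ v ∈ B := by
    intro v
    rw [← hAB.mem]; simp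
  simp only [List.cons_append, List.nodup_cons, List.nodup_append, List.mem_append, List.mem_cons] at hnd
  -- membership in the two cycles
  have m1 : ∀ v, v ∉ A → v ≠ x → v ≠ y → v ∉ x :: A ++ y :: ([] : List V).reverse := by
    intro v h1 h2 h3; simp [h1, h2, h3]
  have m2 : ∀ v, v ∉ B → v ≠ x → v ≠ y → v ∉ x :: [] ++ y :: B := by
    intro v h1 h2 h3; simp [h1, h2, h3]
  have hone : ∀ a : ZMod 2, a + 1 ≠ a := by decide
  have hpA : ∀ v ∈ A, v ∉ B ∧ v ≠ x ∧ v ≠ y := by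
    intro v hv; clear * - hnd hv; grind
  have hqB : ∀ v ∈ B, v ∉ A ∧ v ≠ x ∧ v ≠ y := by
    intro v hv; clear * - hnd hv; grind
  have hpS : ∀ v ∈ A, ∀ k, k ≠ i → v ∈ φ k → c k = c i + 1 := by
    intro v hv k hk hvk
    obtain ⟨a1, a2, a3⟩ := hpA v hv
    have := h.const hs hc t2 hcc2 (m2 v a1 a2 a3) hvk ((hmem v).2 (by tauto))
    simpa [hk] using this
  have hqS : ∀ v ∈ B, ∀ k, v ∈ φ k → c k = c i := by
    intro v hv k hvk
    obtain ⟨a1, a2, a3⟩ := hqB v hv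
    exact h.const hs hc t1 hcc (m1 v a1 a2 a3) hvk ((hmem v).2 (by tauto))
  have hW := (h.cyc i).sub hs
  have hqn : ∀ v ∈ B, ¬ ∀ k, k ≠ i → v ∈ φ k → c k = c i + 1 := by
    intro v hv hcon
    obtain ⟨z, _, _, hz⟩ := (h.cyc i).deg_two ((hmem v).2 (Or.inr (Or.inr (Or.inr hv))))
    obtain ⟨k, hk, hk', -⟩ := h.other ((hz z).2 (Or.inl rfl))
    have hvk := (h.cyc k).edge_mem hk' (x := v) (by simp)
    have := hcon k hk hvk
    rw [hqS v hv k hvk] at this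
    exact hone _ this.symm
  obtain ⟨s, hsW, hsS, t, htW, htS, hst⟩ := (hcut x y hxy).cut'
    {v | ∀ k, k ≠ i → v ∈ φ k → c k = c i + 1} (a := p) (b := q)
    ⟨hW p ((hmem p).2 (by tauto)), by simpa using (hpA p hp).2⟩ (hpS p hp)
    ⟨hW q ((hmem q).2 (by tauto)), by simpa using (hqB q hq).2⟩ (hqn q hq)
  have htx : t ≠ x ∧ t ≠ y := by simpa using htW.2
  have htA : t ∉ A := fun hh => htS (hpS t hh)
  obtain ⟨k1, k2, hk12, hk1, hk2, -⟩ := h.two s(s, t) hst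
  have : ∃ k, k ≠ i ∧ cv (φ k) s(s, t) ≠ 0 := by
    by_cases hk : k1 = i
    · exact ⟨k2, fun hh => hk12 (hk.trans hh.symm), hk2⟩
    · exact ⟨k1, hk, hk1⟩
  obtain ⟨k, hki, hk⟩ := this
  have hck := hsS k hki ((h.cyc k).edge_mem hk (by simp))
  have htk := (h.cyc k).edge_mem hk (x := t) (by simp)
  apply htS
  intro k' _ htk'
  rw [← hck]
  exact h.const hs hc t1 hcc (m1 t htA htx.1 htx.2) htk' htk

end

end Th

namespace Th

universe u
variable {V : Type u}

theorem theta_short {H : SimpleGraph V} (h : ¬ HasTheta6 H) {a b c d e f : V}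
    (nd : [a, b, c, d, e, f].Nodup) (h1 : H.Adj a b) (h2 : H.Adj b c) (h3 : H.Adj c d) (h4 : H.Adj d e)
    (h5 : H.Adj e f) (h6 : H.Adj f a) (hc : H.Adj a c) : False := by
  apply h
  refine ⟨[a, b, c, d, e, f].get, List.nodup_iff_injective_get.1 nd, ?_, 0, 2, by decide, by decide, by decide, hc⟩
  intro i
  fin_cases i <;> assumption

theorem theta_long {H : SimpleGraph V} (h : ¬ HasTheta6 H) {a b c d e f : V}
    (nd : [a, b, c, d, e, f].Nodup) (h1 : H.Adj a b) (h2 : H.Adj b c) (h3 : H.Adj c d) (h4 : H.Adj d e)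
    (h5 : H.Adj e f) (h6 : H.Adj f a) (hc : H.Adj a d) : False := by
  apply h
  refine ⟨[a, b, c, d, e, f].get, List.nodup_iff_injective_get.1 nd, ?_, 0, 3, by decide, by decide, by decide, hc⟩
  intro i
  fin_cases i <;> assumption

/-- the cyclic list is a triangle -/
structure Tri (H : SimpleGraph V) (l : List V) (u v w : V) : Prop where
  uv : H.Adj u v
  vw : H.Adj v w
  wu : H.Adj w u
  len : l.length = 3
  mem : ∀ x, x ∈ l ↔ x = u ∨ x = v ∨ x = w
  edge : ∀ e, cv l e ≠ 0 ↔ e = s(u, v) ∨ e = s(v, w) ∨ e = s(w, u)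

theorem Tri.rot {H : SimpleGraph V} {l : List V} {u v w : V} (h : Tri H l u v w) : Tri H l v w u :=
  ⟨h.vw, h.wu, h.uv, h.len, fun x => by rw [h.mem]; tauto, fun e => by rw [h.edge]; tauto⟩

theorem Tri.swap {H : SimpleGraph V} {l : List V} {u v w : V} (h : Tri H l u v w) : Tri H l v u w :=
  ⟨h.uv.symm, h.wu.symm, h.vw.symm, h.len, fun x => by rw [h.mem]; tauto,
    fun e => by rw [h.edge, Sym2.eq_swap (a := v) (b := u), Sym2.eq_swap (a := u) (b := w),
      Sym2.eq_swap (a := w) (b := v)]; tauto⟩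

/-- the cyclic list is a quadrilateral -/
structure Quad (H : SimpleGraph V) (l : List V) (u v a b : V) : Prop where
  uv : H.Adj u v
  va : H.Adj v a
  ab : H.Adj a b
  bu : H.Adj b u
  ua : u ≠ a
  vb : v ≠ b
  len : l.length = 4
  mem : ∀ x, x ∈ l ↔ x = u ∨ x = v ∨ x = a ∨ x = b
  edge : ∀ e, cv l e ≠ 0 ↔ e = s(u, v) ∨ e = s(v, a) ∨ e = s(a, b) ∨ e = s(b, u)

theorem Quad.rot {H : SimpleGraph V} {l : List V} {u v a b : V} (h : Quad H l u v a b) : Quad H l v a b u :=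
  ⟨h.va, h.ab, h.bu, h.uv, h.vb, h.ua.symm, h.len, fun x => by rw [h.mem]; tauto,
    fun e => by rw [h.edge]; tauto⟩

theorem Quad.rev {H : SimpleGraph V} {l : List V} {u v a b : V} (h : Quad H l u v a b) : Quad H l v u b a :=
  ⟨h.uv.symm, h.bu.symm, h.ab.symm, h.va.symm, h.vb, h.ua, h.len, fun x => by rw [h.mem]; tauto,
    fun e => by rw [h.edge, Sym2.eq_swap (a := v) (b := u), Sym2.eq_swap (a := u) (b := b),
      Sym2.eq_swap (a := b) (b := a), Sym2.eq_swap (a := a) (b := v)]; tauto⟩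

theorem cv_ne_of_tri {u v w : V} (h1 : u ≠ v) (h2 : v ≠ w) (h3 : w ≠ u) (e : Sym2 V) :
    cv [u, v, w] e ≠ 0 ↔ e = s(u, v) ∨ e = s(v, w) ∨ e = s(w, u) := by
  have : cv [u, v, w] = sv s(u, v) + (sv s(v, w) + sv s(w, u)) := by
    change pv [u, v, w, u] = _
    simp [pv_cons]
  rw [this, Pi.add_apply, Pi.add_apply]
  have e1 : s(u, v) ≠ s(v, w) := by rw [Ne, Sym2.eq_iff]; grind
  have e2 : s(v, w) ≠ s(w, u) := by rw [Ne, Sym2.eq_iff]; grind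
  have e3 : s(u, v) ≠ s(w, u) := by rw [Ne, Sym2.eq_iff]; grind
  unfold sv
  by_cases a1 : e = s(u, v)
  · subst a1; simp [e1, e3]
  · by_cases a2 : e = s(v, w)
    · subst a2; simp [e1.symm, e2]
    · by_cases a3 : e = s(w, u)
      · subst a3; simp [e3.symm, e2.symm]
      · simp [a1, a2, a3]

theorem cv_ne_of_quad {u v a b : V} (h1 : u ≠ v) (h2 : v ≠ a) (h3 : a ≠ b) (h4 : b ≠ u) (h5 : u ≠ a)
    (h6 : v ≠ b) (e : Sym2 V) :
    cv [u, v, a, b] e ≠ 0 ↔ e = s(u, v) ∨ e = s(v, a) ∨ e = s(a, b) ∨ e = s(b, u) := by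
  have : cv [u, v, a, b] = sv s(u, v) + (sv s(v, a) + (sv s(a, b) + sv s(b, u))) := by
    change pv [u, v, a, b, u] = _
    simp [pv_cons]
  rw [this, Pi.add_apply, Pi.add_apply, Pi.add_apply]
  have e1 : s(u, v) ≠ s(v, a) := by rw [Ne, Sym2.eq_iff]; grind
  have e2 : s(u, v) ≠ s(a, b) := by rw [Ne, Sym2.eq_iff]; grind
  have e3 : s(u, v) ≠ s(b, u) := by rw [Ne, Sym2.eq_iff]; grind
  have e4 : s(v, a) ≠ s(a, b) := by rw [Ne, Sym2.eq_iff]; grind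
  have e5 : s(v, a) ≠ s(b, u) := by rw [Ne, Sym2.eq_iff]; grind
  have e6 : s(a, b) ≠ s(b, u) := by rw [Ne, Sym2.eq_iff]; grind
  unfold sv
  by_cases a1 : e = s(u, v)
  · subst a1; simp [e1, e2, e3]
  · by_cases a2 : e = s(v, a)
    · subst a2; simp [e1.symm, e4, e5]
    · by_cases a3 : e = s(a, b)
      · subst a3; simp [e2.symm, e4.symm, e6]
      · by_cases a4 : e = s(b, u)
        · subst a4; simp [e3.symm, e5.symm, e6.symm]
        · simp [a1, a2, a3, a4]

theorem IsCyc.tri {H : SimpleGraph V} {l : List V} (h : IsCyc H l) (hl : l.length = 3) {u v : V}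
    (he : cv l s(u, v) ≠ 0) : ∃ w, Tri H l u v w := by
  obtain ⟨t, ht⟩ := h.edge_start he
  have hlen := ht.len
  rw [hl] at hlen
  match t, ht, hlen with
  | [w], ht, _ =>
    have h1 := ht.cyc.2.1
    simp at h1
    refine ⟨w, h1.1, h1.2.1, h1.2.2, hl, fun x => by rw [← ht.mem]; simp, fun e => ?_⟩
    rw [← ht.vec, cv_ne_of_tri h1.1.ne h1.2.1.ne h1.2.2.ne]

theorem IsCyc.quad {H : SimpleGraph V} {l : List V} (h : IsCyc H l) (hl : l.length = 4) {u v : V}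
    (he : cv l s(u, v) ≠ 0) : ∃ a b, Quad H l u v a b := by
  obtain ⟨t, ht⟩ := h.edge_start he
  have hlen := ht.len
  rw [hl] at hlen
  match t, ht, hlen with
  | [a, b], ht, _ =>
    have h1 := ht.cyc.2.1
    have h2 := ht.cyc.nd
    simp at h1 h2
    refine ⟨a, b, h1.1, h1.2.1, h1.2.2.1, h1.2.2.2, by tauto, by tauto, hl, fun x => by rw [← ht.mem]; simp,
      fun e => ?_⟩
    rw [← ht.vec, cv_ne_of_quad h1.1.ne h1.2.1.ne h1.2.2.1.ne h1.2.2.2.ne (by tauto) (by tauto)]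

structure Ctx {ι : Type} [Fintype ι] (H : SimpleGraph V) (W : Set V) (φ : ι → List V)
    (hv : Set (Sym2 V)) : Prop where
  fs : FS H φ
  supp : ∀ x y, H.Adj x y → x ∈ W
  c2 : ∀ x, Conn H (W \ {x})
  c3 : ∀ x y, H.Adj x y → Conn H (W \ {x, y})
  card : 6 ≤ W.ncard
  th : ¬ HasTheta6 H
  hvE : hv ⊆ H.edgeSet
  heavy : ∀ i, ∀ e ∈ hv, cv (φ i) e ≠ 0 → 6 ≤ (φ i).length
  deg : ∀ v ∈ W, (∃ e ∈ hv, v ∈ e) ∨ ∀ x y, ∃ z, H.Adj v z ∧ z ≠ x ∧ z ≠ y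

section
variable [Finite V] {ι : Type} [Fintype ι] {H : SimpleGraph V} {φ : ι → List V} {W : Set V} {hv : Set (Sym2 V)}

theorem Ctx.deg_le (C : Ctx H W φ hv) {i : ι} {v x y : V} (hx : cv (φ i) s(v, x) ≠ 0)
    (hy : cv (φ i) s(v, y) ≠ 0) (hN : ∀ z, H.Adj v z → z = x ∨ z = y) : 6 ≤ (φ i).length := by
  have hvW := C.supp v x ((C.fs.cyc i).edge_adj hx)
  rcases C.deg v hvW with ⟨e, he, hve⟩ | hd
  · obtain ⟨z, rfl⟩ := Sym2.mem_iff_exists.1 hve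
    have := hN z (C.hvE he)
    rcases this with rfl | rfl
    · exact C.heavy i _ he hx
    · exact C.heavy i _ he hy
  · obtain ⟨z, hz, h1, h2⟩ := hd x y
    rcases hN z hz with rfl | rfl
    · exact absurd rfl h1
    · exact absurd rfl h2

theorem Ctx.share (C : Ctx H W φ hv) {i j : ι} (hij : i ≠ j) {v x y : V} (hxy : x ≠ y)
    (h1 : cv (φ i) s(v, x) ≠ 0) (h2 : cv (φ i) s(v, y) ≠ 0) (h3 : cv (φ j) s(v, x) ≠ 0)
    (h4 : cv (φ j) s(v, y) ≠ 0) : 6 ≤ (φ i).length := by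
  have key : ∀ k, k = i ∨ k = j → ∀ z, cv (φ k) s(v, z) ≠ 0 → z = x ∨ z = y := by
    intro k hk z hz
    have hx : cv (φ k) s(v, x) ≠ 0 := by rcases hk with rfl | rfl <;> assumption
    have hy : cv (φ k) s(v, y) ≠ 0 := by rcases hk with rfl | rfl <;> assumption
    obtain ⟨p, q, hpq, h⟩ := (C.fs.cyc k).deg_two ((C.fs.cyc k).edge_mem hx (x := v) (by simp))
    have a1 := (h x).1 hx
    have a2 := (h y).1 hy
    have a3 := (h z).1 hz
    clear * - a1 a2 a3 hxy
    grind
  have hN : ∀ z, H.Adj v z → z = x ∨ z = y := by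
    have := C.fs.link C.supp C.c2 (v := v) (x0 := x) (A := {z | z = x ∨ z = y}) (Or.inl rfl)
      ((C.fs.cyc i).edge_adj h1) (by
        intro k z hz hk y' hy'
        refine key k ?_ y' hy'
        rcases hz with rfl | rfl
        · exact C.fs.third h1 h3 hij hk
        · exact C.fs.third h2 h4 hij hk)
    exact this
  exact C.deg_le h1 h2 hN

/-- a third neighbour of a vertex on a small face -/
theorem Ctx.third (C : Ctx H W φ hv) {i : ι} {v x y : V} (hx : cv (φ i) s(v, x) ≠ 0)
    (hy : cv (φ i) s(v, y) ≠ 0) (hl : (φ i).length < 6) : ∃ z, H.Adj v z ∧ z ≠ x ∧ z ≠ y := by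
  by_contra hcon
  push Not at hcon
  have := C.deg_le hx hy (fun z hz => by by_contra h; push Not at h; exact h.2 (hcon z hz h.1))
  omega

theorem Ctx.apex (C : Ctx H W φ hv) {i j : ι} (hij : i ≠ j) {u v w : V} (t : Tri H (φ i) u v w)
    (hj : cv (φ j) s(u, v) ≠ 0) : w ∉ φ j := by
  intro hw
  have hu := (C.fs.cyc j).edge_mem hj (x := u) (by simp)
  have h1 := C.fs.induced C.supp C.c2 C.c3 hu hw t.wu.symm
  have := C.share hij t.vw.ne ((t.edge _).2 (Or.inl rfl))
    ((t.edge _).2 (Or.inr (Or.inr Sym2.eq_swap))) hj h1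
  rw [t.len] at this
  omega

theorem Ctx.tri_inj (C : Ctx H W φ hv) {i j : ι} {u v w : V} (t : Tri H (φ i) u v w)
    (t' : Tri H (φ j) u v w) : i = j := by
  by_contra hij
  exact C.apex hij t ((t'.edge _).2 (Or.inl rfl)) ((t'.mem _).2 (by simp))

theorem Ctx.g1 (C : Ctx H W φ hv) {i j : ι} {u v w : V} (t : Tri H (φ i) u v w)
    (hj : cv (φ j) s(u, v) ≠ 0) : (φ j).length ≠ 5 := by
  intro hl
  have hij : i ≠ j := by
    rintro rfl
    rw [t.len] at hl; omega
  have hw := C.apex hij t hj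
  obtain ⟨s, hs⟩ := (C.fs.cyc j).edge_start hj
  have hlen := hs.len
  rw [hl] at hlen
  match s, hs, hlen with
  | [a, b, c], hs, _ =>
    have h1 := hs.cyc.2.1
    have h2 := hs.cyc.nd
    rw [← hs.mem] at hw
    simp at h1
    refine theta_short C.th (a := u) (b := w) (c := v) (d := a) (e := b) (f := c) ?_ t.wu.symm t.vw.symm
      h1.2.1 h1.2.2.1 h1.2.2.2.1 h1.2.2.2.2 t.uv
    simp at h2 hw ⊢
    clear * - h2 hw
    grind

theorem Ctx.g2 (C : Ctx H W φ hv) {i j : ι} (hij : i ≠ j) {u v a b : V} (q : Quad H (φ i) u v a b)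
    (hj : cv (φ j) s(u, v) ≠ 0) : (φ j).length ≠ 4 := by
  intro hl
  obtain ⟨c, d, q'⟩ := (C.fs.cyc j).quad hl hj
  have ha : a ∉ φ j := by
    intro ha
    have h1 := C.fs.induced C.supp C.c2 C.c3 ((q'.mem v).2 (by simp)) ha q.va
    have := C.share hij q.ua ((q.edge s(v, u)).2 (Or.inl Sym2.eq_swap)) ((q.edge s(v, a)).2 (by simp))
      ((q'.edge s(v, u)).2 (Or.inl Sym2.eq_swap)) h1
    rw [q.len] at this; omega
  have hb : b ∉ φ j := by
    intro hb
    have h1 := C.fs.induced C.supp C.c2 C.c3 ((q'.mem u).2 (by simp)) hb q.bu.symm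
    have := C.share hij q.vb ((q.edge s(u, v)).2 (Or.inl rfl))
      ((q.edge s(u, b)).2 (by right; right; right; exact Sym2.eq_swap)) hj h1
    rw [q.len] at this; omega
  rw [q'.mem] at ha hb
  refine theta_long C.th (a := u) (b := b) (c := a) (d := v) (e := c) (f := d) ?_ q.bu.symm q.ab.symm
    q.va.symm q'.va q'.ab q'.bu q.uv
  have := q.uv.ne
  have := q.ab.ne
  have := q'.ab.ne
  have := q'.ua
  have := q'.vb
  have := q'.va.ne
  have := q'.bu.ne
  clear q q'
  simp
  grind

theorem Ctx.quad_apex (C : Ctx H W φ hv) {i j : ι} {u v a b w : V} (q : Quad H (φ i) u v a b)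
    (t : Tri H (φ j) u v w) : w ≠ u ∧ w ≠ v ∧ w ≠ a ∧ w ≠ b := by
  have hij : j ≠ i := by
    rintro rfl
    have := q.len; rw [t.len] at this; omega
  have := C.apex hij t ((q.edge _).2 (Or.inl rfl))
  rw [q.mem] at this
  tauto

theorem Ctx.g3 (C : Ctx H W φ hv) {i j k : ι} {u v a b w z : V} (q : Quad H (φ i) u v a b)
    (t : Tri H (φ j) u v w) (t' : Tri H (φ k) u w z) (hjk : j ≠ k) :
    z = b ∧ ∀ y, H.Adj u y → y = v ∨ y = w ∨ y = b := by
  obtain ⟨w1, w2, w3, w4⟩ := C.quad_apex q t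
  have hzv : z ≠ v := by
    rintro rfl
    exact hjk (C.tri_inj t t'.swap.rot)
  have hza : z ≠ a := by
    rintro rfl
    have h1 := C.fs.induced C.supp C.c2 C.c3 ((q.mem u).2 (by simp)) ((q.mem z).2 (by simp)) t'.wu.symm
    have a1 := q.uv.ne
    have a2 := q.va.ne
    have a3 := q.ab.ne
    have a4 := q.bu.ne
    have a5 := q.ua
    have a6 := q.vb
    rw [q.edge] at h1
    simp only [Sym2.eq_iff] at h1
    clear * - h1 a1 a2 a3 a4 a5 a6
    grind
  have hzb : z = b := by
    by_contra hzb
    refine theta_short C.th (a := u) (b := z) (c := w) (d := v) (e := a) (f := b) ?_ t'.wu.symm t'.vw.symm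
      t.vw.symm q.va q.ab q.bu t.wu.symm
    have a1 := q.uv.ne
    have a2 := q.va.ne
    have a3 := q.ab.ne
    have a4 := q.bu.ne
    have a5 := q.ua
    have a6 := q.vb
    have a7 := t'.vw.ne
    have a8 := t'.wu.ne
    clear q t t'
    simp
    grind
  refine ⟨hzb, ?_⟩
  subst hzb
  have hij : i ≠ j := by
    rintro rfl
    have := q.len; rw [t.len] at this; omega
  have hik : i ≠ k := by
    rintro rfl
    have := q.len; rw [t'.len] at this; omega
  have e1 : cv (φ i) s(u, v) ≠ 0 := (q.edge _).2 (by simp)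
  have e2 : cv (φ i) s(u, z) ≠ 0 := (q.edge _).2 (by right; right; right; exact Sym2.eq_swap)
  have e3 : cv (φ j) s(u, v) ≠ 0 := (t.edge _).2 (by simp)
  have e4 : cv (φ j) s(u, w) ≠ 0 := (t.edge _).2 (by right; right; exact Sym2.eq_swap)
  have e5 : cv (φ k) s(u, w) ≠ 0 := (t'.edge _).2 (by simp)
  have e6 : cv (φ k) s(u, z) ≠ 0 := (t'.edge _).2 (by right; right; exact Sym2.eq_swap)
  have key : ∀ m, m = i ∨ m = j ∨ m = k → ∀ y, cv (φ m) s(u, y) ≠ 0 → y = v ∨ y = w ∨ y = z := by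
    intro m hm y hy
    have hy' := (C.fs.cyc m).edge_mem hy (x := y) (by simp)
    have hne : y ≠ u := by
      rintro rfl
      exact ((C.fs.cyc m).edge_adj hy).ne rfl
    rcases hm with rfl | rfl | rfl
    · rw [q.edge] at hy
      have := q.ua
      have := q.uv.ne
      have := q.bu.ne
      clear * - hy hne this q
      simp only [Sym2.eq_iff] at hy
      have := q.ua
      have := q.uv.ne
      grind
    · rw [t.mem] at hy'; tauto
    · rw [t'.mem] at hy'; tauto
  exact C.fs.link C.supp C.c2 (v := u) (x0 := v) (A := {y | y = v ∨ y = w ∨ y = z}) (Or.inl rfl) q.uv (by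
    intro m x hx hm y hy
    refine key m ?_ y hy
    rcases hx with rfl | rfl | rfl
    · have := C.fs.third e1 e3 hij hm; tauto
    · have := C.fs.third e4 e5 hjk hm; tauto
    · have := C.fs.third e2 e6 hik hm; tauto)

theorem Ctx.same1 (C : Ctx H W φ hv) {i j k : ι} {u v a b w w' : V} (q : Quad H (φ i) u v a b)
    (t : Tri H (φ j) u v w) (t' : Tri H (φ k) v a w') : w' = w := by
  by_contra hne
  obtain ⟨w1, w2, w3, w4⟩ := C.quad_apex q t
  obtain ⟨x1, x2, x3, x4⟩ := C.quad_apex q.rot t'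
  refine theta_short C.th (a := u) (b := w) (c := v) (d := w') (e := a) (f := b) ?_ t.wu.symm t.vw.symm
    t'.wu.symm t'.vw.symm q.ab q.bu q.uv
  have a1 := q.uv.ne
  have a2 := q.va.ne
  have a3 := q.ab.ne
  have a4 := q.bu.ne
  have a5 := q.ua
  have a6 := q.vb
  clear q t t'
  simp
  grind

theorem Ctx.same2 (C : Ctx H W φ hv) {i j k : ι} {u v a b w w' : V} (q : Quad H (φ i) u v a b)
    (t : Tri H (φ j) u v w) (t' : Tri H (φ k) a b w') : w' = w := by
  by_contra hne
  obtain ⟨w1, w2, w3, w4⟩ := C.quad_apex q t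
  obtain ⟨x1, x2, x3, x4⟩ := C.quad_apex q.rot.rot t'
  refine theta_short C.th (a := u) (b := w) (c := v) (d := a) (e := w') (f := b) ?_ t.wu.symm t.vw.symm
    q.va t'.wu.symm t'.vw.symm q.bu q.uv
  have a1 := q.uv.ne
  have a2 := q.va.ne
  have a3 := q.ab.ne
  have a4 := q.bu.ne
  have a5 := q.ua
  have a6 := q.vb
  clear q t t'
  simp
  grind

end

end Th

namespace Th

universe u
variable {V : Type u}

section
open Classical
variable [Fintype V] {ι : Type} [Fintype ι]

/-- number of edges of a path -/
theorem card_pv {a : V} {t : List V} (h : (a :: t).Nodup) :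
    (Finset.univ.filter (fun e => pv (a :: t) e ≠ 0)).card = t.length := by
  induction t generalizing a with
  | nil => simp
  | cons b t ih =>
    have h1 := ih (List.nodup_cons.1 h).2
    have h0 : pv (b :: t) s(a, b) = 0 := by
      by_contra h0
      exact (List.nodup_cons.1 h).1 (pv_supp_mem h0 (x := a) (by simp))
    have h2 : Finset.univ.filter (fun e => pv (a :: b :: t) e ≠ 0)
        = insert s(a, b) (Finset.univ.filter (fun e => pv (b :: t) e ≠ 0)) := by
      ext e
      simp only [Finset.mem_filter, Finset.mem_univ, true_and, Finset.mem_insert]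
      rw [pv_cons, Pi.add_apply]
      by_cases he : e = s(a, b)
      · subst he; rw [sv_self, h0]; simp
      · rw [sv_ne he, zero_add]; simp [he]
    rw [h2, Finset.card_insert_of_notMem (by simp [h0]), h1]
    simp

theorem card_cv {H : SimpleGraph V} {l : List V} (h : IsCyc H l) :
    (Finset.univ.filter (fun e => cv l e ≠ 0)).card = l.length := by
  match l, h with
  | [], h => exact h.elim
  | a :: t, h =>
    rcases List.eq_nil_or_concat t with rfl | ⟨m, b, rfl⟩
    · have := h.len; simp at this
    rw [List.concat_eq_append] at h ⊢
    match m, h with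
    | [], h => have := h.len; simp at this
    | c :: m, h =>
      have h1 := card_pv h.nd
      have e1 : cv (a :: (c :: m ++ [b])) = pv (a :: (c :: m ++ [b])) + sv s(b, a) := by
        change pv ((a :: (c :: m ++ [b])) ++ [a]) = _
        have : (a :: (c :: m ++ [b])) ++ [a] = (a :: c :: m) ++ b :: [a] := by simp
        rw [this, pv_append]
        have h3 : pv [b, a] = sv s(b, a) := by rw [pv_cons, pv_one, add_zero]
        rw [h3]
        rfl
      have hl : cv (a :: (c :: m ++ [b])) s(b, a) = 1 := by
        rw [Sym2.eq_swap]; exact cv_last (t := c :: m) h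
      have h0 : pv (a :: (c :: m ++ [b])) s(b, a) = 0 := by
        rw [e1, Pi.add_apply, sv_self] at hl
        simpa using hl
      have h2 : Finset.univ.filter (fun e => cv (a :: (c :: m ++ [b])) e ≠ 0)
          = insert s(b, a) (Finset.univ.filter (fun e => pv (a :: (c :: m ++ [b])) e ≠ 0)) := by
        ext e
        simp only [Finset.mem_filter, Finset.mem_univ, true_and, Finset.mem_insert]
        rw [e1, Pi.add_apply]
        by_cases he : e = s(b, a)
        · subst he; rw [sv_self, h0]; simp
        · rw [sv_ne he, add_zero]; simp [he]
      rw [h2, Finset.card_insert_of_notMem (by rw [Finset.mem_filter]; exact fun hh => hh.2 h0), h1]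
      simp

/-- two edges on a common triangular face -/
def RT (φ : ι → List V) (e f : Sym2 V) : Prop := ∃ i, (φ i).length = 3 ∧ cv (φ i) e ≠ 0 ∧ cv (φ i) f ≠ 0

noncomputable def blk (φ : ι → List V) (e : Sym2 V) : Finset (Sym2 V) :=
  Finset.univ.filter (fun f => Relation.EqvGen (RT φ) e f)

noncomputable def vs (B : Finset (Sym2 V)) : Finset V := Finset.univ.filter (fun v => ∃ e ∈ B, v ∈ e)

theorem mem_vs {B : Finset (Sym2 V)} {v : V} : v ∈ vs B ↔ ∃ e ∈ B, v ∈ e := by simp [vs]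

noncomputable def blks (H : SimpleGraph V) (φ : ι → List V) : Finset (Finset (Sym2 V)) :=
  (Finset.univ.filter (fun e => e ∈ H.edgeSet)).image (blk φ)

noncomputable def mult (H : SimpleGraph V) (φ : ι → List V) (v : V) : ℕ :=
  ((blks H φ).filter (fun B => v ∈ vs B)).card

noncomputable def mu (H : SimpleGraph V) (φ : ι → List V) (v : V) : ℚ := 1 / (mult H φ v : ℚ)

/-- `e` lies on a triangular face other than `i` -/
def tr (φ : ι → List V) (i : ι) (e : Sym2 V) : Prop := ∃ j, j ≠ i ∧ (φ j).length = 3 ∧ cv (φ j) e ≠ 0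

noncomputable def tau (φ : ι → List V) (i : ι) : ℕ :=
  (Finset.univ.filter (fun e => cv (φ i) e ≠ 0 ∧ tr φ i e)).card

noncomputable def gf (φ : ι → List V) (i : ι) (e : Sym2 V) : ℚ :=
  if cv (φ i) e = 0 then 0 else
    if (φ i).length = 4 ∧ tau φ i = 2 then (if tr φ i e then 5 else 7) else 24 / ((φ i).length : ℚ)

noncomputable def gift (φ : ι → List V) (e : Sym2 V) : ℚ := ∑ i, gf φ i e

theorem mem_blk_self (φ : ι → List V) (e : Sym2 V) : e ∈ blk φ e := by
  simp [blk]; exact Relation.EqvGen.refl _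

theorem blk_step {φ : ι → List V} {e f g : Sym2 V} (hf : f ∈ blk φ e) (h : RT φ f g) : g ∈ blk φ e := by
  simp only [blk, Finset.mem_filter, Finset.mem_univ, true_and] at hf ⊢
  exact Relation.EqvGen.trans _ _ _ hf (Relation.EqvGen.rel _ _ h)

theorem blk_sub {φ : ι → List V} {e : Sym2 V} (S : Set (Sym2 V)) (he : e ∈ S)
    (hS : ∀ f ∈ S, ∀ g, RT φ f g → g ∈ S) : ∀ f ∈ blk φ e, f ∈ S := by
  intro f hf
  simp only [blk, Finset.mem_filter, Finset.mem_univ, true_and] at hf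
  have key : ∀ a b, Relation.EqvGen (RT φ) a b → (a ∈ S ↔ b ∈ S) := by
    intro a b hab
    induction hab with
    | rel x y h =>
      refine ⟨fun hx => hS x hx y h, fun hy => hS y hy x ?_⟩
      obtain ⟨i, h1, h2, h3⟩ := h
      exact ⟨i, h1, h3, h2⟩
    | refl => rfl
    | symm _ _ _ ih => exact ih.symm
    | trans _ _ _ _ _ ih1 ih2 => exact ih1.trans ih2
  exact (key e f hf).1 he

theorem blk_eq {φ : ι → List V} {e f : Sym2 V} (h : f ∈ blk φ e) : blk φ f = blk φ e := by
  have h1 : Relation.EqvGen (RT φ) e f := by simpa [blk] using h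
  ext g
  simp only [blk, Finset.mem_filter, Finset.mem_univ, true_and]
  exact ⟨fun h2 => Relation.EqvGen.trans _ _ _ h1 h2,
    fun h2 => Relation.EqvGen.trans _ _ _ (Relation.EqvGen.symm _ _ h1) h2⟩

theorem blk_edge {H : SimpleGraph V} {φ : ι → List V} (h : FS H φ) {e : Sym2 V} (he : e ∈ H.edgeSet) :
    ∀ f ∈ blk φ e, f ∈ H.edgeSet := by
  refine blk_sub H.edgeSet he ?_
  rintro f - g ⟨i, -, -, hg⟩
  exact (h.cyc i).edge_adj hg

theorem face_sum {H : SimpleGraph V} {φ : ι → List V} (h : FS H φ) (i : ι) : ∑ e, gf φ i e = 24 := by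
  have hc := card_cv (h.cyc i)
  have hsplit : ∑ e, gf φ i e = ∑ e ∈ Finset.univ.filter (fun e => cv (φ i) e ≠ 0), gf φ i e := by
    rw [Finset.sum_filter]
    apply Finset.sum_congr rfl
    intro e _
    split_ifs with h0
    · rfl
    · unfold gf; rw [if_pos (not_not.1 h0)]
  rw [hsplit]
  by_cases h4 : (φ i).length = 4 ∧ tau φ i = 2
  · have : ∀ e ∈ Finset.univ.filter (fun e => cv (φ i) e ≠ 0), gf φ i e = if tr φ i e then 5 else 7 := by
      intro e he
      unfold gf
      rw [if_neg (by simpa using he), if_pos h4]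
    rw [Finset.sum_congr rfl this, Finset.sum_ite, Finset.sum_const, Finset.sum_const]
    have h5 : ((Finset.univ.filter (fun e => cv (φ i) e ≠ 0)).filter (fun e => tr φ i e)).card = 2 := by
      rw [Finset.filter_filter]; exact h4.2
    have h6 := Finset.card_filter_add_card_filter_not (s := Finset.univ.filter (fun e => cv (φ i) e ≠ 0))
      (fun e => tr φ i e)
    rw [h5, hc, h4.1] at h6
    have h7 : ((Finset.univ.filter (fun e => cv (φ i) e ≠ 0)).filter (fun e => ¬ tr φ i e)).card = 2 := by
      omega
    rw [h5, h7]; norm_num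
  · have : ∀ e ∈ Finset.univ.filter (fun e => cv (φ i) e ≠ 0), gf φ i e = 24 / ((φ i).length : ℚ) := by
      intro e he
      unfold gf
      rw [if_neg (by simpa using he), if_neg h4]
    rw [Finset.sum_congr rfl this, Finset.sum_const, hc, nsmul_eq_mul]
    have h3 := (h.cyc i).len
    have : ((φ i).length : ℚ) ≠ 0 := by
      have : (φ i).length ≠ 0 := by omega
      exact_mod_cast this
    field_simp

theorem gf_zero {φ : ι → List V} {i : ι} {e : Sym2 V} (h : cv (φ i) e = 0) : gf φ i e = 0 := by
  unfold gf; rw [if_pos h]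

theorem discharge {H : SimpleGraph V} {W : Set V} {φ : ι → List V} {hv : Set (Sym2 V)}
    (C : Ctx H W φ hv)
    (hB : ∀ e0 ∈ H.edgeSet, 6 * ∑ v ∈ vs (blk φ e0), mu H φ v ≤
      ∑ e ∈ blk φ e0, (17 - gift φ e - if e ∈ hv then 2 else 0)) :
    7 * H.edgeSet.ncard + 2 * hv.ncard + 48 ≤ 18 * W.ncard := by
  set E : Finset (Sym2 V) := Finset.univ.filter (fun e => e ∈ H.edgeSet) with hE
  have hEc : H.edgeSet.ncard = E.card := by
    rw [← Set.ncard_coe_finset]; congr 1; ext e; simp [hE]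
  have hHc : hv.ncard = (E.filter (fun e => e ∈ hv)).card := by
    rw [← Set.ncard_coe_finset]; congr 1; ext e
    simp only [hE, Finset.coe_filter, Set.mem_ofPred_eq, Finset.mem_filter, Finset.mem_univ, true_and]
    exact ⟨fun h => ⟨C.hvE h, h⟩, fun h => h.2⟩
  -- every vertex of W has a neighbour
  have hnb : ∀ v ∈ W, ∃ w, H.Adj v w := by
    intro v hvW
    have h1 : ∃ x y, x ∈ W ∧ y ∈ W ∧ x ≠ v ∧ y ≠ v ∧ x ≠ y := by
      have h2 : 2 ≤ (W \ {v}).ncard := by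
        have := Set.ncard_sdiff_singleton_of_mem hvW
        have := C.card
        omega
      obtain ⟨x, y, hx, hy, hxy⟩ := (Set.one_lt_ncard_iff (Set.toFinite _)).1 h2
      exact ⟨x, y, hx.1, hy.1, hx.2, hy.2, hxy⟩
    obtain ⟨x, y, hx, hy, hxv, hyv, hxy⟩ := h1
    obtain ⟨p, hp, hp', q, hq, hq', hpq⟩ := (C.c2 y).cut' {v} (a := v) (b := x) ⟨hvW, fun h => hyv h.symm⟩
      rfl ⟨hx, hxy⟩ hxv
    rw [Set.mem_singleton_iff] at hp'
    subst hp'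
    exact ⟨q, hpq⟩
  have hWne : W.Nonempty := by
    rw [Set.nonempty_iff_ne_empty]
    rintro rfl
    have := C.card
    simp at this
  obtain ⟨v0, hv0⟩ := hWne
  obtain ⟨w0, hvw0⟩ := hnb v0 hv0
  have hconn : Conn H W := by
    apply conn_of_cut
    intro S a ha haS b hb hbS
    have h3 : ∃ z, z ∈ W ∧ z ≠ a ∧ z ≠ b := by
      by_contra hcon
      push Not at hcon
      have h4 : W ⊆ {a, b} := by
        intro z hz
        by_cases hza : z = a
        · simp [hza]
        · simp [hcon z hz hza]
      have h5 := Set.ncard_le_ncard h4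
      have h6 := Set.ncard_insert_le a {b}
      have := C.card
      simp at h6
      omega
    obtain ⟨z, hz, hza, hzb⟩ := h3
    obtain ⟨x, hx, hxS, y, hy, hyS, hxy⟩ := (C.c2 z).cut' S (a := a) (b := b) ⟨ha, hza.symm⟩ haS ⟨hb, hzb.symm⟩ hbS
    exact ⟨x, hx.1, hxS, y, hy.1, hyS, hxy⟩
  have heul := C.fs.euler hconn ⟨v0, hv0⟩ C.supp ⟨s(v0, w0), hvw0⟩
  -- grouping
  have hfib : ∀ B ∈ blks H φ, E.filter (fun e => blk φ e = B) = B := by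
    intro B hB
    obtain ⟨e0, he0, rfl⟩ := Finset.mem_image.1 hB
    have he0 : e0 ∈ H.edgeSet := by simpa using he0
    ext e
    simp only [Finset.mem_filter]
    constructor
    · rintro ⟨_, h⟩
      rw [← h]; exact mem_blk_self φ e
    · intro h
      exact ⟨by simpa [hE] using blk_edge C.fs he0 e h, blk_eq h⟩
  have hgroup : ∀ g : Sym2 V → ℚ, ∑ e ∈ E, g e = ∑ B ∈ blks H φ, ∑ e ∈ B, g e := by
    intro g
    rw [← Finset.sum_fiberwise_of_maps_to (s := E) (t := blks H φ) (g := blk φ)]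
    · apply Finset.sum_congr rfl
      intro B hB
      rw [hfib B hB]
    · intro e he
      exact Finset.mem_image_of_mem _ he
  have hgift : ∑ e ∈ E, gift φ e = 24 * (Fintype.card ι : ℚ) := by
    unfold gift
    rw [Finset.sum_comm]
    have : ∀ i ∈ (Finset.univ : Finset ι), ∑ e ∈ E, gf φ i e = 24 := by
      intro i _
      rw [← face_sum C.fs i]
      apply Finset.sum_subset (Finset.subset_univ _)
      intro e _ he
      apply gf_zero
      by_contra h0
      exact he (by simpa [hE] using (C.fs.cyc i).edge_adj h0)
    rw [Finset.sum_congr rfl this, Finset.sum_const, nsmul_eq_mul, mul_comm]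
    rfl
  have hvert : ∑ B ∈ blks H φ, ∑ v ∈ vs B, mu H φ v = (W.ncard : ℚ) := by
    have h1 : ∀ B ∈ blks H φ, ∑ v ∈ vs B, mu H φ v = ∑ v, if v ∈ vs B then mu H φ v else 0 := by
      intro B _
      rw [← Finset.sum_filter]
      congr 1
      ext v; simp
    rw [Finset.sum_congr rfl h1, Finset.sum_comm]
    have h2 : ∀ v ∈ (Finset.univ : Finset V), (∑ B ∈ blks H φ, if v ∈ vs B then mu H φ v else 0)
        = if v ∈ W then 1 else 0 := by
      intro v _
      rw [← Finset.sum_filter, Finset.sum_const, nsmul_eq_mul]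
      change (mult H φ v : ℚ) * mu H φ v = _
      unfold mu
      by_cases hvW : v ∈ W
      · rw [if_pos hvW]
        obtain ⟨w, hw⟩ := hnb v hvW
        have : mult H φ v ≠ 0 := by
          unfold mult
          rw [Finset.card_ne_zero]
          refine ⟨blk φ s(v, w), Finset.mem_filter.2 ⟨Finset.mem_image_of_mem _ (by simpa using hw), ?_⟩⟩
          exact mem_vs.2 ⟨_, mem_blk_self φ _, by simp⟩
        have : (mult H φ v : ℚ) ≠ 0 := by exact_mod_cast this
        field_simp
      · rw [if_neg hvW]
        have : mult H φ v = 0 := by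
          unfold mult
          rw [Finset.card_eq_zero, Finset.filter_eq_empty_iff]
          intro B hB hvB
          obtain ⟨e0, he0, rfl⟩ := Finset.mem_image.1 hB
          have he0 : e0 ∈ H.edgeSet := by simpa using he0
          obtain ⟨e, he, hve⟩ := mem_vs.1 hvB
          have he' := blk_edge C.fs he0 e he
          obtain ⟨z, rfl⟩ := Sym2.mem_iff_exists.1 hve
          exact hvW (C.supp v z he')
        rw [this]; simp
    rw [Finset.sum_congr rfl h2, ← Finset.sum_filter, Finset.sum_const, nsmul_eq_mul, mul_one]
    congr 1
    rw [← Set.ncard_coe_finset]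
    congr 1
    ext v; simp
  have htot : 6 * (W.ncard : ℚ) ≤ ∑ e ∈ E, (17 - gift φ e - if e ∈ hv then 2 else 0) := by
    rw [hgroup, ← hvert, Finset.mul_sum]
    apply Finset.sum_le_sum
    intro B hB'
    obtain ⟨e0, he0, rfl⟩ := Finset.mem_image.1 hB'
    exact hB e0 (by simpa using he0)
  rw [Finset.sum_sub_distrib, Finset.sum_sub_distrib, hgift, ← Finset.sum_filter, Finset.sum_const,
    Finset.sum_const, ← hHc, ← hEc] at htot
  simp only [nsmul_eq_mul] at htot
  have heul' : (H.edgeSet.ncard : ℚ) + 2 ≤ Fintype.card ι + W.ncard := by exact_mod_cast heul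
  have : (7 * H.edgeSet.ncard + 2 * hv.ncard + 48 : ℚ) ≤ 18 * W.ncard := by linarith
  exact_mod_cast this

end

end Th

namespace Th

universe u
variable {V : Type u}

section
open Classical
variable [Fintype V] {ι : Type} [Fintype ι] {H : SimpleGraph V} {φ : ι → List V} {W : Set V} {hv : Set (Sym2 V)}

theorem mu_nonneg (H : SimpleGraph V) (φ : ι → List V) (v : V) : 0 ≤ mu H φ v := by
  unfold mu; positivity

theorem mu_le {v : V} {k : ℕ} (hk : 0 < k) (h : k ≤ mult H φ v) : mu H φ v ≤ 1 / k := by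
  unfold mu
  have : (k : ℚ) ≤ mult H φ v := by exact_mod_cast h
  have h2 : (0 : ℚ) < k := by exact_mod_cast hk
  exact one_div_le_one_div_of_le h2 this

theorem mu_le_one (H : SimpleGraph V) (φ : ι → List V) (v : V) : mu H φ v ≤ 1 := by
  by_cases h : mult H φ v = 0
  · unfold mu; rw [h]; simp
  · have := mu_le (H := H) (φ := φ) (v := v) (k := 1) (by omega) (by omega)
    simpa using this

theorem blk_mem_filter {v x : V} (h : H.Adj v x) :
    blk φ s(v, x) ∈ (blks H φ).filter (fun B => v ∈ vs B) :=
  Finset.mem_filter.2 ⟨Finset.mem_image_of_mem _ (by simpa using h),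
    mem_vs.2 ⟨_, mem_blk_self φ _, by simp⟩⟩

theorem mu_half {v x y : V} (hx : H.Adj v x) (hy : H.Adj v y) (h : blk φ s(v, x) ≠ blk φ s(v, y)) :
    mu H φ v ≤ 1 / 2 := by
  have : 2 ≤ mult H φ v := by
    unfold mult
    exact Finset.one_lt_card.2 ⟨_, blk_mem_filter hx, _, blk_mem_filter hy, h⟩
  simpa using mu_le (k := 2) (by omega) this

theorem mu_third {v x y z : V} (hx : H.Adj v x) (hy : H.Adj v y) (hz : H.Adj v z)
    (h1 : blk φ s(v, x) ≠ blk φ s(v, y)) (h2 : blk φ s(v, x) ≠ blk φ s(v, z))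
    (h3 : blk φ s(v, y) ≠ blk φ s(v, z)) : mu H φ v ≤ 1 / 3 := by
  have : 3 ≤ mult H φ v := by
    unfold mult
    exact Finset.two_lt_card.2 ⟨_, blk_mem_filter hx, _, blk_mem_filter hy, _, blk_mem_filter hz, h1, h2, h3⟩
  simpa using mu_le (k := 3) (by omega) this

theorem blk_ne {e f : Sym2 V} (h : f ∉ blk φ e) : blk φ e ≠ blk φ f := by
  intro h1; rw [h1] at h; exact h (mem_blk_self φ f)

theorem gift_eq (C : Ctx H W φ hv) {e : Sym2 V} {i j : ι} (hij : i ≠ j) (hi : cv (φ i) e ≠ 0)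
    (hj : cv (φ j) e ≠ 0) : gift φ e = gf φ i e + gf φ j e := by
  unfold gift
  rw [← Finset.sum_pair (f := fun i => gf φ i e) hij]
  symm
  apply Finset.sum_subset (Finset.subset_univ _)
  intro k _ hk
  apply gf_zero
  by_contra h
  exact hk (by simpa using C.fs.third hi hj hij h)

theorem gf_three {i : ι} {e : Sym2 V} (h : (φ i).length = 3) : gf φ i e ≤ 8 := by
  unfold gf
  split_ifs with h1 h2 h3
  · norm_num
  · omega
  · omega
  · rw [h]; norm_num

theorem gf_four {i : ι} {e : Sym2 V} (h : (φ i).length = 4) : gf φ i e ≤ 7 := by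
  unfold gf
  split_ifs with h1 h2 h3
  · norm_num
  · norm_num
  · norm_num
  · rw [h]; norm_num

theorem gf_four_tr {i : ι} {e : Sym2 V} (h : (φ i).length = 4) (ht : tr φ i e) : gf φ i e ≤ 6 := by
  unfold gf
  split_ifs with h1 h2
  · norm_num
  · norm_num
  · rw [h]; norm_num

theorem gf_four_ne {i : ι} {e : Sym2 V} (h : (φ i).length = 4) (ht : tau φ i ≠ 2) : gf φ i e ≤ 6 := by
  unfold gf
  split_ifs with h1 h2 h3
  · norm_num
  · norm_num
  · exact absurd h2.2 ht
  · rw [h]; norm_num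

theorem gf_four_two {i : ι} {e : Sym2 V} (h : (φ i).length = 4) (h' : tau φ i = 2) (ht : tr φ i e) :
    gf φ i e ≤ 5 := by
  unfold gf
  split_ifs with h1 h2
  · norm_num
  · norm_num
  · exact absurd ⟨h, h'⟩ h2

theorem gf_ge {i : ι} {e : Sym2 V} {k : ℕ} (hk : 5 ≤ k) (h : k ≤ (φ i).length) : gf φ i e ≤ 24 / k := by
  unfold gf
  split_ifs with h1 h2 h3
  · positivity
  · omega
  · omega
  · have h1 : (0 : ℚ) < k := by exact_mod_cast (by omega : 0 < k)
    have h2 : (k : ℚ) ≤ (φ i).length := by exact_mod_cast h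
    exact div_le_div_of_nonneg_left (by norm_num) h1 h2

theorem gf_six {i : ι} {e : Sym2 V} (h : 6 ≤ (φ i).length) : gf φ i e ≤ 4 := by
  have := gf_ge (φ := φ) (e := e) (k := 6) (by omega) h
  norm_num at this; exact this

theorem gf_five {i : ι} {e : Sym2 V} (h : 5 ≤ (φ i).length) : gf φ i e ≤ 24 / 5 := by
  have := gf_ge (φ := φ) (e := e) (k := 5) (by omega) h
  norm_num at this; exact this

theorem gf_le (C : Ctx H W φ hv) (i : ι) (e : Sym2 V) : gf φ i e ≤ 8 := by
  have := (C.fs.cyc i).len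
  rcases (by omega : (φ i).length = 3 ∨ (φ i).length = 4 ∨ 5 ≤ (φ i).length) with h | h | h
  · exact gf_three h
  · exact (gf_four h).trans (by norm_num)
  · exact (gf_five h).trans (by norm_num)

/-- an edge on no triangular face forms its own block -/
theorem blk_single {e : Sym2 V} (h : ∀ i, cv (φ i) e ≠ 0 → (φ i).length ≠ 3) : blk φ e = {e} := by
  apply Finset.Subset.antisymm
  · intro f hf
    have := blk_sub (φ := φ) (e := e) {e} rfl (by
      rintro f rfl g ⟨i, h1, h2, -⟩
      exact absurd h1 (h i h2)) f hf
    simpa using this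
  · intro f hf
    rw [Finset.mem_singleton] at hf
    subst hf; exact mem_blk_self φ f

theorem sv_notMem {v x y : V} (h : y ≠ x) : s(v, y) ∉ ({s(v, x)} : Finset (Sym2 V)) := by
  simp only [Finset.mem_singleton, Sym2.eq_iff]
  grind

/-- second edge of a face at a vertex -/
theorem Ctx.next (C : Ctx H W φ hv) {i : ι} {v x : V} (h : cv (φ i) s(v, x) ≠ 0) :
    ∃ y, y ≠ x ∧ cv (φ i) s(v, y) ≠ 0 ∧ ∀ z, cv (φ i) s(v, z) ≠ 0 → z = x ∨ z = y := by
  obtain ⟨p, q, hpq, hz⟩ := (C.fs.cyc i).deg_two ((C.fs.cyc i).edge_mem h (x := v) (by simp))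
  rcases (hz x).1 h with rfl | rfl
  · exact ⟨q, hpq.symm, (hz q).2 (by simp), fun z h => (hz z).1 h⟩
  · exact ⟨p, hpq, (hz p).2 (by simp), fun z h => ((hz z).1 h).symm⟩

theorem single_half (C : Ctx H W φ hv) {v x : V} (hvx : H.Adj v x)
    (h : ∀ i, cv (φ i) s(v, x) ≠ 0 → (φ i).length ≠ 3) : mu H φ v ≤ 1 / 2 := by
  obtain ⟨i, _, _, hi, _⟩ := C.fs.two s(v, x) hvx
  obtain ⟨y, hyx, hy, _⟩ := C.next hi
  refine mu_half hvx ((C.fs.cyc i).edge_adj hy) (blk_ne ?_)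
  rw [blk_single h]
  exact sv_notMem hyx

theorem t0_aux (C : Ctx H W φ hv) {i j k : ι} {v a b u : V} (q : Quad H (φ i) v a b u)
    (hk : (φ k).length = 3) (hk' : cv (φ k) s(v, u) ≠ 0) (hij : i ≠ j) (hj : cv (φ j) s(v, a) ≠ 0)
    (hj5 : (φ j).length = 5) (hva : ∀ i, cv (φ i) s(v, a) ≠ 0 → (φ i).length ≠ 3) : mu H φ v ≤ 1 / 3 := by
  obtain ⟨y, hya, hy, hyy⟩ := C.next hj
  have hyu : y ≠ u := by
    rintro rfl
    have := C.share hij hya ((q.edge _).2 (by right; right; right; exact Sym2.eq_swap))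
      ((q.edge _).2 (by left; rfl)) hy hj
    rw [q.len] at this; omega
  have hvy : ∀ i, cv (φ i) s(v, y) ≠ 0 → (φ i).length ≠ 3 := by
    intro m hm hm3
    obtain ⟨w, t⟩ := (C.fs.cyc m).tri hm3 hm
    exact C.g1 t hy hj5
  have hau : a ≠ u := q.vb
  refine mu_third q.uv ((C.fs.cyc j).edge_adj hy) q.bu.symm (blk_ne ?_) (blk_ne ?_) (blk_ne ?_)
  · rw [blk_single hva]; exact sv_notMem hya
  · rw [blk_single hva]; exact sv_notMem hau.symm
  · rw [blk_single hvy]; exact sv_notMem hyu.symm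

theorem block_T0 (C : Ctx H W φ hv) {e0 : Sym2 V} (he0 : e0 ∈ H.edgeSet)
    (h : ∀ i, cv (φ i) e0 ≠ 0 → (φ i).length ≠ 3) :
    6 * ∑ v ∈ vs (blk φ e0), mu H φ v ≤ ∑ e ∈ blk φ e0, (17 - gift φ e - if e ∈ hv then 2 else 0) := by
  rw [blk_single h, Finset.sum_singleton]
  induction e0 with | _ u v =>
  have huv : H.Adj u v := he0
  have hvs : vs {s(u, v)} = {u, v} := by
    ext x; simp [mem_vs]
  rw [hvs, Finset.sum_pair huv.ne]
  have hu := single_half C huv h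
  have hv' := single_half C huv.symm (by rw [Sym2.eq_swap]; exact h)
  obtain ⟨i, j, hij, hi, hj, -⟩ := C.fs.two _ he0
  rw [gift_eq C hij hi hj]
  by_cases hh : s(u, v) ∈ hv
  · rw [if_pos hh]
    have := gf_six (e := s(u, v)) (C.heavy i _ hh hi)
    have := gf_six (e := s(u, v)) (C.heavy j _ hh hj)
    linarith
  rw [if_neg hh]
  have key : ∀ i j, i ≠ j → cv (φ i) s(u, v) ≠ 0 → cv (φ j) s(u, v) ≠ 0 → (φ i).length = 4 →
      6 * (mu H φ u + mu H φ v) ≤ 17 - (gf φ i s(u, v) + gf φ j s(u, v)) - 0 := by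
    intro i j hij hi hj h4
    obtain ⟨a, b, q⟩ := (C.fs.cyc i).quad h4 hi
    have h1 := C.g2 hij q hj
    have h2 := h j hj
    have h3 := (C.fs.cyc j).len
    by_cases h6 : 6 ≤ (φ j).length
    · have := gf_six (e := s(u, v)) h6
      have := gf_four (e := s(u, v)) h4
      linarith
    have h5 : (φ j).length = 5 := by omega
    have g5 := gf_five (e := s(u, v)) (by omega : 5 ≤ (φ j).length)
    by_cases htau : tau φ i = 2
    · have g4 := gf_four (e := s(u, v)) h4
      have hex : tr φ i s(v, a) ∨ tr φ i s(b, u) := by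
        by_contra hcon
        push Not at hcon
        have : tau φ i ≤ ({s(a, b)} : Finset (Sym2 V)).card := by
          unfold tau
          apply Finset.card_le_card
          intro e he
          simp only [Finset.mem_filter, Finset.mem_univ, true_and] at he
          rcases (q.edge e).1 he.1 with rfl | rfl | rfl | rfl
          · obtain ⟨k, -, hk, hk'⟩ := he.2
            exact absurd hk (h k hk')
          · exact absurd he.2 hcon.1
          · simp
          · exact absurd he.2 hcon.2
        simp at this; omega
      rcases hex with ⟨k, -, hk, hk'⟩ | ⟨k, -, hk, hk'⟩
      · have := t0_aux C q.rev hk hk' hij (by rw [Sym2.eq_swap]; exact hj) h5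
          (by rw [Sym2.eq_swap]; exact h)
        linarith
      · have := t0_aux C q hk (by rw [Sym2.eq_swap]; exact hk') hij hj h5 h
        linarith
    · have := gf_four_ne (e := s(u, v)) h4 htau
      linarith
  have h3 := (C.fs.cyc i).len
  have h3' := (C.fs.cyc j).len
  have h1 := h i hi
  have h2 := h j hj
  by_cases h4 : (φ i).length = 4
  · exact key i j hij hi hj h4
  by_cases h4' : (φ j).length = 4
  · have := key j i hij.symm hj hi h4'
    linarith
  have := gf_five (e := s(u, v)) (by omega : 5 ≤ (φ i).length)
  have := gf_five (e := s(u, v)) (by omega : 5 ≤ (φ j).length)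
  linarith

end

end Th

namespace Th

universe u
variable {V : Type u}

section
open Classical
variable [Fintype V] {ι : Type} [Fintype ι] {H : SimpleGraph V} {φ : ι → List V} {W : Set V} {hv : Set (Sym2 V)}

/-- `e` lies on a triangular face -/
def onT (φ : ι → List V) (e : Sym2 V) : Prop := ∃ i, (φ i).length = 3 ∧ cv (φ i) e ≠ 0

/-- `e` lies on a non-triangular face -/
def onN (φ : ι → List V) (e : Sym2 V) : Prop := ∃ i, (φ i).length ≠ 3 ∧ cv (φ i) e ≠ 0

theorem blk_onT {e0 : Sym2 V} (h : onT φ e0) : ∀ e ∈ blk φ e0, onT φ e :=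
  blk_sub {e | onT φ e} h (by
    rintro f - g ⟨i, h1, -, h3⟩
    exact ⟨i, h1, h3⟩)

theorem gift_le (C : Ctx H W φ hv) {e : Sym2 V} (he : e ∈ H.edgeSet) : gift φ e ≤ 16 := by
  obtain ⟨i, j, hij, hi, hj, -⟩ := C.fs.two _ he
  rw [gift_eq C hij hi hj]
  have := gf_le C i e
  have := gf_le C j e
  linarith

theorem gift_bd (C : Ctx H W φ hv) {i : ι} {e : Sym2 V} (ht : onT φ e) (hi : cv (φ i) e ≠ 0)
    (h3 : (φ i).length ≠ 3) : gift φ e ≤ 14 := by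
  obtain ⟨j, hj3, hj⟩ := ht
  have hij : i ≠ j := by rintro rfl; exact h3 hj3
  rw [gift_eq C hij hi hj]
  have := gf_three (e := e) hj3
  have hl := (C.fs.cyc i).len
  by_cases h4 : (φ i).length = 4
  · have := gf_four_tr (e := e) h4 ⟨j, hij.symm, hj3, hj⟩
    linarith
  · have := gf_five (e := e) (by omega : 5 ≤ (φ i).length)
    linarith

theorem Ctx.not5 (C : Ctx H W φ hv) {i : ι} {e : Sym2 V} (ht : onT φ e) (hi : cv (φ i) e ≠ 0) :
    (φ i).length ≠ 5 := by
  obtain ⟨j, hj3, hj⟩ := ht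
  induction e with | _ u v =>
  obtain ⟨w, t⟩ := (C.fs.cyc j).tri hj3 hj
  exact C.g1 t hi

theorem gift_bd6 (C : Ctx H W φ hv) {i : ι} {e : Sym2 V} (ht : onT φ e) (hi : cv (φ i) e ≠ 0)
    (h3 : (φ i).length ≠ 3) (h4 : (φ i).length ≠ 4) : gift φ e ≤ 12 := by
  have h5 := C.not5 ht hi
  obtain ⟨j, hj3, hj⟩ := ht
  have hij : i ≠ j := by rintro rfl; exact h3 hj3
  rw [gift_eq C hij hi hj]
  have := gf_three (e := e) hj3
  have hl := (C.fs.cyc i).len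
  have := gf_six (e := e) (by omega : 6 ≤ (φ i).length)
  linarith

theorem block_of (C : Ctx H W φ hv) {e0 : Sym2 V} (he0 : e0 ∈ H.edgeSet) (ht : onT φ e0)
    (S : Finset (Sym2 V)) (U : Finset V) (hS : S ⊆ blk φ e0) (hU : vs (blk φ e0) ⊆ U)
    (h : 6 * ∑ v ∈ U, mu H φ v ≤ ∑ e ∈ S, (17 - gift φ e)) :
    6 * ∑ v ∈ vs (blk φ e0), mu H φ v ≤ ∑ e ∈ blk φ e0, (17 - gift φ e - if e ∈ hv then 2 else 0) := by
  have h1 : ∑ v ∈ vs (blk φ e0), mu H φ v ≤ ∑ v ∈ U, mu H φ v :=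
    Finset.sum_le_sum_of_subset_of_nonneg hU (fun v _ _ => mu_nonneg H φ v)
  have h2 : ∑ e ∈ S, (17 - gift φ e) ≤ ∑ e ∈ blk φ e0, (17 - gift φ e) :=
    Finset.sum_le_sum_of_subset_of_nonneg hS (fun e he _ => by
      have := gift_le C (blk_edge C.fs he0 e he)
      linarith)
  have h3 : ∑ e ∈ blk φ e0, (17 - gift φ e - if e ∈ hv then 2 else 0) = ∑ e ∈ blk φ e0, (17 - gift φ e) := by
    apply Finset.sum_congr rfl
    intro e he
    obtain ⟨i, h3, hi⟩ := blk_onT ht e he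
    rw [if_neg, sub_zero]
    intro hh
    have := C.heavy i e hh hi
    omega
  rw [h3]
  linarith

theorem mu_sh {e0 : Sym2 V} {v y : V} (he0 : e0 ∈ H.edgeSet) (C : Ctx H W φ hv)
    (hvB : v ∈ vs (blk φ e0)) (hy : H.Adj v y) (h : s(v, y) ∉ blk φ e0) : mu H φ v ≤ 1 / 2 := by
  obtain ⟨e, he, hve⟩ := mem_vs.1 hvB
  obtain ⟨z, rfl⟩ := Sym2.mem_iff_exists.1 hve
  refine mu_half (x := z) (y := y) (blk_edge C.fs he0 _ he) hy ?_
  rw [blk_eq he]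
  exact blk_ne h

theorem block_T1 (C : Ctx H W φ hv) {i : ι} {x y w : V} (t : Tri H (φ i) x y w)
    (hc : ∀ e, cv (φ i) e ≠ 0 → ∀ j, cv (φ j) e ≠ 0 → (φ j).length = 3 → j = i) {e0 : Sym2 V}
    (he0 : cv (φ i) e0 ≠ 0) :
    6 * ∑ v ∈ vs (blk φ e0), mu H φ v ≤ ∑ e ∈ blk φ e0, (17 - gift φ e - if e ∈ hv then 2 else 0) := by
  have hsub : ∀ e ∈ blk φ e0, cv (φ i) e ≠ 0 := blk_sub {e | cv (φ i) e ≠ 0} he0 (by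
    rintro f hf g ⟨j, h1, h2, h3⟩
    have := hc f hf j h2 h1
    subst this
    exact h3)
  have hsup : ∀ e, cv (φ i) e ≠ 0 → e ∈ blk φ e0 := fun e he =>
    blk_step (mem_blk_self φ e0) ⟨i, t.len, he0, he⟩
  have hE : e0 ∈ H.edgeSet := (C.fs.cyc i).edge_adj he0
  have n1 := t.uv.ne
  have n2 := t.vw.ne
  have n3 := t.wu.ne
  refine block_of C hE ⟨i, t.len, he0⟩ {s(x, y), s(y, w), s(w, x)} {x, y, w} ?_ ?_ ?_
  · intro e he
    apply hsup
    rw [t.edge]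
    simpa using he
  · intro v hvB
    obtain ⟨e, he, hve⟩ := mem_vs.1 hvB
    have := (C.fs.cyc i).edge_mem (hsub e he) (x := v) hve
    rw [t.mem] at this
    simpa using this
  · have hm : ∀ v, v ∈ φ i → mu H φ v ≤ 1 / 2 := by
      intro v hvi
      obtain ⟨p, q, hpq, hz⟩ := (C.fs.cyc i).deg_two hvi
      obtain ⟨z, hvz, h1, h2⟩ := C.third ((hz p).2 (by simp)) ((hz q).2 (by simp)) (by rw [t.len]; omega)
      refine mu_sh hE C (mem_vs.2 ⟨s(v, p), hsup _ ((hz p).2 (by simp)), by simp⟩) hvz (fun hh => ?_)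
      have := (hz z).1 (hsub _ hh)
      tauto
    have hg : ∀ e, cv (φ i) e ≠ 0 → gift φ e ≤ 14 := by
      intro e he
      obtain ⟨j, hji, hj, -⟩ := C.fs.other he
      exact gift_bd C ⟨i, t.len, he⟩ hj (fun h3 => hji (hc e he j hj h3))
    rw [Finset.sum_insert, Finset.sum_pair, Finset.sum_insert, Finset.sum_pair]
    · have := hm x ((t.mem x).2 (by simp))
      have := hm y ((t.mem y).2 (by simp))
      have := hm w ((t.mem w).2 (by simp))
      have := hg _ ((t.edge s(x, y)).2 (by simp))
      have := hg _ ((t.edge s(y, w)).2 (by simp))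
      have := hg _ ((t.edge s(w, x)).2 (by simp))
      linarith
    all_goals
      simp
      clear * - n1 n2 n3
      grind

/-- cuts: there is a shared vertex away from one vertex or from an adjacent pair -/
theorem exists_sh (C : Ctx H W φ hv) {B : Finset (Sym2 V)} {p q a : V} (hB : (vs B).card < 6)
    (hpq : p = q ∨ H.Adj p q) (hp : p ∈ vs B) (hq : q ∈ vs B) (ha : a ∈ vs B) (hap : a ≠ p) (haq : a ≠ q) (haW : a ∈ W) :
    ∃ x ∈ vs B, x ≠ p ∧ x ≠ q ∧ ∃ y, H.Adj x y ∧ s(x, y) ∉ B := by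
  have hcn : Conn H (W \ {p, q}) := by
    rcases hpq with rfl | h
    · simpa using C.c2 p
    · exact C.c3 p q h
  have hz : ∃ z ∈ W, z ∉ vs B := by
    by_contra hcon
    push Not at hcon
    have : W ⊆ (vs B : Set V) := fun z hz => by simpa using hcon z hz
    have h1 := Set.ncard_le_ncard this
    rw [Set.ncard_coe_finset] at h1
    have := C.card
    omega
  obtain ⟨z, hzW, hzB⟩ := hz
  obtain ⟨x, hx, hxS, y, hy, hyS, hxy⟩ := hcn.cut' (vs B : Set V) (a := a) (b := z)
    ⟨haW, by simp [hap, haq]⟩ (by simpa using ha) ⟨hzW, by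
      simp only [Set.mem_insert_iff, Set.mem_singleton_iff]
      rintro (rfl | rfl)
      · exact hzB hp
      · exact hzB hq⟩ (by simpa using hzB)
  have hx2 := hx.2
  simp at hx2
  exact ⟨x, by simpa using hxS, hx2.1, hx2.2, y, hxy, fun h => hyS (by
    simpa using mem_vs.2 ⟨_, h, Sym2.mem_mk_right x y⟩)⟩

theorem two_bd (C : Ctx H W φ hv) {e0 : Sym2 V} (he0 : e0 ∈ H.edgeSet) (ht : onT φ e0) {v y0 : V}
    (hvB : v ∈ vs (blk φ e0)) (hy0 : H.Adj v y0) (hy0B : s(v, y0) ∉ blk φ e0) :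
    ∃ x x', x ≠ x' ∧ s(v, x) ∈ blk φ e0 ∧ onN φ s(v, x) ∧ s(v, x') ∈ blk φ e0 ∧ onN φ s(v, x') := by
  obtain ⟨e, he, hve⟩ := mem_vs.1 hvB
  obtain ⟨x0, rfl⟩ := Sym2.mem_iff_exists.1 hve
  have h1 : ∃ i x, s(v, x) ∈ blk φ e0 ∧ cv (φ i) s(v, x) ≠ 0 ∧ (φ i).length ≠ 3 := by
    by_contra hcon
    push Not at hcon
    have := C.fs.link C.supp C.c2 (v := v) (x0 := x0) (A := {z | s(v, z) ∈ blk φ e0}) he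
      (blk_edge C.fs he0 _ he) (by
        intro i x hx hi y hy
        exact blk_step hx ⟨i, hcon i x hx hi, hi, hy⟩) y0 hy0
    exact hy0B this
  obtain ⟨i, x, hxB, hi, hi3⟩ := h1
  by_contra hcon
  have huniq : ∀ x', s(v, x') ∈ blk φ e0 → onN φ s(v, x') → x' = x := by
    intro x' h1 h2
    by_contra hne
    exact hcon ⟨x', x, hne, h1, h2, hxB, ⟨i, hi3, hi⟩⟩
  have hsum : ∑ k, ∑ z ∈ Finset.univ.filter (fun z => s(v, z) ∈ blk φ e0), cv (φ k) s(v, z) = 0 := by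
    rw [Finset.sum_comm]
    apply Finset.sum_eq_zero
    intro z _
    have := congrFun C.fs.sum s(v, z)
    rw [Finset.sum_apply] at this
    exact this
  rw [Finset.sum_eq_single i] at hsum
  · rw [Finset.sum_eq_single x] at hsum
    · exact hi hsum
    · intro z hz hzx
      by_contra h0
      exact hzx (huniq z (by simpa using hz) ⟨i, hi3, h0⟩)
    · intro h; exact absurd hxB (by simpa using h)
  · intro k _ hki
    by_cases hk3 : (φ k).length = 3
    · by_cases hex : ∃ z, s(v, z) ∈ blk φ e0 ∧ cv (φ k) s(v, z) ≠ 0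
      · obtain ⟨z, hz, hkz⟩ := hex
        obtain ⟨z', hzz, hkz', hall⟩ := C.next hkz
        have hz' : s(v, z') ∈ blk φ e0 := blk_step hz ⟨k, hk3, hkz, hkz'⟩
        rw [← Finset.sum_subset (s₁ := {z, z'})]
        · rw [Finset.sum_pair hzz.symm, zmod2_ne.1 hkz, zmod2_ne.1 hkz']; rfl
        · intro a ha
          simp at ha
          rcases ha with rfl | rfl <;> simpa
        · intro a _ ha
          by_contra h0
          exact ha (by simpa using hall a h0)
      · push Not at hex
        apply Finset.sum_eq_zero
        intro z hz
        exact hex z (by simpa using hz)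
    · apply Finset.sum_eq_zero
      intro z hz
      by_contra h0
      have hzB : s(v, z) ∈ blk φ e0 := by simpa using hz
      have := huniq z hzB ⟨k, hk3, h0⟩
      subst this
      obtain ⟨j, hj3, hj⟩ := blk_onT ht _ hzB
      rcases C.fs.third hi h0 (Ne.symm hki) hj with rfl | rfl
      · exact hi3 hj3
      · exact hk3 hj3
  · simp

end

end Th

namespace Th

universe u
variable {V : Type u}

section
open Classical
variable [Fintype V] {ι : Type} [Fintype ι] {H : SimpleGraph V} {φ : ι → List V} {W : Set V} {hv : Set (Sym2 V)}

theorem tri_count (C : Ctx H W φ hv) {e0 : Sym2 V} (he0 : e0 ∈ H.edgeSet) (ht : onT φ e0) :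
    ∃ t, 3 * t + ((blk φ e0).filter (onN φ)).card = 2 * (blk φ e0).card := by
  set B := blk φ e0 with hBdef
  set T : Finset ι := Finset.univ.filter (fun i => (φ i).length = 3) with hT
  have h1 := Finset.sum_card_bipartiteAbove_eq_sum_card_bipartiteBelow (s := B) (t := T)
    (fun e i => cv (φ i) e ≠ 0)
  have h2 : ∀ e ∈ B, (T.bipartiteAbove (fun e i => cv (φ i) e ≠ 0) e).card + (if onN φ e then 1 else 0) = 2 := by
    intro e he
    obtain ⟨i, hi3, hi⟩ := blk_onT ht e he
    obtain ⟨j, hji, hj, hall⟩ := C.fs.other hi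
    by_cases hj3 : (φ j).length = 3
    · have hN : ¬ onN φ e := by
        rintro ⟨k, hk3, hk⟩
        rcases hall k hk with rfl | rfl
        · exact hk3 hi3
        · exact hk3 hj3
      rw [if_neg hN]
      have : T.bipartiteAbove (fun e i => cv (φ i) e ≠ 0) e = {i, j} := by
        ext k
        simp only [Finset.mem_bipartiteAbove, hT, Finset.mem_filter, Finset.mem_univ, true_and,
          Finset.mem_insert, Finset.mem_singleton]
        constructor
        · rintro ⟨_, h⟩; exact hall k h
        · rintro (rfl | rfl)
          · exact ⟨hi3, hi⟩
          · exact ⟨hj3, hj⟩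
      rw [this, Finset.card_pair hji.symm]
    · rw [if_pos ⟨j, hj3, hj⟩]
      have : T.bipartiteAbove (fun e i => cv (φ i) e ≠ 0) e = {i} := by
        ext k
        simp only [Finset.mem_bipartiteAbove, hT, Finset.mem_filter, Finset.mem_univ, true_and,
          Finset.mem_singleton]
        constructor
        · rintro ⟨h3, h⟩
          rcases hall k h with rfl | rfl
          · rfl
          · exact absurd h3 hj3
        · rintro rfl
          exact ⟨hi3, hi⟩
      rw [this, Finset.card_singleton]
  have h3 : ∀ i ∈ T, ∃ m, (B.bipartiteBelow (fun e i => cv (φ i) e ≠ 0) i).card = 3 * m := by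
    intro i hi
    have hi3 : (φ i).length = 3 := by simpa [hT] using hi
    by_cases hex : ∃ e ∈ B, cv (φ i) e ≠ 0
    · obtain ⟨e, he, hie⟩ := hex
      refine ⟨1, ?_⟩
      rw [mul_one, ← hi3, ← card_cv (C.fs.cyc i)]
      congr 1
      ext f
      simp only [Finset.mem_bipartiteBelow, Finset.mem_filter, Finset.mem_univ, true_and]
      exact ⟨fun h => h.2, fun h => ⟨blk_step he ⟨i, hi3, hie, h⟩, h⟩⟩
    · refine ⟨0, ?_⟩
      rw [mul_zero, Finset.card_eq_zero]
      ext f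
      simp only [Finset.mem_bipartiteBelow, Finset.notMem_empty, iff_false]
      exact fun h => hex ⟨f, h⟩
  have h4 : ∃ t, ∑ i ∈ T, (B.bipartiteBelow (fun e i => cv (φ i) e ≠ 0) i).card = 3 * t :=
    Finset.dvd_sum (fun i hi => h3 i hi)
  obtain ⟨t, ht'⟩ := h4
  refine ⟨t, ?_⟩
  rw [← ht', ← h1, Finset.card_filter, ← Finset.sum_add_distrib, Finset.sum_congr rfl h2, Finset.sum_const,
    smul_eq_mul, mul_comm]

theorem big (C : Ctx H W φ hv) {e0 : Sym2 V} (he0 : e0 ∈ H.edgeSet) (ht : onT φ e0)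
    (hno4 : ∀ e ∈ blk φ e0, ∀ i, cv (φ i) e ≠ 0 → (φ i).length ≠ 4) (U : Finset V) (hU : vs (blk φ e0) ⊆ U)
    (hcard : U.card = 4 ∧ 5 ≤ (blk φ e0).card ∨ U.card = 5 ∧ 7 ≤ (blk φ e0).card) :
    6 * ∑ v ∈ vs (blk φ e0), mu H φ v ≤ ∑ e ∈ blk φ e0, (17 - gift φ e - if e ∈ hv then 2 else 0) := by
  refine block_of C he0 ht (blk φ e0) U (Finset.Subset.refl _) hU ?_
  obtain ⟨t, htc⟩ := tri_count C he0 ht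
  set B := blk φ e0 with hBdef
  set Bd := B.filter (onN φ) with hBd
  have hlow : ((B.card : ℚ) + 4 * Bd.card) ≤ ∑ e ∈ B, (17 - gift φ e) := by
    have h1 : ∑ e ∈ B, ((1 : ℚ) + 4 * if onN φ e then 1 else 0) = B.card + 4 * Bd.card := by
      rw [Finset.sum_add_distrib, ← Finset.mul_sum, hBd, Finset.card_filter]
      simp
    rw [← h1]
    apply Finset.sum_le_sum
    intro e he
    split_ifs with hN
    · obtain ⟨i, hi3, hi⟩ := hN
      have := gift_bd6 C (blk_onT ht e he) hi hi3 (hno4 e he i hi)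
      linarith
    · have := gift_le C (blk_edge C.fs he0 e he)
      linarith
  refine le_trans ?_ hlow
  -- shared vertices
  have hWm : ∀ a ∈ vs B, a ∈ W := by
    intro a ha
    obtain ⟨e, he, hae⟩ := mem_vs.1 ha
    obtain ⟨z, rfl⟩ := Sym2.mem_iff_exists.1 hae
    exact C.supp a z (blk_edge C.fs he0 _ he)
  have hUc : (vs B).card < 6 := by
    have := Finset.card_le_card hU
    omega
  have htri : ∃ a ∈ vs B, ∃ b ∈ vs B, ∃ c ∈ vs B, a ≠ b ∧ b ≠ c ∧ c ≠ a := by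
    obtain ⟨i, hi3, hi⟩ := ht
    induction e0 with | _ p q =>
    obtain ⟨r, tt⟩ := (C.fs.cyc i).tri hi3 hi
    refine ⟨p, mem_vs.2 ⟨_, mem_blk_self φ _, by simp⟩, q, mem_vs.2 ⟨_, mem_blk_self φ _, by simp⟩, r,
      mem_vs.2 ⟨s(q, r), blk_step (mem_blk_self φ _) ⟨i, hi3, hi, (tt.edge _).2 (by simp)⟩, by simp⟩,
      tt.uv.ne, tt.vw.ne, tt.wu.ne⟩
  have hsh : ∀ p ∈ vs B, ∀ q ∈ vs B, (p = q ∨ H.Adj p q) →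
      ∃ x ∈ vs B, x ≠ p ∧ x ≠ q ∧ ∃ y, H.Adj x y ∧ s(x, y) ∉ B := by
    intro p hp q hq hpq
    obtain ⟨a, ha, b, hb, c, hc, hab, hbc, hca⟩ := htri
    have : ∃ d ∈ vs B, d ≠ p ∧ d ≠ q := by
      by_cases h1 : a ≠ p ∧ a ≠ q
      · exact ⟨a, ha, h1⟩
      by_cases h2 : b ≠ p ∧ b ≠ q
      · exact ⟨b, hb, h2⟩
      · refine ⟨c, hc, ?_⟩
        clear * - h1 h2 hab hbc hca
        grind
    obtain ⟨d, hd, hdp, hdq⟩ := this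
    exact exists_sh C hUc hpq hp hq hd hdp hdq (hWm d hd)
  obtain ⟨a0, ha0, -⟩ := htri
  obtain ⟨p, hp, -, -, yp, hyp, hypB⟩ := hsh a0 ha0 a0 ha0 (Or.inl rfl)
  obtain ⟨q, hq, hqp, -, yq, hyq, hyqB⟩ := hsh p hp p hp (Or.inl rfl)
  have mp := mu_sh he0 C hp hyp hypB
  have mq := mu_sh he0 C hq hyq hyqB
  have htwo : ∀ v ∈ vs B, ∀ y, H.Adj v y → s(v, y) ∉ B → 2 ≤ (Bd.filter (fun e => v ∈ e)).card := by
    intro v hvB y hy hyB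
    obtain ⟨x, x', hne, h1, h2, h3, h4⟩ := two_bd C he0 ht hvB hy hyB
    refine Finset.one_lt_card.2 ⟨s(v, x), ?_, s(v, x'), ?_, ?_⟩
    · exact Finset.mem_filter.2 ⟨Finset.mem_filter.2 ⟨h1, h2⟩, by simp⟩
    · exact Finset.mem_filter.2 ⟨Finset.mem_filter.2 ⟨h3, h4⟩, by simp⟩
    · intro h
      rw [Sym2.eq_iff] at h
      clear * - h hne
      grind
  have tp := htwo p hp yp hyp hypB
  have tq := htwo q hq yq hyq hyqB
  by_cases hpq : H.Adj p q
  · obtain ⟨r, hr, hrp, hrq, yr, hyr, hyrB⟩ := hsh p hp q hq (Or.inr hpq)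
    have mr := mu_sh he0 C hr hyr hyrB
    have tr' := htwo r hr yr hyr hyrB
    have hb : 3 ≤ Bd.card := by
      have h1 := Finset.sum_card_bipartiteAbove_eq_sum_card_bipartiteBelow (s := ({p, q, r} : Finset V))
        (t := Bd) (fun v e => v ∈ e)
      rw [Finset.sum_insert (by simp; grind), Finset.sum_pair hrq.symm] at h1
      have h2 : ∀ e ∈ Bd, (Finset.bipartiteBelow (fun v e => v ∈ e) ({p, q, r} : Finset V) e).card ≤ 2 := by
        intro e _
        induction e with | _ c d =>
        have : Finset.bipartiteBelow (fun v e => v ∈ e) ({p, q, r} : Finset V) s(c, d) ⊆ {c, d} := by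
          intro z hz
          rw [Finset.mem_bipartiteBelow] at hz
          simpa using hz.2
        exact (Finset.card_le_card this).trans Finset.card_le_two
      have h3 := Finset.sum_le_card_nsmul Bd _ 2 h2
      rw [smul_eq_mul] at h3
      simp only [Finset.bipartiteAbove] at h1
      omega
    have hU' : ∑ v ∈ U, mu H φ v ≤ (U.card : ℚ) - 3 / 2 := by
      have hsub : ({p, q, r} : Finset V) ⊆ U := by
        intro z hz
        simp at hz
        rcases hz with rfl | rfl | rfl
        · exact hU hp
        · exact hU hq
        · exact hU hr
      rw [← Finset.sum_sdiff hsub, Finset.sum_insert (by simp; grind), Finset.sum_pair hrq.symm]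
      have h1 := Finset.sum_le_card_nsmul (U \ {p, q, r}) (mu H φ) 1 (fun v _ => mu_le_one H φ v)
      have h2 := Finset.card_sdiff_add_card_eq_card hsub
      have h3 : ({p, q, r} : Finset V).card = 3 := by
        rw [Finset.card_eq_three]; exact ⟨p, q, r, hqp.symm, hrp.symm, hrq.symm, rfl⟩
      rw [h3] at h2
      have h2' : ((U \ {p, q, r}).card : ℚ) + 3 = U.card := by exact_mod_cast h2
      simp only [nsmul_eq_mul, mul_one] at h1
      linarith
    have : (6 * (U.card : ℤ) - 9) ≤ B.card + 4 * Bd.card := by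
      rcases hcard with ⟨h1, h2⟩ | ⟨h1, h2⟩
      · rw [h1]; push_cast; omega
      · rw [h1]; push_cast; omega
    have : (6 * (U.card : ℚ) - 9) ≤ B.card + 4 * Bd.card := by exact_mod_cast this
    linarith
  · have hb : 4 ≤ Bd.card := by
      have hd : Disjoint (Bd.filter (fun e => p ∈ e)) (Bd.filter (fun e => q ∈ e)) := by
        rw [Finset.disjoint_left]
        intro e h1 h2
        rw [Finset.mem_filter] at h1 h2
        have : e = s(p, q) := (Sym2.mem_and_mem_iff hqp.symm).1 ⟨h1.2, h2.2⟩
        have h3 := blk_edge C.fs he0 e (Finset.mem_filter.1 h1.1).1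
        rw [this] at h3
        exact hpq h3
      have h1 := Finset.card_union_of_disjoint hd
      have h2 : ((Bd.filter (fun e => p ∈ e)) ∪ (Bd.filter (fun e => q ∈ e))).card ≤ Bd.card :=
        Finset.card_le_card (Finset.union_subset (Finset.filter_subset _ _) (Finset.filter_subset _ _))
      omega
    have hU' : ∑ v ∈ U, mu H φ v ≤ (U.card : ℚ) - 1 := by
      have hsub : ({p, q} : Finset V) ⊆ U := by
        intro z hz
        simp at hz
        rcases hz with rfl | rfl
        · exact hU hp
        · exact hU hq
      rw [← Finset.sum_sdiff hsub, Finset.sum_pair hqp.symm]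
      have h1 := Finset.sum_le_card_nsmul (U \ {p, q}) (mu H φ) 1 (fun v _ => mu_le_one H φ v)
      have h2 := Finset.card_sdiff_add_card_eq_card hsub
      rw [Finset.card_pair hqp.symm] at h2
      have h2' : ((U \ {p, q}).card : ℚ) + 2 = U.card := by exact_mod_cast h2
      simp only [nsmul_eq_mul, mul_one] at h1
      linarith
    have : (6 * (U.card : ℤ) - 6) ≤ B.card + 4 * Bd.card := by
      rcases hcard with ⟨h1, h2⟩ | ⟨h1, h2⟩
      · rw [h1]; push_cast; omega
      · rw [h1]; push_cast; omega
    have : (6 * (U.card : ℚ) - 6) ≤ B.card + 4 * Bd.card := by exact_mod_cast this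
    linarith

end

end Th

namespace Th

universe u
variable {V : Type u}

section
open Classical
variable [Fintype V] {ι : Type} [Fintype ι] {H : SimpleGraph V} {φ : ι → List V} {W : Set V} {hv : Set (Sym2 V)}

theorem vs_sub {e0 : Sym2 V} (S : Set (Sym2 V)) (U : Finset V) (h0 : e0 ∈ S)
    (hS : ∀ f ∈ S, ∀ g, RT φ f g → g ∈ S) (hU : ∀ e ∈ S, ∀ x ∈ e, x ∈ U) : vs (blk φ e0) ⊆ U := by
  intro v hvB
  obtain ⟨e, he, hve⟩ := mem_vs.1 hvB
  exact hU e (blk_sub S h0 hS e he) v hve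

theorem card_ge {B : Finset (Sym2 V)} (l : List (Sym2 V)) (hn : l.Nodup) (h : ∀ e ∈ l, e ∈ B) :
    l.length ≤ B.card := by
  rw [← List.toFinset_card_of_nodup hn]
  exact Finset.card_le_card (fun e he => h e (by simpa using he))

/-- the good structure for a block -/
def Str (φ : ι → List V) (e0 : Sym2 V) : Prop :=
  ∃ U : Finset V, vs (blk φ e0) ⊆ U ∧ (U.card = 4 ∧ 5 ≤ (blk φ e0).card ∨ U.card = 5 ∧ 7 ≤ (blk φ e0).card)

/-- set of pairs inside U -/
theorem vs_sub_pairs (C : Ctx H W φ hv) {e0 : Sym2 V} (U : Finset V) (h0 : ∀ x ∈ e0, x ∈ U)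
    (hS : ∀ k q r s, Tri H (φ k) q r s → q ∈ U → r ∈ U → s ∈ U) : vs (blk φ e0) ⊆ U := by
  refine vs_sub {e | ∀ x ∈ e, x ∈ U} U h0 ?_ (fun e he => he)
  rintro f hf g ⟨k, hk3, hkf, hkg⟩
  induction f with | _ q r =>
  obtain ⟨s, t⟩ := (C.fs.cyc k).tri hk3 hkf
  have hq : q ∈ U := hf q (by simp)
  have hr : r ∈ U := hf r (by simp)
  have hs := hS k q r s t hq hr
  intro x hx
  have := (C.fs.cyc k).edge_mem hkg (x := x) hx
  rw [t.mem] at this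
  rcases this with rfl | rfl | rfl <;> assumption

theorem fan (C : Ctx H W φ hv) {i j k : ι} {c p1 p2 p3 p4 : V} (hij : i ≠ j) (hjk : j ≠ k)
    (t1 : Tri H (φ i) c p1 p2) (t2 : Tri H (φ j) c p2 p3) (t3 : Tri H (φ k) c p3 p4)
    (h13 : p1 ≠ p3) (h14 : p1 ≠ p4) (h24 : p2 ≠ p4) {e0 : Sym2 V}
    (h0 : s(c, p2) ∈ blk φ e0) : Str φ e0 := by
  have d1 := t1.uv.ne
  have d2 := t1.vw.ne
  have d3 := t1.wu.ne
  have d4 := t2.vw.ne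
  have d5 := t2.wu.ne
  have d6 := t3.vw.ne
  have d7 := t3.wu.ne
  have b1 : ∀ e, cv (φ i) e ≠ 0 → e ∈ blk φ e0 := fun e he =>
    blk_step h0 ⟨i, t1.len, (t1.edge _).2 (by right; right; exact Sym2.eq_swap), he⟩
  have b2 : ∀ e, cv (φ j) e ≠ 0 → e ∈ blk φ e0 := fun e he =>
    blk_step h0 ⟨j, t2.len, (t2.edge _).2 (by left; rfl), he⟩
  have b3 : ∀ e, cv (φ k) e ≠ 0 → e ∈ blk φ e0 := fun e he =>
    blk_step (b2 s(p3, c) ((t2.edge _).2 (by simp))) ⟨k, t3.len, (t3.edge _).2 (by left; exact Sym2.eq_swap), he⟩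
  rw [← blk_eq h0] at b1 b2 b3
  unfold Str
  rw [← blk_eq h0]
  refine ⟨{c, p1, p2, p3, p4}, ?_, Or.inr ⟨?_, ?_⟩⟩
  · apply vs_sub_pairs C
    · intro x hx
      simp at hx ⊢
      tauto
    intro m q r s t hq hr
    by_contra hs
    have hP : ∀ d e f, [q, r, d, e, f].Nodup → s ∉ [q, r, d, e, f] → H.Adj r d → H.Adj d e → H.Adj e f →
        H.Adj f q → False := by
      intro d e f h1 h2 h3 h4 h5 h6
      refine theta_short C.th (a := q) (b := s) (c := r) (d := d) (e := e) (f := f) ?_ t.wu.symm t.vw.symm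
        h3 h4 h5 h6 t.uv
      clear * - h1 h2
      simp at h1 h2 ⊢
      grind
    have f2 : ∀ m, cv (φ m) s(c, p2) ≠ 0 → s ∉ φ m := by
      intro m hm
      have := C.fs.third ((t1.edge s(c, p2)).2 (by right; right; exact Sym2.eq_swap))
        ((t2.edge s(c, p2)).2 (by left; rfl)) hij hm
      simp at hs
      rcases this with rfl | rfl
      · rw [t1.mem]; tauto
      · rw [t2.mem]; tauto
    have f3 : ∀ m, cv (φ m) s(c, p3) ≠ 0 → s ∉ φ m := by
      intro m hm
      have := C.fs.third ((t2.edge s(c, p3)).2 (by right; right; exact Sym2.eq_swap))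
        ((t3.edge s(c, p3)).2 (by left; rfl)) hjk hm
      simp at hs
      rcases this with rfl | rfl
      · rw [t2.mem]; tauto
      · rw [t3.mem]; tauto
    have sm : s ∈ φ m := (t.mem s).2 (by simp)
    have qr : cv (φ m) s(q, r) ≠ 0 := (t.edge _).2 (by simp)
    have rq : cv (φ m) s(r, q) ≠ 0 := (t.edge _).2 (by left; exact Sym2.eq_swap)
    have hqr := t.uv.ne
    have nds : ∀ d e f, d ∈ ({c, p1, p2, p3, p4} : Finset V) → e ∈ ({c, p1, p2, p3, p4} : Finset V) →
        f ∈ ({c, p1, p2, p3, p4} : Finset V) → s ∉ [q, r, d, e, f] := by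
      intro d e f hd he hf h
      simp only [List.mem_cons, List.not_mem_nil, or_false] at h
      rcases h with rfl | rfl | rfl | rfl | rfl <;> contradiction
    have e1 := t1.uv
    have e2 := t1.vw
    have e3 := t1.wu
    have e4 := t2.vw
    have e5 := t2.wu
    have e6 := t3.vw
    have e7 := t3.wu
    have nd : [c, p1, p2, p3, p4].Nodup := by simp; clear * - d1 d2 d3 d4 d5 d6 d7 h13 h14 h24; grind
    clear t t1 t2 t3 b1 b2 b3
    clear hs
    simp only [Finset.mem_insert, Finset.mem_singleton] at hq hr
    rcases hq with rfl | rfl | rfl | rfl | rfl <;> rcases hr with rfl | rfl | rfl | rfl | rfl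
    · exact hqr rfl
    · refine hP p2 p3 p4 ?_ (nds _ _ _ (by simp) (by simp) (by simp)) e2 e4 e6 e7
      clear * - nd; simp at nd ⊢; grind
    · exact f2 m qr sm
    · exact f3 m qr sm
    · refine hP p3 p2 p1 ?_ (nds _ _ _ (by simp) (by simp) (by simp)) e6.symm e4.symm e2.symm e1.symm
      clear * - nd; simp at nd ⊢; grind
    · refine hP p4 p3 p2 ?_ (nds _ _ _ (by simp) (by simp) (by simp)) e7.symm e6.symm e4.symm e2.symm
      clear * - nd; simp at nd ⊢; grind
    · exact hqr rfl
    · refine hP p3 p4 c ?_ (nds _ _ _ (by simp) (by simp) (by simp)) e4 e6 e7 e1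
      clear * - nd; simp at nd ⊢; grind
    · refine hP p4 c p2 ?_ (nds _ _ _ (by simp) (by simp) (by simp)) e6 e7 e3.symm e2.symm
      clear * - nd; simp at nd ⊢; grind
    · refine hP p3 c p2 ?_ (nds _ _ _ (by simp) (by simp) (by simp)) e6.symm e5 e3.symm e2.symm
      clear * - nd; simp at nd ⊢; grind
    · exact f2 m rq sm
    · refine hP c p4 p3 ?_ (nds _ _ _ (by simp) (by simp) (by simp)) e1.symm e7.symm e6.symm e4.symm
      clear * - nd; simp at nd ⊢; grind
    · exact hqr rfl
    · refine hP p4 c p1 ?_ (nds _ _ _ (by simp) (by simp) (by simp)) e6 e7 e1 e2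
      clear * - nd; simp at nd ⊢; grind
    · refine hP p3 c p1 ?_ (nds _ _ _ (by simp) (by simp) (by simp)) e6.symm e5 e1 e2
      clear * - nd; simp at nd ⊢; grind
    · exact f3 m rq sm
    · refine hP p2 c p4 ?_ (nds _ _ _ (by simp) (by simp) (by simp)) e2 e3 e7.symm e6.symm
      clear * - nd; simp at nd ⊢; grind
    · refine hP p1 c p4 ?_ (nds _ _ _ (by simp) (by simp) (by simp)) e2.symm e1.symm e7.symm e6.symm
      clear * - nd; simp at nd ⊢; grind
    · exact hqr rfl
    · refine hP c p1 p2 ?_ (nds _ _ _ (by simp) (by simp) (by simp)) e7 e1 e2 e4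
      clear * - nd; simp at nd ⊢; grind
    · refine hP p1 p2 p3 ?_ (nds _ _ _ (by simp) (by simp) (by simp)) e1 e2 e4 e6
      clear * - nd; simp at nd ⊢; grind
    · refine hP p2 c p3 ?_ (nds _ _ _ (by simp) (by simp) (by simp)) e2 e3 e5.symm e6
      clear * - nd; simp at nd ⊢; grind
    · refine hP p1 c p3 ?_ (nds _ _ _ (by simp) (by simp) (by simp)) e2.symm e1.symm e5.symm e6
      clear * - nd; simp at nd ⊢; grind
    · refine hP p2 p1 c ?_ (nds _ _ _ (by simp) (by simp) (by simp)) e4.symm e2.symm e1.symm e7.symm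
      clear * - nd; simp at nd ⊢; grind
    · exact hqr rfl
  · have : ({c, p1, p2, p3, p4} : Finset V) = [c, p1, p2, p3, p4].toFinset := by simp
    rw [this, List.toFinset_card_of_nodup]
    · rfl
    · simp; clear * - d1 d2 d3 d4 d5 d6 d7 h13 h14 h24; grind
  · refine card_ge [s(c, p1), s(p1, p2), s(p2, c), s(p2, p3), s(p3, c), s(p3, p4), s(p4, c)] ?_ ?_
    · clear * - d1 d2 d3 d4 d5 d6 d7 h13 h14 h24
      simp
      grind
    · intro e he
      simp only [List.mem_cons, List.not_mem_nil, or_false] at he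
      rcases he with rfl | rfl | rfl | rfl | rfl | rfl | rfl
      · exact b1 _ ((t1.edge _).2 (by simp))
      · exact b1 _ ((t1.edge _).2 (by simp))
      · exact b1 _ ((t1.edge _).2 (by simp))
      · exact b2 _ ((t2.edge _).2 (by simp))
      · exact b2 _ ((t2.edge _).2 (by simp))
      · exact b3 _ ((t3.edge _).2 (by simp))
      · exact b3 _ ((t3.edge _).2 (by simp))

theorem struct2 (C : Ctx H W φ hv) {i j k : ι} {x y w z r : V} (hij : i ≠ j) (hik : i ≠ k)
    (ti : Tri H (φ i) x y w) (tj : Tri H (φ j) x y z) (tk : Tri H (φ k) x w r) {e0 : Sym2 V}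
    (h0 : s(x, y) ∈ blk φ e0) : Str φ e0 := by
  have hzw : z ≠ w := by
    rintro rfl
    exact hij (C.tri_inj ti tj)
  have hry : r ≠ y := by
    rintro rfl
    exact hik (C.tri_inj ti tk.swap.rot)
  have d1 := ti.uv.ne
  have d2 := ti.vw.ne
  have d3 := ti.wu.ne
  have d4 := tj.vw.ne
  have d5 := tj.wu.ne
  have bi : ∀ e, cv (φ i) e ≠ 0 → e ∈ blk φ e0 := fun e he =>
    blk_step h0 ⟨i, ti.len, (ti.edge _).2 (by simp), he⟩
  have bj : ∀ e, cv (φ j) e ≠ 0 → e ∈ blk φ e0 := fun e he =>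
    blk_step h0 ⟨j, tj.len, (tj.edge _).2 (by simp), he⟩
  by_cases hrz : r = z
  swap
  · exact fan C (i := k) (j := i) (k := j) (c := x) (p1 := r) (p2 := w) (p3 := y) (p4 := z) hik.symm hij
      tk.swap.rot ti.swap.rot tj hry hrz (Ne.symm hzw) (bi _ ((ti.edge _).2 (by right; right; exact Sym2.eq_swap)))
  subst hrz
  have bk : ∀ e, cv (φ k) e ≠ 0 → e ∈ blk φ e0 := fun e he =>
    blk_step (bi s(w, x) ((ti.edge _).2 (by simp))) ⟨k, tk.len, (tk.edge _).2 (by left; exact Sym2.eq_swap), he⟩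
  have hjk : j ≠ k := by
    rintro rfl
    have := (tj.mem w).1 ((tk.mem w).2 (by simp))
    clear * - this d2 d3 hzw
    grind
  by_cases hcl : ∀ m q r' s, Tri H (φ m) q r' s → q ∈ ({x, y, w, r} : Finset V) →
      r' ∈ ({x, y, w, r} : Finset V) → s ∈ ({x, y, w, r} : Finset V)
  · refine ⟨{x, y, w, r}, ?_, Or.inl ⟨?_, ?_⟩⟩
    · rw [← blk_eq h0]
      apply vs_sub_pairs C _ _ hcl
      intro a ha
      simp at ha ⊢
      tauto
    · have : ({x, y, w, r} : Finset V) = [x, y, w, r].toFinset := by simp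
      rw [this, List.toFinset_card_of_nodup]
      · rfl
      · simp; clear * - d1 d2 d3 d4 d5 hzw hry; grind
    · refine card_ge [s(x, y), s(y, w), s(w, x), s(y, r), s(r, x)] ?_ ?_
      · clear * - d1 d2 d3 d4 d5 hzw hry
        simp
        grind
      · intro e he
        simp only [List.mem_cons, List.not_mem_nil, or_false] at he
        rcases he with rfl | rfl | rfl | rfl | rfl
        · exact bi _ ((ti.edge _).2 (by simp))
        · exact bi _ ((ti.edge _).2 (by simp))
        · exact bi _ ((ti.edge _).2 (by simp))
        · exact bj _ ((tj.edge _).2 (by simp))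
        · exact bj _ ((tj.edge _).2 (by simp))
  · push Not at hcl
    obtain ⟨m, q, r', s, tm, hq, hr', hs⟩ := hcl
    simp only [Finset.mem_insert, Finset.mem_singleton, not_or] at hs hq hr'
    obtain ⟨s1, s2, s3, s4⟩ := hs
    have mi : m ≠ i := by
      rintro rfl
      have := (ti.mem s).1 ((tm.mem s).2 (by simp)); tauto
    have mj : m ≠ j := by
      rintro rfl
      have := (tj.mem s).1 ((tm.mem s).2 (by simp)); tauto
    have mk : m ≠ k := by
      rintro rfl
      have := (tk.mem s).1 ((tm.mem s).2 (by simp)); tauto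
    have hx : x ∉ φ m := by
      intro hxm
      have hx2 : x = q ∨ x = r' := by
        have := (tm.mem x).1 hxm
        rcases this with h | h | h
        · exact Or.inl h
        · exact Or.inr h
        · exact absurd h.symm s1
      have hne := tm.uv.ne
      have key : ∀ b, (b = y ∨ b = w ∨ b = r) → cv (φ m) s(x, b) ≠ 0 → False := by
        rintro b (rfl | rfl | rfl) hb
        · have := C.fs.third ((ti.edge s(x, b)).2 (by simp)) ((tj.edge s(x, b)).2 (by simp)) hij hb
          tauto
        · have := C.fs.third ((ti.edge s(x, b)).2 (by right; right; exact Sym2.eq_swap)) ((tk.edge s(x, b)).2 (by simp)) hik hb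
          tauto
        · have := C.fs.third ((tj.edge s(x, b)).2 (by right; right; exact Sym2.eq_swap)) ((tk.edge s(x, b)).2 (by right; right; exact Sym2.eq_swap)) hjk hb
          tauto
      rcases hx2 with rfl | rfl
      · refine key r' ?_ ((tm.edge _).2 (by simp))
        clear * - hr' hne; grind
      · refine key q ?_ ((tm.edge _).2 (by left; exact Sym2.eq_swap))
        clear * - hq hne; grind
    have hq' : q = y ∨ q = w ∨ q = r := by
      rcases hq with rfl | h
      · exact absurd ((tm.mem q).2 (by simp)) hx
      · exact h
    have hr2 : r' = y ∨ r' = w ∨ r' = r := by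
      rcases hr' with rfl | h
      · exact absurd ((tm.mem r').2 (by simp)) hx
      · exact h
    have main : Tri H (φ m) y w s ∨ Tri H (φ m) y r s ∨ Tri H (φ m) w r s := by
      have hne := tm.uv.ne
      rcases hq' with rfl | rfl | rfl <;> rcases hr2 with rfl | rfl | rfl
      · exact absurd rfl hne
      · exact Or.inl tm
      · exact Or.inr (Or.inl tm)
      · exact Or.inl tm.swap
      · exact absurd rfl hne
      · exact Or.inr (Or.inr tm)
      · exact Or.inr (Or.inl tm.swap)
      · exact Or.inr (Or.inr tm.swap)
      · exact absurd rfl hne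
    rcases main with tm | tm | tm
    · exact fan C (i := m) (j := i) (k := j) (c := y) (p1 := s) (p2 := w) (p3 := x) (p4 := r) mi hij
        tm.swap.rot ti.rot tj.swap s1 s4 (Ne.symm hzw) (bi _ ((ti.edge _).2 (by simp)))
    · exact fan C (i := m) (j := j) (k := i) (c := y) (p1 := s) (p2 := r) (p3 := x) (p4 := w) mj hij.symm
        tm.swap.rot tj.rot ti.swap s1 s3 hzw (bj _ ((tj.edge _).2 (by simp)))
    · exact fan C (i := m) (j := k) (k := i) (c := w) (p1 := s) (p2 := r) (p3 := x) (p4 := y) mk hik.symm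
        tm.swap.rot tk.rot ti.rot.rot s1 s2 hry (bk _ ((tk.edge _).2 (by simp)))

theorem struct (C : Ctx H W φ hv) {e0 : Sym2 V} {i : ι} (hi3 : (φ i).length = 3) (hi : cv (φ i) e0 ≠ 0)
    (hnc : ¬ ∀ e, cv (φ i) e ≠ 0 → ∀ j, cv (φ j) e ≠ 0 → (φ j).length = 3 → j = i) : Str φ e0 := by
  push Not at hnc
  obtain ⟨e, he, j, hj, hj3, hji⟩ := hnc
  have heB : e ∈ blk φ e0 := blk_step (mem_blk_self φ e0) ⟨i, hi3, hi, he⟩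
  induction e with | _ x y =>
  obtain ⟨w, ti⟩ := (C.fs.cyc i).tri hi3 he
  obtain ⟨z, tj⟩ := (C.fs.cyc j).tri hj3 hj
  have hyx : s(y, x) ∈ blk φ e0 := by rw [Sym2.eq_swap]; exact heB
  have key : ∀ i j x y w z, i ≠ j → Tri H (φ i) x y w → Tri H (φ j) x y z → s(x, y) ∈ blk φ e0 →
      (∃ k, (φ k).length = 3 ∧ cv (φ k) s(x, w) ≠ 0 ∧ k ≠ i) → Str φ e0 := by
    rintro i j x y w z hij ti tj h0 ⟨k, hk3, hk, hki⟩
    obtain ⟨r, tk⟩ := (C.fs.cyc k).tri hk3 hk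
    exact struct2 C hij hki.symm ti tj tk h0
  by_cases h1 : ∃ k, (φ k).length = 3 ∧ cv (φ k) s(x, w) ≠ 0 ∧ k ≠ i
  · exact key i j x y w z hji.symm ti tj heB h1
  by_cases h2 : ∃ k, (φ k).length = 3 ∧ cv (φ k) s(y, w) ≠ 0 ∧ k ≠ i
  · exact key i j y x w z hji.symm ti.swap tj.swap hyx h2
  by_cases h3 : ∃ k, (φ k).length = 3 ∧ cv (φ k) s(x, z) ≠ 0 ∧ k ≠ j
  · exact key j i x y z w hji tj ti heB h3
  by_cases h4 : ∃ k, (φ k).length = 3 ∧ cv (φ k) s(y, z) ≠ 0 ∧ k ≠ j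
  · exact key j i y x z w hji tj.swap ti.swap hyx h4
  push Not at h1 h2 h3 h4
  have hzw : z ≠ w := by
    rintro rfl
    exact hji (C.tri_inj tj ti)
  have d1 := ti.uv.ne
  have d2 := ti.vw.ne
  have d3 := ti.wu.ne
  have d4 := tj.vw.ne
  have d5 := tj.wu.ne
  have bi : ∀ e, cv (φ i) e ≠ 0 → e ∈ blk φ e0 := fun e he' => blk_step heB ⟨i, ti.len, he, he'⟩
  have bj : ∀ e, cv (φ j) e ≠ 0 → e ∈ blk φ e0 := fun e he' => blk_step heB ⟨j, tj.len, hj, he'⟩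
  refine ⟨{x, y, w, z}, ?_, Or.inl ⟨?_, ?_⟩⟩
  · refine vs_sub {e | cv (φ i) e ≠ 0 ∨ cv (φ j) e ≠ 0} _ (Or.inl hi) ?_ ?_
    · rintro f hf g ⟨k, hk3, hkf, hkg⟩
      have hk : k = i ∨ k = j := by
        rcases hf with hf | hf
        · rcases (ti.edge f).1 hf with rfl | rfl | rfl
          · exact C.fs.third he hj hji.symm hkf
          · exact Or.inl (h2 k hk3 hkf)
          · exact Or.inl (h1 k hk3 (by rw [Sym2.eq_swap]; exact hkf))
        · rcases (tj.edge f).1 hf with rfl | rfl | rfl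
          · exact C.fs.third he hj hji.symm hkf
          · exact Or.inr (h4 k hk3 hkf)
          · exact Or.inr (h3 k hk3 (by rw [Sym2.eq_swap]; exact hkf))
      rcases hk with rfl | rfl
      · exact Or.inl hkg
      · exact Or.inr hkg
    · rintro e (he | he) a ha
      · have := (C.fs.cyc i).edge_mem he (x := a) ha
        rw [ti.mem] at this
        simp; tauto
      · have := (C.fs.cyc j).edge_mem he (x := a) ha
        rw [tj.mem] at this
        simp; tauto
  · have : ({x, y, w, z} : Finset V) = [x, y, w, z].toFinset := by simp
    rw [this, List.toFinset_card_of_nodup]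
    · rfl
    · simp; clear * - d1 d2 d3 d4 d5 hzw; grind
  · refine card_ge [s(x, y), s(y, w), s(w, x), s(y, z), s(z, x)] ?_ ?_
    · clear * - d1 d2 d3 d4 d5 hzw
      simp
      grind
    · intro e he
      simp only [List.mem_cons, List.not_mem_nil, or_false] at he
      rcases he with rfl | rfl | rfl | rfl | rfl
      · exact bi _ ((ti.edge _).2 (by simp))
      · exact bi _ ((ti.edge _).2 (by simp))
      · exact bi _ ((ti.edge _).2 (by simp))
      · exact bj _ ((tj.edge _).2 (by simp))
      · exact bj _ ((tj.edge _).2 (by simp))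

end

end Th

namespace Th

universe u
variable {V : Type u}

section
open Classical
variable [Fintype V] {ι : Type} [Fintype ι] {H : SimpleGraph V} {φ : ι → List V} {W : Set V} {hv : Set (Sym2 V)}

theorem tau_two {i j k : ι} {u v a b : V} (q : Quad H (φ i) u v a b)
    (hj : (φ j).length = 3) (hju : cv (φ j) s(u, v) ≠ 0) (hk : (φ k).length = 3) (hku : cv (φ k) s(b, u) ≠ 0)
    (h1 : ¬ onT φ s(v, a)) (h2 : ¬ onT φ s(a, b)) : tau φ i = 2 := by
  have hji : j ≠ i := by rintro rfl; rw [q.len] at hj; omega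
  have hki : k ≠ i := by rintro rfl; rw [q.len] at hk; omega
  have : Finset.univ.filter (fun e => cv (φ i) e ≠ 0 ∧ tr φ i e) = {s(u, v), s(b, u)} := by
    ext e
    simp only [Finset.mem_filter, Finset.mem_univ, true_and, Finset.mem_insert, Finset.mem_singleton]
    constructor
    · rintro ⟨h, m, -, hm, hm'⟩
      rcases (q.edge e).1 h with rfl | rfl | rfl | rfl
      · exact Or.inl rfl
      · exact absurd ⟨m, hm, hm'⟩ h1
      · exact absurd ⟨m, hm, hm'⟩ h2
      · exact Or.inr rfl
    · rintro (rfl | rfl)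
      · exact ⟨(q.edge _).2 (by simp), j, hji, hj, hju⟩
      · exact ⟨(q.edge _).2 (by simp), k, hki, hk, hku⟩
  unfold tau
  rw [this, Finset.card_pair]
  intro h
  rw [Sym2.eq_iff] at h
  have := q.uv.ne
  have := q.vb
  have := q.bu.ne
  clear q
  grind

theorem gift_q5 (C : Ctx H W φ hv) {i j : ι} {e : Sym2 V} (hj3 : (φ j).length = 3) (hj : cv (φ j) e ≠ 0)
    (hi : cv (φ i) e ≠ 0) (h4 : (φ i).length = 4) (ht : tau φ i = 2) : gift φ e ≤ 13 := by
  have hij : i ≠ j := by rintro rfl; omega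
  rw [gift_eq C hij hi hj]
  have := gf_three (e := e) hj3
  have := gf_four_two (e := e) h4 ht ⟨j, hij.symm, hj3, hj⟩
  linarith

theorem card5_lt (C : Ctx H W φ hv) {u v a b w : V} (hW : ∀ z ∈ W, z = u ∨ z = v ∨ z = a ∨ z = b ∨ z = w) : False := by
  have h1 : W ⊆ (([u, v, a, b, w].toFinset : Finset V) : Set V) := by
    intro z hz
    have := hW z hz
    simp
    tauto
  have h2 := Set.ncard_le_ncard h1
  rw [Set.ncard_coe_finset] at h2
  have h3 := List.toFinset_card_le [u, v, a, b, w]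
  have := C.card
  simp only [List.length_cons, List.length_nil] at h3
  omega

theorem no_tri_ab (C : Ctx H W φ hv) {i j k m : ι} {u v a b w : V} (q : Quad H (φ i) u v a b)
    (t : Tri H (φ j) u v w) (t' : Tri H (φ k) u w b) (t'' : Tri H (φ m) v a w) : ¬ onT φ s(a, b) := by
  rintro ⟨n, hn3, hn⟩
  obtain ⟨s, tn⟩ := (C.fs.cyc n).tri hn3 hn
  have := C.same2 q t tn
  subst this
  obtain ⟨w1, w2, w3, w4⟩ := C.quad_apex q t
  have a1 := q.uv.ne
  have a2 := q.va.ne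
  have a3 := q.ab.ne
  have a4 := q.bu.ne
  have a5 := q.ua
  have a6 := q.vb
  have jk : j ≠ k := by
    rintro rfl
    have := (t.mem b).1 ((t'.mem b).2 (by simp)); grind
  have jm : j ≠ m := by
    rintro rfl
    have := (t.mem a).1 ((t''.mem a).2 (by simp)); grind
  have mn : m ≠ n := by
    rintro rfl
    have := (t''.mem b).1 ((tn.mem b).2 (by simp)); grind
  have nk : n ≠ k := by
    rintro rfl
    have := (tn.mem u).1 ((t'.mem u).2 (by simp)); grind
  have nu := (C.g3 q t t' jk).2
  have nv := (C.g3 q.rot t'' t.rot jm.symm).2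
  have na := (C.g3 q.rot.rot tn t''.rot mn.symm).2
  have nb := (C.g3 q.rot.rot.rot (t'.rot.rot) tn.rot nk.symm).2
  refine card5_lt C (u := u) (v := v) (a := a) (b := b) (w := s) ?_
  intro z hz
  by_contra hcon
  push Not at hcon
  obtain ⟨x, hx, hxS, y, hy, hyS, hxy⟩ := (C.c2 s).cut' {x | x = u ∨ x = v ∨ x = a ∨ x = b} (a := u) (b := z)
    ⟨C.supp _ _ q.uv, by simp; exact fun h => w1 h.symm⟩ (by simp) ⟨hz, by simp; tauto⟩ (by simp; tauto)
  have hys : y ≠ s := hy.2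
  apply hyS
  simp only [Set.mem_ofPred_eq] at hxS ⊢
  rcases hxS with rfl | rfl | rfl | rfl
  · have := nu y hxy; tauto
  · have := nv y hxy; tauto
  · have := na y hxy; tauto
  · have := nb y hxy; tauto

theorem block_S3 (C : Ctx H W φ hv) {i j k m : ι} {u v a b w : V} (q : Quad H (φ i) u v a b)
    (t : Tri H (φ j) u v w) (t' : Tri H (φ k) u w b) (t'' : Tri H (φ m) v a w) {e0 : Sym2 V}
    (hE : e0 ∈ H.edgeSet) (hT : onT φ e0) (h0 : s(u, v) ∈ blk φ e0) :
    6 * ∑ v ∈ vs (blk φ e0), mu H φ v ≤ ∑ e ∈ blk φ e0, (17 - gift φ e - if e ∈ hv then 2 else 0) := by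
  have hab := no_tri_ab C q t t' t''
  obtain ⟨w1, w2, w3, w4⟩ := C.quad_apex q t
  have a1 := q.uv.ne
  have a2 := q.va.ne
  have a3 := q.ab.ne
  have a4 := q.bu.ne
  have a5 := q.ua
  have a6 := q.vb
  have jk : j ≠ k := by
    rintro rfl
    have := (t.mem b).1 ((t'.mem b).2 (by simp)); grind
  have jm : j ≠ m := by
    rintro rfl
    have := (t.mem a).1 ((t''.mem a).2 (by simp)); grind
  have nu := (C.g3 q t t' jk).2
  have nv := (C.g3 q.rot t'' t.rot jm.symm).2
  -- the edge wb
  have wb3 : ∀ n, cv (φ n) s(w, b) ≠ 0 → (φ n).length = 3 → n = k := by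
    intro n hn hn3
    by_contra hnk
    obtain ⟨s, tn⟩ := (C.fs.cyc n).tri hn3 hn
    have := (C.g3 q.rot.rot.rot t'.rot.rot tn.swap (Ne.symm hnk)).1
    subst this
    exact hab ⟨n, hn3, (tn.edge _).2 (by right; left; exact Sym2.eq_swap)⟩
  have wa3 : ∀ n, cv (φ n) s(w, a) ≠ 0 → (φ n).length = 3 → n = m := by
    intro n hn hn3
    by_contra hnk
    obtain ⟨s, tn⟩ := (C.fs.cyc n).tri hn3 hn
    have := (C.g3 q.rot.rev t''.swap tn.swap (Ne.symm hnk)).1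
    subst this
    exact hab ⟨n, hn3, (tn.edge _).2 (by right; left; rfl)⟩
  have wb4 : ∀ n, cv (φ n) s(w, b) ≠ 0 → (φ n).length ≠ 4 := by
    intro n hn hn4
    obtain ⟨c, d, q'⟩ := (C.fs.cyc n).quad hn4 hn
    obtain ⟨hd, hN⟩ := C.g3 q' t'.rot t.rot.rot jk.symm
    have := hN a t''.vw.symm
    subst hd
    clear * - this a1 a2 a3 a4 a5 a6 w1 w2 w3 w4
    grind
  have wa4 : ∀ n, cv (φ n) s(w, a) ≠ 0 → (φ n).length ≠ 4 := by
    intro n hn hn4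
    obtain ⟨c, d, q'⟩ := (C.fs.cyc n).quad hn4 hn
    obtain ⟨hd, hN⟩ := C.g3 q' t''.swap.rot.rot t.swap.rot.rot jm.symm
    have := hN b t'.vw
    subst hd
    clear * - this a1 a2 a3 a4 a5 a6 w1 w2 w3 w4
    grind
  have bj : ∀ e, cv (φ j) e ≠ 0 → e ∈ blk φ e0 := fun e he' =>
    blk_step h0 ⟨j, t.len, (t.edge _).2 (by simp), he'⟩
  have bk : ∀ e, cv (φ k) e ≠ 0 → e ∈ blk φ e0 := fun e he' =>
    blk_step (bj s(w, u) ((t.edge _).2 (by simp))) ⟨k, t'.len, (t'.edge _).2 (by left; exact Sym2.eq_swap), he'⟩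
  have bm : ∀ e, cv (φ m) e ≠ 0 → e ∈ blk φ e0 := fun e he' =>
    blk_step (bj s(v, w) ((t.edge _).2 (by simp))) ⟨m, t''.len, (t''.edge _).2 (by right; right; exact Sym2.eq_swap), he'⟩
  have ji : j ≠ i := by rintro rfl; have h1 := t.len; have h2 := q.len; omega
  have ki : k ≠ i := by rintro rfl; have h1 := t'.len; have h2 := q.len; omega
  have mi : m ≠ i := by rintro rfl; have h1 := t''.len; have h2 := q.len; omega
  have i3 : (φ i).length ≠ 3 := by have h2 := q.len; omega
  have hU : vs (blk φ e0) ⊆ {u, v, w, a, b} := by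
    rw [← blk_eq h0]
    refine vs_sub {e | cv (φ j) e ≠ 0 ∨ cv (φ k) e ≠ 0 ∨ cv (φ m) e ≠ 0} _
      (Or.inl ((t.edge _).2 (by simp))) ?_ ?_
    · rintro f hf g ⟨n, hn3, hnf, hng⟩
      have hn : n = j ∨ n = k ∨ n = m := by
        have ni : n ≠ i := by rintro rfl; exact i3 hn3
        rcases hf with hf | hf | hf
        · rcases (t.edge f).1 hf with rfl | rfl | rfl
          · have := C.fs.third hf ((q.edge _).2 (by simp)) ji hnf; tauto
          · have := C.fs.third hf ((t''.edge _).2 (by right; right; exact Sym2.eq_swap)) jm hnf; tauto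
          · have := C.fs.third hf ((t'.edge _).2 (by left; exact Sym2.eq_swap)) jk hnf; tauto
        · rcases (t'.edge f).1 hf with rfl | rfl | rfl
          · have := C.fs.third hf ((t.edge _).2 (by right; right; exact Sym2.eq_swap)) jk.symm hnf; tauto
          · have := wb3 n hnf hn3; tauto
          · have := C.fs.third hf ((q.edge _).2 (by simp)) ki hnf; tauto
        · rcases (t''.edge f).1 hf with rfl | rfl | rfl
          · have := C.fs.third hf ((q.edge _).2 (by simp)) mi hnf; tauto
          · have := wa3 n (by rw [Sym2.eq_swap]; exact hnf) hn3; tauto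
          · have := C.fs.third hf ((t.edge _).2 (by right; left; exact Sym2.eq_swap)) jm.symm hnf; tauto
      rcases hn with rfl | rfl | rfl
      · exact Or.inl hng
      · exact Or.inr (Or.inl hng)
      · exact Or.inr (Or.inr hng)
    · rintro e (he | he | he) x hx
      · have := (C.fs.cyc j).edge_mem he (x := x) hx
        rw [t.mem] at this
        simp; tauto
      · have := (C.fs.cyc k).edge_mem he (x := x) hx
        rw [t'.mem] at this
        simp; tauto
      · have := (C.fs.cyc m).edge_mem he (x := x) hx
        rw [t''.mem] at this
        simp; tauto
  have nd : [s(u, v), s(v, w), s(w, u), s(w, b), s(b, u), s(v, a), s(a, w)].Nodup := by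
    clear * - a1 a2 a3 a4 a5 a6 w1 w2 w3 w4
    simp
    grind
  have ndv : [u, v, w, a, b].Nodup := by
    clear * - a1 a2 a3 a4 a5 a6 w1 w2 w3 w4
    simp
    grind
  have eb1 := bj s(u, v) ((t.edge _).2 (by simp))
  have eb2 := bj s(v, w) ((t.edge _).2 (by simp))
  have eb3 := bj s(w, u) ((t.edge _).2 (by simp))
  have eb4 := bk s(w, b) ((t'.edge _).2 (by simp))
  have eb5 := bk s(b, u) ((t'.edge _).2 (by simp))
  have eb6 := bm s(v, a) ((t''.edge _).2 (by simp))
  have eb7 := bm s(a, w) ((t''.edge _).2 (by simp))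
  have ma : mu H φ a ≤ 1 / 2 := mu_sh hE C (mem_vs.2 ⟨_, eb6, by simp⟩) q.ab
    (fun h => hab (blk_onT hT _ h))
  have mb : mu H φ b ≤ 1 / 2 := mu_sh hE C (mem_vs.2 ⟨_, eb4, by simp⟩) q.ab.symm
    (fun h => hab (by rw [Sym2.eq_swap]; exact blk_onT hT _ h))
  have mw : mu H φ w ≤ 1 / 2 := by
    have hc6 : (vs (blk φ e0)).card < 6 := by
      have h1 := Finset.card_le_card hU
      have : ({u, v, w, a, b} : Finset V) = [u, v, w, a, b].toFinset := by simp
      rw [this, List.toFinset_card_of_nodup ndv] at h1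
      simp at h1; omega
    obtain ⟨x, hx, hxa, hxb, y, hy, hyB⟩ := exists_sh C hc6 (Or.inr q.ab) (mem_vs.2 ⟨_, eb6, by simp⟩)
      (mem_vs.2 ⟨_, eb4, by simp⟩) (a := w) (mem_vs.2 ⟨_, eb4, by simp⟩) w3 w4 (C.supp _ _ t.wu)
    have hx2 := hU hx
    simp only [Finset.mem_insert, Finset.mem_singleton] at hx2
    have : x = w := by
      rcases hx2 with rfl | rfl | rfl | rfl | rfl
      · exfalso
        rcases nu y hy with rfl | rfl | rfl
        · exact hyB eb1
        · exact hyB (by rw [Sym2.eq_swap]; exact eb3)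
        · exact hyB (by rw [Sym2.eq_swap]; exact eb5)
      · exfalso
        rcases nv y hy with rfl | rfl | rfl
        · exact hyB eb6
        · exact hyB eb2
        · exact hyB (by rw [Sym2.eq_swap]; exact eb1)
      · rfl
      · exact absurd rfl hxa
      · exact absurd rfl hxb
    subst this
    exact mu_sh hE C hx hy hyB
  refine block_of C hE hT [s(u, v), s(v, w), s(w, u), s(w, b), s(b, u), s(v, a), s(a, w)].toFinset
    [u, v, w, a, b].toFinset ?_ (by simpa using hU) ?_
  · intro e he
    simp only [List.mem_toFinset, List.mem_cons, List.not_mem_nil, or_false] at he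
    rcases he with rfl | rfl | rfl | rfl | rfl | rfl | rfl <;> assumption
  · rw [List.sum_toFinset _ nd, List.sum_toFinset _ ndv]
    simp only [List.map_cons, List.map_nil, List.sum_cons, List.sum_nil]
    have g1 := gift_bd C (blk_onT hT _ eb1) ((q.edge _).2 (by simp)) i3
    have g2 := gift_le C (blk_edge C.fs hE _ eb2)
    have g3 := gift_le C (blk_edge C.fs hE _ eb3)
    have g5 := gift_bd C (blk_onT hT _ eb5) ((q.edge _).2 (by simp)) i3
    have g6 := gift_bd C (blk_onT hT _ eb6) ((q.edge _).2 (by simp)) i3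
    have g4 : gift φ s(w, b) ≤ 12 := by
      obtain ⟨n, hn, hn', -⟩ := C.fs.other (i := k) (e := s(w, b)) ((t'.edge _).2 (by simp))
      exact gift_bd6 C (blk_onT hT _ eb4) hn' (fun h => hn (wb3 n hn' h)) (wb4 n hn')
    have g7 : gift φ s(a, w) ≤ 12 := by
      obtain ⟨n, hn, hn', -⟩ := C.fs.other (i := m) (e := s(a, w)) ((t''.edge _).2 (by simp))
      exact gift_bd6 C (blk_onT hT _ eb7) hn' (fun h => hn (wa3 n (by rw [Sym2.eq_swap]; exact hn') h))
        (wa4 n (by rw [Sym2.eq_swap]; exact hn'))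
    have := mu_le_one H φ u
    have := mu_le_one H φ v
    linarith

end

end Th

namespace Th

universe u
variable {V : Type u}

section
open Classical
variable [Fintype V] {ι : Type} [Fintype ι] {H : SimpleGraph V} {φ : ι → List V} {W : Set V} {hv : Set (Sym2 V)}

theorem not_onT_blk {e f : Sym2 V} (h : ¬ onT φ f) (hne : f ≠ e) : blk φ f ≠ blk φ e := by
  rw [blk_single (e := f) (fun i hi h3 => h ⟨i, h3, hi⟩)]
  intro h1
  have := mem_blk_self φ e
  rw [← h1] at this
  simp at this
  exact hne this.symm

theorem S2_second (C : Ctx H W φ hv) {i j k n : ι} {u v a b w : V} (q : Quad H (φ i) u v a b)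
    (t : Tri H (φ j) u v w) (t' : Tri H (φ k) u w b) (hva : ¬ onT φ s(v, a)) (hab : ¬ onT φ s(a, b))
    (hn : cv (φ n) s(v, w) ≠ 0) (hn4 : (φ n).length = 4) :
    gift φ s(v, w) ≤ 13 ∧ gift φ s(w, b) ≤ 13 ∧ mu H φ v ≤ 1 / 3 ∧ mu H φ b ≤ 1 / 3 := by
  obtain ⟨w1, w2, w3, w4⟩ := C.quad_apex q t
  have a1 := q.uv.ne
  have a2 := q.va.ne
  have a3 := q.ab.ne
  have a4 := q.bu.ne
  have a5 := q.ua
  have a6 := q.vb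
  have jk : j ≠ k := by
    rintro rfl
    have := (t.mem b).1 ((t'.mem b).2 (by simp)); grind
  have nu := (C.g3 q t t' jk).2
  obtain ⟨p, d, q'⟩ := (C.fs.cyc n).quad hn4 (u := w) (v := v) (by rw [Sym2.eq_swap]; exact hn)
  have hd := (C.g3 q' t.rot.swap t'.swap jk).1
  subst hd
  have hni : i ≠ n := by
    rintro rfl
    have := (q.mem w).1 ((q'.mem w).2 (by simp)); grind
  obtain ⟨u1, u2, u3, u4⟩ := C.quad_apex q' t.rot.swap
  have hup : ¬ H.Adj u p := by
    intro h
    have b1 := nu p h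
    have b2 := q'.va.ne
    have b3 := q'.ab.ne
    have b4 := q'.ua
    clear * - b1 b2 b3 b4
    grind
  have hvp : ¬ onT φ s(v, p) := by
    rintro ⟨m, hm3, hm⟩
    obtain ⟨s, tm⟩ := (C.fs.cyc m).tri hm3 hm
    have := C.same1 q' t.rot.swap tm
    subst this
    exact hup tm.vw.symm
  have hpb : ¬ onT φ s(p, b) := by
    rintro ⟨m, hm3, hm⟩
    obtain ⟨s, tm⟩ := (C.fs.cyc m).tri hm3 hm
    have := C.same2 q' t.rot.swap tm
    subst this
    exact hup tm.wu
  have hap : a ≠ p := by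
    rintro rfl
    have := C.share hni a6 ((q.edge s(a, v)).2 (by right; left; exact Sym2.eq_swap)) ((q.edge s(a, b)).2 (by simp))
      ((q'.edge s(a, v)).2 (by right; left; exact Sym2.eq_swap)) ((q'.edge s(a, b)).2 (by simp))
    have := q.len
    omega
  have htau := tau_two q' t.len ((t.edge _).2 (by right; left; exact Sym2.eq_swap)) t'.len
    ((t'.edge _).2 (by right; left; exact Sym2.eq_swap)) hvp hpb
  refine ⟨gift_q5 C t.len ((t.edge _).2 (by simp)) hn hn4 htau, gift_q5 C t'.len ((t'.edge _).2 (by simp))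
    ((q'.edge _).2 (by right; right; right; exact Sym2.eq_swap)) hn4 htau, ?_, ?_⟩
  · refine mu_third q.va q'.va q.uv.symm (not_onT_blk hva ?_) (not_onT_blk hva ?_) (not_onT_blk hvp ?_)
    all_goals (clear * - hap a5 u3 a2 a1; rw [Ne, Sym2.eq_iff]; grind)
  · have hba : ¬ onT φ s(b, a) := by rw [Sym2.eq_swap]; exact hab
    have hbp : ¬ onT φ s(b, p) := by rw [Sym2.eq_swap]; exact hpb
    refine mu_third q.ab.symm q'.ab.symm q.bu (not_onT_blk hba ?_) (not_onT_blk hba ?_) (not_onT_blk hbp ?_)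
    all_goals (clear * - hap a5 u3 a3 a4; rw [Ne, Sym2.eq_iff]; grind)

theorem block_S2 (C : Ctx H W φ hv) {i j k : ι} {u v a b w : V} (q : Quad H (φ i) u v a b)
    (t : Tri H (φ j) u v w) (t' : Tri H (φ k) u w b) (hva : ¬ onT φ s(v, a)) (hab : ¬ onT φ s(a, b)) {e0 : Sym2 V}
    (hE : e0 ∈ H.edgeSet) (hT : onT φ e0) (h0 : s(u, v) ∈ blk φ e0) :
    6 * ∑ v ∈ vs (blk φ e0), mu H φ v ≤ ∑ e ∈ blk φ e0, (17 - gift φ e - if e ∈ hv then 2 else 0) := by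
  obtain ⟨w1, w2, w3, w4⟩ := C.quad_apex q t
  have a1 := q.uv.ne
  have a2 := q.va.ne
  have a3 := q.ab.ne
  have a4 := q.bu.ne
  have a5 := q.ua
  have a6 := q.vb
  have jk : j ≠ k := by
    rintro rfl
    have := (t.mem b).1 ((t'.mem b).2 (by simp)); grind
  have wb3 : ∀ n, cv (φ n) s(w, b) ≠ 0 → (φ n).length = 3 → n = k := by
    intro n hn hn3
    by_contra hnk
    obtain ⟨s, tn⟩ := (C.fs.cyc n).tri hn3 hn
    have := (C.g3 q.rot.rot.rot t'.rot.rot tn.swap (Ne.symm hnk)).1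
    subst this
    exact hab ⟨n, hn3, (tn.edge _).2 (by right; left; exact Sym2.eq_swap)⟩
  have vw3 : ∀ n, cv (φ n) s(v, w) ≠ 0 → (φ n).length = 3 → n = j := by
    intro n hn hn3
    by_contra hnk
    obtain ⟨s, tn⟩ := (C.fs.cyc n).tri hn3 hn
    have := (C.g3 q.rev t.swap tn (Ne.symm hnk)).1
    subst this
    exact hva ⟨n, hn3, (tn.edge _).2 (by right; right; exact Sym2.eq_swap)⟩
  have bj : ∀ e, cv (φ j) e ≠ 0 → e ∈ blk φ e0 := fun e he' =>
    blk_step h0 ⟨j, t.len, (t.edge _).2 (by simp), he'⟩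
  have bk : ∀ e, cv (φ k) e ≠ 0 → e ∈ blk φ e0 := fun e he' =>
    blk_step (bj s(w, u) ((t.edge _).2 (by simp))) ⟨k, t'.len, (t'.edge _).2 (by left; exact Sym2.eq_swap), he'⟩
  have ji : j ≠ i := by rintro rfl; have h1 := t.len; have h2 := q.len; omega
  have ki : k ≠ i := by rintro rfl; have h1 := t'.len; have h2 := q.len; omega
  have i3 : (φ i).length ≠ 3 := by have h2 := q.len; omega
  have hU : vs (blk φ e0) ⊆ {u, v, w, b} := by
    rw [← blk_eq h0]
    refine vs_sub {e | cv (φ j) e ≠ 0 ∨ cv (φ k) e ≠ 0} _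
      (Or.inl ((t.edge _).2 (by simp))) ?_ ?_
    · rintro f hf g ⟨n, hn3, hnf, hng⟩
      have hn : n = j ∨ n = k := by
        have ni : n ≠ i := by rintro rfl; exact i3 hn3
        rcases hf with hf | hf
        · rcases (t.edge f).1 hf with rfl | rfl | rfl
          · have := C.fs.third hf ((q.edge _).2 (by simp)) ji hnf; tauto
          · have := vw3 n hnf hn3; tauto
          · have := C.fs.third hf ((t'.edge _).2 (by left; exact Sym2.eq_swap)) jk hnf; tauto
        · rcases (t'.edge f).1 hf with rfl | rfl | rfl
          · have := C.fs.third hf ((t.edge _).2 (by right; right; exact Sym2.eq_swap)) jk.symm hnf; tauto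
          · have := wb3 n hnf hn3; tauto
          · have := C.fs.third hf ((q.edge _).2 (by simp)) ki hnf; tauto
      rcases hn with rfl | rfl
      · exact Or.inl hng
      · exact Or.inr hng
    · rintro e (he | he) x hx
      · have := (C.fs.cyc j).edge_mem he (x := x) hx
        rw [t.mem] at this
        simp; tauto
      · have := (C.fs.cyc k).edge_mem he (x := x) hx
        rw [t'.mem] at this
        simp; tauto
  have nd : [s(u, v), s(v, w), s(w, u), s(w, b), s(b, u)].Nodup := by
    clear * - a1 a2 a3 a4 a5 a6 w1 w2 w3 w4
    simp
    grind
  have ndv : [u, v, w, b].Nodup := by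
    clear * - a1 a2 a3 a4 a5 a6 w1 w2 w3 w4
    simp
    grind
  have eb1 := bj s(u, v) ((t.edge _).2 (by simp))
  have eb2 := bj s(v, w) ((t.edge _).2 (by simp))
  have eb3 := bj s(w, u) ((t.edge _).2 (by simp))
  have eb4 := bk s(w, b) ((t'.edge _).2 (by simp))
  have eb5 := bk s(b, u) ((t'.edge _).2 (by simp))
  have hba : ¬ onT φ s(b, a) := by rw [Sym2.eq_swap]; exact hab
  have hav : ¬ onT φ s(a, v) := by rw [Sym2.eq_swap]; exact hva
  have htau := tau_two q t.len ((t.edge _).2 (by simp)) t'.len ((t'.edge _).2 (by simp)) hva hab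
  have key : gift φ s(v, w) + gift φ s(w, b) + 6 * mu H φ v + 6 * mu H φ b ≤ 30 := by
    obtain ⟨n, hn, hn', -⟩ := C.fs.other (i := j) (e := s(v, w)) ((t.edge _).2 (by simp))
    obtain ⟨m, hm, hm', -⟩ := C.fs.other (i := k) (e := s(w, b)) ((t'.edge _).2 (by simp))
    by_cases n4 : (φ n).length = 4
    · obtain ⟨h1, h2, h3, h4⟩ := S2_second C q t t' hva hab hn' n4
      linarith
    by_cases m4 : (φ m).length = 4
    · obtain ⟨h1, h2, h3, h4⟩ := S2_second C q.rev.rot t'.swap.rot t.swap.rot hba hav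
        (by rw [Sym2.eq_swap]; exact hm') m4
      rw [Sym2.eq_swap] at h1 h2
      linarith
    have h1 := gift_bd6 C (blk_onT hT _ eb2) hn' (fun h => hn (vw3 n hn' h)) n4
    have h2 := gift_bd6 C (blk_onT hT _ eb4) hm' (fun h => hm (wb3 m hm' h)) m4
    have mv : mu H φ v ≤ 1 / 2 := mu_sh hE C (mem_vs.2 ⟨_, eb2, by simp⟩) q.va
      (fun h => hva (blk_onT hT _ h))
    have mb : mu H φ b ≤ 1 / 2 := mu_sh hE C (mem_vs.2 ⟨_, eb4, by simp⟩) q.ab.symm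
      (fun h => hba (blk_onT hT _ h))
    linarith
  refine block_of C hE hT [s(u, v), s(v, w), s(w, u), s(w, b), s(b, u)].toFinset
    [u, v, w, b].toFinset ?_ (by simpa using hU) ?_
  · intro e he
    simp only [List.mem_toFinset, List.mem_cons, List.not_mem_nil, or_false] at he
    rcases he with rfl | rfl | rfl | rfl | rfl <;> assumption
  · rw [List.sum_toFinset _ nd, List.sum_toFinset _ ndv]
    simp only [List.map_cons, List.map_nil, List.sum_cons, List.sum_nil]
    have g1 := gift_q5 C t.len ((t.edge s(u, v)).2 (by simp)) ((q.edge _).2 (by simp)) q.len htau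
    have g3 := gift_le C (blk_edge C.fs hE _ eb3)
    have g5 := gift_q5 C t'.len ((t'.edge s(b, u)).2 (by simp)) ((q.edge _).2 (by simp)) q.len htau
    have := mu_le_one H φ u
    have := mu_le_one H φ w
    linarith

/-- 4-face, triangle and a second triangle on uw -/
theorem block_4a (C : Ctx H W φ hv) {i j k : ι} {u v a b w : V} (q : Quad H (φ i) u v a b)
    (t : Tri H (φ j) u v w) (hk3 : (φ k).length = 3) (hk : cv (φ k) s(u, w) ≠ 0) (hjk : j ≠ k) {e0 : Sym2 V}
    (hE : e0 ∈ H.edgeSet) (hT : onT φ e0) (h0 : s(u, v) ∈ blk φ e0) :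
    6 * ∑ v ∈ vs (blk φ e0), mu H φ v ≤ ∑ e ∈ blk φ e0, (17 - gift φ e - if e ∈ hv then 2 else 0) := by
  obtain ⟨z, t'⟩ := (C.fs.cyc k).tri hk3 hk
  have := (C.g3 q t t' hjk).1
  subst this
  by_cases hva : onT φ s(v, a)
  · obtain ⟨m, hm3, hm⟩ := hva
    obtain ⟨s, tm⟩ := (C.fs.cyc m).tri hm3 hm
    have := C.same1 q t tm
    subst this
    exact block_S3 C q t t' tm hE hT h0
  by_cases hab : onT φ s(a, z)
  · obtain ⟨m, hm3, hm⟩ := hab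
    obtain ⟨s, tm⟩ := (C.fs.cyc m).tri hm3 hm
    have := C.same2 q t tm
    subst this
    refine block_S3 C q.rot.rot.rot t'.rot.rot tm.rot t hE hT ?_
    refine blk_step (f := s(s, u)) (blk_step h0 ⟨j, t.len, (t.edge _).2 (by simp), (t.edge _).2 (by simp)⟩)
      ⟨k, t'.len, (t'.edge _).2 (by left; exact Sym2.eq_swap), (t'.edge _).2 (by simp)⟩
  exact block_S2 C q t t' hva hab hE hT h0

theorem block_all (C : Ctx H W φ hv) {e0 : Sym2 V} (hE : e0 ∈ H.edgeSet) :
    6 * ∑ v ∈ vs (blk φ e0), mu H φ v ≤ ∑ e ∈ blk φ e0, (17 - gift φ e - if e ∈ hv then 2 else 0) := by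
  by_cases hT : onT φ e0
  swap
  · exact block_T0 C hE (fun i hi h3 => hT ⟨i, h3, hi⟩)
  by_cases h4 : ∀ e ∈ blk φ e0, ∀ i, cv (φ i) e ≠ 0 → (φ i).length ≠ 4
  · obtain ⟨i, h3, hi⟩ := hT
    by_cases hc : ∀ e, cv (φ i) e ≠ 0 → ∀ j, cv (φ j) e ≠ 0 → (φ j).length = 3 → j = i
    · induction e0 with
      | _ x y =>
        obtain ⟨w, t⟩ := (C.fs.cyc i).tri h3 hi
        exact block_T1 C t hc hi
    · obtain ⟨U, hU, hcard⟩ := struct C h3 hi hc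
      exact big C hE ⟨i, h3, hi⟩ h4 U hU hcard
  push Not at h4
  obtain ⟨e, he, i, hi, hi4⟩ := h4
  obtain ⟨j, hj3, hj⟩ := blk_onT hT e he
  induction e with
  | _ u v =>
  obtain ⟨a, b, q⟩ := (C.fs.cyc i).quad hi4 hi
  obtain ⟨w, t⟩ := (C.fs.cyc j).tri hj3 hj
  by_cases hc : ∀ e, cv (φ j) e ≠ 0 → ∀ k, cv (φ k) e ≠ 0 → (φ k).length = 3 → k = j
  · rw [← blk_eq he]
    exact block_T1 C t hc hj
  push Not at hc
  obtain ⟨f, hf, k, hk, hk3, hkj⟩ := hc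
  rcases (t.edge f).1 hf with rfl | rfl | rfl
  · have := C.fs.third hi hj (by rintro rfl; omega) hk
    rcases this with rfl | rfl
    · omega
    · exact absurd rfl hkj
  · exact block_4a C q.rev t.swap hk3 hk hkj.symm hE hT (by rw [Sym2.eq_swap]; exact he)
  · exact block_4a C q t hk3 (by rw [Sym2.eq_swap]; exact hk) hkj.symm hE hT he

theorem Ctx.main (C : Ctx H W φ hv) : 7 * H.edgeSet.ncard + 2 * hv.ncard + 48 ≤ 18 * W.ncard :=
  discharge C (fun _ he => block_all C he)

end

end Th

namespace Th

universe u
variable {V : Type u}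

/-- restriction of `G` to `W` -/
def res (G : SimpleGraph V) (W : Set V) : SimpleGraph V where
  Adj x y := G.Adj x y ∧ x ∈ W ∧ y ∈ W
  symm := ⟨fun _ _ h => ⟨h.1.symm, h.2.2, h.2.1⟩⟩
  loopless := ⟨fun x h => G.loopless.irrefl x h.1⟩

theorem res_le (G : SimpleGraph V) (W : Set V) : res G W ≤ G := fun _ _ h => h.1

theorem conn_res {G : SimpleGraph V} {W A : Set V} (hA : A ⊆ W) (h : Conn G A) : Conn (res G W) A := by
  intro S hS h1 h2
  obtain ⟨x, hx, y, hy, hxy⟩ := h S hS h1 h2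
  exact ⟨x, hx, y, hy, hxy, hA (hS hx), hA hy.1⟩

theorem theta_mono {G H : SimpleGraph V} (h : H ≤ G) (hG : ¬ HasTheta6 G) : ¬ HasTheta6 H := by
  rintro ⟨v, h1, h2, i, j, h3, h4, h5, h6⟩
  exact hG ⟨v, h1, fun i => h (h2 i), i, j, h3, h4, h5, h h6⟩

/-- number of edges inside `W` -/
noncomputable def eW (G : SimpleGraph V) (W : Set V) : ℕ := (res G W).edgeSet.ncard

theorem mem_res {G : SimpleGraph V} {W : Set V} {x y : V} :
    s(x, y) ∈ (res G W).edgeSet ↔ G.Adj x y ∧ x ∈ W ∧ y ∈ W := Iff.rfl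

def P2 (G : SimpleGraph V) (X : Set V) (u v : V) : Prop := ∃ x ∈ X, G.Adj u x ∧ G.Adj x v
def P3 (G : SimpleGraph V) (X : Set V) (u v : V) : Prop :=
  ∃ x ∈ X, ∃ y ∈ X, G.Adj u x ∧ G.Adj x y ∧ G.Adj y v
def P4 (G : SimpleGraph V) (X : Set V) (u v : V) : Prop :=
  ∃ x ∈ X, ∃ y ∈ X, ∃ z ∈ X, x ≠ z ∧ G.Adj u x ∧ G.Adj x y ∧ G.Adj y z ∧ G.Adj z v

theorem th33 {G : SimpleGraph V} (hth : ¬ HasTheta6 G) {X Y : Set V} {u v : V} (huv : G.Adj u v)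
    (hX : ∀ x ∈ X, x ≠ u ∧ x ≠ v ∧ x ∉ Y) (hY : ∀ x ∈ Y, x ≠ u ∧ x ≠ v) (h1 : P3 G X u v) (h2 : P3 G Y u v) :
    False := by
  obtain ⟨x, hx, y, hy, a1, a2, a3⟩ := h1
  obtain ⟨x', hx', y', hy', b1, b2, b3⟩ := h2
  refine theta_long hth (a := u) (b := x) (c := y) (d := v) (e := y') (f := x') ?_ a1 a2 a3 b3.symm b2.symm b1.symm huv
  have := a2.ne
  have := b2.ne
  have := huv.ne
  have := hX x hx
  have := hX y hy
  have := hY x' hx'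
  have := hY y' hy'
  clear * - this hx' hy' hX hY hx hy a2 b2 huv
  have := a2.ne
  have := b2.ne
  have := huv.ne
  simp
  grind

theorem th24 {G : SimpleGraph V} (hth : ¬ HasTheta6 G) {X Y : Set V} {u v : V} (huv : G.Adj u v)
    (hX : ∀ x ∈ X, x ≠ u ∧ x ≠ v ∧ x ∉ Y) (hY : ∀ x ∈ Y, x ≠ u ∧ x ≠ v) (h1 : P2 G X u v) (h2 : P4 G Y u v) :
    False := by
  obtain ⟨x, hx, a1, a2⟩ := h1
  obtain ⟨x', hx', y', hy', z', hz', b0, b1, b2, b3, b4⟩ := h2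
  refine theta_short hth (a := u) (b := x) (c := v) (d := z') (e := y') (f := x') ?_ a1 a2 b4.symm b3.symm b2.symm b1.symm huv
  have := b3.ne
  have := b2.ne
  have := huv.ne
  simp
  grind

section
variable [Finite V] {G : SimpleGraph V} {W : Set V}

theorem eW_union {A B : Set V} (h : ∀ x y, G.Adj x y → x ∈ W → y ∈ W → (x ∈ A ∧ y ∈ A) ∨ (x ∈ B ∧ y ∈ B)) :
    eW G W ≤ eW G A + eW G B := by
  refine le_trans (Set.ncard_le_ncard (t := (res G A).edgeSet ∪ (res G B).edgeSet) ?_) (Set.ncard_union_le _ _)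
  intro e he
  induction e with
  | _ x y =>
    rw [mem_res] at he
    rw [Set.mem_union, mem_res, mem_res]
    have := h x y he.1 he.2.1 he.2.2
    tauto

theorem eW_union2 {A B : Set V} (h : ∀ x y, G.Adj x y → x ∈ W → y ∈ W → (x ∈ A ∧ y ∈ A) ∨ (x ∈ B ∧ y ∈ B))
    {u v : V} (huv : G.Adj u v) (h1 : u ∈ A) (h2 : v ∈ A) (h3 : u ∈ B) (h4 : v ∈ B) :
    eW G W + 1 ≤ eW G A + eW G B := by
  have := Set.ncard_union_add_ncard_inter (res G A).edgeSet (res G B).edgeSet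
  have h5 : 0 < ((res G A).edgeSet ∩ (res G B).edgeSet).ncard := by
    rw [Set.ncard_pos]
    exact ⟨s(u, v), mem_res.2 ⟨huv, h1, h2⟩, mem_res.2 ⟨huv, h3, h4⟩⟩
  have h6 : eW G W ≤ ((res G A).edgeSet ∪ (res G B).edgeSet).ncard := by
    refine Set.ncard_le_ncard ?_
    intro e he
    induction e with
    | _ x y =>
      rw [mem_res] at he
      rw [Set.mem_union, mem_res, mem_res]
      have := h x y he.1 he.2.1 he.2.2
      tauto
  unfold eW at *
  omega

theorem eW_remove (w : V) (N : Set V) (hN : ∀ z ∈ W, G.Adj w z → z ∈ N) :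
    eW G W ≤ eW G (W \ {w}) + N.ncard := by
  have h1 : (res G W).edgeSet ⊆ (res G (W \ {w})).edgeSet ∪ (fun z => s(w, z)) '' N := by
    intro e he
    induction e with
    | _ x y =>
      rw [mem_res] at he
      rw [Set.mem_union, mem_res]
      by_cases hx : x = w
      · subst hx; exact Or.inr ⟨y, hN y he.2.2 he.1, rfl⟩
      by_cases hy : y = w
      · subst hy; exact Or.inr ⟨x, hN x he.2.1 he.1.symm, Sym2.eq_swap⟩
      exact Or.inl ⟨he.1, ⟨he.2.1, hx⟩, ⟨he.2.2, hy⟩⟩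
  have h2 := Set.ncard_le_ncard h1
  have h3 := Set.ncard_union_le (res G (W \ {w})).edgeSet ((fun z => s(w, z)) '' N)
  have h4 := Set.ncard_image_le (f := (fun z => s(w, z))) (s := N) (Set.toFinite _)
  unfold eW
  omega

theorem eW_empty : eW G (∅ : Set V) = 0 := by
  unfold eW
  rw [Set.ncard_eq_zero]
  ext e
  induction e with
  | _ x y => rw [mem_res]; simp

theorem eW_choose : ∀ n, ∀ W : Set V, W.ncard = n → eW G W ≤ n * (n - 1) / 2 := by
  intro n
  induction n with
  | zero =>
    intro W hW
    rw [Set.ncard_eq_zero] at hW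
    subst hW; simp [eW_empty]
  | succ n ih =>
    intro W hW
    obtain ⟨w, hw⟩ : W.Nonempty := by rw [← Set.ncard_pos]; omega
    have h1 : (W \ {w}).ncard = n := by rw [Set.ncard_sdiff_singleton_of_mem hw]; omega
    have h2 := eW_remove (G := G) (W := W) w (W \ {w}) (fun z hz hwz => ⟨hz, hwz.ne'⟩)
    have h3 := ih _ h1
    rw [h1] at h2
    have h4 : (n + 1) * (n + 1 - 1) = n * (n - 1) + n * 2 := by
      cases n with
      | zero => rfl
      | succ m => simp; ring
    rw [h4, Nat.add_mul_div_right _ _ (by omega)]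
    omega

/-- all pairs in `A` but at most one are adjacent -/
def AC (G : SimpleGraph V) (A : Set V) : Prop :=
  ∀ a ∈ A, ∀ b ∈ A, ∀ c ∈ A, ∀ d ∈ A, a ≠ b → c ≠ d → ¬ G.Adj a b → ¬ G.Adj c d → s(a, b) = s(c, d)

theorem ac_of {A : Set V} (hA : A.ncard * (A.ncard - 1) / 2 ≤ eW G A + 1) : AC G A := by
  intro a ha b hb c hc d hd hab hcd h1 h2
  by_contra hne
  -- add both edges
  let G' : SimpleGraph V := G ⊔ (SimpleGraph.fromEdgeSet {s(a, b), s(c, d)})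
  have h3 := eW_choose (G := G') A.ncard A rfl
  have h4 : insert s(a, b) (insert s(c, d) (res G A).edgeSet) ⊆ (res G' A).edgeSet := by
    rintro e (rfl | rfl | he)
    · refine mem_res.2 ⟨Or.inr ?_, ha, hb⟩
      simp [hab]
    · refine mem_res.2 ⟨Or.inr ?_, hc, hd⟩
      simp [hcd]
    · induction e with
      | _ x y => exact ⟨Or.inl he.1, he.2⟩
  have h5 := Set.ncard_le_ncard h4
  rw [Set.ncard_insert_of_notMem, Set.ncard_insert_of_notMem] at h5
  · unfold eW at *
    omega
  · intro h; exact h2 h.1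
  · rintro (h | h)
    · exact hne h
    · exact h1 h.1

theorem complete_of {A : Set V} (hA : A.ncard * (A.ncard - 1) / 2 ≤ eW G A) : ∀ a ∈ A, ∀ b ∈ A, a ≠ b → G.Adj a b := by
  intro a ha b hb hab
  by_contra h1
  let G' : SimpleGraph V := G ⊔ (SimpleGraph.fromEdgeSet {s(a, b)})
  have h3 := eW_choose (G := G') A.ncard A rfl
  have h4 : insert s(a, b) (res G A).edgeSet ⊆ (res G' A).edgeSet := by
    rintro e (rfl | he)
    · refine mem_res.2 ⟨Or.inr ?_, ha, hb⟩
      simp [hab]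
    · induction e with
      | _ x y => exact ⟨Or.inl he.1, he.2⟩
  have h5 := Set.ncard_le_ncard h4
  rw [Set.ncard_insert_of_notMem] at h5
  · unfold eW at *
    omega
  · intro h; exact h1 h.1

theorem five_of {A : Set V} (hA : A.ncard = 5) {p q : V} (hp : p ∈ A) (hq : q ∈ A) (hpq : p ≠ q) :
    ∃ a b c, A = {p, q, a, b, c} ∧ [p, q, a, b, c].Nodup := by
  have h1 : (A \ {p, q}).ncard = 3 := by
    rw [Set.ncard_sdiff (by rintro x (rfl | rfl) <;> assumption), Set.ncard_pair hpq, hA]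
  obtain ⟨a, b, c, h2, h3, h4, h5⟩ := Set.ncard_eq_three.1 h1
  have ha : a ∈ A \ {p, q} := by rw [h5]; simp
  have hb : b ∈ A \ {p, q} := by rw [h5]; simp
  have hc : c ∈ A \ {p, q} := by rw [h5]; simp
  refine ⟨a, b, c, ?_, ?_⟩
  · have : A = {p, q} ∪ (A \ {p, q}) := by
      rw [Set.union_sdiff_cancel]; rintro x (rfl | rfl) <;> assumption
    rw [this, h5]
    ext x; simp; tauto
  · simp only [Set.mem_sdiff, Set.mem_insert_iff, Set.mem_singleton_iff] at ha hb hc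
    simp
    grind

theorem eW_five (hp : IsPlanar G) {A : Set V} (hA : A.ncard = 5) : eW G A ≤ 9 := by
  by_contra hcon
  have h := complete_of (G := G) (A := A) (by rw [hA]; norm_num; omega)
  obtain ⟨p, hpA, q, hqA, hpq⟩ := Set.one_lt_ncard_iff_nontrivial.1 (by omega : 1 < A.ncard)
  obtain ⟨a, b, c, hE, nd⟩ := five_of hA hpA hqA hpq
  have e : ∀ x ∈ A, ∀ y ∈ A, x ≠ y → Lk G {x} {y} := fun x hx y hy hxy => ⟨x, rfl, y, rfl, h x hx y hy hxy⟩
  rw [hE] at e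
  simp at nd
  refine no_K5 hp (conn_singleton _ p) (conn_singleton _ q) (conn_singleton _ a) (conn_singleton _ b)
    (conn_singleton _ c) ?_ ?_ ?_ ?_ ?_ ?_ ?_ ?_ ?_ ?_ ?_ ?_ ?_ ?_ ?_ ?_ ?_ ?_ ?_ ?_
  all_goals first
    | exact e _ (by simp) _ (by simp) (by tauto)
    | (rw [Set.disjoint_singleton]; tauto)

end

end Th

namespace Th

universe u
variable {V : Type u}

structure Dec (G : SimpleGraph V) (W : Set V) (hv : Set (Sym2 V)) : Prop where
  c2 : ∀ x, Conn G (W \ {x})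
  card : 6 ≤ W.ncard
  hvE : ∀ u v, s(u, v) ∈ hv → G.Adj u v ∧ u ∈ W ∧ v ∈ W
  hvP : ∀ u v, s(u, v) ∈ hv → ¬ P2 G (W \ {u, v}) u v ∧ ¬ P3 G (W \ {u, v}) u v ∧ ¬ P4 G (W \ {u, v}) u v
  deg : ∀ v ∈ W, (∃ e ∈ hv, v ∈ e) ∨ ∀ x y, ∃ z ∈ W, G.Adj v z ∧ z ≠ x ∧ z ≠ y
  cut : ∀ u v X Y, G.Adj u v → Sep G W u v X Y →
    (X.ncard = 3 ∧ eW G (X ∪ {u, v}) = 9 ∧ ∀ e ∈ hv, ∀ x ∈ e, x ∉ X) ∨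
    (Y.ncard = 3 ∧ eW G (Y ∪ {u, v}) = 9 ∧ ∀ e ∈ hv, ∀ x ∈ e, x ∉ Y)

theorem lemmaD [Fintype V] {G : SimpleGraph V} {W : Set V} {hv : Set (Sym2 V)} (hp : IsPlanar G)
    (hth : ¬ HasTheta6 G) (D : Dec G W hv) (h3 : ∀ u v, G.Adj u v → Conn G (W \ {u, v})) :
    7 * eW G W + 2 * hv.ncard + 48 ≤ 18 * W.ncard := by
  have c2 : ∀ x, Conn (res G W) (W \ {x}) := fun x => conn_res Set.sdiff_subset (D.c2 x)
  have supp : ∀ x y, (res G W).Adj x y → x ∈ W := fun x y h => h.2.1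
  obtain ⟨F, hF⟩ := mac_2conn W.ncard (res G W) W (IsPlanar.mono hp (res_le G W)) supp c2
    (by have := D.card; omega) rfl
  obtain ⟨n, φ, fs⟩ := hF.fs
  have C : Ctx (res G W) W φ hv := by
    refine ⟨fs, supp, c2, fun x y h => conn_res Set.sdiff_subset (h3 x y h.1), D.card,
      theta_mono (res_le G W) hth, ?_, ?_, ?_⟩
    · intro e he
      induction e with
      | _ x y => exact D.hvE x y he
    · intro i e he hi
      induction e with
      | _ u v =>
      obtain ⟨n2, n3, n4⟩ := D.hvP u v he
      have hl := (fs.cyc i).len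
      by_contra hcon
      have : (φ i).length = 3 ∨ (φ i).length = 4 ∨ (φ i).length = 5 := by omega
      rcases this with hl | hl | hl
      · obtain ⟨w, t⟩ := (fs.cyc i).tri hl hi
        exact n2 ⟨w, ⟨t.wu.2.1, by have := t.wu.ne; have := t.vw.ne'; simp; tauto⟩, t.wu.1.symm, t.vw.1.symm⟩
      · obtain ⟨a, b, q⟩ := (fs.cyc i).quad hl hi
        refine n3 ⟨b, ⟨q.bu.2.1, ?_⟩, a, ⟨q.ab.2.1, ?_⟩, q.bu.1.symm, q.ab.1.symm, q.va.1.symm⟩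
        · have := q.bu.ne; have := q.vb.symm; simp; tauto
        · have := q.va.ne'; have := q.ua.symm; simp; tauto
      · obtain ⟨s, hs⟩ := (fs.cyc i).edge_start hi
        have hlen := hs.len
        rw [hl] at hlen
        match s, hs, hlen with
        | [a, b, c], hs, _ =>
          have h1 := hs.cyc.2.1
          have h2 := hs.cyc.nd
          simp at h1 h2
          refine n4 ⟨c, ⟨h1.2.2.2.2.2.1, ?_⟩, b, ⟨h1.2.2.2.1.2.1, ?_⟩, a, ⟨h1.2.1.2.2, ?_⟩, ?_,
            h1.2.2.2.2.1.symm, h1.2.2.2.1.1.symm, h1.2.2.1.1.symm, h1.2.1.1.symm⟩ <;> simp <;> grind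
    · intro v hvW
      rcases D.deg v hvW with h | h
      · exact Or.inl h
      · refine Or.inr fun x y => ?_
        obtain ⟨z, hz, h1, h2⟩ := h x y
        exact ⟨z, ⟨h1, hvW, hz⟩, h2⟩
  exact C.main

theorem P2.mono {G : SimpleGraph V} {X Y : Set V} {u v : V} (h : X ⊆ Y) (hP : P2 G X u v) : P2 G Y u v := by
  obtain ⟨x, hx, h1⟩ := hP
  exact ⟨x, h hx, h1⟩
theorem P3.mono {G : SimpleGraph V} {X Y : Set V} {u v : V} (h : X ⊆ Y) (hP : P3 G X u v) : P3 G Y u v := by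
  obtain ⟨x, hx, y, hy, h1⟩ := hP
  exact ⟨x, h hx, y, h hy, h1⟩
theorem P4.mono {G : SimpleGraph V} {X Y : Set V} {u v : V} (h : X ⊆ Y) (hP : P4 G X u v) : P4 G Y u v := by
  obtain ⟨x, hx, y, hy, z, hz, h1⟩ := hP
  exact ⟨x, h hx, y, h hy, z, h hz, h1⟩

theorem P4.symm {G : SimpleGraph V} {X : Set V} {u v : V} (hP : P4 G X u v) : P4 G X v u := by
  obtain ⟨x, hx, y, hy, z, hz, h0, h1, h2, h3, h4⟩ := hP
  exact ⟨z, hz, y, hy, x, hx, h0.symm, h4.symm, h3.symm, h2.symm, h1.symm⟩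
theorem P3.symm {G : SimpleGraph V} {X : Set V} {u v : V} (hP : P3 G X u v) : P3 G X v u := by
  obtain ⟨x, hx, y, hy, h1, h2, h3⟩ := hP
  exact ⟨y, hy, x, hx, h3.symm, h2.symm, h1.symm⟩
theorem P2.symm {G : SimpleGraph V} {X : Set V} {u v : V} (hP : P2 G X u v) : P2 G X v u := by
  obtain ⟨x, hx, h1, h2⟩ := hP
  exact ⟨x, hx, h2.symm, h1.symm⟩

/-- a pod contains all short paths -/
theorem pod_paths [Finite V] {G : SimpleGraph V} {X : Set V} {u v : V} (huv : G.Adj u v) (hu : u ∉ X) (hv : v ∉ X)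
    (hX : X.ncard = 3) (he : eW G (X ∪ {u, v}) = 9) : P2 G X u v ∧ P3 G X u v ∧ P4 G X u v := by
  obtain ⟨a, b, c, hab, hac, hbc, rfl⟩ := Set.ncard_eq_three.1 hX
  have h5 : (({a, b, c} : Set V) ∪ {u, v}).ncard = 5 := by
    rw [Set.ncard_union_eq, hX, Set.ncard_pair huv.ne]
    rw [Set.disjoint_left]
    rintro x hx (rfl | rfl)
    · exact hu hx
    · exact hv hx
  have hac' : AC G (({a, b, c} : Set V) ∪ {u, v}) := ac_of (by rw [h5, he])
  have huv' := huv.ne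
  simp only [Set.mem_insert_iff, Set.mem_singleton_iff, not_or] at hu hv
  -- the missing edge misses two of the three vertices, or the situation is symmetric
  have key : ∀ m s t, m ∈ ({a, b, c} : Set V) → s ∈ ({a, b, c} : Set V) → t ∈ ({a, b, c} : Set V) →
      m ≠ s → m ≠ t → s ≠ t → G.Adj u s → G.Adj v s → G.Adj u t → G.Adj v t → G.Adj m s → G.Adj m t →
      (G.Adj u m ∨ G.Adj s t) → P2 G ({a, b, c} : Set V) u v ∧ P3 G ({a, b, c} : Set V) u v ∧ P4 G ({a, b, c} : Set V) u v := by
    intro m s t hm hs ht h1 h2 h3 us vs ut vt ms mt ho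
    refine ⟨⟨s, hs, us, vs.symm⟩, ?_, s, hs, m, hm, t, ht, h3, us, ms.symm, mt, vt.symm⟩
    rcases ho with ho | ho
    · exact ⟨m, hm, s, hs, ho, ms, vs.symm⟩
    · exact ⟨s, hs, t, ht, us, ho, vt.symm⟩
  have fact : ∀ x ∈ ({a, b, c} : Set V) ∪ {u, v}, ∀ y ∈ ({a, b, c} : Set V) ∪ {u, v}, x ≠ y → ¬ G.Adj x y →
    ∀ z ∈ ({a, b, c} : Set V) ∪ {u, v}, ∀ w ∈ ({a, b, c} : Set V) ∪ {u, v}, z ≠ w → 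
      ¬ (z = x ∧ w = y ∨ z = y ∧ w = x) → G.Adj z w := by
    intro x hx y hy hxy h1 z hz w hw hzw h2
    by_contra h3
    have := hac' z hz w hw x hx y hy hzw hxy h3 h1
    rw [Sym2.eq_iff] at this
    exact h2 this
  have ma : a ∈ ({a, b, c} : Set V) ∪ {u, v} := by simp
  have mb : b ∈ ({a, b, c} : Set V) ∪ {u, v} := by simp
  have mc : c ∈ ({a, b, c} : Set V) ∪ {u, v} := by simp
  have mu : u ∈ ({a, b, c} : Set V) ∪ {u, v} := by simp
  have mv : v ∈ ({a, b, c} : Set V) ∪ {u, v} := by simp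
  -- choose the middle
  have mid : ∀ m s t, m ∈ ({a, b, c} : Set V) → s ∈ ({a, b, c} : Set V) → t ∈ ({a, b, c} : Set V) →
      m ≠ s → m ≠ t → s ≠ t → (¬ G.Adj u m ∨ ¬ G.Adj v m ∨ ¬ G.Adj s t) → 
      P2 G ({a, b, c} : Set V) u v ∧ P3 G ({a, b, c} : Set V) u v ∧ P4 G ({a, b, c} : Set V) u v := by
    intro m s t hm hs ht h1 h2 h3 hbad
    have nm : ∀ x ∈ ({a, b, c} : Set V), x ≠ u ∧ x ≠ v := by
      rintro x (rfl | rfl | rfl) <;> tauto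
    have m1 := nm m hm
    have s1 := nm s hs
    have t1 := nm t ht
    have m2 : m ∈ ({a, b, c} : Set V) ∪ {u, v} := Or.inl hm
    have s2 : s ∈ ({a, b, c} : Set V) ∪ {u, v} := Or.inl hs
    have t2 : t ∈ ({a, b, c} : Set V) ∪ {u, v} := Or.inl ht
    have := key m s t hm hs ht h1 h2 h3
    rcases hbad with hb | hb | hb
    · have f := fact u mu m m2 m1.1.symm hb
      refine this (f _ mu _ s2 ?_ ?_) (f _ mv _ s2 ?_ ?_) (f _ mu _ t2 ?_ ?_) (f _ mv _ t2 ?_ ?_) (f _ m2 _ s2 ?_ ?_)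
        (f _ m2 _ t2 ?_ ?_) (Or.inr (f _ s2 _ t2 ?_ ?_)) <;> clear * - m1 s1 t1 h1 h2 h3 huv' <;> grind
    · have f := fact v mv m m2 m1.2.symm hb
      refine this (f _ mu _ s2 ?_ ?_) (f _ mv _ s2 ?_ ?_) (f _ mu _ t2 ?_ ?_) (f _ mv _ t2 ?_ ?_) (f _ m2 _ s2 ?_ ?_)
        (f _ m2 _ t2 ?_ ?_) (Or.inr (f _ s2 _ t2 ?_ ?_)) <;> clear * - m1 s1 t1 h1 h2 h3 huv' <;> grind
    · have f := fact s s2 t t2 h3 hb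
      refine this (f _ mu _ s2 ?_ ?_) (f _ mv _ s2 ?_ ?_) (f _ mu _ t2 ?_ ?_) (f _ mv _ t2 ?_ ?_) (f _ m2 _ s2 ?_ ?_)
        (f _ m2 _ t2 ?_ ?_) (Or.inl (f _ mu _ m2 ?_ ?_)) <;> clear * - m1 s1 t1 h1 h2 h3 huv' <;> grind
  by_contra hcon
  have k1 := mt (mid a b c (by simp) (by simp) (by simp) hab hac hbc) hcon
  have k2 := mt (mid b a c (by simp) (by simp) (by simp) hab.symm hbc hac) hcon
  have k3 := mt (mid c a b (by simp) (by simp) (by simp) hac.symm hbc.symm hab) hcon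
  push Not at k1 k2 k3
  exact hcon (key a b c (by simp) (by simp) (by simp) hab hac hbc k2.1 k2.2.1 k3.1 k3.2.1 k3.2.2 k2.2.2 (Or.inl k1.1))

end Th

namespace Th

universe u
variable {V : Type u}

theorem side_le {G : SimpleGraph V} {X : Set V} {u v : V} (huv : G.Adj u v) : side G X u v ≤ G := by
  rintro a b ⟨h1, h | h⟩
  · exact h.1
  · rw [Sym2.eq_iff] at h
    rcases h with ⟨rfl, rfl⟩ | ⟨rfl, rfl⟩
    · exact huv
    · exact huv.symm

theorem Sep.c2 {G : SimpleGraph V} {W X Y : Set V} {u v : V} (h : Sep G W u v X Y) (huv : G.Adj u v)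
    (h2 : ∀ x, Conn G (W \ {x})) : ∀ x, Conn G ((X ∪ {u, v}) \ {x}) :=
  fun x => (h.conn_side h2 x).mono (side_le huv)

theorem Sep.count [Finite V] {G : SimpleGraph V} {W X Y : Set V} {u v : V} (h : Sep G W u v X Y) (huv : G.Adj u v) :
    eW G W + 1 ≤ eW G (X ∪ {u, v}) + eW G (Y ∪ {u, v}) := by
  refine eW_union2 ?_ huv (by simp) (by simp) (by simp) (by simp)
  intro x y hxy hx hy
  have h1 := h.cov x hx
  have h2 := h.cov y hy
  have h3 := h.no x
  have h4 := h.no y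
  simp only [Set.mem_union, Set.mem_insert_iff, Set.mem_singleton_iff]
  by_cases a : x ∈ X <;> by_cases b : y ∈ Y
  · exact absurd hxy (h3 a y b)
  · clear h3 h4; tauto
  · clear h3; have := fun c => h4 c x; clear h4; by_cases d : x ∈ Y <;> tauto
  · by_cases c : y ∈ X <;> by_cases d : x ∈ Y
    · exact absurd hxy.symm (h4 c x d)
    all_goals
      clear h3 h4 hxy
      tauto

theorem Sep.card_side [Finite V] {G : SimpleGraph V} {W X Y : Set V} {u v : V} (h : Sep G W u v X Y) :
    (X ∪ {u, v}).ncard = X.ncard + 2 := by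
  rw [Set.ncard_union_eq, Set.ncard_pair h.ne]
  rw [Set.disjoint_left]
  rintro x hx (rfl | rfl)
  · exact (h.memX _ hx).2.1 rfl
  · exact (h.memX _ hx).2.2.1 rfl

theorem Sep.card_eq [Finite V] {G : SimpleGraph V} {W X Y : Set V} {u v : V} (h : Sep G W u v X Y) :
    W.ncard = X.ncard + Y.ncard + 2 := by
  have h1 : W = Y ∪ (X ∪ {u, v}) := by
    ext x
    simp only [Set.mem_union, Set.mem_insert_iff, Set.mem_singleton_iff]
    constructor
    · intro hx; have := h.cov x hx; tauto
    · rintro (h' | h' | rfl | rfl)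
      · exact (h.memY x h').1
      · exact (h.memX x h').1
      · exact h.uW
      · exact h.vW
  rw [h1, Set.ncard_union_eq, h.card_side]
  · omega
  rw [Set.disjoint_left]
  rintro x hx (h' | rfl | rfl)
  · exact (h.memY _ hx).2.2.2 h'
  · exact (h.memY _ hx).2.1 rfl
  · exact (h.memY _ hx).2.2.1 rfl

theorem Sep.sub_side {G : SimpleGraph V} {W X Y : Set V} {u v : V} (h : Sep G W u v X Y) : (Y ∪ {u, v}) ⊆ W := by
  rintro x (h' | rfl | rfl)
  · exact (h.memY x h').1
  · exact h.uW
  · exact h.vW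

/-- without short paths the side is large -/
theorem Sep.long [Finite V] {G : SimpleGraph V} {W X Y : Set V} {u v : V} (h : Sep G W u v X Y)
    (h2 : ∀ x, Conn G (W \ {x})) (n2 : ¬ P2 G Y u v) (n3 : ¬ P3 G Y u v) (n4 : ¬ P4 G Y u v) : 4 ≤ Y.ncard := by
  have hc := h.conn_insert h2
  obtain ⟨b, hb, v', rfl, hbv⟩ := h.swap.lk h2
  have hub : u ≠ b := fun e => (h.memY b hb).2.1 e.symm
  obtain ⟨l, hl⟩ := hc.path (x := u) (y := b) (by simp) (by simp [hb])
  have hlen : 5 ≤ l.length := by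
    by_contra hcon
    have hch := hl.ch
    have hnd := hl.nd
    have hhd := hl.hd
    have hls := hl.ls
    have hm := hl.mem
    match l, hcon with
    | [], _ => simp at hhd
    | [a], _ => simp at hhd hls; exact hub (hhd.symm.trans hls)
    | [a, c], _ =>
      simp at hhd hls hch; subst hhd; subst hls
      exact n2 ⟨c, hb, hch, hbv⟩
    | [a, c, d], _ =>
      simp at hhd hls hch hm hnd; subst hhd; subst hls
      exact n3 ⟨c, by grind, d, hb, hch.1, hch.2, hbv⟩
    | [a, c, d, e], _ =>
      simp at hhd hls hch hm hnd; subst hhd; subst hls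
      exact n4 ⟨c, by grind, d, by grind, e, hb, by grind, hch.1, hch.2.1, hch.2.2, hbv⟩
    | a :: c :: d :: e :: f :: t, h => simp at h
  classical
  have h1 : ((l.toFinset : Finset V) : Set V) ⊆ insert u Y := by
    intro x hx; simp at hx; exact hl.mem x hx
  have h3 := Set.ncard_le_ncard h1
  rw [Set.ncard_coe_finset, List.toFinset_card_of_nodup hl.nd] at h3
  have := Set.ncard_insert_le u Y
  omega

theorem dec [Fintype V] {G : SimpleGraph V} (hp : IsPlanar G)
    (hth : ¬ HasTheta6 G) : ∀ n, ∀ (W : Set V) (hv : Set (Sym2 V)), W.ncard = n → Dec G W hv →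
    7 * eW G W + 2 * hv.ncard + 48 ≤ 18 * W.ncard := by
  intro n
  induction n using Nat.strong_induction_on with
  | _ n ih =>
  intro W hv hn D
  by_cases h3 : ∀ u v, G.Adj u v → Conn G (W \ {u, v})
  · exact lemmaD hp hth D h3
  push Not at h3
  obtain ⟨u, v, huv, hnc⟩ := h3
  obtain ⟨X, Y, hS, hX3, hX9, hXv⟩ : ∃ X Y, Sep G W u v X Y ∧ X.ncard = 3 ∧ eW G (X ∪ {u, v}) = 9 ∧
      ∀ e ∈ hv, ∀ x ∈ e, x ∉ X := by
    obtain ⟨X, Y, hS⟩ := exists_sep D.c2 hnc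
    rcases D.cut u v X Y huv hS with h | h
    · exact ⟨X, Y, hS, h⟩
    · exact ⟨Y, X, hS.symm, h⟩
  have huX : u ∉ X := fun h => (hS.memX u h).2.1 rfl
  have hvX : v ∉ X := fun h => (hS.memX v h).2.2.1 rfl
  obtain ⟨p2, p3, p4⟩ := pod_paths huv huX hvX hX3 hX9
  have dX : ∀ x ∈ X, x ≠ u ∧ x ≠ v ∧ x ∉ Y := fun x hx => (hS.memX x hx).2
  have dY : ∀ x ∈ Y, x ≠ u ∧ x ≠ v ∧ x ∉ X := fun x hx => (hS.memY x hx).2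
  have dX' : ∀ x ∈ X, x ≠ u ∧ x ≠ v := fun x hx => ⟨(dX x hx).1, (dX x hx).2.1⟩
  have dY' : ∀ x ∈ Y, x ≠ u ∧ x ≠ v := fun x hx => ⟨(dY x hx).1, (dY x hx).2.1⟩
  have n2 : ¬ P2 G Y u v := fun h => th24 hth huv dY dX' h p4
  have n3 : ¬ P3 G Y u v := fun h => th33 hth huv dY dX' h p3
  have n4 : ¬ P4 G Y u v := fun h => th24 hth huv dX dY' p2 h
  have hY4 := hS.long D.c2 n2 n3 n4
  have hcard := hS.card_eq
  have hcardY := hS.symm.card_side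
  have huvn : s(u, v) ∉ hv := fun h => (D.hvP u v h).1 (p2.mono (fun x hx => ⟨(hS.memX x hx).1, by
    have := dX' x hx; simp; tauto⟩))
  have hYuv : (Y ∪ {u, v}) \ {u, v} ⊆ Y := by
    rintro x ⟨h1 | h1, h2⟩
    · exact h1
    · exact absurd h1 h2
  have hYuv' : (Y ∪ {u, v}) \ {v, u} ⊆ Y := by rw [Set.pair_comm v u]; exact hYuv
  have inW' : ∀ x ∈ W, x ∉ X → x ∈ Y ∪ {u, v} := by
    intro x hx hxX
    have := hS.cov x hx
    simp; tauto
  have D' : Dec G (Y ∪ {u, v}) (insert s(u, v) hv) := by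
    refine ⟨hS.symm.c2 huv D.c2, by omega, ?_, ?_, ?_, ?_⟩
    · rintro a b (h | h)
      · rw [Sym2.eq_iff] at h
        rcases h with ⟨rfl, rfl⟩ | ⟨rfl, rfl⟩
        · exact ⟨huv, by simp, by simp⟩
        · exact ⟨huv.symm, by simp, by simp⟩
      · obtain ⟨h1, h2, h3⟩ := D.hvE a b h
        exact ⟨h1, inW' a h2 (hXv _ h a (by simp)), inW' b h3 (hXv _ h b (by simp))⟩
    · rintro a b (h | h)
      · rw [Sym2.eq_iff] at h
        rcases h with ⟨rfl, rfl⟩ | ⟨rfl, rfl⟩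
        · exact ⟨fun h => n2 (h.mono hYuv), fun h => n3 (h.mono hYuv), fun h => n4 (h.mono hYuv)⟩
        · exact ⟨fun h => n2 (h.mono hYuv').symm, fun h => n3 (h.mono hYuv').symm, fun h => n4 (h.mono hYuv').symm⟩
      · obtain ⟨h1, h2, h3⟩ := D.hvP a b h
        have hs : (Y ∪ {u, v}) \ {a, b} ⊆ W \ {a, b} := Set.sdiff_subset_sdiff_left hS.sub_side
        exact ⟨fun h => h1 (h.mono hs), fun h => h2 (h.mono hs), fun h => h3 (h.mono hs)⟩
    · intro y hy
      by_cases hyu : y = u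
      · exact Or.inl ⟨s(u, v), by simp, by simp [hyu]⟩
      by_cases hyv : y = v
      · exact Or.inl ⟨s(u, v), by simp, by simp [hyv]⟩
      have hyY : y ∈ Y := hYuv ⟨hy, by simp; tauto⟩
      rcases D.deg y (hS.sub_side hy) with ⟨e, he, hye⟩ | h
      · exact Or.inl ⟨e, by simp [he], hye⟩
      · refine Or.inr fun a b => ?_
        obtain ⟨z, hz, h1, h2⟩ := h a b
        exact ⟨z, inW' z hz (fun hzX => hS.no z hzX y hyY h1.symm), h1, h2⟩
    · intro p q P Q hpq hPQ
      -- the main step, for the side not containing u, v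
      have main : ∀ P Q, Sep G (Y ∪ {u, v}) p q P Q → u ∉ Q → v ∉ Q →
          (Q.ncard = 3 ∧ eW G (Q ∪ {p, q}) = 9 ∧ ∀ e ∈ insert s(u, v) hv, ∀ x ∈ e, x ∉ Q) := by
        intro P Q hPQ huQ hvQ
        have hXn : ∀ x ∈ X, x ∉ Y ∪ {u, v} := by
          rintro x hx (h | rfl | rfl)
          · exact (dX x hx).2.2 h
          · exact huX hx
          · exact hvX hx
        have hS' : Sep G W p q (P ∪ X) Q := by
          refine ⟨hPQ.ne, hS.sub_side hPQ.uW, hS.sub_side hPQ.vW, ?_, ?_, ?_, ?_, hPQ.neY, ?_⟩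
          · rintro x (hx | hx)
            · have := hPQ.memX x hx
              exact ⟨hS.sub_side this.1, this.2⟩
            · refine ⟨(hS.memX x hx).1, ?_, ?_, ?_⟩
              · rintro rfl; exact hXn _ hx hPQ.uW
              · rintro rfl; exact hXn _ hx hPQ.vW
              · intro h; exact hXn _ hx (hPQ.memY x h).1
          · intro x hx
            have := hPQ.memY x hx
            refine ⟨hS.sub_side this.1, this.2.1, this.2.2.1, ?_⟩
            rintro (h | h)
            · exact this.2.2.2 h
            · exact hXn _ h this.1
          · intro x hx
            by_cases hxX : x ∈ X
            · right; right; left; exact Or.inr hxX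
            · have := hPQ.cov x (inW' x hx hxX)
              rcases this with h | h | h | h
              · exact Or.inl h
              · exact Or.inr (Or.inl h)
              · right; right; left; exact Or.inl h
              · right; right; right; exact h
          · exact hPQ.neX.mono Set.subset_union_left
          · rintro x (hx | hx) y hy
            · exact hPQ.no x hx y hy
            · intro hxy
              rcases (hPQ.memY y hy).1 with h | rfl | rfl
              · exact hS.no x hx y h hxy
              · exact huQ hy
              · exact hvQ hy
        rcases D.cut p q _ _ hpq hS' with h | h
        · exfalso
          have h1 : (P ∪ X).ncard = P.ncard + X.ncard := by
            rw [Set.ncard_union_eq]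
            rw [Set.disjoint_left]
            intro x hx hxX
            exact hXn x hxX (hPQ.memX x hx).1
          have : 0 < P.ncard := by rw [Set.ncard_pos]; exact hPQ.neX
          omega
        · refine ⟨h.1, h.2.1, ?_⟩
          rintro e (rfl | he) x hx
          · simp at hx
            rcases hx with rfl | rfl <;> assumption
          · exact h.2.2 e he x hx
      by_cases hcase : u ∈ Q ∨ v ∈ Q
      · left
        apply main Q P hPQ.symm
        · intro huP
          rcases hcase with h | h
          · exact (hPQ.memX u huP).2.2.2 h
          · exact hPQ.no u huP v h huv
        · intro huP
          rcases hcase with h | h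
          · exact hPQ.no v huP u h huv.symm
          · exact (hPQ.memX v huP).2.2.2 h
      · push Not at hcase
        right
        exact main P Q hPQ hcase.1 hcase.2
  have key := ih (Y ∪ {u, v}).ncard (by omega) (Y ∪ {u, v}) (insert s(u, v) hv) rfl D'
  rw [Set.ncard_insert_of_notMem huvn] at key
  have := hS.count huv
  omega

end Th

namespace Th

universe u
variable {V : Type u}

/-- the bound for all graphs -/
def F (n : ℕ) : ℕ := if n < 14 then [0, 0, 1, 3, 6, 9, 10, 12, 15, 18, 19, 21, 24, 27].getD n 0 else (18 * n - 48) / 7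
/-- the bound for 2-connected graphs -/
def F2 (n : ℕ) : ℕ := if n < 14 then [0, 0, 1, 3, 6, 9, 10, 12, 14, 16, 19, 21, 24, 26].getD n 0 else (18 * n - 48) / 7

theorem F_big {n : ℕ} (h : 14 ≤ n) : F n = (18 * n - 48) / 7 := by unfold F; rw [if_neg (by omega)]
theorem F2_big {n : ℕ} (h : 14 ≤ n) : F2 n = (18 * n - 48) / 7 := by unfold F2; rw [if_neg (by omega)]

theorem F_vals : F 0 = 0 ∧ F 1 = 0 ∧ F 2 = 1 ∧ F 3 = 3 ∧ F 4 = 6 ∧ F 5 = 9 ∧ F 6 = 10 ∧ F 7 = 12 ∧ F 8 = 15 ∧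
    F 9 = 18 ∧ F 10 = 19 ∧ F 11 = 21 ∧ F 12 = 24 ∧ F 13 = 27 := by decide
theorem F2_vals : F2 3 = 3 ∧ F2 4 = 6 ∧ F2 5 = 9 ∧ F2 6 = 10 ∧ F2 7 = 12 ∧ F2 8 = 14 ∧
    F2 9 = 16 ∧ F2 10 = 19 ∧ F2 11 = 21 ∧ F2 12 = 24 ∧ F2 13 = 26 := by decide

theorem F_zone (n : ℕ) : 7 * F n + 36 ≤ 18 * n ∨ (n ≤ 13 ∧ 7 * F n ≤ 18 * n) := by
  by_cases h : 14 ≤ n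
  · rw [F_big h]; omega
  · right; refine ⟨by omega, ?_⟩
    have : n < 14 := by omega
    interval_cases n <;> decide

theorem F_super0 {a b n : ℕ} (ha : 1 ≤ a) (hb : 1 ≤ b) (h : a + b = n + 1) (hn : 6 ≤ n) : F a + F b ≤ F n := by
  by_cases h1 : 14 ≤ a <;> by_cases h2 : 14 ≤ b
  · rw [F_big h1, F_big h2, F_big (by omega)]; omega
  · rw [F_big h1, F_big (n := n) (by omega)]
    obtain rfl : n = a + b - 1 := by omega
    interval_cases b <;> simp [F] <;> omega
  · rw [F_big h2, F_big (n := n) (by omega)]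
    obtain rfl : n = a + b - 1 := by omega
    interval_cases a <;> simp [F] <;> omega
  · obtain rfl : n = a + b - 1 := by omega
    interval_cases a <;> interval_cases b <;> first | (exfalso; omega) | decide

theorem F_mono1 (n : ℕ) : F n ≤ F (n + 1) := by
  by_cases h1 : 13 ≤ n
  · by_cases h2 : n = 13
    · subst h2; decide
    · rw [F_big (n := n) (by omega), F_big (by omega)]; omega
  · interval_cases n <;> decide

theorem F_super1 {a b n : ℕ} (ha : 1 ≤ a) (hb : 1 ≤ b) (h : a + b = n) (hn : 6 ≤ n) : F a + F b ≤ F n :=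
  (Nat.add_le_add_left (F_mono1 b) _).trans (F_super0 ha (by omega) (by omega) hn)

theorem F2_le (n : ℕ) : F2 n ≤ F n := by
  by_cases h1 : 14 ≤ n
  · rw [F_big h1, F2_big h1]
  · interval_cases n <;> decide

theorem F2_dec {n e : ℕ} (hn : 6 ≤ n) (h : 7 * e + 48 ≤ 18 * n) : e ≤ F2 n := by
  by_cases h1 : 14 ≤ n
  · rw [F2_big h1]; omega
  · interval_cases n <;> simp [F2] <;> omega

theorem F2_b1 {n : ℕ} (hn : 7 ≤ n) (h9 : n ≠ 9) (h10 : n ≠ 10) : F (n - 1) + 2 ≤ F2 n := by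
  by_cases h1 : 14 ≤ n
  · by_cases h2 : n = 14
    · subst h2; decide
    · rw [F_big (by omega), F2_big h1]; omega
  · interval_cases n <;> first | (exfalso; omega) | decide

theorem F2_x2 {n : ℕ} (hn : 8 ≤ n) : F2 n + 5 ≤ F2 (n + 2) := by
  by_cases h1 : 14 ≤ n
  · rw [F2_big h1, F2_big (by omega)]; omega
  · interval_cases n <;> decide

theorem F2_x3 {n : ℕ} (hn : 6 ≤ n) : F2 n + 6 ≤ F2 (n + 3) := by
  by_cases h1 : 14 ≤ n
  · rw [F2_big h1, F2_big (by omega)]; omega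
  · interval_cases n <;> decide

theorem F2_x38 {n : ℕ} (hn : 8 ≤ n) : F2 n + 7 ≤ F2 (n + 3) := by
  by_cases h1 : 14 ≤ n
  · rw [F2_big h1, F2_big (by omega)]; omega
  · interval_cases n <;> decide

theorem F2_x4 {a b n : ℕ} (ha : 6 ≤ a) (hb : 6 ≤ b) (h : a + b = n + 2) : F2 a + F2 b ≤ F2 n + 1 := by
  by_cases h1 : 14 ≤ a <;> by_cases h2 : 14 ≤ b
  · rw [F2_big h1, F2_big h2, F2_big (by omega)]; omega
  · rw [F2_big h1, F2_big (n := n) (by omega)]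
    obtain rfl : n = a + b - 2 := by omega
    interval_cases b <;> simp [F2] <;> omega
  · rw [F2_big h2, F2_big (n := n) (by omega)]
    obtain rfl : n = a + b - 2 := by omega
    interval_cases a <;> simp [F2] <;> omega
  · obtain rfl : n = a + b - 2 := by omega
    interval_cases a <;> interval_cases b <;> decide

theorem F_15 {a b : ℕ} (ha : 2 ≤ a) (hb : 2 ≤ b) (h : a + b = 9) (h1 : 15 ≤ F a + F b) :
    (a = 5 ∧ b = 4) ∨ (a = 4 ∧ b = 5) := by
  obtain rfl : b = 9 - a := by omega
  have : a ≤ 7 := by omega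
  interval_cases a <;> revert h1 <;> decide

theorem F_18 {a b : ℕ} (ha : 2 ≤ a) (hb : 2 ≤ b) (h : a + b = 10) (h1 : 18 ≤ F a + F b) :
    a = 5 ∧ b = 5 := by
  obtain rfl : b = 10 - a := by omega
  have : a ≤ 8 := by omega
  interval_cases a <;> revert h1 <;> decide

/-! ### Lemma S -/

theorem lemmaS1 {G : SimpleGraph V} (hth : ¬ HasTheta6 G) {Y : Set V} {u v : V} (hu : u ∉ Y)
    (deg : ∀ y ∈ Y, ∀ x z, ∃ t, (t ∈ Y ∨ t = u ∨ t = v) ∧ G.Adj y t ∧ t ≠ x ∧ t ≠ z)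
    (n4 : ¬ P4 G Y u v) {c d d1 d2 e : V} (hc : c ∈ Y) (hd : d ∈ Y) (hd1 : d1 ∈ Y) (hd2 : d2 ∈ Y) (he : e ∈ Y)
    (nd : [c, d, d1, d2, e].Nodup)
    (hY : ∀ y ∈ Y, y = c ∨ y = d ∨ y = d1 ∨ y = d2 ∨ y = e) (uc : G.Adj u c) (vc : G.Adj v c)
    (cd : G.Adj c d) (dd1 : G.Adj d d1) (dd2 : G.Adj d d2) (ue : G.Adj u e)
    (k1 : ¬ G.Adj d1 u) (k2 : ¬ G.Adj d1 v) (ed1 : G.Adj e d1) : False := by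
  have h1 : ¬ G.Adj d1 c := fun h => n4 ⟨e, he, d1, hd1, c, hc, by simp at nd; tauto, ue, ed1, h, vc.symm⟩
  obtain ⟨t, ht, h2, h3, h4⟩ := deg d1 hd1 d e
  have ht2 : t = d2 := by
    rcases ht with ht | rfl | rfl
    · rcases hY t ht with rfl | rfl | rfl | rfl | rfl
      · exact absurd h2 h1
      · exact absurd rfl h3
      · exact absurd h2 (G.loopless.irrefl _)
      · rfl
      · exact absurd rfl h4
    · exact absurd h2 k1
    · exact absurd h2 k2
  subst ht2
  refine theta_short hth (a := d) (b := t) (c := d1) (d := e) (e := u) (f := c) ?_ dd2 h2.symm ed1.symm ue.symm uc cd dd1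
  have : ∀ y ∈ Y, y ≠ u := fun y hy h => hu (h ▸ hy)
  have a1 := this c hc
  have a2 := this d hd
  have a3 := this d1 hd1
  have a4 := this t hd2
  have a5 := this e he
  clear * - nd a1 a2 a3 a4 a5
  simp at *
  grind

theorem lemmaS2 {G : SimpleGraph V} (hth : ¬ HasTheta6 G) {Y : Set V} {u v : V} (hu : u ∉ Y)
    (deg : ∀ y ∈ Y, ∀ x z, ∃ t, (t ∈ Y ∨ t = u ∨ t = v) ∧ G.Adj y t ∧ t ≠ x ∧ t ≠ z)
    (n3 : ¬ P3 G Y u v)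
    (n4 : ¬ P4 G Y u v) {c d d1 d2 e : V} (hc : c ∈ Y) (hd : d ∈ Y) (hd1 : d1 ∈ Y) (hd2 : d2 ∈ Y) (he : e ∈ Y)
    (nd : [c, d, d1, d2, e].Nodup)
    (hY : ∀ y ∈ Y, y = c ∨ y = d ∨ y = d1 ∨ y = d2 ∨ y = e) (uc : G.Adj u c) (vc : G.Adj v c)
    (cd : G.Adj c d) (dd1 : G.Adj d d1) (dd2 : G.Adj d d2) (ue : G.Adj u e)
    (k1 : ¬ G.Adj d1 u) (k2 : ¬ G.Adj d1 v) (k3 : ¬ G.Adj d2 u) (k4 : ¬ G.Adj d2 v) : False := by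
  have nd' := nd
  simp at nd'
  have h1 : ¬ G.Adj e c := fun h => n3 ⟨e, he, c, hc, ue, h, vc.symm⟩
  have h2 : ¬ G.Adj e d := fun h => n4 ⟨e, he, d, hd, c, hc, by tauto, ue, h, cd.symm, vc.symm⟩
  obtain ⟨t, ht, h3, h4, h5⟩ := deg e he u v
  have ht : t ∈ Y := by tauto
  rcases hY t ht with rfl | rfl | rfl | rfl | rfl
  · exact h1 h3
  · exact h2 h3
  · exact lemmaS1 hth hu deg n4 hc hd hd1 hd2 he nd hY uc vc cd dd1 dd2 ue k1 k2 h3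
  · refine lemmaS1 hth hu deg n4 hc hd hd2 hd1 he ?_ ?_ uc vc cd dd2 dd1 ue k3 k4 h3
    · simp; grind
    · intro y hy; have := hY y hy; tauto
  · exact G.loopless.irrefl _ h3

theorem six_le [Finite V] {Y : Set V} {l : List V} (nd : l.Nodup) (h : ∀ x ∈ l, x ∈ Y) : l.length ≤ Y.ncard := by
  classical
  have h1 : ((l.toFinset : Finset V) : Set V) ⊆ Y := by
    intro x hx; simp at hx; exact h x hx
  have h3 := Set.ncard_le_ncard h1
  rwa [Set.ncard_coe_finset, List.toFinset_card_of_nodup nd] at h3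

theorem lemmaS [Finite V] {G : SimpleGraph V} (hth : ¬ HasTheta6 G) {Y : Set V} {u v : V} (hu : u ∉ Y) (hv : v ∉ Y)
    (deg : ∀ y ∈ Y, ∀ x z, ∃ t, (t ∈ Y ∨ t = u ∨ t = v) ∧ G.Adj y t ∧ t ≠ x ∧ t ≠ z)
    (nu : ∃ a ∈ Y, G.Adj u a) (nv : ∃ b ∈ Y, G.Adj v b)
    (hc : ∀ c ∈ Y, ∀ d ∈ Y, d ≠ c → ∃ e ∈ Y, e ≠ c ∧ (G.Adj u e ∨ G.Adj v e))
    (n3 : ¬ P3 G Y u v) (n4 : ¬ P4 G Y u v) : 6 ≤ Y.ncard := by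
  by_contra hcon
  have n3' : ¬ P3 G Y v u := fun h => n3 h.symm
  have n4' : ¬ P4 G Y v u := fun h => n4 h.symm
  by_cases hcom : ∃ c ∈ Y, G.Adj u c ∧ G.Adj v c
  · obtain ⟨c, hcY, uc, vc⟩ := hcom
    obtain ⟨d, hd, cd, d1, d2⟩ := deg c hcY u v
    have hd : d ∈ Y := by tauto
    have a1 : ¬ G.Adj d u := fun h => n3 ⟨d, hd, c, hcY, h.symm, cd.symm, vc.symm⟩
    have a2 : ¬ G.Adj d v := fun h => n3 ⟨c, hcY, d, hd, uc, cd, h⟩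
    have hn : ∀ t, (t ∈ Y ∨ t = u ∨ t = v) → G.Adj d t → t ≠ c → t ∈ Y ∧ ¬ G.Adj t u ∧ ¬ G.Adj t v := by
      intro t ht h1 h2
      have ht : t ∈ Y := by
        rcases ht with ht | rfl | rfl
        · exact ht
        · exact absurd h1 a1
        · exact absurd h1 a2
      exact ⟨ht, fun h => n4 ⟨t, ht, d, hd, c, hcY, h2, h.symm, h1.symm, cd.symm, vc.symm⟩,
        fun h => n4 ⟨c, hcY, d, hd, t, ht, h2.symm, uc, cd, h1, h⟩⟩
    obtain ⟨t1, ht1, b1, b2, -⟩ := deg d hd c c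
    obtain ⟨t2, ht2, c1, c2, c3⟩ := deg d hd c t1
    obtain ⟨ht1, b3, b4⟩ := hn t1 ht1 b1 b2
    obtain ⟨ht2, c4, c5⟩ := hn t2 ht2 c1 c2
    obtain ⟨e, he, hec, hee⟩ := hc c hcY d hd cd.ne'
    have ne1 : e ≠ d := by rintro rfl; rcases hee with h | h; exacts [a1 h.symm, a2 h.symm]
    have ne2 : e ≠ t1 := by rintro rfl; rcases hee with h | h; exacts [b3 h.symm, b4 h.symm]
    have ne3 : e ≠ t2 := by rintro rfl; rcases hee with h | h; exacts [c4 h.symm, c5 h.symm]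
    have nd : [c, d, t1, t2, e].Nodup := by
      have := cd.ne
      have := b1.ne
      have := c1.ne
      clear * - cd b1 c1 this b2 c2 c3 hec ne1 ne2 ne3
      have := cd.ne
      have := b1.ne
      simp
      grind
    have hY : ∀ y ∈ Y, y = c ∨ y = d ∨ y = t1 ∨ y = t2 ∨ y = e := by
      intro y hy
      by_contra h
      have := six_le (Y := Y) (l := [y, c, d, t1, t2, e]) (by rw [List.nodup_cons]; exact ⟨by simpa using h, nd⟩)
        (by simp [hy, hcY, hd, ht1, ht2, he])
      simp at this
      omega
    rcases hee with h | h
    · exact lemmaS2 hth hu deg n3 n4 hcY hd ht1 ht2 he nd hY uc vc cd b1 c1 h b3 b4 c4 c5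
    · exact lemmaS2 hth hv (fun y hy x z => by
        obtain ⟨t, ht, h⟩ := deg y hy x z
        exact ⟨t, by tauto, h⟩) n3' n4' hcY hd ht1 ht2 he nd hY vc uc cd b1 c1 h b4 b3 c5 c4
  · push Not at hcom
    obtain ⟨a, ha, ua⟩ := nu
    obtain ⟨b, hb, vb⟩ := nv
    have av := hcom a ha ua
    have bu : ¬ G.Adj u b := fun h => hcom b hb h vb
    have getA : ∀ x, ∃ t ∈ Y, G.Adj a t ∧ t ≠ x := by
      intro x
      obtain ⟨t, ht, h1, h2, h3⟩ := deg a ha u x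
      refine ⟨t, ?_, h1, h3⟩
      rcases ht with ht | rfl | rfl
      · exact ht
      · exact absurd rfl h2
      · exact absurd h1.symm av
    have getB : ∀ x, ∃ t ∈ Y, G.Adj b t ∧ t ≠ x := by
      intro x
      obtain ⟨t, ht, h1, h2, h3⟩ := deg b hb v x
      refine ⟨t, ?_, h1, h3⟩
      rcases ht with ht | rfl | rfl
      · exact ht
      · exact absurd h1.symm bu
      · exact absurd rfl h2
    obtain ⟨p1, hp1, ap1, -⟩ := getA a
    obtain ⟨p2, hp2, ap2, p12⟩ := getA p1
    obtain ⟨q1, hq1, bq1, -⟩ := getB b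
    obtain ⟨q2, hq2, bq2, q12⟩ := getB q1
    have hab : a ≠ b := fun h => bu (h ▸ ua)
    have nab : ∀ p, G.Adj a p → p ≠ b := fun p h e => n3 ⟨a, ha, b, hb, ua, e ▸ h, vb.symm⟩
    have nba : ∀ p, G.Adj b p → p ≠ a := fun p h e => n3 ⟨a, ha, b, hb, ua, (e ▸ h).symm, vb.symm⟩
    have npq : ∀ p ∈ Y, ∀ q, G.Adj a p → G.Adj b q → p ≠ q := fun p hp q h1 h2 e =>
      n4 ⟨a, ha, p, hp, b, hb, hab, ua, h1, (e ▸ h2).symm, vb.symm⟩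
    have := six_le (Y := Y) (l := [a, b, p1, p2, q1, q2]) (by
      have x1 := nab _ ap1
      have x2 := nab _ ap2
      have x3 := nba _ bq1
      have x4 := nba _ bq2
      have x5 := npq _ hp1 _ ap1 bq1
      have x6 := npq _ hp1 _ ap1 bq2
      have x7 := npq _ hp2 _ ap2 bq1
      have x8 := npq _ hp2 _ ap2 bq2
      have y1 := ap1.ne
      have y2 := ap2.ne
      have y3 := bq1.ne
      have y4 := bq2.ne
      clear * - x1 x2 x3 x4 x5 x6 x7 x8 y1 y2 y3 y4 p12 q12 hab
      simp
      grind) (by simp [ha, hb, hp1, hp2, hq1, hq2])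
    simp at this
    omega

end Th

namespace Th

universe u
variable {V : Type u}

theorem AC.fact {G : SimpleGraph V} {A : Set V} (h : AC G A) {x y : V} (hx : x ∈ A) (hy : y ∈ A) (hxy : x ≠ y)
    (h1 : ¬ G.Adj x y) : ∀ z ∈ A, ∀ w ∈ A, z ≠ w → ¬ (z = x ∧ w = y ∨ z = y ∧ w = x) → G.Adj z w := by
  intro z hz w hw hzw h2
  by_contra h3
  have := h z hz w hw x hx y hy hzw hxy h3 h1
  rw [Sym2.eq_iff] at this
  exact h2 this

/-- splitting a set along a cut vertex -/
theorem split [Finite V] {G : SimpleGraph V} {W : Set V} {x : V} (h : ¬ Conn G (W \ {x})) :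
    ∃ A B : Set V, A ⊆ W ∧ B ⊆ W ∧ (∀ z ∈ W, z ∈ A ∨ z ∈ B) ∧ (∃ a ∈ A, a ≠ x) ∧ (∃ b ∈ B, b ≠ x) ∧
      (∀ a ∈ A, a ≠ x → ∀ b ∈ B, b ≠ x → ¬ G.Adj a b ∧ a ≠ b) ∧ eW G W ≤ eW G A + eW G B ∧
      ((x ∈ A ∧ x ∈ B ∧ A.ncard + B.ncard = W.ncard + 1 ∧ 2 ≤ A.ncard ∧ 2 ≤ B.ncard) ∨
        (A.ncard + B.ncard = W.ncard ∧ 1 ≤ A.ncard ∧ 1 ≤ B.ncard)) := by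
  unfold Conn at h
  push Not at h
  obtain ⟨S, hS, ⟨s, hs⟩, ⟨t, ht⟩, hno⟩ := h
  have hxS : x ∉ S := fun h => (hS h).2 rfl
  have key : ∀ A B : Set V, (∀ z, z ∈ A ↔ z ∈ S ∨ (z = x ∧ x ∈ W)) →
      (∀ z, z ∈ B ↔ (z ∈ W ∧ z ∉ S)) → A ⊆ W ∧ B ⊆ W ∧ (∀ z ∈ W, z ∈ A ∨ z ∈ B) ∧ (∃ a ∈ A, a ≠ x) ∧ (∃ b ∈ B, b ≠ x) ∧
      (∀ a ∈ A, a ≠ x → ∀ b ∈ B, b ≠ x → ¬ G.Adj a b ∧ a ≠ b) ∧ eW G W ≤ eW G A + eW G B := by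
    intro A B hA hB
    have no' : ∀ a ∈ A, a ≠ x → ∀ b ∈ B, b ≠ x → ¬ G.Adj a b ∧ a ≠ b := by
      intro a ha hax b hb hbx
      rw [hA] at ha
      rw [hB] at hb
      have haS : a ∈ S := by tauto
      exact ⟨hno a haS b ⟨⟨hb.1, hbx⟩, hb.2⟩, fun h => hb.2 (h ▸ haS)⟩
    refine ⟨?_, ?_, ?_, ⟨s, (hA s).2 (Or.inl hs), (hS hs).2⟩, ⟨t, (hB t).2 ⟨ht.1.1, ht.2⟩, ht.1.2⟩, no', ?_⟩
    · intro z hz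
      rcases (hA z).1 hz with h | ⟨rfl, h⟩
      · exact (hS h).1
      · exact h
    · intro z hz; exact ((hB z).1 hz).1
    · intro z hz; rw [hA, hB]; tauto
    · apply eW_union
      intro a b hab ha hb
      by_contra hcon
      by_cases a1 : a = x
      · subst a1
        have : b ≠ a := hab.ne'
        rw [hA, hB, hA, hB] at hcon
        tauto
      by_cases b1 : b = x
      · subst b1
        rw [hA, hB, hA, hB] at hcon
        tauto
      have k1 := hno a
      have k2 := hno b
      by_cases a2 : a ∈ S <;> by_cases b2 : b ∈ S
      · rw [hA, hB, hA, hB] at hcon; tauto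
      · exact hno a a2 b ⟨⟨hb, b1⟩, b2⟩ hab
      · exact hno b b2 a ⟨⟨ha, a1⟩, a2⟩ hab.symm
      · rw [hA, hB, hA, hB] at hcon; tauto
  have hS' : S ⊆ W := fun z hz => (hS hz).1
  by_cases hx : x ∈ W
  · refine ⟨insert x S, W \ S, ?_⟩
    obtain ⟨k1, k2, k3, k4, k5, k6, k7⟩ := key (insert x S) (W \ S) (fun z => by simp; tauto) (fun z => by simp)
    refine ⟨k1, k2, k3, k4, k5, k6, k7, Or.inl ⟨by simp, ⟨hx, hxS⟩, ?_, ?_, ?_⟩⟩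
    · rw [Set.ncard_insert_of_notMem hxS, Set.ncard_sdiff hS']
      have := Set.ncard_le_ncard hS'
      omega
    · rw [Set.ncard_insert_of_notMem hxS]
      have : 0 < S.ncard := by rw [Set.ncard_pos]; exact ⟨s, hs⟩
      omega
    · have : ({x, t} : Set V) ⊆ W \ S := by
        rintro z (rfl | rfl)
        · exact ⟨hx, hxS⟩
        · exact ⟨ht.1.1, ht.2⟩
      have h2 := Set.ncard_le_ncard this
      rwa [Set.ncard_pair (Ne.symm ht.1.2)] at h2
  · refine ⟨S, W \ S, ?_⟩
    obtain ⟨k1, k2, k3, k4, k5, k6, k7⟩ := key S (W \ S) (fun z => by simp; tauto) (fun z => by simp)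
    refine ⟨k1, k2, k3, k4, k5, k6, k7, Or.inr ⟨?_, ?_, ?_⟩⟩
    · rw [Set.ncard_sdiff hS']
      have := Set.ncard_le_ncard hS'
      omega
    · have : 0 < S.ncard := by rw [Set.ncard_pos]; exact ⟨s, hs⟩
      omega
    · have : 0 < (W \ S).ncard := by rw [Set.ncard_pos]; exact ⟨t, ht.1.1, ht.2⟩
      omega

theorem choose2 [Finite V] {G : SimpleGraph V} {A : Set V} (hA : A.ncard = 5) (h : AC G A) {u x : V} (hu : u ∈ A) (hx : x ∈ A)
    (hux : u ≠ x) : ∃ p ∈ A, ∃ q ∈ A, [u, x, p, q].Nodup ∧ G.Adj u p ∧ G.Adj u q ∧ G.Adj p q ∧ G.Adj p x ∧ G.Adj q x := by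
  obtain ⟨a, b, c, hE, nd⟩ := five_of hA hu hx hux
  have ha : a ∈ A := by rw [hE]; simp
  have hb : b ∈ A := by rw [hE]; simp
  have hc : c ∈ A := by rw [hE]; simp
  -- drop a vertex of the missing edge
  have main : ∀ p q r, p ∈ A → q ∈ A → r ∈ A → [u, x, p, q, r].Nodup → (∃ s ∈ A, r ≠ s ∧ ¬ G.Adj r s) →
      ∃ p ∈ A, ∃ q ∈ A, [u, x, p, q].Nodup ∧ G.Adj u p ∧ G.Adj u q ∧ G.Adj p q ∧ G.Adj p x ∧ G.Adj q x := by
    intro p q r hp hq hr nd' ⟨s, hs, hrs, hn⟩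
    have f := h.fact hr hs hrs hn
    clear * - f hp hq hr nd' hu hx
    simp at nd'
    exact ⟨p, hp, q, hq, by simp; tauto, f _ hu _ hp (by tauto) (by tauto), f _ hu _ hq (by tauto) (by tauto),
      f _ hp _ hq (by tauto) (by tauto), f _ hp _ hx (by grind) (by grind), f _ hq _ hx (by grind) (by grind)⟩
  by_contra hcon
  have k1 := mt (main a b c ha hb hc nd) hcon
  have k2 := mt (main a c b ha hc hb (by clear * - nd; simp at *; grind)) hcon
  push Not at k1 k2
  simp at nd
  have b1 := k2 a ha (by tauto)
  have b2 := k2 u hu (by tauto)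
  have b3 := k2 x hx (by tauto)
  have c2 := k1 u hu (by tauto)
  have c3 := k1 x hx (by tauto)
  have c4 := k1 b hb (by tauto)
  exact hcon ⟨b, hb, c, hc, by simp; tauto, b2.symm, c2.symm, c4.symm, b3, c3⟩

theorem k5w [Finite V] {G : SimpleGraph V} (hth : ¬ HasTheta6 G) {A : Set V} (hA : A.ncard = 5) (h : AC G A) {w s t : V}
    (hw : w ∉ A) (hs : s ∈ A) (ht : t ∈ A) (hst : s ≠ t) (ws : G.Adj w s) (wt : G.Adj w t) : False := by
  obtain ⟨a, b, c, hE, nd⟩ := five_of hA hs ht hst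
  have ha : a ∈ A := by rw [hE]; simp
  have hb : b ∈ A := by rw [hE]; simp
  have hc : c ∈ A := by rw [hE]; simp
  have key : ∀ p m r, p ∈ A → m ∈ A → r ∈ A → [s, t, p, m, r].Nodup → G.Adj s p → G.Adj p m → G.Adj m r →
      G.Adj r t → G.Adj s m ∨ G.Adj p r → False := by
    intro p m r hp hm hr nd' h1 h2 h3 h4 ho
    have nw : ∀ z ∈ A, w ≠ z := fun z hz e => hw (e ▸ hz)
    have n1 := nw s hs
    have n2 := nw t ht
    have n3 := nw p hp
    have n4 := nw m hm
    have n5 := nw r hr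
    rcases ho with ho | ho
    · refine theta_short hth (a := s) (b := p) (c := m) (d := r) (e := t) (f := w) ?_ h1 h2 h3 h4 wt.symm ws ho
      clear * - nd' n1 n2 n3 n4 n5; simp at *; grind
    · refine theta_short hth (a := p) (b := m) (c := r) (d := t) (e := w) (f := s) ?_ h2 h3 h4 wt.symm ws h1 ho
      clear * - nd' n1 n2 n3 n4 n5; simp at *; grind
  have nd1 : [s, t, c, b, a].Nodup := by clear * - nd; simp at *; grind
  have nd2 : [s, t, a, c, b].Nodup := by clear * - nd; simp at *; grind
  have nd3 : [s, t, b, a, c].Nodup := by clear * - nd; simp at *; grind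
  have k0 := key a b c ha hb hc nd
  have k1 := key c b a hc hb ha nd1
  have k2 := key a c b ha hc hb nd2
  have k3 := key b a c hb ha hc nd3
  have nd' := nd
  simp at nd'
  clear nd nd1 nd2 nd3
  by_cases h1 : G.Adj s a
  swap
  · have f := h.fact hs ha (by clear * - nd'; tauto) h1
    refine k1 (f _ hs _ hc ?_ ?_) (f _ hc _ hb ?_ ?_) (f _ hb _ ha ?_ ?_) (f _ ha _ ht ?_ ?_) (Or.inl (f _ hs _ hb ?_ ?_)) <;>
      (clear * - nd'; grind)
  by_cases h2 : G.Adj c t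
  swap
  · have f := h.fact hc ht (by clear * - nd'; tauto) h2
    refine k1 (f _ hs _ hc ?_ ?_) (f _ hc _ hb ?_ ?_) (f _ hb _ ha ?_ ?_) (f _ ha _ ht ?_ ?_) (Or.inl (f _ hs _ hb ?_ ?_)) <;>
      (clear * - nd'; grind)
  by_cases h3 : G.Adj a b
  swap
  · have f := h.fact ha hb (by clear * - nd'; tauto) h3
    refine k2 h1 (f _ ha _ hc ?_ ?_) (f _ hc _ hb ?_ ?_) (f _ hb _ ht ?_ ?_) (Or.inl (f _ hs _ hc ?_ ?_)) <;>
      (clear * - nd'; grind)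
  by_cases h4 : G.Adj b c
  swap
  · have f := h.fact hb hc (by clear * - nd'; tauto) h4
    refine k3 (f _ hs _ hb ?_ ?_) h3.symm (f _ ha _ hc ?_ ?_) h2 (Or.inl h1) <;>
      (clear * - nd'; grind)
  refine k0 h1 h3 h4 h2 ?_
  by_contra h5
  push Not at h5
  have f := h.fact hs hb (by clear * - nd'; tauto) h5.1
  exact h5.2 (f _ ha _ hc (by clear * - nd'; tauto) (by clear * - nd'; grind))

theorem blocks1 [Finite V] {G : SimpleGraph V} (hth : ¬ HasTheta6 G) {A B : Set V} {x w u v : V}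
    (hA : A.ncard = 5) (h : AC G A) (hxA : x ∈ A) (hd : ∀ a ∈ A, a ≠ x → a ∉ B) (hwA : w ∉ A) (hwB : w ∉ B)
    (hu : u ∈ A) (hux : u ≠ x) (hv : v ∈ B) (hvx : v ≠ x) (wu : G.Adj w u) (wv : G.Adj w v) (xv : G.Adj x v) : False := by
  obtain ⟨p, hp, q, hq, nd, h1, h2, h3, h4, h5⟩ := choose2 hA h hu hxA hux
  refine theta_short hth (a := u) (b := p) (c := q) (d := x) (e := v) (f := w) ?_ h1 h3 h5 xv wv.symm wu h2
  have nw : ∀ z ∈ A, w ≠ z := fun z hz e => hwA (e ▸ hz)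
  have n1 := nw u hu
  have n2 := nw p hp
  have n3 := nw q hq
  have n4 := nw x hxA
  have nv : ∀ z ∈ A, v ≠ z := by
    intro z hz e
    by_cases hzx : z = x
    · exact hvx (e.trans hzx)
    · exact hd z hz hzx (e ▸ hv)
  have m1 := nv u hu
  have m2 := nv p hp
  have m3 := nv q hq
  have wv' := wv.ne
  clear * - n1 n2 n3 n4 m1 m2 m3 hvx nd wv'
  simp at *
  grind

theorem blocks [Finite V] {G : SimpleGraph V} (hp : IsPlanar G) (hth : ¬ HasTheta6 G) {A B : Set V} {x w u v : V}
    (hA : A.ncard = 5) (h : AC G A) (hB : (B.ncard = 5 ∧ AC G B) ∨ ∀ a ∈ B, ∀ b ∈ B, a ≠ b → G.Adj a b)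
    (hxA : x ∈ A) (hxB : x ∈ B) (hd : ∀ a ∈ A, a ≠ x → a ∉ B) (hwA : w ∉ A) (hwB : w ∉ B)
    (hu : u ∈ A) (hux : u ≠ x) (hv : v ∈ B) (hvx : v ≠ x) (wu : G.Adj w u) (wv : G.Adj w v) : False := by
  have xv : ¬ G.Adj x v := blocks1 hth hA h hxA hd hwA hwB hu hux hv hvx wu wv
  rcases hB with ⟨hB, h'⟩ | hB
  swap
  · exact xv (hB x hxB v hv hvx.symm)
  have xu : ¬ G.Adj x u := blocks1 hth hB h' hxB (fun b hb hbx hbA => hd b hbA hbx hb) hwB hwA hv hvx hu hux wv wu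
  obtain ⟨r, hr, q, hq, nd, h1, -, -, h4, -⟩ := choose2 hB h' hv hxB hvx
  obtain ⟨a, b, c, hE, nd2⟩ := five_of hA hu hxA hux
  have ha : a ∈ A := by rw [hE]; simp
  have hb : b ∈ A := by rw [hE]; simp
  have hc : c ∈ A := by rw [hE]; simp
  have f := h.fact hxA hu hux.symm xu
  have nd3 := nd2
  have nd1 := nd
  simp at nd3 nd1
  have e : ∀ y ∈ A, ∀ z ∈ A, y ≠ z → y ≠ u → z ≠ u → Lk G {y} {z} := fun y hy z hz hyz hyu hzu =>
    ⟨y, rfl, z, rfl, f y hy z hz hyz (by tauto)⟩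
  have e' : ∀ y ∈ A, y ≠ x → y ≠ u → Lk G {y} {u, w, v, r} := fun y hy hyx hyu =>
    ⟨y, rfl, u, by simp, f y hy u hu hyu (by tauto)⟩
  have dis : ∀ y ∈ A, y ≠ u → Disjoint {y} ({u, w, v, r} : Set V) := by
    intro y hy hyu
    rw [Set.disjoint_singleton_left]
    rintro (rfl | rfl | rfl | rfl)
    · exact hyu rfl
    · exact hwA hy
    · exact hd y hy hvx hv
    · exact hd y hy (by clear * - nd1; tauto) hr
  have cE : Conn G {u, w, v, r} := by
    have := conn_list (H := G) (l := [u, w, v, r]) (by simp; exact ⟨wu.symm, wv, h1⟩)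
    convert this using 1
    ext; simp
  refine no_K5 hp (conn_singleton _ x) (conn_singleton _ a) (conn_singleton _ b) (conn_singleton _ c) cE
    ?_ ?_ ?_ ?_ ?_ ?_ ?_ ?_ ?_ ?_ ?_ ?_ ?_ ?_ ?_ ?_ ?_ ?_ ?_ ?_
  all_goals first
    | exact e _ (by assumption) _ (by assumption) (by clear * - nd3 hux; tauto) (by clear * - nd3 hux; tauto) (by clear * - nd3 hux; tauto)
    | exact dis _ (by assumption) (by clear * - nd3 hux; tauto)
    | exact e' _ (by assumption) (by clear * - nd3 hux; tauto) (by clear * - nd3 hux; tauto)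
    | (rw [Set.disjoint_singleton]; clear * - nd3 hux; tauto)
    | exact ⟨x, rfl, r, by simp, h4.symm⟩

end Th

namespace Th

universe u
variable {V : Type u}

/-- induction hypothesis -/
def IH (G : SimpleGraph V) (N : ℕ) : Prop := ∀ W : Set V, W.ncard < N → eW G W ≤ F W.ncard ∧
  (3 ≤ W.ncard → (∀ x, Conn G (W \ {x})) → eW G W ≤ F2 W.ncard)

theorem blocks' [Finite V] {G : SimpleGraph V} (hp : IsPlanar G) (hth : ¬ HasTheta6 G) {W A B : Set V} {x w : V}
    (c2 : ∀ x, Conn G (W \ {x})) (hw : w ∈ W)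
    (hA : A.ncard = 5) (h : AC G A) (hB : (B.ncard = 5 ∧ AC G B) ∨ ∀ a ∈ B, ∀ b ∈ B, a ≠ b → G.Adj a b)
    (sA : A ⊆ W \ {w}) (sB : B ⊆ W \ {w}) (cov : ∀ z ∈ W \ {w}, z ∈ A ∨ z ∈ B)
    (eA : ∃ a ∈ A, a ≠ x) (eB : ∃ b ∈ B, b ≠ x)
    (no : ∀ a ∈ A, a ≠ x → ∀ b ∈ B, b ≠ x → ¬ G.Adj a b ∧ a ≠ b)
    (hxA : x ∈ A) (hxB : x ∈ B) : False := by
  have wx : w ≠ x := fun e => (sA hxA).2 e.symm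
  have hwA : w ∉ A := fun h => (sA h).2 rfl
  have hwB : w ∉ B := fun h => (sB h).2 rfl
  have get : ∀ A B : Set V, A ⊆ W \ {w} → (∀ z ∈ W \ {w}, z ∈ A ∨ z ∈ B) → (∃ a ∈ A, a ≠ x) → 
      (∀ a ∈ A, a ≠ x → ∀ b ∈ B, b ≠ x → ¬ G.Adj a b ∧ a ≠ b) → ∃ u ∈ A, u ≠ x ∧ G.Adj w u := by
    intro A B sA cov ⟨a, ha, hax⟩ no
    obtain ⟨s, hs, hsA, t, ht, htA, hst⟩ := (c2 x).cut' A (a := a) (b := w) ⟨(sA ha).1, hax⟩ ha ⟨hw, wx⟩ (fun h => (sA h).2 rfl)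
    by_cases htw : t = w
    · subst htw
      exact ⟨s, hsA, hs.2, hst.symm⟩
    · have := cov t ⟨ht.1, htw⟩
      have htB : t ∈ B := by tauto
      exact absurd hst (no s hsA hs.2 t htB ht.2).1
  obtain ⟨u, hu, hux, wu⟩ := get A B sA cov eA no
  obtain ⟨v, hv, hvx, wv⟩ := get B A sB (fun z hz => (cov z hz).symm) eB
    (fun b hb hbx a ha hax => ⟨fun h => (no a ha hax b hb hbx).1 h.symm, (no a ha hax b hb hbx).2.symm⟩)
  exact blocks hp hth hA h hB hxA hxB (fun a ha hax haB => (no a ha hax a haB hax).2 rfl) hwA hwB hu hux hv hvx wu wv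

theorem b1 [Finite V] {G : SimpleGraph V} (hp : IsPlanar G) (hth : ¬ HasTheta6 G) {W : Set V}
    (hn : 6 ≤ W.ncard) (c2 : ∀ x, Conn G (W \ {x})) (ih : IH G W.ncard) {w x y : V} (hw : w ∈ W)
    (hd : ∀ z ∈ W, G.Adj w z → z = x ∨ z = y) : eW G W ≤ F2 W.ncard := by
  have hc : (W \ {w}).ncard = W.ncard - 1 := Set.ncard_sdiff_singleton_of_mem hw
  have h1 : eW G W ≤ eW G (W \ {w}) + 2 := by
    have h2 := eW_remove (G := G) (W := W) w {x, y} (fun z hz h => by simpa using hd z hz h)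
    have h3 := Set.ncard_insert_le x ({y} : Set V)
    rw [Set.ncard_singleton] at h3
    omega
  obtain ⟨i1, i2⟩ := ih (W \ {w}) (by omega)
  rw [hc] at i1 i2
  obtain ⟨f0, f1, f2, f3, f4, f5, f6, f7, f8, f9, f10, f11, f12, f13⟩ := F_vals
  obtain ⟨g3, g4, g5, g6, g7, g8, g9, g10, g11, g12, g13⟩ := F2_vals
  by_contra hcon
  by_cases h6 : W.ncard = 6
  · rw [h6] at i1 hcon hc
    norm_num at i1 hc
    have hone : ∀ z0, (∀ z ∈ W, G.Adj w z → z = z0) → False := by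
      intro z0 h
      have h2 := eW_remove (G := G) (W := W) w {z0} (fun z hz h' => by simpa using h z hz h')
      rw [Set.ncard_singleton] at h2
      omega
    have hac : AC G (W \ {w}) := ac_of (by rw [hc]; norm_num; omega)
    have hx : x ∈ W ∧ G.Adj w x := by
      by_contra h
      refine hone y (fun z hz hwz => ?_)
      rcases hd z hz hwz with rfl | rfl
      · exact absurd ⟨hz, hwz⟩ h
      · rfl
    have hy : y ∈ W ∧ G.Adj w y := by
      by_contra h
      refine hone x (fun z hz hwz => ?_)
      rcases hd z hz hwz with rfl | rfl
      · rfl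
      · exact absurd ⟨hz, hwz⟩ h
    have hxy : x ≠ y := by
      rintro rfl
      exact hone x (fun z hz hwz => (hd z hz hwz).elim id id)
    exact k5w hth hc hac (fun h => h.2 rfl) ⟨hx.1, hx.2.ne'⟩ ⟨hy.1, hy.2.ne'⟩ hxy hx.2 hy.2
  by_cases h9 : W.ncard = 9
  · rw [h9] at i1 i2 hcon hc
    norm_num at i1 i2 hc
    by_cases hcc : ∀ z, Conn G ((W \ {w}) \ {z})
    · have := i2 hcc; omega
    push Not at hcc
    obtain ⟨z, hz⟩ := hcc
    obtain ⟨A, B, sA, sB, cov, eA, eB, no, he, hcase⟩ := split hz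
    rw [hc] at hcase
    rcases hcase with ⟨hzA, hzB, hab, ha, hb⟩ | ⟨hab, ha, hb⟩
    · have jA := (ih A (by omega)).1
      have jB := (ih B (by omega)).1
      rcases F_15 ha hb hab (by omega) with ⟨ha, hb⟩ | ⟨ha, hb⟩
      · rw [ha] at jA
        rw [hb] at jB
        exact blocks' hp hth c2 hw ha (ac_of (by rw [ha]; norm_num; omega))
          (Or.inr (complete_of (by rw [hb]; norm_num; omega))) sA sB cov eA eB no hzA hzB
      · rw [ha] at jA
        rw [hb] at jB
        exact blocks' hp hth c2 hw hb (ac_of (by rw [hb]; norm_num; omega))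
          (Or.inr (complete_of (by rw [ha]; norm_num; omega))) sB sA (fun z hz => (cov z hz).symm) eB eA
          (fun b hb hbx a ha hax => ⟨fun h => (no a ha hax b hb hbx).1 h.symm, (no a ha hax b hb hbx).2.symm⟩) hzB hzA
    · have jA := (ih A (by omega)).1
      have jB := (ih B (by omega)).1
      have := F_super0 (n := 7) ha hb hab (by omega)
      omega
  by_cases h10 : W.ncard = 10
  · rw [h10] at i1 i2 hcon hc
    norm_num at i1 i2 hc
    by_cases hcc : ∀ z, Conn G ((W \ {w}) \ {z})
    · have := i2 hcc; omega
    push Not at hcc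
    obtain ⟨z, hz⟩ := hcc
    obtain ⟨A, B, sA, sB, cov, eA, eB, no, he, hcase⟩ := split hz
    rw [hc] at hcase
    rcases hcase with ⟨hzA, hzB, hab, ha, hb⟩ | ⟨hab, ha, hb⟩
    · have jA := (ih A (by omega)).1
      have jB := (ih B (by omega)).1
      obtain ⟨ha, hb⟩ := F_18 ha hb hab (by omega)
      rw [ha] at jA
      rw [hb] at jB
      exact blocks' hp hth c2 hw ha (ac_of (by rw [ha]; norm_num; omega))
          (Or.inl ⟨hb, ac_of (by rw [hb]; norm_num; omega)⟩) sA sB cov eA eB no hzA hzB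
    · have jA := (ih A (by omega)).1
      have jB := (ih B (by omega)).1
      have := F_super0 (n := 8) ha hb hab (by omega)
      omega
  have := F2_b1 (n := W.ncard) (by omega) h9 h10
  omega

/-- minimum degree at least three -/
def Deg3 (G : SimpleGraph V) (W : Set V) : Prop := ∀ v ∈ W, ∀ x y, ∃ z ∈ W, G.Adj v z ∧ z ≠ x ∧ z ≠ y

theorem Sep.deg {G : SimpleGraph V} {W X Y : Set V} {u v : V} (h : Sep G W u v X Y) (d : Deg3 G W) :
    ∀ y ∈ Y, ∀ x z, ∃ t, (t ∈ Y ∨ t = u ∨ t = v) ∧ G.Adj y t ∧ t ≠ x ∧ t ≠ z := by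
  intro y hy x z
  obtain ⟨t, ht, h1, h2⟩ := d y (h.memY y hy).1 x z
  refine ⟨t, ?_, h1, h2⟩
  rcases h.cov t ht with h3 | h3 | h3 | h3
  · tauto
  · tauto
  · exact absurd h1.symm (h.no t h3 y hy)
  · tauto

theorem Sep.nbr {G : SimpleGraph V} {W X Y : Set V} {u v : V} (h : Sep G W u v X Y) (c2 : ∀ x, Conn G (W \ {x})) :
    (∃ a ∈ Y, G.Adj u a) ∧ ∃ b ∈ Y, G.Adj v b := by
  obtain ⟨a, ha, u', rfl, h1⟩ := h.lk c2
  obtain ⟨b, hb, v', rfl, h2⟩ := h.swap.lk c2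
  exact ⟨⟨a, ha, h1.symm⟩, ⟨b, hb, h2.symm⟩⟩

theorem Sep.big [Finite V] {G : SimpleGraph V} (hth : ¬ HasTheta6 G) {W X Y : Set V} {u v : V} (h : Sep G W u v X Y)
    (huv : G.Adj u v) (c2 : ∀ x, Conn G (W \ {x})) (d : Deg3 G W) (p2 : P2 G X u v) (p3 : P3 G X u v) :
    6 ≤ Y.ncard := by
  obtain ⟨nu, nv⟩ := h.nbr c2
  have hX : ∀ x ∈ X, x ≠ u ∧ x ≠ v ∧ x ∉ Y := fun x hx => (h.memX x hx).2
  have hY : ∀ x ∈ Y, x ≠ u ∧ x ≠ v := fun x hx => ⟨(h.memY x hx).2.1, (h.memY x hx).2.2.1⟩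
  refine lemmaS hth (fun hu => (hY u hu).1 rfl) (fun hv => (hY v hv).2 rfl) (h.deg d) nu nv ?_
    (fun h3 => th33 hth huv hX hY p3 h3) (fun h4 => th24 hth huv hX hY p2 h4)
  intro c hc e he hec
  obtain ⟨s, hs, hsY, t, ht, htY, hst⟩ := (c2 c).cut' Y (a := e) (b := u) ⟨(h.memY e he).1, hec⟩ he
    ⟨h.uW, fun e => (hY c hc).1 e.symm⟩ (fun hu => (hY u hu).1 rfl)
  refine ⟨s, hsY, hs.2, ?_⟩
  rcases h.cov t ht.1 with rfl | rfl | h3 | h3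
  · exact Or.inl hst.symm
  · exact Or.inr hst.symm
  · exact absurd hst.symm (h.no t h3 s hsY)
  · exact absurd h3 htY

theorem Sep.two [Finite V] {G : SimpleGraph V} {W X Y : Set V} {u v : V} (h : Sep G W u v X Y) (d : Deg3 G W) :
    2 ≤ Y.ncard := by
  obtain ⟨p, hp⟩ := h.neY
  obtain ⟨t, ht, h1, h2, h3⟩ := h.deg d p hp u v
  have ht : t ∈ Y := by tauto
  exact six_le (Y := Y) (l := [p, t]) (by simpa using h1.ne) (by simp; tauto)

theorem Sep.case2 {G : SimpleGraph V} {W X Y : Set V} {u v : V} (h : Sep G W u v X Y) (d : Deg3 G W)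
    (hY : Y.ncard = 2) : P2 G Y u v ∧ P3 G Y u v := by
  obtain ⟨p, q, hpq, rfl⟩ := Set.ncard_eq_two.1 hY
  have hp : p ∈ ({p, q} : Set V) := by simp
  have hq : q ∈ ({p, q} : Set V) := by simp
  have key : ∀ p q, ({p, q} : Set V) = {p, q} → True := fun _ _ _ => trivial
  have e1 : G.Adj p u := by
    obtain ⟨t, ht, h1, h2, h3⟩ := h.deg d p hp q v
    have := h1.ne
    simp at ht
    have : t = u := by grind
    exact this ▸ h1
  have e2 : G.Adj p v := by
    obtain ⟨t, ht, h1, h2, h3⟩ := h.deg d p hp q u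
    have := h1.ne
    simp at ht
    have : t = v := by grind
    exact this ▸ h1
  have e3 : G.Adj p q := by
    obtain ⟨t, ht, h1, h2, h3⟩ := h.deg d p hp u v
    have := h1.ne
    simp at ht
    have : t = q := by grind
    exact this ▸ h1
  have e4 : G.Adj q v := by
    obtain ⟨t, ht, h1, h2, h3⟩ := h.deg d q hq p u
    have := h1.ne
    simp at ht
    have : t = v := by grind
    exact this ▸ h1
  exact ⟨⟨p, hp, e1.symm, e2⟩, p, hp, q, hq, e1.symm, e3, e4⟩

theorem prop9 {au bu cu av bv cv ab ac bc : Prop}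
    (ka : (ab ∨ au) ∧ (ab ∨ av) ∧ (ac ∨ au) ∧ (ac ∨ av) ∧ (ab ∨ ac) ∧ (au ∨ av))
    (kb : (ab ∨ bu) ∧ (ab ∨ bv) ∧ (bc ∨ bu) ∧ (bc ∨ bv) ∧ (ab ∨ bc) ∧ (bu ∨ bv))
    (kc : (ac ∨ cu) ∧ (ac ∨ cv) ∧ (bc ∨ cu) ∧ (bc ∨ cv) ∧ (ac ∨ bc) ∧ (cu ∨ cv))
    (n1 : au → ab → ¬ bv) (n2 : au → ac → ¬ cv) (n3 : bu → ab → ¬ av) (n4 : bu → bc → ¬ cv)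
    (n5 : cu → ac → ¬ av) (n6 : cu → bc → ¬ bv) (hU : au ∨ bu ∨ cu) (hV : av ∨ bv ∨ cv) : False := by
  by_cases h1 : ab <;> by_cases h2 : ac <;> by_cases h3 : bc <;> by_cases h4 : au <;> by_cases h5 : bu <;>
    simp_all

theorem Sep.case3 {G : SimpleGraph V} {W X Y : Set V} {u v : V} (h : Sep G W u v X Y) (c2 : ∀ x, Conn G (W \ {x}))
    (d : Deg3 G W) (hY : Y.ncard = 3) : P3 G Y u v := by
  obtain ⟨⟨s, hs, us⟩, ⟨t, ht, vt⟩⟩ := h.nbr c2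
  obtain ⟨a, b, c, hab, hac, hbc, rfl⟩ := Set.ncard_eq_three.1 hY
  have ha : a ∈ ({a, b, c} : Set V) := by simp
  have hb : b ∈ ({a, b, c} : Set V) := by simp
  have hc : c ∈ ({a, b, c} : Set V) := by simp
  -- a vertex of the side misses at most one of the four others
  have key : ∀ p q r, p ∈ ({a, b, c} : Set V) → (∀ z ∈ ({a, b, c} : Set V), z = p ∨ z = q ∨ z = r) →
      (G.Adj p q ∨ G.Adj p u) ∧ (G.Adj p q ∨ G.Adj p v) ∧ (G.Adj p r ∨ G.Adj p u) ∧ (G.Adj p r ∨ G.Adj p v) ∧ 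
      (G.Adj p q ∨ G.Adj p r) ∧ (G.Adj p u ∨ G.Adj p v) := by
    intro p q r hp hall
    have D := h.deg d p hp
    have m : ∀ t, (t ∈ ({a, b, c} : Set V) ∨ t = u ∨ t = v) → G.Adj p t → t = q ∨ t = r ∨ t = u ∨ t = v := by
      intro t ht hpt
      rcases ht with ht | ht
      · rcases hall t ht with rfl | h' | h'
        · exact absurd hpt (G.loopless.irrefl _)
        · exact Or.inl h'
        · exact Or.inr (Or.inl h')
      · exact Or.inr (Or.inr ht)
    have D' : ∀ x z, ∃ t, (t = q ∨ t = r ∨ t = u ∨ t = v) ∧ G.Adj p t ∧ t ≠ x ∧ t ≠ z := by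
      intro x z
      obtain ⟨t, ht, h1, h2⟩ := D x z
      exact ⟨t, m t ht h1, h1, h2⟩
    clear * - D'
    refine ⟨?_, ?_, ?_, ?_, ?_, ?_⟩
    · obtain ⟨t, ht, h1, h2, h3⟩ := D' r v; clear D'; grind
    · obtain ⟨t, ht, h1, h2, h3⟩ := D' r u; clear D'; grind
    · obtain ⟨t, ht, h1, h2, h3⟩ := D' q v; clear D'; grind
    · obtain ⟨t, ht, h1, h2, h3⟩ := D' q u; clear D'; grind
    · obtain ⟨t, ht, h1, h2, h3⟩ := D' u v; clear D'; grind
    · obtain ⟨t, ht, h1, h2, h3⟩ := D' q r; clear D'; grind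
  have ka := key a b c ha (fun z hz => by simpa using hz)
  have kb := key b a c hb (fun z hz => by clear * - hz; simp at hz; tauto)
  have kc := key c a b hc (fun z hz => by clear * - hz; simp at hz; tauto)
  by_contra hcon
  have np : ∀ p ∈ ({a, b, c} : Set V), ∀ q ∈ ({a, b, c} : Set V), G.Adj p u → G.Adj p q → ¬ G.Adj q v :=
    fun p hp q hq h1 h2 h3 => hcon ⟨p, hp, q, hq, h1.symm, h2, h3⟩
  have n1 := np a ha b hb
  have n2 := np a ha c hc
  have n3 := np b hb a ha
  have n4 := np b hb c hc
  have n5 := np c hc a ha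
  have n6 := np c hc b hb
  have hU : G.Adj a u ∨ G.Adj b u ∨ G.Adj c u := by
    simp only [Set.mem_insert_iff, Set.mem_singleton_iff] at hs
    clear * - hs us
    rcases hs with h' | h' | h'
    · rw [h'] at us; exact Or.inl us.symm
    · rw [h'] at us; exact Or.inr (Or.inl us.symm)
    · rw [h'] at us; exact Or.inr (Or.inr us.symm)
  have hV : G.Adj a v ∨ G.Adj b v ∨ G.Adj c v := by
    simp only [Set.mem_insert_iff, Set.mem_singleton_iff] at ht
    clear * - ht vt
    rcases ht with h' | h' | h'
    · rw [h'] at vt; exact Or.inl vt.symm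
    · rw [h'] at vt; exact Or.inr (Or.inl vt.symm)
    · rw [h'] at vt; exact Or.inr (Or.inr vt.symm)
  rw [G.adj_comm b a] at kb n3
  rw [G.adj_comm c a, G.adj_comm c b] at kc
  rw [G.adj_comm c a] at n5
  rw [G.adj_comm c b] at n6
  exact prop9 ka kb kc n1 n2 n3 n4 n5 n6 hU hV

theorem Sep.case3e [Finite V] {G : SimpleGraph V} {W X Y : Set V} {u v : V} (h : Sep G W u v X Y) 
    (hY : Y.ncard = 3) (he : 8 ≤ eW G (Y ∪ {u, v})) : P2 G Y u v := by
  by_contra hcon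
  have n : ∀ y ∈ Y, ∃ t, ∀ z, (z = u ∨ z = v) → G.Adj y z → z = t := by
    intro y hy
    by_cases h1 : G.Adj y u
    · refine ⟨u, ?_⟩
      rintro z (rfl | rfl) h2
      · rfl
      · exact absurd ⟨y, hy, h1.symm, h2⟩ hcon
    · refine ⟨v, ?_⟩
      rintro z (rfl | rfl) h2
      · exact absurd h2 h1
      · rfl
  obtain ⟨a, b, c, hab, hac, hbc, rfl⟩ := Set.ncard_eq_three.1 hY
  obtain ⟨ta, hta⟩ := n a (by simp)
  obtain ⟨tb, htb⟩ := n b (by simp)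
  obtain ⟨tc, htc⟩ := n c (by simp)
  have r1 := eW_remove (G := G) (W := {a, b, c} ∪ {u, v}) a {b, c, ta} (by
    intro z hz haz
    have := hta z
    have := haz.ne
    simp at hz ⊢
    grind)
  have r2 := eW_remove (G := G) (W := ({a, b, c} ∪ {u, v}) \ {a}) b {c, tb} (by
    intro z hz haz
    have := htb z
    have := haz.ne
    simp at hz ⊢
    grind)
  have r3 := eW_remove (G := G) (W := (({a, b, c} ∪ {u, v}) \ {a}) \ {b}) c {tc} (by
    intro z hz haz
    have := htc z
    have := haz.ne
    simp at hz ⊢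
    grind)
  have hE : ((({a, b, c} ∪ {u, v}) \ {a}) \ {b}) \ {c} = ({u, v} : Set V) := by
    have k1 := h.memY a (by simp)
    have k2 := h.memY b (by simp)
    have k3 := h.memY c (by simp)
    ext z
    simp
    grind
  rw [hE] at r3
  have r4 := eW_choose (G := G) 2 {u, v} (Set.ncard_pair h.ne)
  have s1 := Set.ncard_insert_le b ({c, ta} : Set V)
  have s2 := Set.ncard_insert_le c ({ta} : Set V)
  have s3 := Set.ncard_insert_le c ({tb} : Set V)
  rw [Set.ncard_singleton] at r3 s2 s3
  norm_num at r4
  omega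

theorem small [Finite V] {G : SimpleGraph V} (hp : IsPlanar G) (hth : ¬ HasTheta6 G) {W X Y : Set V} {u v : V}
    (h : Sep G W u v X Y) (huv : G.Adj u v) (c2 : ∀ x, Conn G (W \ {x})) (d : Deg3 G W) (ih : IH G W.ncard)
    (hX : X.ncard ≤ 3) (hpod : ¬ (X.ncard = 3 ∧ eW G (X ∪ {u, v}) = 9)) : eW G W ≤ F2 W.ncard := by
  have tX := h.symm.two d
  have tY := h.two d
  have hc := h.card_eq
  have hcnt := h.count huv
  have sX := h.card_side
  have sY := h.symm.card_side
  have iY := (ih (Y ∪ {u, v}) (by omega)).2 (by omega) (h.symm.c2 huv c2)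
  rw [sY] at iY
  have hX' : ∀ x ∈ X, x ≠ u ∧ x ≠ v ∧ x ∉ Y := fun x hx => (h.memX x hx).2
  have hY' : ∀ x ∈ Y, x ≠ u ∧ x ≠ v := fun x hx => ⟨(h.memY x hx).2.1, (h.memY x hx).2.2.1⟩
  by_cases h2 : X.ncard = 2
  · obtain ⟨p2, p3⟩ := h.symm.case2 d h2
    have h6 := h.big hth huv c2 d p2 p3
    have f := F2_x2 (n := Y.ncard + 2) (by omega)
    have e4 := eW_choose (G := G) 4 (X ∪ {u, v}) (by omega)
    have : W.ncard = Y.ncard + 2 + 2 := by omega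
    rw [this]
    omega
  have h3 : X.ncard = 3 := by omega
  have p3 := h.symm.case3 c2 d h3
  have h4 : 4 ≤ Y.ncard := by
    by_contra h4
    have : Y.ncard = 2 ∨ Y.ncard = 3 := by omega
    rcases this with h5 | h5
    · exact th33 hth huv hX' hY' p3 (h.case2 d h5).2
    · exact th33 hth huv hX' hY' p3 (h.case3 c2 d h5)
  have hW : W.ncard = Y.ncard + 2 + 3 := by omega
  have e5 := eW_five (G := G) hp (A := X ∪ {u, v}) (by omega)
  rw [hW]
  by_cases he : 8 ≤ eW G (X ∪ {u, v})
  · have h6 := h.big hth huv c2 d (h.symm.case3e h3 he) p3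
    have f := F2_x38 (n := Y.ncard + 2) (by omega)
    have : eW G (X ∪ {u, v}) ≠ 9 := fun e => hpod ⟨h3, e⟩
    omega
  · have f := F2_x3 (n := Y.ncard + 2) (by omega)
    omega

theorem two_conn [Fintype V] {G : SimpleGraph V} (hp : IsPlanar G) (hth : ¬ HasTheta6 G) {W : Set V}
    (hn : 6 ≤ W.ncard) (c2 : ∀ x, Conn G (W \ {x})) (ih : IH G W.ncard) : eW G W ≤ F2 W.ncard := by
  by_cases d : Deg3 G W
  swap
  · unfold Deg3 at d
    push Not at d
    obtain ⟨w, hw, x, y, hd⟩ := d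
    exact b1 hp hth hn c2 ih hw (fun z hz h => by have := hd z hz h; tauto)
  by_contra hcon
  have D : Dec G W ∅ := by
    refine ⟨c2, hn, by simp, by simp, fun v hv => Or.inr (d v hv), ?_⟩
    intro u v X Y huv h
    by_contra hpod
    simp only [Set.mem_empty_iff_false, false_imp_iff, implies_true, and_true, not_or] at hpod
    apply hcon
    by_cases hX : X.ncard ≤ 3
    · exact small hp hth h huv c2 d ih hX hpod.1
    by_cases hY : Y.ncard ≤ 3
    · exact small hp hth h.symm huv c2 d ih hY hpod.2
    have hc := h.card_eq
    have hcnt := h.count huv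
    have sX := h.card_side
    have sY := h.symm.card_side
    have iX := (ih (X ∪ {u, v}) (by omega)).2 (by omega) (h.c2 huv c2)
    have iY := (ih (Y ∪ {u, v}) (by omega)).2 (by omega) (h.symm.c2 huv c2)
    have := F2_x4 (a := (X ∪ {u, v}).ncard) (b := (Y ∪ {u, v}).ncard) (n := W.ncard) (by omega) (by omega) (by omega)
    omega
  have := dec hp hth _ W ∅ rfl D
  rw [Set.ncard_empty] at this
  exact hcon (F2_dec hn (by omega))

theorem total [Fintype V] {G : SimpleGraph V} (hp : IsPlanar G) (hth : ¬ HasTheta6 G) : ∀ N, IH G N := by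
  intro N
  induction N with
  | zero => intro W hW; omega
  | succ N ih =>
    intro W hW
    by_cases hlt : W.ncard < N
    · exact ih W hlt
    have hN : W.ncard = N := by omega
    subst hN
    by_cases hn : 6 ≤ W.ncard
    · have hF2 : (∀ x, Conn G (W \ {x})) → eW G W ≤ F2 W.ncard := fun c2 => two_conn hp hth hn c2 ih
      refine ⟨?_, fun _ => hF2⟩
      by_cases c2 : ∀ x, Conn G (W \ {x})
      · exact (hF2 c2).trans (F2_le _)
      push Not at c2
      obtain ⟨x, hx⟩ := c2
      obtain ⟨A, B, -, -, -, -, -, -, he, hcase⟩ := split hx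
      rcases hcase with ⟨-, -, hab, ha, hb⟩ | ⟨hab, ha, hb⟩
      · have jA := (ih A (by omega)).1
        have jB := (ih B (by omega)).1
        have := F_super0 (n := W.ncard) (by omega) (by omega) hab hn
        omega
      · have jA := (ih A (by omega)).1
        have jB := (ih B (by omega)).1
        have := F_super1 (n := W.ncard) ha hb hab hn
        omega
    · have h5 : W.ncard = 5 → eW G W ≤ 9 := fun h => eW_five hp h
      have hch := eW_choose (G := G) W.ncard W rfl
      have hle : W.ncard ≤ 5 := by omega
      obtain ⟨f0, f1, f2, f3, f4, f5, -⟩ := F_vals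
      obtain ⟨g3, g4, g5, -⟩ := F2_vals
      generalize W.ncard = m at *
      refine ⟨?_, fun h3 _ => ?_⟩
      · interval_cases m <;> norm_num at hch h5 <;> omega
      · interval_cases m <;> norm_num at hch h5 <;> omega

end Th

/-- For all `n ≥ 14`, every `n`-vertex planar graph containing no Theta graph on
6 vertices as a subgraph has at most `18n/7 - 48/7` edges. -/
theorem theta6_planar_turan {V : Type*} [Fintype V] (n : ℕ)
    (G : SimpleGraph V) (hcard : Fintype.card V = n) (hn : 14 ≤ n)
    (hplanar : IsPlanar G) (hfree : ¬ HasTheta6 G) :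
    (G.edgeSet.ncard : ℚ) ≤ 18 / 7 * n - 48 / 7 := by
  have h1 := (Th.total hplanar hfree (n + 1) Set.univ (by rw [Set.ncard_univ, Nat.card_eq_fintype_card]; omega)).1
  rw [Set.ncard_univ, Nat.card_eq_fintype_card, hcard, Th.F_big hn] at h1
  have h2 : Th.eW G Set.univ = G.edgeSet.ncard := by
    unfold Th.eW
    congr 1
    ext e
    induction e with
    | _ x y => rw [Th.mem_res]; simp
  rw [h2] at h1
  have h3 : 7 * G.edgeSet.ncard + 48 ≤ 18 * n := by omega
  have h4 : (7 * G.edgeSet.ncard + 48 : ℚ) ≤ 18 * n := by exact_mod_cast h3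
  linarith
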